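/- **Notation.** Let $d\ge 2$. For $r>0$ and $(s,z)\in\mathbb R\times\mathbb R^d$ let $B_r(z)$ be the open Euclidean ball, $B_r:=B_r(0)$, $Q_r^{s,z}:=[s-r^2,s+r^2]\times B_r(z)$ and $Q_r:=Q_r^{0,0}$. For exponents $p,q\in(0,\infty]$ and measurable $g$ on $\mathbb R\times\mathbb R^d$ put $$\|g\|_{\mathbb L^{q,p}_{t,x}}:=\Big(\int_{\mathbb R}\Big(\int_{\mathbb R^d}|g(t,x)|^p\,dx\Big)^{q/p}dt\Big)^{1/q},\qquad \|g\|_{\mathbb L^{p,q}_{x,t}}:=\Big(\int_{\mathbb R^d}\Big(\int_{\mathbb R}|g(t,x)|^q\,dt\Big)^{p/q}dx\Big)^{1/p}$$ (essential suprema for infinite exponents), $|||g|||_{\widetilde{\mathbb L}^{q,p}_{t,x}}:=\sup_{(s,z)}\|\mathbf 1_{Q_1^{s,z}}g\|_{\mathbb L^{q,p}_{t,x}}$, $|||g|||_{\widetilde{\mathbb L}^{p,q}_{x,t}}:=\sup_{(s,z)}\|\mathbf 1_{Q_1^{s,z}}g\|_{\mathbb L^{p,q}_{x,t}}$, and $|||h|||_p:=\sup_z\|\mathbf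 1_{B_1(z)}h\|_{L^p}$ for $h$ on $\mathbb R^d$. **Assumptions.** Fix $p_0\in(d/2,\infty]$ and $p_1\in[1,\infty]$ with $\frac1{p_0}+\frac1{p_1}<\frac2{d-1}$. Let $a:\mathbb R^{1+d}\to\mathbb R^{d\times d}$, $b:\mathbb R^{1+d}\to\mathbb R^d$, $f:\mathbb R^{1+d}\to\mathbb R$ be Borel, and let $$\lambda(x):=\inf_{t\in\mathbb R,|\xi|=1}\xi\cdot a(t,x)\xi,\qquad \mu(x):=\sup_{t\in\mathbb R,|\xi|=1}\frac{|a(t,x)\xi|^2}{\xi\cdot a(t,x)\xi}$$ be nonnegative Borel functions with values in $[0,\infty]$ (and $\lambda^{-1}=\infty$ where $\lambda=0$). * $(H^a)$: $|||\lambda^{-1}|||_{p_0}+|||\mu|||_{p_1}<\infty$. * $(H^b)$: $b=b_1+b_2$ with $b_1,b_2$ Borel. If $p_0\le d$, then $b_1\equiv0$; if $p_0>d$, then $|||b_1|||_{\widetilde{\mathbb L}^{q_2,p_2}_{t,x}}<\infty$ for some $p_2,q_2\in[1,\infty]$ with $\frac1{2p_0}+\frac1{p_2}<(\frac12-\frac1{q_2})(\frac2d-\frac1{p_0})$.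 Moreover $\operatorname{div}b_2\ge0$ in the sense of distributions on $\mathbb R^{1+d}$ (divergence in $x$), and $|||b_2|||_{\widetilde{\mathbb L}^{p_3,q_3}_{x,t}}<\infty$ for some $1\le p_3\le q_3\le\infty$ with $\frac{(d-1)\vartheta_1}{p_3}+\frac{2+\vartheta_1+d(\vartheta_2-\vartheta_1)}{q_3}<2$, where $\vartheta_1:=(1-\frac{d-1}{2p_0})^{-1}$ and $\vartheta_2:=(1-\frac d{2p_0})^{-1}$. A continuous $u:\mathbb R^{1+d}\to\mathbb R$ whose spatial gradient $\nabla u$ is locally bounded (i.e. for every $R$ the functions $u(t,\cdot)$, $|t|\le R$, are Lipschitz on $B_R$ with a common constant) is a *Lipschitz weak subsolution* of $\partial_tu=\operatorname{div}(a\cdot\nabla u)+b\cdot\nabla u+f$ if for every nonnegative compactly supported Lipschitz $\varphi$ on $\mathbb R^{1+d}$ the following integrals converge absolutely and $$-\iint u\,\partial_t\varphi\le-\iint(a\cdot\nabla u)\cdot\nabla\varphi+\iint(b\cdot\nabla u)\,\varphi+\iint f\varphi .$$ **Theorem (local maximum estimate).** Assume $(H^a)$ and $(H^b)$, and let $\|f\mathbf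 1_{Q_2}\|_{\mathbb L^{q_4,p_4}_{t,x}}<\infty$, where $p_4,q_4\in[1,\infty]$ and $\frac1{p_4}<(1-\frac1{q_4})(\frac2d-\frac1{p_0})$. Then for every $p>0$ there is a constant $C>0$, depending only on $p,d,p_0,p_1,p_2,q_2,p_3,q_3,p_4,q_4$ and on upper bounds for $|||\lambda^{-1}|||_{p_0}$, $|||\mu|||_{p_1}$, $|||b_1|||_{\widetilde{\mathbb L}^{q_2,p_2}_{t,x}}$ (if $p_0>d$) and $|||b_2|||_{\widetilde{\mathbb L}^{p_3,q_3}_{x,t}}$, such that every Lipschitz weak subsolution $u$ satisfies $$\|u^+\mathbf 1_{Q_1}\|_{L^\infty}\le C\big(\|u^+\mathbf 1_{Q_2}\|_{\mathbb L^{p,p}_{t,x}}+\|f\mathbf 1_{Q_2}\|_{\mathbb L^{q_4,p_4}_{t,x}}\big),\qquad u^+:=\max(u,0).$$ -/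

import Mathlib

open MeasureTheory Set
open scoped ENNReal NNReal

noncomputable section

/-- The space `ℝ^d` with its Euclidean norm. -/
abbrev Space (d : ℕ) := EuclideanSpace ℝ (Fin d)

/-- Space-time `ℝ × ℝ^d`, points written `(t, x)`. -/
abbrev SpaceTime (d : ℕ) := ℝ × Space d

/-- The real number `1/p` for an exponent `p ∈ [1,∞]`, with `1/∞ = 0`. -/
def recip (p : ℝ≥0∞) : ℝ := (p⁻¹).toReal

/-- The mixed norm of `𝕃^{q,p}_{t,x}`: the `L^q` norm in time of the `L^p` norms in space. The inner
norm is kept in `[0,∞]`. -/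
def mixedNormTX {d : ℕ} {F : Type*} [ENorm F] (q p : ℝ≥0∞) (g : SpaceTime d → F) : ℝ≥0∞ :=
  eLpNorm (fun t : ℝ => eLpNorm (fun x : Space d => g (t, x)) p volume) q volume

/-- The mixed norm of `𝕃^{p,q}_{x,t}`: the `L^p` norm in space of the `L^q` norms in time. -/
def mixedNormXT {d : ℕ} {F : Type*} [ENorm F] (p q : ℝ≥0∞) (g : SpaceTime d → F) : ℝ≥0∞ :=
  eLpNorm (fun x : Space d => eLpNorm (fun t : ℝ => g (t, x)) q volume) p volume

/-- The parabolic cylinder `Q_r^{s,z} = [s - r², s + r²] × B_r(z)`, with `c = (s,z)`. -/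
def cyl {d : ℕ} (r : ℝ) (c : SpaceTime d) : Set (SpaceTime d) :=
  Icc (c.1 - r ^ 2) (c.1 + r ^ 2) ×ˢ Metric.ball c.2 r

/-- The localized norm of `𝕃̃^{q,p}_{t,x}`. -/
def locNormTX {d : ℕ} {F : Type*} [ENorm F] [Zero F] (q p : ℝ≥0∞) (g : SpaceTime d → F) : ℝ≥0∞ :=
  ⨆ c : SpaceTime d, mixedNormTX q p ((cyl 1 c).indicator g)

/-- The localized norm of `𝕃̃^{p,q}_{x,t}`. -/
def locNormXT {d : ℕ} {F : Type*} [ENorm F] [Zero F] (p q : ℝ≥0∞) (g : SpaceTime d → F) : ℝ≥0∞ :=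
  ⨆ c : SpaceTime d, mixedNormXT p q ((cyl 1 c).indicator g)

/-- The localized norm `|||g|||_p` of a `[0,∞]`-valued function on `ℝ^d`. -/
def locNorm {d : ℕ} (p : ℝ≥0∞) (g : Space d → ℝ≥0∞) : ℝ≥0∞ :=
  ⨆ z : Space d, eLpNorm ((Metric.ball z 1).indicator g) p volume

/-- The matrix `A` applied to the vector `ξ`. -/
def matVec {d : ℕ} (A : Matrix (Fin d) (Fin d) ℝ) (ξ : Space d) : Space d :=
  WithLp.toLp 2 (A.mulVec ξ.ofLp)

/-- The quadratic form `ξ · A ξ`. -/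
def quadForm {d : ℕ} (A : Matrix (Fin d) (Fin d) ℝ) (ξ : Space d) : ℝ :=
  inner ℝ ξ (matVec A ξ)

/-- `λ(x) = inf_{t ∈ ℝ, |ξ| = 1} ξ · a(t,x) ξ`, as an element of `[0,∞]`; a negative value of the
quadratic form is counted as `0`. Its inverse is taken in `[0,∞]`, so that `λ(x)⁻¹ = ∞` where
`λ(x) = 0`, and integrability of `λ⁻¹` forces `λ > 0` almost everywhere. -/
def lam {d : ℕ} (a : SpaceTime d → Matrix (Fin d) (Fin d) ℝ) (x : Space d) : ℝ≥0∞ :=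
  ⨅ (t : ℝ) (ξ : Space d) (_ : ‖ξ‖ = 1), ENNReal.ofReal (quadForm (a (t, x)) ξ)

/-- `μ(x) = sup_{t ∈ ℝ, |ξ| = 1} |a(t,x) ξ|² / (ξ · a(t,x) ξ)`, as an element of `[0,∞]`. -/
def mu {d : ℕ} (a : SpaceTime d → Matrix (Fin d) (Fin d) ℝ) (x : Space d) : ℝ≥0∞ :=
  ⨆ (t : ℝ) (ξ : Space d) (_ : ‖ξ‖ = 1),
    ENNReal.ofReal (‖matVec (a (t, x)) ξ‖ ^ 2) / ENNReal.ofReal (quadForm (a (t, x)) ξ)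

/-- Assumption (H^a): `a` is Borel, `λ` and `μ` are Borel, and the norms `|||λ⁻¹|||_{p₀}` and
`|||μ|||_{p₁}` are finite, with the bounds `Nlam` and `Nmu`. -/
structure HypA {d : ℕ} (p0 p1 : ℝ≥0∞) (Nlam Nmu : ℝ≥0)
    (a : SpaceTime d → Matrix (Fin d) (Fin d) ℝ) : Prop where
  measurable_a : ∀ i j, Measurable fun z => a z i j
  measurable_lam : Measurable (lam a)
  measurable_mu : Measurable (mu a)
  norm_lam_inv_le : locNorm p0 (fun x => (lam a x)⁻¹) ≤ Nlam
  norm_mu_le : locNorm p1 (mu a) ≤ Nmu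

/-- `ϑ₁ = (1 - (d-1)/(2p₀))⁻¹`. -/
def theta1 (d : ℕ) (p0 : ℝ≥0∞) : ℝ := (1 - ((d : ℝ) - 1) / 2 * recip p0)⁻¹

/-- `ϑ₂ = (1 - d/(2p₀))⁻¹`. -/
def theta2 (d : ℕ) (p0 : ℝ≥0∞) : ℝ := (1 - (d : ℝ) / 2 * recip p0)⁻¹

/-- The condition `1/(2p₀) + 1/p₂ < (1/2 - 1/q₂)(2/d - 1/p₀)`, for `p₂, q₂ ∈ [1,∞]`. -/
def DriftExponents1 (d : ℕ) (p0 p2 q2 : ℝ≥0∞) : Prop :=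
  1 ≤ p2 ∧ 1 ≤ q2 ∧
    recip p0 / 2 + recip p2 < (1 / 2 - recip q2) * (2 / (d : ℝ) - recip p0)

/-- The condition `(d-1)ϑ₁/p₃ + (2 + ϑ₁ + d(ϑ₂ - ϑ₁))/q₃ < 2`, for `1 ≤ p₃ ≤ q₃ ≤ ∞`. -/
def DriftExponents2 (d : ℕ) (p0 p3 q3 : ℝ≥0∞) : Prop :=
  1 ≤ p3 ∧ p3 ≤ q3 ∧
    ((d : ℝ) - 1) * theta1 d p0 * recip p3
      + (2 + theta1 d p0 + (d : ℝ) * (theta2 d p0 - theta1 d p0)) * recip q3 < 2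

/-- The index set `𝕀^d_{p₀}`: `(p,q) ∈ [1,∞]²` with `1/p < (1 - 1/q)(2/d - 1/p₀)`. -/
def indexSet (d : ℕ) (p0 : ℝ≥0∞) : Set (ℝ≥0∞ × ℝ≥0∞) :=
  {pq | 1 ≤ pq.1 ∧ 1 ≤ pq.2 ∧ recip pq.1 < (1 - recip pq.2) * (2 / (d : ℝ) - recip p0)}

/-- The gradient `∇g(t,x)` in the space variable. -/
def spaceGrad {d : ℕ} (g : SpaceTime d → ℝ) (z : SpaceTime d) : Space d :=
  gradient (fun x => g (z.1, x)) z.2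

/-- The derivative `∂_t g(t,x)` in the time variable. -/
def timeDeriv {d : ℕ} (g : SpaceTime d → ℝ) (z : SpaceTime d) : ℝ :=
  deriv (fun t => g (t, z.2)) z.1

/-- `(div v)⁻ = 0`: the distribution `div v` (divergence in the space variable) is nonnegative,
that is, `⟨div v, φ⟩ = -∬ v · ∇φ ≥ 0` for all nonnegative test functions `φ`. -/
def DivNonneg {d : ℕ} (v : SpaceTime d → Space d) : Prop :=
  ∀ φ : SpaceTime d → ℝ, ContDiff ℝ ((⊤ : ℕ∞) : WithTop ℕ∞) φ → HasCompactSupport φ → (∀ z, 0 ≤ φ z) →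
    ∫ z, inner ℝ (v z) (spaceGrad φ z) ≤ 0

/-- Assumption (H^b): `b = b₁ + b₂`, where `b₁ ≡ 0` if `p₀ ≤ d`, while `b₁ ∈ 𝕃̃^{q₂,p₂}_{t,x}` with
norm at most `N1` if `p₀ > d`, and where `(div b₂)⁻ = 0` and `b₂ ∈ 𝕃̃^{p₃,q₃}_{x,t}` with norm at
most `N2`. The restrictions on the exponents are `DriftExponents1` (if `p₀ > d`) and
`DriftExponents2`. -/
def HypB {d : ℕ} (p0 p2 q2 p3 q3 : ℝ≥0∞) (N1 N2 : ℝ≥0) (b : SpaceTime d → Space d) : Prop :=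
  ((d : ℝ≥0∞) < p0 → DriftExponents1 d p0 p2 q2) ∧ DriftExponents2 d p0 p3 q3 ∧
    ∃ b1 b2 : SpaceTime d → Space d, Measurable b1 ∧ Measurable b2 ∧ (∀ z, b z = b1 z + b2 z) ∧
      (p0 ≤ (d : ℝ≥0∞) → ∀ z, b1 z = 0) ∧
      ((d : ℝ≥0∞) < p0 → locNormTX q2 p2 b1 ≤ N1) ∧
      DivNonneg b2 ∧ locNormXT p3 q3 b2 ≤ N2

/-- `u` is a Lipschitz weak subsolution of `∂_t u = div(a·∇u) + b·∇u + f` in `ℝ^{1+d}`.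

Local boundedness of the spatial gradient of the continuous function `u` is expressed by saying that
on bounded sets `u(t,·)` is Lipschitz with a constant that does not depend on `t`; then the classical
gradient exists almost everywhere and is the weak gradient. As usual, the integrals in the weak
formulation are required to converge absolutely. -/
structure IsLipschitzWeakSubsolution {d : ℕ} (a : SpaceTime d → Matrix (Fin d) (Fin d) ℝ)
    (b : SpaceTime d → Space d) (f : SpaceTime d → ℝ) (u : SpaceTime d → ℝ) : Prop where
  continuous : Continuous u
  gradient_locally_bounded : ∀ R : ℝ, ∃ L : ℝ≥0, ∀ t ∈ Icc (-R) R,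
    LipschitzOnWith L (fun x => u (t, x)) (Metric.ball 0 R)
  weak_inequality : ∀ φ : SpaceTime d → ℝ, (∃ L : ℝ≥0, LipschitzWith L φ) →
    HasCompactSupport φ → (∀ z, 0 ≤ φ z) →
      Integrable (fun z => u z * timeDeriv φ z) ∧
      Integrable (fun z => inner ℝ (matVec (a z) (spaceGrad u z)) (spaceGrad φ z)) ∧
      Integrable (fun z => inner ℝ (b z) (spaceGrad u z) * φ z) ∧
      Integrable (fun z => f z * φ z) ∧
      -(∫ z, u z * timeDeriv φ z) ≤
        -(∫ z, inner ℝ (matVec (a z) (spaceGrad u z)) (spaceGrad φ z))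
          + (∫ z, inner ℝ (b z) (spaceGrad u z) * φ z) + ∫ z, f z * φ z

end

section

open Filter Topology Convolution in
/-- A compactly supported Lipschitz function is the limit of smooth functions with a common compact
support, uniformly bounded derivatives, and derivatives converging almost everywhere. -/
theorem exists_smooth_approx_of_lipschitz {E : Type*} [NormedAddCommGroup E] [NormedSpace ℝ E]
    [FiniteDimensional ℝ E] [MeasurableSpace E] [BorelSpace E] (μ : Measure E) [μ.IsAddHaarMeasure]
    {v : E → ℝ} {L : ℝ≥0} (hv : LipschitzWith L v) (hc : HasCompactSupport v) :
    ∃ (vk : ℕ → E → ℝ) (K : Set E) (M : ℝ), IsCompact K ∧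
      (∀ k, ContDiff ℝ ((⊤ : ℕ∞) : WithTop ℕ∞) (vk k)) ∧
      (∀ k, tsupport (vk k) ⊆ K) ∧ (tsupport v ⊆ K) ∧ ((∀ x, 0 ≤ v x) → ∀ k x, 0 ≤ vk k x) ∧
      (∀ k x, ‖vk k x‖ ≤ M) ∧ (∀ x, ‖v x‖ ≤ M) ∧ (∀ k x, ‖fderiv ℝ (vk k) x‖ ≤ L) ∧
      (∀ x, Tendsto (fun k => vk k x) atTop (𝓝 (v x))) ∧
      (∀ᵐ x ∂μ, Tendsto (fun k => fderiv ℝ (vk k) x) atTop (𝓝 (fderiv ℝ v x))) := by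
  obtain ⟨M, hM⟩ := hc.exists_bound_of_continuous hv.continuous
  let φ : ℕ → ContDiffBump (0 : E) := fun k =>
    { rIn := 1 / ((k : ℝ) + 1)
      rOut := 2 / ((k : ℝ) + 1)
      rIn_pos := by positivity
      rIn_lt_rOut := by gcongr; norm_num }
  have hrout : ∀ k, (φ k).rOut ≤ 2 := fun k => by
    change 2 / ((k : ℝ) + 1) ≤ 2
    rw [div_le_iff₀ (by positivity)]; nlinarith [(Nat.cast_nonneg k : (0:ℝ) ≤ k)]
  have htend : Tendsto (fun k => (φ k).rOut) atTop (𝓝 0) := by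
    change Tendsto (fun k : ℕ => 2 / ((k : ℝ) + 1)) atTop (𝓝 0)
    have := (tendsto_one_div_add_atTop_nhds_zero_nat (𝕜 := ℝ)).const_mul 2
    simpa [div_eq_mul_inv] using this
  have hdv : Measurable (fderiv ℝ v) := measurable_fderiv ℝ v
  have hdb : ∀ x, ‖fderiv ℝ v x‖ ≤ L := fun x => norm_fderiv_le_of_lipschitz ℝ hv
  have hloc : LocallyIntegrable (fderiv ℝ v) μ := by
    apply (locallyIntegrable_const (L : ℝ)).mono hdv.aestronglyMeasurable
    exact Eventually.of_forall fun x => by simpa using hdb x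
  have hvint : LocallyIntegrable v μ := hv.continuous.locallyIntegrable
  have hφint : ∀ k, Integrable ((φ k).normed μ) μ := fun k => (φ k).integrable_normed
  have hφn : ∀ k y, 0 ≤ (φ k).normed μ y := fun k y => (φ k).nonneg_normed y
  have hder : ∀ k x, HasFDerivAt ((φ k).normed μ ⋆[ContinuousLinearMap.lsmul ℝ ℝ, μ] v)
      (((φ k).normed μ ⋆[ContinuousLinearMap.lsmul ℝ ℝ, μ] (fderiv ℝ v)) x) x := by
    intro k x
    have := hasFDerivAt_integral_of_dominated_loc_of_lip (μ := μ) (𝕜 := ℝ)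
      (F := fun x y => (φ k).normed μ y • v (x - y))
      (F' := fun y => (φ k).normed μ y • fderiv ℝ v (x - y)) (x₀ := x) (s := univ)
      (bound := fun y => (φ k).normed μ y * L) univ_mem ?_ ?_ ?_ ?_ ?_ ?_
    · exact this.2
    · refine Eventually.of_forall fun x => ?_
      exact ((φ k).continuous_normed.smul
        (hv.continuous.comp (continuous_const.sub continuous_id))).aestronglyMeasurable
    · refine Integrable.mono ((hφint k).mul_const M) ((φ k).continuous_normed.smul
        (hv.continuous.comp (continuous_const.sub continuous_id))).aestronglyMeasurable ?_
      refine Eventually.of_forall fun y => ?_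
      simp only [norm_smul, norm_mul]
      gcongr
      exact (hM _).trans (le_abs_self M)
    · exact ((φ k).continuous_normed.measurable.smul
        (hdv.comp (measurable_const.sub measurable_id))).aestronglyMeasurable
    · refine Eventually.of_forall fun y => LipschitzOnWith.of_dist_le_mul fun a _ b _ => ?_
      rw [dist_eq_norm, ← smul_sub, norm_smul, Real.coe_nnabs, abs_mul, Real.norm_eq_abs, mul_assoc]
      gcongr
      have := hv.dist_le_mul (a - y) (b - y)
      rw [dist_sub_right, dist_eq_norm] at this
      simpa using this
    · exact (hφint k).mul_const _
    · have h1 : ∀ᵐ y ∂μ, DifferentiableAt ℝ v (x - y) := by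
        have := (quasiMeasurePreserving_sub_left_of_right_invariant μ x).ae hv.ae_differentiableAt
        exact this
      filter_upwards [h1] with y hy
      have := (hy.hasFDerivAt.comp x ((hasFDerivAt_id x).sub_const y))
      simpa using! this.const_smul ((φ k).normed μ y)
  refine ⟨fun k => (φ k).normed μ ⋆[ContinuousLinearMap.lsmul ℝ ℝ, μ] v,
    Metric.cthickening 2 (tsupport v), M, hc.isCompact.cthickening, ?_, ?_, ?_, ?_, ?_, hM, ?_, ?_, ?_⟩
  · intro k
    exact (φ k).hasCompactSupport_normed.contDiff_convolution_left _ (φ k).contDiff_normed hvint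
  · intro k
    apply closure_minimal _ Metric.isClosed_cthickening
    intro x hx
    obtain ⟨a, ha, b, hb, rfl⟩ := support_convolution_subset _ hx
    rw [ContDiffBump.support_normed_eq] at ha
    refine Metric.mem_cthickening_of_dist_le _ b _ _ (subset_tsupport _ hb) ?_
    simp only [Metric.mem_ball, dist_zero_right] at ha
    simpa [dist_eq_norm] using ha.le.trans (hrout k)
  · exact Metric.self_subset_cthickening _
  · intro h0 k x
    exact integral_nonneg fun y => mul_nonneg (hφn k y) (h0 _)
  · intro k x
    have : ‖∫ y, (φ k).normed μ y • v (x - y) ∂μ‖ ≤ ∫ y, (φ k).normed μ y * M ∂μ := by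
      apply norm_integral_le_of_norm_le ((hφint k).mul_const M)
      refine Eventually.of_forall fun y => ?_
      rw [norm_smul, Real.norm_of_nonneg (hφn k y)]
      exact mul_le_mul_of_nonneg_left (hM _) (hφn k y)
    rw [integral_mul_const, (φ k).integral_normed, one_mul] at this
    exact this
  · intro k x
    rw [(hder k x).fderiv]
    have : ‖∫ y, (φ k).normed μ y • fderiv ℝ v (x - y) ∂μ‖ ≤ ∫ y, (φ k).normed μ y * L ∂μ := by
      apply norm_integral_le_of_norm_le ((hφint k).mul_const _)
      refine Eventually.of_forall fun y => ?_
      rw [norm_smul, Real.norm_of_nonneg (hφn k y)]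
      exact mul_le_mul_of_nonneg_left (hdb _) (hφn k y)
    rw [integral_mul_const, (φ k).integral_normed, one_mul] at this
    exact this
  · intro x
    exact ContDiffBump.convolution_tendsto_right_of_continuous htend hv.continuous x
  · filter_upwards [ContDiffBump.ae_convolution_tendsto_right_of_locallyIntegrable (K := 2) htend
      (Eventually.of_forall fun k => by
        change 2 / ((k : ℝ) + 1) ≤ 2 * (1 / ((k : ℝ) + 1)); rw [mul_one_div]) hloc] with x hx
    simpa only [(hder _ x).fderiv] using hx

end

section

open Filter Topology in
theorem tendsto_lintegral_enorm_rpow_of_bounded {E F : Type*} [MeasurableSpace E] [TopologicalSpace E]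
    [T2Space E] [OpensMeasurableSpace E] {μ : Measure E} [IsFiniteMeasureOnCompacts μ]
    [NormedAddCommGroup F] [MeasurableSpace F] [BorelSpace F]
    {fk : ℕ → E → F} {f : E → F} {K : Set E} {M r : ℝ} (hr : 0 < r) (hK : IsCompact K)
    (hmeas : ∀ k, Measurable (fk k)) (hsupp : ∀ k, ∀ x ∉ K, fk k x = 0) (hM : ∀ k x, ‖fk k x‖ ≤ M)
    (hlim : ∀ᵐ x ∂μ, Tendsto (fun k => fk k x) atTop (𝓝 (f x))) :
    Tendsto (fun k => ∫⁻ x, ‖fk k x‖ₑ ^ r ∂μ) atTop (𝓝 (∫⁻ x, ‖f x‖ₑ ^ r ∂μ)) ∧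
      ∫⁻ x, ‖f x‖ₑ ^ r ∂μ ≠ ⊤ := by
  have hKm := hK.measurableSet
  have hbd : ∀ k x, ‖fk k x‖ₑ ^ r ≤ K.indicator (fun _ => ENNReal.ofReal M ^ r) x := by
    intro k x
    by_cases hx : x ∈ K
    · rw [indicator_of_mem hx]
      gcongr
      rw [← ofReal_norm]
      exact ENNReal.ofReal_le_ofReal (hM k x)
    · rw [hsupp k x hx]; simp [hr]
  have hfin : ∫⁻ x, K.indicator (fun _ => ENNReal.ofReal M ^ r) x ∂μ ≠ ⊤ := by
    rw [lintegral_indicator hKm, setLIntegral_const]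
    exact ENNReal.mul_ne_top (ENNReal.rpow_ne_top_of_nonneg hr.le ENNReal.ofReal_ne_top)
      hK.measure_lt_top.ne
  have hT : Tendsto (fun k => ∫⁻ x, ‖fk k x‖ₑ ^ r ∂μ) atTop (𝓝 (∫⁻ x, ‖f x‖ₑ ^ r ∂μ)) := by
    apply tendsto_lintegral_of_dominated_convergence _
      (fun k => (hmeas k).enorm.pow_const r) (fun k => Eventually.of_forall (hbd k)) hfin
    filter_upwards [hlim] with x hx
    exact (ENNReal.continuous_rpow_const.tendsto _).comp hx.enorm
  refine ⟨hT, ne_top_of_le_ne_top hfin (le_of_tendsto' hT fun k => lintegral_mono (hbd k))⟩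

open Filter Topology in
/-- An interpolation inequality of Gagliardo-Nirenberg type passes from smooth to Lipschitz
functions of compact support. -/
theorem gagliardoNirenberg_of_smooth {E : Type*} [NormedAddCommGroup E] [NormedSpace ℝ E]
    [FiniteDimensional ℝ E] [MeasurableSpace E] [BorelSpace E] (μ : Measure E) [μ.IsAddHaarMeasure]
    {P : ℝ≥0∞} {C : ℝ≥0} {r m x y : ℝ} (hr : 0 < r) (hm : 0 < m) (hx : 0 ≤ x) (hy : 0 ≤ y)
    (H : ∀ v : E → ℝ, ContDiff ℝ 1 v → HasCompactSupport v →
      eLpNorm v P μ ≤ C * ((∫⁻ z, ‖fderiv ℝ v z‖ₑ ^ r ∂μ) ^ x * (∫⁻ z, ‖v z‖ₑ ^ m ∂μ) ^ y))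
    {v : E → ℝ} {L : ℝ≥0} (hv : LipschitzWith L v) (hc : HasCompactSupport v) :
    eLpNorm v P μ ≤ C * ((∫⁻ z, ‖fderiv ℝ v z‖ₑ ^ r ∂μ) ^ x * (∫⁻ z, ‖v z‖ₑ ^ m ∂μ) ^ y) := by
  obtain ⟨vk, K, M, hK, hsm, hsupp, -, -, hM, -, hL, hlim, hdlim⟩ :=
    exists_smooth_approx_of_lipschitz μ hv hc
  have h1 := tendsto_lintegral_enorm_rpow_of_bounded (μ := μ) (fk := fun k => fderiv ℝ (vk k))
    (f := fderiv ℝ v) hr hK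
    (fun k => measurable_fderiv ℝ (vk k)) (fun k z hz => by
      have : z ∉ tsupport (fderiv ℝ (vk k)) := fun h => hz (hsupp k (tsupport_fderiv_subset ℝ h))
      exact image_eq_zero_of_notMem_tsupport this) hL hdlim
  have h2 := tendsto_lintegral_enorm_rpow_of_bounded (μ := μ) (fk := vk) (f := v) hm hK
    (fun k => (hsm k).continuous.measurable) (fun k z hz =>
      image_eq_zero_of_notMem_tsupport fun h => hz (hsupp k h)) hM (Eventually.of_forall hlim)
  have h3 : Tendsto (fun k => (C : ℝ≥0∞) * ((∫⁻ z, ‖fderiv ℝ (vk k) z‖ₑ ^ r ∂μ) ^ x *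
      (∫⁻ z, ‖vk k z‖ₑ ^ m ∂μ) ^ y)) atTop
      (𝓝 (C * ((∫⁻ z, ‖fderiv ℝ v z‖ₑ ^ r ∂μ) ^ x * (∫⁻ z, ‖v z‖ₑ ^ m ∂μ) ^ y))) := by
    apply ENNReal.Tendsto.const_mul _ (Or.inr ENNReal.coe_ne_top)
    apply ENNReal.Tendsto.mul
    · exact (ENNReal.continuous_rpow_const.tendsto _).comp h1.1
    · exact Or.inr (ENNReal.rpow_ne_top_of_nonneg hy h2.2)
    · exact (ENNReal.continuous_rpow_const.tendsto _).comp h2.1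
    · exact Or.inr (ENNReal.rpow_ne_top_of_nonneg hx h1.2)
  calc eLpNorm v P μ ≤ liminf (fun k => eLpNorm (vk k) P μ) atTop :=
        Lp.eLpNorm_lim_le_liminf_eLpNorm
          (fun k => (hsm k).continuous.aestronglyMeasurable) v (Eventually.of_forall hlim)
    _ ≤ liminf (fun k => (C : ℝ≥0∞) * ((∫⁻ z, ‖fderiv ℝ (vk k) z‖ₑ ^ r ∂μ) ^ x *
      (∫⁻ z, ‖vk k z‖ₑ ^ m ∂μ) ^ y)) atTop := by
        exact liminf_le_liminf (Eventually.of_forall fun k =>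
          H _ ((hsm k).of_le (by exact_mod_cast le_top))
            (hK.of_isClosed_subset (isClosed_tsupport _) (hsupp k)))
    _ = _ := h3.liminf_eq

theorem recip_eq_toReal_inv (P : ℝ≥0∞) : recip P = P.toReal⁻¹ := by
  rw [recip, ENNReal.toReal_inv]

/-- Gagliardo-Nirenberg in dimension at least two, for smooth functions. -/
theorem gagliardoNirenberg_smooth_of_two_le {n : ℕ} (hn : 2 ≤ n) {P : ℝ≥0∞} {r m θ : ℝ}
    (hr : 1 ≤ r) (hrn : r < n) (hm : 1 ≤ m) (hθ0 : 0 ≤ θ) (hθ1 : θ ≤ 1)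
    (hP : recip P = θ * (1 / r - 1 / n) + (1 - θ) / m) :
    ∃ C : ℝ≥0, ∀ v : (Fin n → ℝ) → ℝ, ContDiff ℝ 1 v → HasCompactSupport v →
      eLpNorm v P volume ≤ C * ((∫⁻ z, ‖fderiv ℝ v z‖ₑ ^ r) ^ (θ / r) *
        (∫⁻ z, ‖v z‖ₑ ^ m) ^ ((1 - θ) / m)) := by
  have hn0 : (0 : ℝ) < n := by positivity
  have hr0 : 0 < r := by linarith
  have hm0 : 0 < m := by linarith
  have hs : 0 < 1 / r - 1 / n := by
    rw [sub_pos]; exact one_div_lt_one_div_of_lt hr0 hrn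
  set s : ℝ := (1 / r - 1 / n)⁻¹ with hsdef
  have hs0 : 0 < s := inv_pos.2 hs
  have hP0 : 0 < recip P := by
    rw [hP]
    rcases hθ0.eq_or_lt with h | h
    · subst h; simp; exact hm0
    · have : 0 ≤ (1 - θ) / m := div_nonneg (by linarith) hm0.le
      nlinarith [mul_pos h hs]
  set pr := P.toReal with hpr
  have hprr : recip P = pr⁻¹ := recip_eq_toReal_inv P
  have hpr0 : 0 < pr := inv_pos.1 (hprr ▸ hP0)
  have hPne0 : P ≠ 0 := fun h => by simp [hpr, h] at hpr0
  have hPnet : P ≠ ⊤ := fun h => by simp [hpr, h] at hpr0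
  refine ⟨(eLpNormLESNormFDerivOfEqInnerConst (volume : Measure (Fin n → ℝ)) r) ^ θ,
    fun v hv hc => ?_⟩
  have hsob := eLpNorm_le_eLpNorm_fderiv_of_eq_inner (volume : Measure (Fin n → ℝ)) hv hc
    (p := r.toNNReal) (p' := s.toNNReal) (Real.one_le_toNNReal.2 hr) (by simp; omega)
    (by rw [NNReal.coe_inv, Real.coe_toNNReal _ hr0.le, Real.coe_toNNReal _ hs0.le]; simp [hsdef])
  have e1 : eLpNorm v (s.toNNReal : ℝ≥0∞) volume = (∫⁻ z, ‖v z‖ₑ ^ s) ^ (1 / s) := by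
    rw [eLpNorm_eq_lintegral_rpow_enorm_toReal
      (by simpa using hs0) ENNReal.coe_ne_top, ENNReal.coe_toReal, Real.coe_toNNReal _ hs0.le]
  have e2 : eLpNorm (fderiv ℝ v) (r.toNNReal : ℝ≥0∞) volume
      = (∫⁻ z, ‖fderiv ℝ v z‖ₑ ^ r) ^ (1 / r) := by
    rw [eLpNorm_eq_lintegral_rpow_enorm_toReal
      (by simpa using hr0) ENNReal.coe_ne_top, ENNReal.coe_toReal, Real.coe_toNNReal _ hr0.le]
  rw [e1, e2, Real.coe_toNNReal _ hr0.le] at hsob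
  have hx : θ * pr / s + (1 - θ) * pr / m = 1 := by
    have : pr * recip P = 1 := by rw [hprr]; exact mul_inv_cancel₀ hpr0.ne'
    rw [hP, show (1 / r - 1 / n : ℝ) = 1 / s by simp [hsdef]] at this
    linear_combination this
  have hmeas : Measurable fun z => ‖v z‖ₑ := hv.continuous.measurable.enorm
  have key := ENNReal.lintegral_mul_norm_pow_le (μ := volume) (hmeas.pow_const s).aemeasurable
    (hmeas.pow_const m).aemeasurable (p := θ * pr / s) (q := (1 - θ) * pr / m)
    (by positivity) (div_nonneg (mul_nonneg (by linarith) hpr0.le) hm0.le) hx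
  have e3 : ∀ z, (‖v z‖ₑ ^ s) ^ (θ * pr / s) * (‖v z‖ₑ ^ m) ^ ((1 - θ) * pr / m) = ‖v z‖ₑ ^ pr := by
    intro z
    rw [← ENNReal.rpow_mul, ← ENNReal.rpow_mul, ← ENNReal.rpow_add_of_nonneg]
    · congr 1; field_simp; ring
    · positivity
    · exact mul_nonneg hm0.le (div_nonneg (mul_nonneg (by linarith) hpr0.le) hm0.le)
  simp_rw [e3] at key
  rw [eLpNorm_eq_lintegral_rpow_enorm_toReal hPne0 hPnet, ← hpr]
  calc (∫⁻ z, ‖v z‖ₑ ^ pr) ^ (1 / pr)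
      ≤ ((∫⁻ z, ‖v z‖ₑ ^ s) ^ (θ * pr / s) * (∫⁻ z, ‖v z‖ₑ ^ m) ^ ((1 - θ) * pr / m)) ^ (1 / pr) := by
        gcongr
    _ = ((∫⁻ z, ‖v z‖ₑ ^ s) ^ (1 / s)) ^ θ * (∫⁻ z, ‖v z‖ₑ ^ m) ^ ((1 - θ) / m) := by
        rw [ENNReal.mul_rpow_of_nonneg _ _ (by positivity), ← ENNReal.rpow_mul, ← ENNReal.rpow_mul,
          ← ENNReal.rpow_mul]
        congr 2 <;> field_simp
    _ ≤ (eLpNormLESNormFDerivOfEqInnerConst (volume : Measure (Fin n → ℝ)) r *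
          (∫⁻ z, ‖fderiv ℝ v z‖ₑ ^ r) ^ (1 / r)) ^ θ * (∫⁻ z, ‖v z‖ₑ ^ m) ^ ((1 - θ) / m) := by
        gcongr
    _ = _ := by
        rw [ENNReal.mul_rpow_of_nonneg _ _ hθ0, ← ENNReal.rpow_mul, ENNReal.coe_rpow_of_nonneg _ hθ0,
          mul_assoc]
        congr 3; field_simp

/-- In dimension one, `|v|^γ` is bounded by the integral of its derivative. -/
theorem enorm_rpow_le_lintegral_fin_one {γ : ℝ} (hγ : 1 < γ) {v : (Fin 1 → ℝ) → ℝ}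
    (hv : ContDiff ℝ 1 v) (hc : HasCompactSupport v) (y : Fin 1 → ℝ) :
    ‖v y‖ₑ ^ γ ≤ ENNReal.ofReal γ * ∫⁻ z, ‖v z‖ₑ ^ (γ - 1) * ‖fderiv ℝ v z‖ₑ := by
  let J : ℝ →L[ℝ] (Fin 1 → ℝ) := ContinuousLinearMap.pi fun _ => ContinuousLinearMap.id ℝ ℝ
  have hJ1 : ‖J 1‖ₑ = 1 := by
    rw [← ofReal_norm]
    have : ‖J 1‖ = 1 := by
      simp [J, Pi.norm_def]
    rw [this]; simp
  have hvc : ContDiff ℝ 1 fun x => ‖v x‖ ^ γ := hv.norm_rpow hγ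
  have hfc : ContDiff ℝ 1 ((fun x => ‖v x‖ ^ γ) ∘ J) := hvc.comp J.contDiff
  have hcs : HasCompactSupport (fun x => ‖v x‖ ^ γ) :=
    hc.comp_left (g := fun x : ℝ => ‖x‖ ^ γ) (by simp [Real.zero_rpow (by linarith : γ ≠ 0)])
  have hfs : HasCompactSupport ((fun x => ‖v x‖ ^ γ) ∘ J) := by
    apply hcs.comp_isClosedEmbedding
    refine Topology.IsClosedEmbedding.of_continuous_injective_isClosedMap J.continuous
      (fun a b h => by simpa [J] using congrFun h 0) ?_
    exact (LinearMap.isClosedEmbedding_of_injective (f := (J : ℝ →ₗ[ℝ] (Fin 1 → ℝ)))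
      (LinearMap.ker_eq_bot.2 fun a b h => by simpa [J] using congrFun h 0)).isClosedMap
  have h := hfs.enorm_le_lintegral_Ici_deriv hfc (y 0)
  have hy : J (y 0) = y := by ext i; fin_cases i; rfl
  have e0 : ‖((fun x => ‖v x‖ ^ γ) ∘ J) (y 0)‖ₑ = ‖v y‖ₑ ^ γ := by
    simp only [Function.comp, hy]
    rw [← ofReal_norm, ← ofReal_norm, ENNReal.ofReal_rpow_of_nonneg (norm_nonneg _)
      (by linarith), Real.norm_of_nonneg (by positivity)]
  rw [e0] at h
  have hd : ∀ s, ‖deriv ((fun x => ‖v x‖ ^ γ) ∘ J) s‖ₑ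
      ≤ ENNReal.ofReal γ * (‖v (J s)‖ₑ ^ (γ - 1) * ‖fderiv ℝ v (J s)‖ₑ) := by
    intro s
    have h1 : HasDerivAt ((fun x => ‖v x‖ ^ γ) ∘ J) (fderiv ℝ (fun x => ‖v x‖ ^ γ) (J s) (J 1)) s := by
      have := ((hvc.differentiable one_ne_zero (J s)).hasFDerivAt.comp_hasDerivAt s
        (J.hasFDerivAt.hasDerivAt))
      simpa using this
    rw [h1.deriv]
    refine (ContinuousLinearMap.le_opENorm _ _).trans ?_
    rw [hJ1, mul_one]
    have h2 := enorm_fderiv_norm_rpow_le (x := J s) (hv.differentiable one_ne_zero) (p := γ.toNNReal)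
      (Real.one_lt_toNNReal.2 hγ)
    rw [Real.coe_toNNReal _ (by linarith)] at h2
    refine h2.trans (le_of_eq ?_)
    rw [mul_assoc]
    rfl
  calc ‖v y‖ₑ ^ γ ≤ ∫⁻ s in Iic (y 0), ‖deriv ((fun x => ‖v x‖ ^ γ) ∘ J) s‖ₑ := h
    _ ≤ ∫⁻ s, ENNReal.ofReal γ * (‖v (J s)‖ₑ ^ (γ - 1) * ‖fderiv ℝ v (J s)‖ₑ) :=
        (setLIntegral_le_lintegral _ _).trans (lintegral_mono hd)
    _ = ENNReal.ofReal γ * ∫⁻ s, (‖v (J s)‖ₑ ^ (γ - 1) * ‖fderiv ℝ v (J s)‖ₑ) :=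
        lintegral_const_mul' _ _ ENNReal.ofReal_ne_top
    _ = _ := by
        congr 1
        exact (volume_preserving_funUnique (Fin 1) ℝ).symm.lintegral_comp_emb
          (MeasurableEquiv.measurableEmbedding _) (fun z => ‖v z‖ₑ ^ (γ - 1) * ‖fderiv ℝ v z‖ₑ)

/-- Gagliardo-Nirenberg in dimension one, for smooth functions. -/
theorem gagliardoNirenberg_smooth_one {P : ℝ≥0∞} {r m θ : ℝ}
    (hr : 1 < r) (hm : 1 ≤ m) (hθ0 : 0 ≤ θ)
    (hP : recip P = θ * (1 / r - 1) + (1 - θ) / m) :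
    ∃ C : ℝ≥0, ∀ v : (Fin 1 → ℝ) → ℝ, ContDiff ℝ 1 v → HasCompactSupport v →
      eLpNorm v P volume ≤ C * ((∫⁻ z, ‖fderiv ℝ v z‖ₑ ^ r) ^ (θ / r) *
        (∫⁻ z, ‖v z‖ₑ ^ m) ^ ((1 - θ) / m)) := by
  have hr0 : 0 < r := by linarith
  have hm0 : 0 < m := by linarith
  have hr1 : 0 < 1 - 1 / r := by rw [sub_pos, div_lt_one hr0]; exact hr
  set γ := 1 + m * (1 - 1 / r) with hγ
  have hγ1 : 1 < γ := by rw [hγ]; nlinarith [mul_pos hm0 hr1]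
  have hγ0 : 0 < γ := by linarith
  refine ⟨γ.toNNReal ^ θ, fun v hv hc => ?_⟩
  set A := ∫⁻ z, ‖fderiv ℝ v z‖ₑ ^ r
  set B := ∫⁻ z, ‖v z‖ₑ ^ m
  have hmeas : Measurable fun z => ‖v z‖ₑ := hv.continuous.measurable.enorm
  have hsup : ∀ y, ‖v y‖ₑ ^ γ ≤ ENNReal.ofReal γ * (A ^ (1 / r) * B ^ (1 - 1 / r)) := by
    intro y
    refine (enorm_rpow_le_lintegral_fin_one hγ1 hv hc y).trans ?_
    gcongr
    have key := ENNReal.lintegral_mul_norm_pow_le (μ := volume)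
      ((measurable_fderiv ℝ v).enorm.pow_const r).aemeasurable
      (hmeas.pow_const m).aemeasurable (p := 1 / r) (q := 1 - 1 / r)
      (by positivity) hr1.le (by ring)
    refine le_trans (le_of_eq (lintegral_congr fun z => ?_)) key
    rw [← ENNReal.rpow_mul, ← ENNReal.rpow_mul, mul_one_div_cancel hr0.ne', ENNReal.rpow_one, mul_comm]
    congr 2; rw [hγ]; ring
  set S := ⨆ y, ‖v y‖ₑ with hS
  have hSγ : S ^ γ ≤ ENNReal.ofReal γ * (A ^ (1 / r) * B ^ (1 - 1 / r)) := by
    rw [← ENNReal.le_rpow_inv_iff hγ0]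
    exact iSup_le fun y => by rw [ENNReal.le_rpow_inv_iff hγ0]; exact hsup y
  have hSθ : S ^ (θ * γ) ≤ (γ.toNNReal : ℝ≥0∞) ^ θ * (A ^ (θ / r) * B ^ (θ * (1 - 1 / r))) := by
    rw [mul_comm, ENNReal.rpow_mul]
    refine (ENNReal.rpow_le_rpow hSγ hθ0).trans (le_of_eq ?_)
    rw [ENNReal.mul_rpow_of_nonneg _ _ hθ0, ENNReal.mul_rpow_of_nonneg _ _ hθ0, ← ENNReal.rpow_mul,
      ← ENNReal.rpow_mul]
    congr 3 <;> ring
  have hmp : m * recip P = 1 - θ * γ := by rw [hP, hγ]; field_simp; ring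
  have hmain : eLpNorm v P volume ≤ S ^ (θ * γ) * B ^ (recip P) := by
    rcases eq_or_ne P 0 with h0 | h0
    · simp [h0]
    rcases eq_or_ne P ⊤ with ht | ht
    · subst ht
      have : recip ⊤ = 0 := by simp [recip]
      rw [this] at hmp ⊢
      have h1 : θ * γ = 1 := by linarith
      rw [h1, ENNReal.rpow_zero, mul_one, ENNReal.rpow_one, eLpNorm_exponent_top]
      exact essSup_le_of_ae_le _ (Filter.Eventually.of_forall fun y => le_iSup (fun y => ‖v y‖ₑ) y)
    · set pr := P.toReal with hpr
      have hpr0 : 0 < pr := ENNReal.toReal_pos h0 ht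
      have hprr : recip P = pr⁻¹ := recip_eq_toReal_inv P
      have hpm : 0 ≤ pr - m := by
        have : m * pr⁻¹ ≤ 1 := by
          rw [← hprr, hmp]; nlinarith [mul_nonneg hθ0 hγ0.le]
        rw [← div_eq_mul_inv, div_le_one hpr0] at this
        linarith
      rw [eLpNorm_eq_lintegral_rpow_enorm_toReal h0 ht, ← hpr, hprr]
      calc (∫⁻ z, ‖v z‖ₑ ^ pr) ^ (1 / pr) ≤ (∫⁻ z, S ^ (pr - m) * ‖v z‖ₑ ^ m) ^ (1 / pr) := by
            gcongr with z
            calc ‖v z‖ₑ ^ pr = ‖v z‖ₑ ^ (pr - m) * ‖v z‖ₑ ^ m := by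
                  rw [← ENNReal.rpow_add_of_nonneg _ _ hpm hm0.le]; congr 1; ring
              _ ≤ _ := by gcongr; exact le_iSup (fun y => ‖v y‖ₑ) z
        _ = S ^ (θ * γ) * B ^ pr⁻¹ := by
            rw [lintegral_const_mul _ (hmeas.pow_const m), ENNReal.mul_rpow_of_nonneg _ _ (by positivity),
              ← ENNReal.rpow_mul, one_div]
            congr 2
            have := hmp; rw [hprr] at this
            field_simp at this ⊢; linarith
  calc eLpNorm v P volume ≤ S ^ (θ * γ) * B ^ (recip P) := hmain
    _ ≤ ((γ.toNNReal : ℝ≥0∞) ^ θ * (A ^ (θ / r) * B ^ (θ * (1 - 1 / r)))) * B ^ (recip P) := by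
        gcongr
    _ = _ := by
        rw [mul_assoc, mul_assoc, ← ENNReal.rpow_add_of_nonneg _ _ (mul_nonneg hθ0 hr1.le)
          (show 0 ≤ recip P from ENNReal.toReal_nonneg), ENNReal.coe_rpow_of_nonneg _ hθ0]
        congr 3
        rw [hP]; ring

/-- The **Gagliardo-Nirenberg inequality** on `ℝⁿ` for compactly supported Lipschitz functions. -/
theorem gagliardoNirenberg {n : ℕ} (hn : 1 ≤ n) {P : ℝ≥0∞} {r m θ : ℝ}
    (hr : 1 < r) (hr2 : r < 2) (hm : 1 ≤ m) (hθ0 : 0 ≤ θ) (hθ1 : θ ≤ 1)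
    (hP : recip P = θ * (1 / r - 1 / n) + (1 - θ) / m) :
    ∃ C : ℝ≥0, ∀ (v : (Fin n → ℝ) → ℝ) (L : ℝ≥0), LipschitzWith L v → HasCompactSupport v →
      eLpNorm v P volume ≤ C * ((∫⁻ z, ‖fderiv ℝ v z‖ₑ ^ r) ^ (θ / r) *
        (∫⁻ z, ‖v z‖ₑ ^ m) ^ ((1 - θ) / m)) := by
  have hx : 0 ≤ θ / r := by positivity
  have hy : 0 ≤ (1 - θ) / m := div_nonneg (by linarith) (by linarith)
  rcases hn.eq_or_lt with rfl | hn
  · obtain ⟨C, hC⟩ := gagliardoNirenberg_smooth_one hr hm hθ0 (by simpa using hP)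
    exact ⟨C, fun v L hv hc => gagliardoNirenberg_of_smooth volume (by linarith) (by linarith)
      hx hy hC hv hc⟩
  · have h2 : (2 : ℝ) ≤ n := by exact_mod_cast hn
    obtain ⟨C, hC⟩ := gagliardoNirenberg_smooth_of_two_le hn hr.le (by linarith) hm hθ0 hθ1 hP
    exact ⟨C, fun v L hv hc => gagliardoNirenberg_of_smooth volume (by linarith) (by linarith)
      hx hy hC hv hc⟩

end

section

/-- The piecewise linear cutoff equal to `1` on `(-∞,ρ]` and to `0` on `[R,∞)`. -/
noncomputable def ramp (ρ R s : ℝ) : ℝ := max 0 (min 1 ((R - s) / (R - ρ)))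

theorem ramp_nonneg (ρ R s : ℝ) : 0 ≤ ramp ρ R s := le_max_left _ _

theorem ramp_le_one (ρ R s : ℝ) : ramp ρ R s ≤ 1 := max_le zero_le_one (min_le_left _ _)

theorem ramp_eq_one {ρ R s : ℝ} (h : ρ < R) (hs : s ≤ ρ) : ramp ρ R s = 1 := by
  have : 1 ≤ (R - s) / (R - ρ) := by rw [one_le_div (by linarith)]; linarith
  rw [ramp, min_eq_left this, max_eq_right zero_le_one]

theorem ramp_eq_zero {ρ R s : ℝ} (h : ρ < R) (hs : R ≤ s) : ramp ρ R s = 0 := by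
  have : (R - s) / (R - ρ) ≤ 0 := div_nonpos_of_nonpos_of_nonneg (by linarith) (by linarith)
  rw [ramp, max_eq_left ((min_le_right _ _).trans this)]

theorem lipschitzWith_ramp {ρ R : ℝ} (h : ρ < R) :
    LipschitzWith (1 / (R - ρ)).toNNReal (ramp ρ R) := by
  have h1 : LipschitzWith (1 / (R - ρ)).toNNReal fun s => (R - s) / (R - ρ) := by
    refine LipschitzWith.of_dist_le_mul fun a b => ?_
    have hp : 0 < R - ρ := by linarith
    rw [Real.coe_toNNReal _ (by positivity), Real.dist_eq, Real.dist_eq, ← sub_div,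
      abs_div, abs_of_pos hp, show R - a - (R - b) = -(a - b) by ring, abs_neg]
    exact le_of_eq (by ring)
  exact (h1.const_min 1).const_max 0

/-- The product of a locally Lipschitz function with a compactly supported Lipschitz function. -/
theorem lipschitzWith_mul_of_locally {E : Type*} [NormedAddCommGroup E] {v ζ : E → ℝ} {L Lζ : ℝ≥0}
    {R M : ℝ} (hv : LipschitzOnWith L v (Metric.ball 0 R)) (hM : ∀ x ∈ Metric.ball 0 R, |v x| ≤ M)
    (hζ : LipschitzWith Lζ ζ) (hζ1 : ∀ x, |ζ x| ≤ 1) (hs : ∀ x ∉ Metric.ball 0 R, ζ x = 0) :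
    LipschitzWith (L + M.toNNReal * Lζ) fun x => v x * ζ x := by
  have key : ∀ x ∈ Metric.ball (0 : E) R, ∀ y ∉ Metric.ball (0 : E) R,
      |v x * ζ x| ≤ (L + M.toNNReal * Lζ) * dist x y := by
    intro x hx y hy
    have h1 := hζ.dist_le_mul x y
    rw [hs y hy, Real.dist_eq, sub_zero] at h1
    have hM0 : 0 ≤ M := (abs_nonneg _).trans (hM x hx)
    rw [abs_mul, Real.coe_toNNReal _ hM0]
    have : |v x| * |ζ x| ≤ M * (Lζ * dist x y) := mul_le_mul (hM x hx) h1 (abs_nonneg _) hM0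
    have := mul_nonneg L.coe_nonneg (dist_nonneg (x := x) (y := y))
    linarith
  refine LipschitzWith.of_dist_le_mul fun x y => ?_
  rw [Real.dist_eq]
  push_cast
  by_cases hx : x ∈ Metric.ball 0 R <;> by_cases hy : y ∈ Metric.ball 0 R
  · have h1 := hζ.dist_le_mul x y
    have h2 := hv.dist_le_mul x hx y hy
    rw [Real.dist_eq] at h1 h2
    have hM0 : 0 ≤ M := (abs_nonneg _).trans (hM x hx)
    rw [Real.coe_toNNReal _ hM0]
    have e : v x * ζ x - v y * ζ y = (v x - v y) * ζ x + v y * (ζ x - ζ y) := by ring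
    rw [e]
    refine (abs_add_le _ _).trans ?_
    rw [abs_mul, abs_mul]
    have a1 : |v x - v y| * |ζ x| ≤ L * dist x y * 1 :=
      mul_le_mul h2 (hζ1 x) (abs_nonneg _) (by positivity)
    have a2 : |v y| * |ζ x - ζ y| ≤ M * (Lζ * dist x y) :=
      mul_le_mul (hM y hy) h1 (abs_nonneg _) hM0
    linarith
  · simpa [hs y hy] using key x hx y hy
  · have := key y hy x hx
    rw [dist_comm] at this
    simpa [hs x hx] using this
  · rw [hs x hx, hs y hy]; simp; positivity

/-- Hölder's inequality with a degenerate weight `l`. -/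
theorem lintegral_rpow_le_weighted {α : Type*} [MeasurableSpace α] {μ : Measure α} {p0 : ℝ}
    (hp0 : 0 < p0) {D l : α → ℝ≥0∞} (hD : AEMeasurable D μ) (hl : AEMeasurable l μ)
    (hlt : ∀ x, l x ≠ ⊤) (hfin : ∫⁻ x, (l x)⁻¹ ^ p0 ∂μ ≠ ⊤) :
    (∫⁻ x, D x ^ (2 * p0 / (p0 + 1)) ∂μ) ^ (1 / (2 * p0 / (p0 + 1)) * 2) ≤
      (∫⁻ x, (l x)⁻¹ ^ p0 ∂μ) ^ (1 / p0) * ∫⁻ x, l x * D x ^ (2 : ℝ) ∂μ := by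
  have hp1 : 0 < p0 + 1 := by linarith
  have hl0 : ∀ᵐ x ∂μ, l x ≠ 0 := by
    filter_upwards [ae_lt_top' (hl.inv.pow_const p0) hfin] with x hx h0
    simp [h0, hp0] at hx
  have key := ENNReal.lintegral_mul_norm_pow_le (μ := μ) (hl.mul (hD.pow_const (2 : ℝ)))
    (hl.inv.pow_const p0) (p := p0 / (p0 + 1)) (q := 1 / (p0 + 1)) (by positivity) (by positivity)
    (by field_simp)
  have e : ∫⁻ x, D x ^ (2 * p0 / (p0 + 1)) ∂μ = ∫⁻ x, (l x * D x ^ (2 : ℝ)) ^ (p0 / (p0 + 1)) *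
      ((l x)⁻¹ ^ p0) ^ (1 / (p0 + 1)) ∂μ := by
    refine lintegral_congr_ae ?_
    filter_upwards [hl0] with x hx
    rw [ENNReal.mul_rpow_of_nonneg _ _ (by positivity), ← ENNReal.rpow_mul, ← ENNReal.rpow_mul,
      mul_one_div, ENNReal.inv_rpow, mul_right_comm, ENNReal.mul_inv_cancel, one_mul, mul_div_assoc]
    · simpa [ENNReal.rpow_eq_zero_iff, hx] using fun h => absurd h (hlt x)
    · exact ENNReal.rpow_ne_top_of_nonneg (by positivity) (hlt x)
  rw [e]
  refine (ENNReal.rpow_le_rpow key (by positivity)).trans (le_of_eq ?_)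
  rw [ENNReal.mul_rpow_of_nonneg _ _ (by positivity), ← ENNReal.rpow_mul, ← ENNReal.rpow_mul, mul_comm,
    show p0 / (p0 + 1) * (1 / (2 * p0 / (p0 + 1)) * 2) = 1 by field_simp,
    show 1 / (p0 + 1) * (1 / (2 * p0 / (p0 + 1)) * 2) = 1 / p0 by field_simp, ENNReal.rpow_one]
  rfl

theorem ENNReal.add_rpow_two_le (a b : ℝ≥0∞) :
    (a + b) ^ (2 : ℝ) ≤ 2 * (a ^ (2 : ℝ) + b ^ (2 : ℝ)) := by
  have := ENNReal.rpow_add_le_mul_rpow_add_rpow a b (p := 2) (by norm_num)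
  norm_num at this ⊢
  exact this

/-- Local Gagliardo-Nirenberg inequality with a degenerate weight on the gradient. -/
theorem local_gagliardoNirenberg {n : ℕ} (hn : 1 ≤ n) {P : ℝ≥0∞} {p0 m θ : ℝ} (hp0 : 1 < p0)
    (hm : 1 ≤ m) (hθ0 : 0 ≤ θ) (hθ1 : θ ≤ 1)
    (hP : recip P = θ * ((1 + 1 / p0) / 2 - 1 / n) + (1 - θ) / m) :
    ∃ C : ℝ≥0, ∀ (y0 : Fin n → ℝ) (ρ R : ℝ) (v : (Fin n → ℝ) → ℝ) (l D : (Fin n → ℝ) → ℝ≥0∞),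
      ρ < R → R ≤ 1 → (∀ R', ∃ L, LipschitzOnWith L v (Metric.ball 0 R')) →
      Measurable l → Measurable D → (∀ y, l y ≠ ⊤) →
      ∫⁻ y in Metric.ball y0 R, (l y)⁻¹ ^ p0 ≠ ⊤ →
      (∀ᵐ y, y ∈ Metric.ball y0 R → DifferentiableAt ℝ v y ∧ ‖fderiv ℝ v y‖ₑ ≤ D y) →
      eLpNorm v P (volume.restrict (Metric.ball y0 ρ)) ^ (2 : ℝ) ≤
        C * (((1 + ∫⁻ y in Metric.ball y0 R, (l y)⁻¹ ^ p0) ^ (1 / p0) *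
          ((∫⁻ y in Metric.ball y0 R, l y * D y ^ (2 : ℝ)) + ENNReal.ofReal (1 / (R - ρ)) ^ (2 : ℝ) *
            ∫⁻ y in Metric.ball y0 R, ‖v y‖ₑ ^ (2 : ℝ))) ^ θ *
          (∫⁻ y in Metric.ball y0 R, ‖v y‖ₑ ^ m) ^ (2 * (1 - θ) / m)) := by
  set r := 2 * p0 / (p0 + 1) with hr
  have hp00 : 0 < p0 := by linarith
  have hr1 : 1 < r := by rw [hr, one_lt_div (by linarith)]; linarith
  have hr2 : r < 2 := by rw [hr, div_lt_iff₀ (by linarith)]; linarith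
  have hr0 : 0 < r := by linarith
  have hm0 : 0 < m := by linarith
  obtain ⟨C0, hC0⟩ := gagliardoNirenberg hn hr1 hr2 hm hθ0 hθ1 (P := P)
    (by rw [hP, hr]; congr 2; field_simp)
  refine ⟨C0 ^ 2 * (8 * ((2 : ℝ≥0) ^ n) ^ (1 / p0)) ^ θ, ?_⟩
  intro y0 ρ R v l D hρR hR1 hvL hl hD hlt hfin hdiff
  set B := Metric.ball y0 R with hB
  have hBm : MeasurableSet B := Metric.isOpen_ball.measurableSet
  set Rm := (ρ + R) / 2 with hRm
  have hρRm : ρ < Rm := by rw [hRm]; linarith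
  have hRmR : Rm < R := by rw [hRm]; linarith
  let ζ : (Fin n → ℝ) → ℝ := fun y => ramp ρ Rm (dist y y0)
  have hζL : LipschitzWith (1 / (Rm - ρ)).toNNReal ζ := by
    have := (lipschitzWith_ramp hρRm).comp (LipschitzWith.dist_left y0)
    rw [mul_one] at this
    exact this
  have hζ1 : ∀ y, |ζ y| ≤ 1 := fun y => by
    rw [abs_of_nonneg (ramp_nonneg _ _ _)]; exact ramp_le_one _ _ _
  have hζ0 : ∀ y, Rm ≤ dist y y0 → ζ y = 0 := fun y hy => ramp_eq_zero hρRm hy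
  have hvc : Continuous v := by
    rw [continuous_iff_continuousAt]
    intro x
    obtain ⟨L, hL⟩ := hvL (‖x‖ + 1)
    exact hL.continuousOn.continuousAt (Metric.isOpen_ball.mem_nhds (by simp))
  set R' := ‖y0‖ + |R| + 1 with hR'
  have hsub : ∀ y ∉ Metric.ball (0 : Fin n → ℝ) R', ζ y = 0 := by
    intro y hy
    apply hζ0
    simp only [Metric.mem_ball, dist_zero_right, not_lt] at hy
    have h1 : ‖y‖ ≤ ‖y - y0‖ + ‖y0‖ := by simpa using norm_add_le (y - y0) y0
    rw [dist_eq_norm]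
    have := le_abs_self R
    linarith
  obtain ⟨L, hL⟩ := hvL R'
  obtain ⟨M, hM⟩ := (isCompact_closedBall (0 : Fin n → ℝ) R').exists_bound_of_continuousOn
    hvc.continuousOn
  have hVL := lipschitzWith_mul_of_locally hL
    (fun x hx => hM x (Metric.ball_subset_closedBall hx)) hζL hζ1 hsub
  set V : (Fin n → ℝ) → ℝ := fun x => v x * ζ x with hVdef
  have hVc : HasCompactSupport V := by
    refine HasCompactSupport.intro (isCompact_closedBall y0 R) fun x hx => ?_
    simp only [Metric.mem_closedBall, not_le] at hx
    simp [hVdef, hζ0 x (by linarith)]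
  have hGN := hC0 V _ hVL hVc
  set c := ENNReal.ofReal (1 / (Rm - ρ)) with hc
  have hgrad : ∀ᵐ y, ‖fderiv ℝ V y‖ₑ ≤ B.indicator (fun y => D y + c * ‖v y‖ₑ) y := by
    filter_upwards [hdiff, hζL.ae_differentiableAt] with y hy hζd
    by_cases hyB : y ∈ B
    · rw [indicator_of_mem hyB]
      obtain ⟨hvd, hvD⟩ := hy hyB
      have e : fderiv ℝ V y = v y • fderiv ℝ ζ y + ζ y • fderiv ℝ v y :=
        (hvd.hasFDerivAt.mul hζd.hasFDerivAt).fderiv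
      have hpos : 0 ≤ 1 / (Rm - ρ) := by
        have : 0 < Rm - ρ := by linarith
        positivity
      have hb := norm_fderiv_le_of_lipschitz ℝ hζL (x₀ := y)
      rw [Real.coe_toNNReal _ hpos] at hb
      have h1 : ‖fderiv ℝ V y‖ ≤ ‖fderiv ℝ v y‖ + 1 / (Rm - ρ) * ‖v y‖ := by
        rw [e]
        refine (norm_add_le _ _).trans ?_
        rw [norm_smul, norm_smul, add_comm]
        refine add_le_add ?_ ?_
        · simpa using mul_le_mul_of_nonneg_right (hζ1 y) (norm_nonneg (fderiv ℝ v y))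
        · rw [mul_comm]; exact mul_le_mul_of_nonneg_right hb (norm_nonneg _)
      calc ‖fderiv ℝ V y‖ₑ = ENNReal.ofReal ‖fderiv ℝ V y‖ := (ofReal_norm _).symm
        _ ≤ ENNReal.ofReal (‖fderiv ℝ v y‖ + 1 / (Rm - ρ) * ‖v y‖) := ENNReal.ofReal_le_ofReal h1
        _ = ‖fderiv ℝ v y‖ₑ + c * ‖v y‖ₑ := by
          rw [ENNReal.ofReal_add (norm_nonneg _) (by positivity), ENNReal.ofReal_mul hpos, ofReal_norm,
            ofReal_norm, hc]
        _ ≤ _ := by gcongr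
    · rw [indicator_of_notMem hyB]
      have hyR : Rm < dist y y0 := by
        simp only [hB, Metric.mem_ball, not_lt] at hyB; linarith
      have : V =ᶠ[nhds y] fun _ => 0 := by
        have ho : {x | Rm < dist x y0} ∈ nhds y :=
          (isOpen_lt continuous_const (continuous_id.dist continuous_const)).mem_nhds hyR
        filter_upwards [ho] with x hx
        simp [hVdef, hζ0 x (le_of_lt hx)]
      rw [this.fderiv_eq, ← ofReal_norm]; simp
  have hvm : Measurable fun y => ‖v y‖ₑ := hvc.measurable.enorm
  have hvolB : volume B ≤ (2 : ℝ≥0∞) ^ n := by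
    rcases le_or_gt R 0 with h | h
    · rw [hB, Metric.ball_eq_empty.2 h]; simp
    rw [hB, Real.volume_pi_ball _ h]
    simp only [Fintype.card_fin]
    calc ENNReal.ofReal ((2 * R) ^ n) ≤ ENNReal.ofReal (2 ^ n) := by
          apply ENNReal.ofReal_le_ofReal
          gcongr; linarith
      _ = _ := by rw [ENNReal.ofReal_pow (by norm_num)]; simp
  set Λ := ∫⁻ y in B, (l y)⁻¹ ^ p0 with hΛ
  set E := ∫⁻ y in B, l y * D y ^ (2 : ℝ) with hE
  set S := ∫⁻ y in B, ‖v y‖ₑ ^ (2 : ℝ) with hS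
  set c' := ENNReal.ofReal (1 / (R - ρ)) with hc'
  have hcc' : c = 2 * c' := by
    rw [hc, hc', show (1 / (Rm - ρ)) = 2 * (1 / (R - ρ)) by
      rw [hRm]; field_simp; ring, ENNReal.ofReal_mul (by norm_num)]
    simp
  have hX := lintegral_rpow_le_weighted (μ := volume.restrict B) hp00 hD.aemeasurable hl.aemeasurable
    hlt hfin
  have hY := lintegral_rpow_le_weighted (μ := volume.restrict B) (l := fun _ => 1) hp00
    hvm.aemeasurable aemeasurable_const (by simp) (by
      simp only [inv_one, ENNReal.one_rpow, lintegral_const, one_mul, Measure.restrict_apply_univ]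
      exact ne_top_of_le_ne_top (by finiteness) hvolB)
  simp only [inv_one, ENNReal.one_rpow, lintegral_const, one_mul, Measure.restrict_apply_univ] at hY
  rw [← hr] at hX hY
  have hgr : (∫⁻ z, ‖fderiv ℝ V z‖ₑ ^ r) ^ (1 / r) ≤
      (∫⁻ y in B, D y ^ r) ^ (1 / r) + c * (∫⁻ y in B, ‖v y‖ₑ ^ r) ^ (1 / r) := by
    calc (∫⁻ z, ‖fderiv ℝ V z‖ₑ ^ r) ^ (1 / r)
        ≤ (∫⁻ y in B, (D y + c * ‖v y‖ₑ) ^ r) ^ (1 / r) := by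
          refine ENNReal.rpow_le_rpow ?_ (by positivity)
          rw [← lintegral_indicator hBm]
          refine lintegral_mono_ae ?_
          filter_upwards [hgrad] with y hy
          refine (ENNReal.rpow_le_rpow hy hr0.le).trans (le_of_eq ?_)
          by_cases hyB : y ∈ B
          · simp [indicator_of_mem hyB]
          · simp [indicator_of_notMem hyB, hr0]
      _ ≤ (∫⁻ y in B, D y ^ r) ^ (1 / r) + (∫⁻ y in B, (c * ‖v y‖ₑ) ^ r) ^ (1 / r) :=
          ENNReal.lintegral_Lp_add_le hD.aemeasurable (hvm.const_mul c).aemeasurable hr1.le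
      _ = _ := by
          congr 1
          simp_rw [ENNReal.mul_rpow_of_nonneg _ _ hr0.le]
          rw [lintegral_const_mul _ (hvm.pow_const r), ENNReal.mul_rpow_of_nonneg _ _ (by positivity),
            ← ENNReal.rpow_mul, mul_one_div_cancel hr0.ne', ENNReal.rpow_one]
  have hΛ1 : 1 ≤ (1 + Λ) ^ (1 / p0) := by
    calc (1 : ℝ≥0∞) = 1 ^ (1 / p0) := by simp
      _ ≤ _ := by gcongr; exact le_self_add
  set V2 : ℝ≥0∞ := ((2 : ℝ≥0∞) ^ n) ^ (1 / p0) with hV2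
  have hV21 : 1 ≤ V2 := by
    calc (1 : ℝ≥0∞) = 1 ^ (1 / p0) := by simp
      _ ≤ _ := by rw [hV2]; gcongr; exact one_le_pow₀ (by norm_num)
  have hgr2 : (∫⁻ z, ‖fderiv ℝ V z‖ₑ ^ r) ^ (1 / r * 2) ≤
      8 * V2 * ((1 + Λ) ^ (1 / p0) * (E + c' ^ (2 : ℝ) * S)) := by
    rw [ENNReal.rpow_mul]
    refine (ENNReal.rpow_le_rpow hgr (by norm_num)).trans ?_
    refine (ENNReal.add_rpow_two_le _ _).trans ?_
    rw [ENNReal.mul_rpow_of_nonneg _ _ (by norm_num : (0 : ℝ) ≤ 2), ← ENNReal.rpow_mul,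
      ← ENNReal.rpow_mul]
    calc 2 * ((∫⁻ y in B, D y ^ r) ^ (1 / r * 2) + c ^ (2 : ℝ) * (∫⁻ y in B, ‖v y‖ₑ ^ r) ^ (1 / r * 2))
        ≤ 2 * (Λ ^ (1 / p0) * E + c ^ (2 : ℝ) * (volume B ^ (1 / p0) * S)) := by gcongr
      _ ≤ 2 * ((4 * V2 * (1 + Λ) ^ (1 / p0)) * E
            + (4 * c' ^ (2 : ℝ)) * ((V2 * (1 + Λ) ^ (1 / p0)) * S)) := by
          gcongr
          · calc Λ ^ (1 / p0) = 1 * 1 * Λ ^ (1 / p0) := by ring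
              _ ≤ 4 * V2 * (1 + Λ) ^ (1 / p0) := by
                gcongr
                · norm_num
                · exact le_add_self
          · rw [hcc', ENNReal.mul_rpow_of_nonneg _ _ (by norm_num : (0 : ℝ) ≤ 2)]
            norm_num
          · calc volume B ^ (1 / p0) = volume B ^ (1 / p0) * 1 := by ring
              _ ≤ V2 * (1 + Λ) ^ (1 / p0) := by
                refine mul_le_mul' ?_ hΛ1
                rw [hV2]; gcongr
      _ = _ := by ring
  have hVm : ∫⁻ z, ‖V z‖ₑ ^ m ≤ ∫⁻ y in B, ‖v y‖ₑ ^ m := by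
    rw [← lintegral_indicator hBm]
    refine lintegral_mono fun y => ?_
    by_cases hyB : y ∈ B
    · rw [indicator_of_mem hyB]
      gcongr
      rw [hVdef, enorm_mul]
      calc ‖v y‖ₑ * ‖ζ y‖ₑ ≤ ‖v y‖ₑ * 1 := by
            gcongr
            rw [← ofReal_norm, ← ENNReal.ofReal_one]
            exact ENNReal.ofReal_le_ofReal (hζ1 y)
        _ = _ := mul_one _
    · have : ζ y = 0 := hζ0 y (by
        simp only [hB, Metric.mem_ball, not_lt] at hyB; linarith)
      simp [hVdef, this, hm0]
  have hloc : eLpNorm v P (volume.restrict (Metric.ball y0 ρ)) ≤ eLpNorm V P volume := by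
    calc eLpNorm v P (volume.restrict (Metric.ball y0 ρ))
        = eLpNorm V P (volume.restrict (Metric.ball y0 ρ)) := by
          apply eLpNorm_congr_ae
          filter_upwards [ae_restrict_mem Metric.isOpen_ball.measurableSet] with y hy
          have : ζ y = 1 := ramp_eq_one hρRm (le_of_lt (Metric.mem_ball.1 hy))
          simp [hVdef, this]
      _ ≤ _ := eLpNorm_mono_measure _ Measure.restrict_le_self
  calc eLpNorm v P (volume.restrict (Metric.ball y0 ρ)) ^ (2 : ℝ)
      ≤ (C0 * ((∫⁻ z, ‖fderiv ℝ V z‖ₑ ^ r) ^ (θ / r) *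
        (∫⁻ z, ‖V z‖ₑ ^ m) ^ ((1 - θ) / m))) ^ (2 : ℝ) := by
        gcongr; exact hloc.trans hGN
    _ = (C0 : ℝ≥0∞) ^ 2 * (((∫⁻ z, ‖fderiv ℝ V z‖ₑ ^ r) ^ (1 / r * 2)) ^ θ *
        (∫⁻ z, ‖V z‖ₑ ^ m) ^ (2 * (1 - θ) / m)) := by
        rw [ENNReal.mul_rpow_of_nonneg _ _ (by norm_num : (0 : ℝ) ≤ 2),
          ENNReal.mul_rpow_of_nonneg _ _ (by norm_num : (0 : ℝ) ≤ 2), ← ENNReal.rpow_mul,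
          ← ENNReal.rpow_mul, ← ENNReal.rpow_mul, ENNReal.rpow_two,
          show θ / r * 2 = 1 / r * 2 * θ by ring, show (1 - θ) / m * 2 = 2 * (1 - θ) / m by ring]
    _ ≤ (C0 : ℝ≥0∞) ^ 2 * ((8 * V2 * ((1 + Λ) ^ (1 / p0) * (E + c' ^ (2 : ℝ) * S))) ^ θ *
        (∫⁻ y in B, ‖v y‖ₑ ^ m) ^ (2 * (1 - θ) / m)) := by
        have : 0 ≤ 2 * (1 - θ) / m := div_nonneg (by linarith) hm0.le
        gcongr
    _ = _ := by
        rw [ENNReal.mul_rpow_of_nonneg _ _ hθ0]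
        push_cast
        rw [ENNReal.coe_rpow_of_nonneg _ hθ0]
        push_cast
        rw [ENNReal.coe_rpow_of_nonneg _ (by positivity)]
        push_cast
        rw [hV2]
        ring

end

section

/-- The open cube of half side `r` centred at `z`. -/
def box {d : ℕ} (z : Space d) (r : ℝ) : Set (Space d) :=
  WithLp.ofLp ⁻¹' Metric.ball (WithLp.ofLp z) r

/-- The product of a time interval and a cube, both of radius `r`. -/
def pcyl {d : ℕ} (c : SpaceTime d) (r : ℝ) : Set (SpaceTime d) :=
  Ioo (c.1 - r) (c.1 + r) ×ˢ box c.2 r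

/-- Continuous functions whose spatial gradient is locally bounded. -/
structure LocLip {d : ℕ} (w : SpaceTime d → ℝ) : Prop where
  continuous : Continuous w
  lip : ∀ R : ℝ, ∃ L : ℝ≥0, ∀ t ∈ Icc (-R) R,
    LipschitzOnWith L (fun x => w (t, x)) (Metric.ball 0 R)

/-- The energy of `w` with weight `l` on `pcyl c ρ`. -/
noncomputable def energy {d : ℕ} (l : Space d → ℝ≥0∞) (w : SpaceTime d → ℝ) (c : SpaceTime d)
    (ρ : ℝ) : ℝ≥0∞ :=
  (⨆ t ∈ Ioo (c.1 - ρ) (c.1 + ρ), ∫⁻ x in box c.2 ρ, ‖w (t, x)‖ₑ ^ (2 : ℝ)) +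
    ∫⁻ z in pcyl c ρ, l z.2 * ‖spaceGrad w z‖ₑ ^ (2 : ℝ)

/-- The integral of `w²` over `pcyl c ρ`. -/
noncomputable def mass {d : ℕ} (w : SpaceTime d → ℝ) (c : SpaceTime d) (ρ : ℝ) : ℝ≥0∞ :=
  ∫⁻ z in pcyl c ρ, ‖w z‖ₑ ^ (2 : ℝ)

section Basic

variable {d : ℕ}

theorem isOpen_box (z : Space d) (r : ℝ) : IsOpen (box z r) :=
  Metric.isOpen_ball.preimage (PiLp.continuous_ofLp 2 _)

theorem measurableSet_box (z : Space d) (r : ℝ) : MeasurableSet (box z r) :=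
  (isOpen_box z r).measurableSet

theorem isOpen_pcyl (c : SpaceTime d) (r : ℝ) : IsOpen (pcyl c r) :=
  isOpen_Ioo.prod (isOpen_box _ _)

theorem measurableSet_pcyl (c : SpaceTime d) (r : ℝ) : MeasurableSet (pcyl c r) :=
  (isOpen_pcyl c r).measurableSet

theorem box_mono {z : Space d} {r s : ℝ} (h : r ≤ s) : box z r ⊆ box z s :=
  preimage_mono (Metric.ball_subset_ball h)

theorem pcyl_mono {c : SpaceTime d} {r s : ℝ} (h : r ≤ s) : pcyl c r ⊆ pcyl c s :=
  prod_mono (Ioo_subset_Ioo (by linarith) (by linarith)) (box_mono h)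

theorem mem_box_iff {z x : Space d} {r : ℝ} (hr : 0 < r) : x ∈ box z r ↔ ∀ i, |x i - z i| < r := by
  simp only [box, mem_preimage, Metric.mem_ball, dist_pi_lt_iff hr, Real.dist_eq]

theorem mass_mono {w : SpaceTime d → ℝ} {c : SpaceTime d} {r s : ℝ} (h : r ≤ s) :
    mass w c r ≤ mass w c s := lintegral_mono_set (pcyl_mono h)

theorem energy_mono {l : Space d → ℝ≥0∞} {w : SpaceTime d → ℝ} {c : SpaceTime d} {r s : ℝ}
    (h : r ≤ s) : energy l w c r ≤ energy l w c s := by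
  refine add_le_add ?_ (lintegral_mono_set (pcyl_mono h))
  refine iSup₂_le fun t ht => ?_
  exact (lintegral_mono_set (box_mono h)).trans
    (le_iSup₂ (f := fun t (_ : t ∈ Ioo (c.1 - s) (c.1 + s)) =>
      ∫⁻ x in box c.2 s, ‖w (t, x)‖ₑ ^ (2 : ℝ)) t ⟨by linarith [ht.1], by linarith [ht.2]⟩)

theorem lintegral_prod_set {I : Set ℝ} {B : Set (Space d)} {F : SpaceTime d → ℝ≥0∞}
    (hF : Measurable F) :
    ∫⁻ z in I ×ˢ B, F z = ∫⁻ t in I, ∫⁻ x in B, F (t, x) := by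
  rw [Measure.volume_eq_prod, ← Measure.prod_restrict, lintegral_prod _ hF.aemeasurable]

theorem norm_spaceGrad (w : SpaceTime d → ℝ) (z : SpaceTime d) :
    ‖spaceGrad w z‖ = ‖fderiv ℝ (fun x => w (z.1, x)) z.2‖ := by
  rw [spaceGrad, gradient, LinearIsometryEquiv.norm_map]

theorem enorm_spaceGrad (w : SpaceTime d → ℝ) (z : SpaceTime d) :
    ‖spaceGrad w z‖ₑ = ‖fderiv ℝ (fun x => w (z.1, x)) z.2‖ₑ := by
  rw [← ofReal_norm, ← ofReal_norm, norm_spaceGrad]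

theorem measurable_spaceGrad {w : SpaceTime d → ℝ} (hw : Continuous w) :
    Measurable (spaceGrad w) := by
  have h := measurable_fderiv_with_param ℝ (f := fun (t : ℝ) (x : Space d) => w (t, x))
    (by simpa [Function.uncurry_def] using hw)
  exact (InnerProductSpace.toDual ℝ (Space d)).symm.continuous.measurable.comp h

theorem LocLip.locLip_slice {w : SpaceTime d → ℝ} (hw : LocLip w) (t : ℝ) (R : ℝ) :
    ∃ L : ℝ≥0, LipschitzOnWith L (fun x => w (t, x)) (Metric.ball 0 R) := by
  obtain ⟨L, hL⟩ := hw.lip (max R |t|)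
  refine ⟨L, (hL t ?_).mono (Metric.ball_subset_ball (le_max_left _ _))⟩
  have := abs_le.1 (le_max_right R |t|)
  exact ⟨by linarith, by linarith⟩

theorem ae_differentiableAt_of_locallyLipschitz {f : Space d → ℝ}
    (hf : ∀ R, ∃ L : ℝ≥0, LipschitzOnWith L f (Metric.ball 0 R)) :
    ∀ᵐ x, DifferentiableAt ℝ f x := by
  have : ∀ n : ℕ, ∀ᵐ x, x ∈ Metric.ball (0 : Space d) n → DifferentiableAt ℝ f x := by
    intro n
    obtain ⟨L, hL⟩ := hf n
    filter_upwards [hL.ae_differentiableWithinAt_of_mem (μ := volume)] with x hx hxn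
    exact (hx hxn).differentiableAt (Metric.isOpen_ball.mem_nhds hxn)
  filter_upwards [ae_all_iff.2 this] with x hx
  obtain ⟨n, hn⟩ := exists_nat_gt ‖x‖
  exact hx n (by simpa using hn)

theorem LocLip.measurableSet_differentiableAt {w : SpaceTime d → ℝ} (hw : LocLip w) :
    MeasurableSet {z : SpaceTime d | DifferentiableAt ℝ (fun x => w (z.1, x)) z.2} :=
  measurableSet_of_differentiableAt_with_param ℝ (f := fun (t : ℝ) (x : Space d) => w (t, x))
    (by simpa [Function.uncurry_def] using hw.continuous)

theorem LocLip.ae_differentiableAt {w : SpaceTime d → ℝ} (hw : LocLip w) :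
    ∀ᵐ z : SpaceTime d, DifferentiableAt ℝ (fun x => w (z.1, x)) z.2 := by
  rw [Measure.volume_eq_prod, Measure.ae_prod_iff_ae_ae hw.measurableSet_differentiableAt]
  exact Filter.Eventually.of_forall fun t =>
    ae_differentiableAt_of_locallyLipschitz (hw.locLip_slice t)

theorem preimage_toLp_box (z : Space d) (r : ℝ) :
    WithLp.toLp 2 ⁻¹' box z r = Metric.ball (WithLp.ofLp z) r := rfl

theorem measurePreserving_toLp_box (z : Space d) (r : ℝ) :
    MeasurePreserving (WithLp.toLp 2 : (Fin d → ℝ) → Space d)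
      (volume.restrict (Metric.ball (WithLp.ofLp z) r)) (volume.restrict (box z r)) := by
  rw [← preimage_toLp_box]
  exact (PiLp.volume_preserving_toLp (Fin d)).restrict_preimage (measurableSet_box z r)

theorem lintegral_box (z : Space d) (r : ℝ) {F : Space d → ℝ≥0∞} (hF : Measurable F) :
    ∫⁻ x in box z r, F x = ∫⁻ y in Metric.ball (WithLp.ofLp z) r, F (WithLp.toLp 2 y) :=
  ((measurePreserving_toLp_box z r).lintegral_comp hF).symm

theorem lipschitzWith_toLp : LipschitzWith d (WithLp.toLp 2 : (Fin d → ℝ) → Space d) := by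
  refine LipschitzWith.of_dist_le_mul fun a b => ?_
  rw [EuclideanSpace.dist_eq]
  have h : ∑ i, dist (a i) (b i) ^ 2 ≤ (d * dist a b) ^ 2 := by
    calc ∑ i, dist (a i) (b i) ^ 2 ≤ ∑ _i : Fin d, dist a b ^ 2 := by
          gcongr with i; exact dist_le_pi_dist a b i
      _ = d * dist a b ^ 2 := by simp
      _ ≤ (d * dist a b) ^ 2 := by
          rw [mul_pow]
          gcongr
          rcases Nat.eq_zero_or_pos d with h | h
          · simp [h]
          · have : (1 : ℝ) ≤ d := by exact_mod_cast h
            nlinarith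
  exact Real.sqrt_le_iff.2 ⟨by positivity, by simpa using h⟩

end Basic

/-- Fixed-time Gagliardo-Nirenberg inequality for `f ∘ A`, with `A` an affine map into `Space d`. -/
theorem comp_gagliardoNirenberg (d : ℕ) (hd : 1 ≤ d) {n : ℕ} (hn : 1 ≤ n) {P : ℝ≥0∞} {p0 m θ : ℝ}
    (hp0 : 1 < p0) (hm : 1 ≤ m) (hθ0 : 0 ≤ θ) (hθ1 : θ ≤ 1)
    (hP : recip P = θ * ((1 + 1 / p0) / 2 - 1 / n) + (1 - θ) / m) :
    ∃ C : ℝ≥0, ∀ (A : (Fin n → ℝ) → Space d), LipschitzWith d A → Differentiable ℝ A →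
      ∀ (y0 : Fin n → ℝ) (ρ R : ℝ) (f : Space d → ℝ) (l : Space d → ℝ≥0∞),
      ρ < R → R ≤ 1 → (∀ R', ∃ L : ℝ≥0, LipschitzOnWith L f (Metric.ball 0 R')) →
      Measurable l → (∀ y, l y ≠ ⊤) →
      ∫⁻ y in Metric.ball y0 R, (l (A y))⁻¹ ^ p0 ≠ ⊤ →
      (∀ᵐ y, y ∈ Metric.ball y0 R → DifferentiableAt ℝ f (A y)) →
      eLpNorm (fun y => f (A y)) P (volume.restrict (Metric.ball y0 ρ)) ^ (2 : ℝ) ≤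
        C * (((1 + ∫⁻ y in Metric.ball y0 R, (l (A y))⁻¹ ^ p0) ^ (1 / p0) *
          ((∫⁻ y in Metric.ball y0 R, l (A y) * ‖fderiv ℝ f (A y)‖ₑ ^ (2 : ℝ)) +
            ENNReal.ofReal (1 / (R - ρ)) ^ (2 : ℝ) *
              ∫⁻ y in Metric.ball y0 R, ‖f (A y)‖ₑ ^ (2 : ℝ))) ^ θ *
          (∫⁻ y in Metric.ball y0 R, ‖f (A y)‖ₑ ^ m) ^ (2 * (1 - θ) / m)) := by
  obtain ⟨C, hC⟩ := local_gagliardoNirenberg hn hp0 hm hθ0 hθ1 hP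
  refine ⟨C * ((d : ℝ≥0) ^ 2) ^ θ, fun A hA hAd y0 ρ R f l hρR hR hf hl hlt hfin hdiff => ?_⟩
  have hAm : Measurable A := hA.continuous.measurable
  have hD : Measurable fun y => ‖fderiv ℝ f (A y)‖ₑ := (measurable_fderiv ℝ f).enorm.comp hAm
  have h := hC y0 ρ R (fun y => f (A y)) (fun y => l (A y)) (fun y => d * ‖fderiv ℝ f (A y)‖ₑ)
    hρR hR ?_ (hl.comp hAm) (hD.const_mul _) (fun y => hlt _) hfin ?_
  · refine h.trans ?_
    have e : ∫⁻ y in Metric.ball y0 R, l (A y) * (d * ‖fderiv ℝ f (A y)‖ₑ) ^ (2 : ℝ) =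
        (d : ℝ≥0∞) ^ 2 * ∫⁻ y in Metric.ball y0 R, l (A y) * ‖fderiv ℝ f (A y)‖ₑ ^ (2 : ℝ) := by
      rw [← lintegral_const_mul' _ _ (by finiteness)]
      refine lintegral_congr fun y => ?_
      rw [ENNReal.mul_rpow_of_nonneg _ _ (by norm_num), ENNReal.rpow_two]; ring
    have hd1 : (1 : ℝ≥0∞) ≤ (d : ℝ≥0∞) ^ 2 := one_le_pow₀ (by exact_mod_cast hd)
    rw [e]
    set a := (1 + ∫⁻ y in Metric.ball y0 R, (l (A y))⁻¹ ^ p0) ^ (1 / p0)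
    set E := ∫⁻ y in Metric.ball y0 R, l (A y) * ‖fderiv ℝ f (A y)‖ₑ ^ (2 : ℝ)
    set S := ENNReal.ofReal (1 / (R - ρ)) ^ (2 : ℝ) * ∫⁻ y in Metric.ball y0 R, ‖f (A y)‖ₑ ^ (2 : ℝ)
    calc _ ≤ (C : ℝ≥0∞) * (((d : ℝ≥0∞) ^ 2 * (a * (E + S))) ^ θ *
          (∫⁻ y in Metric.ball y0 R, ‖f (A y)‖ₑ ^ m) ^ (2 * (1 - θ) / m)) := by
          have : a * ((d : ℝ≥0∞) ^ 2 * E + S) ≤ (d : ℝ≥0∞) ^ 2 * (a * (E + S)) := by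
            calc a * ((d : ℝ≥0∞) ^ 2 * E + S) ≤ a * ((d : ℝ≥0∞) ^ 2 * E + (d : ℝ≥0∞) ^ 2 * S) := by
                  gcongr; exact le_mul_of_one_le_left' hd1
              _ = _ := by ring
          gcongr
      _ = _ := by
          rw [ENNReal.mul_rpow_of_nonneg _ _ hθ0]
          push_cast
          rw [ENNReal.coe_rpow_of_nonneg _ hθ0]
          push_cast
          ring
  · intro R'
    obtain ⟨L, hL⟩ := hf (‖A 0‖ + d * |R'| + 1)
    refine ⟨L * d, hL.comp (hA.lipschitzOnWith (s := Metric.ball 0 R')) fun y hy => ?_⟩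
    have h1 := hA.dist_le_mul y 0
    rw [Metric.mem_ball] at hy
    have h2 : dist (A y) 0 ≤ dist (A y) (A 0) + dist (A 0) 0 := dist_triangle _ _ _
    rw [dist_zero_right (A 0)] at h2
    rw [Metric.mem_ball]
    have h3 : (d : ℝ) * dist y 0 ≤ d * |R'| := by
      gcongr; exact hy.le.trans (le_abs_self _)
    have h4 : ((d : ℝ≥0) : ℝ) = d := by simp
    rw [h4] at h1
    linarith
  · filter_upwards [hdiff] with y hy hyB
    have hfd := hy hyB
    refine ⟨hfd.comp y (hAd y), ?_⟩
    have e : fderiv ℝ (fun y => f (A y)) y = (fderiv ℝ f (A y)).comp (fderiv ℝ A y) :=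
      fderiv_comp y hfd (hAd y)
    have hb : ‖fderiv ℝ A y‖ ≤ d := by
      have := norm_fderiv_le_of_lipschitz ℝ hA (x₀ := y)
      simpa using this
    have h1 : ‖fderiv ℝ (fun y => f (A y)) y‖ ≤ d * ‖fderiv ℝ f (A y)‖ := by
      rw [e, mul_comm]
      refine (ContinuousLinearMap.opNorm_comp_le _ _).trans ?_
      gcongr
    rw [← ofReal_norm, ← ofReal_norm]
    refine (ENNReal.ofReal_le_ofReal h1).trans (le_of_eq ?_)
    rw [ENNReal.ofReal_mul (by positivity), ENNReal.ofReal_natCast]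

/-- Parabolic interpolation between the energy and the `L²` norm. -/
theorem parabolic_interpolation {d : ℕ} (hd : 2 ≤ d) {P : ℝ≥0∞} {p0 p' q' θ : ℝ} (hp0 : 1 < p0)
    (hPp : recip P = 1 / p' / 2) (hq' : 1 ≤ q') (hθ0 : 0 ≤ θ) (hθ : 1 - 1 / p' = θ * (2 / d - 1 / p0)) (hθq : θ ≤ 1 / q')
    (NΛ : ℝ≥0) :
    ∃ C : ℝ≥0, ∀ (l : Space d → ℝ≥0∞) (w : SpaceTime d → ℝ) (c : SpaceTime d) (ρ R : ℝ),
      ρ < R → R ≤ 1 → Measurable l → (∀ x, l x ≠ ⊤) → LocLip w →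
      ∫⁻ x in box c.2 R, (l x)⁻¹ ^ p0 ≤ NΛ →
      (∫⁻ t in Ioo (c.1 - ρ) (c.1 + ρ), (eLpNorm (fun x => w (t, x)) P
        (volume.restrict (box c.2 ρ)) ^ (2 : ℝ)) ^ q') ^ (1 / q') ≤
      C * ((energy l w c R + ENNReal.ofReal (1 / (R - ρ)) ^ (2 : ℝ) * mass w c R) ^
        (1 - (1 / q' - θ)) * mass w c R ^ (1 / q' - θ)) := by
  have hq0 : 0 < q' := by linarith
  have hq1 : 1 / q' ≤ 1 := by rw [div_le_one hq0]; exact hq'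
  have hP : recip P = θ * ((1 + 1 / p0) / 2 - 1 / d) + (1 - θ) / 2 := by
    rw [hPp, show 1 / p' = 1 - θ * (2 / d - 1 / p0) by linarith]; ring
  obtain ⟨C, hC⟩ := comp_gagliardoNirenberg d (by omega) (n := d) (by omega) hp0
    (by norm_num : (1 : ℝ) ≤ 2) hθ0 (hθq.trans hq1) hP
  refine ⟨C * ((1 + NΛ) ^ (1 / p0)) ^ θ, fun l w c ρ R hρR hR hl hlt hw hΛ => ?_⟩
  set κ := ENNReal.ofReal (1 / (R - ρ)) ^ (2 : ℝ) with hκ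
  have hκt : κ ≠ ⊤ := by rw [hκ]; finiteness
  have hgm := measurable_spaceGrad hw.continuous
  have hFm : Measurable fun z : SpaceTime d => l z.2 * ‖spaceGrad w z‖ₑ ^ (2 : ℝ) :=
    (hl.comp measurable_snd).mul (hgm.enorm.pow_const _)
  have hwm : Measurable fun z : SpaceTime d => ‖w z‖ₑ ^ (2 : ℝ) :=
    (hw.continuous.measurable.enorm).pow_const _
  set e : ℝ → ℝ≥0∞ := fun t => ∫⁻ x in box c.2 R, ‖w (t, x)‖ₑ ^ (2 : ℝ) with he
  set g : ℝ → ℝ≥0∞ := fun t => ∫⁻ x in box c.2 R, l x * ‖spaceGrad w (t, x)‖ₑ ^ (2 : ℝ) with hg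
  have hem : Measurable e := hwm.lintegral_prod_right' (ν := volume.restrict (box c.2 R))
  have hggm : Measurable g := hFm.lintegral_prod_right' (ν := volume.restrict (box c.2 R))
  obtain ⟨K, hK⟩ : ∃ K : ℝ≥0∞, K = C * ((1 + NΛ) ^ (1 / p0)) ^ θ := ⟨_, rfl⟩
  have hpt : ∀ t, eLpNorm (fun x => w (t, x)) P
      (volume.restrict (box c.2 ρ)) ^ (2 : ℝ) ≤ K * ((g t + κ * e t) ^ θ * e t ^ (1 - θ)) := by
    intro t
    have hwtc : Continuous fun x => w (t, x) := hw.continuous.comp (by fun_prop)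
    have h := hC (WithLp.toLp 2) lipschitzWith_toLp
      (PiLp.continuousLinearEquiv 2 ℝ (fun _ : Fin d => ℝ)).symm.differentiable
      (WithLp.ofLp c.2) ρ R (fun x => w (t, x)) l hρR hR (hw.locLip_slice t) hl hlt ?_ ?_
    · have e0 : eLpNorm (fun y => w (t, WithLp.toLp 2 y)) P
          (volume.restrict (Metric.ball (WithLp.ofLp c.2) ρ)) =
          eLpNorm (fun x => w (t, x)) P (volume.restrict (box c.2 ρ)) :=
        eLpNorm_comp_measurePreserving hwtc.aestronglyMeasurable (measurePreserving_toLp_box c.2 ρ)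
      have e1 := lintegral_box c.2 R (F := fun x => (l x)⁻¹ ^ p0) (hl.inv.pow_const _)
      have e2 := lintegral_box c.2 R
        (F := fun x => l x * ‖fderiv ℝ (fun x => w (t, x)) x‖ₑ ^ (2 : ℝ))
        (hl.mul ((measurable_fderiv ℝ _).enorm.pow_const _))
      have e3 := lintegral_box c.2 R (F := fun x => ‖w (t, x)‖ₑ ^ (2 : ℝ))
        (hwtc.measurable.enorm.pow_const _)
      rw [e0, ← e1, ← e2, ← e3] at h
      refine h.trans ?_
      rw [hK]
      calc _ ≤ (C : ℝ≥0∞) * (((1 + NΛ) ^ (1 / p0) * (g t + κ * e t)) ^ θ * e t ^ (1 - θ)) := by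
            rw [show 2 * (1 - θ) / 2 = 1 - θ by ring]
            gcongr
            exact le_of_eq (by simp only [hg, enorm_spaceGrad])
        _ = _ := by rw [ENNReal.mul_rpow_of_nonneg _ _ hθ0]; ring
    · rw [← lintegral_box c.2 R (F := fun x => (l x)⁻¹ ^ p0) (hl.inv.pow_const _)]
      exact ne_top_of_le_ne_top ENNReal.coe_ne_top hΛ
    · have := ((PiLp.volume_preserving_toLp (Fin d)).quasiMeasurePreserving).ae
        (ae_differentiableAt_of_locallyLipschitz (hw.locLip_slice t))
      filter_upwards [this] with y hy _ using hy
  set I := Ioo (c.1 - ρ) (c.1 + ρ) with hI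
  set J := Ioo (c.1 - R) (c.1 + R) with hJ
  have hIJ : I ⊆ J := Ioo_subset_Ioo (by linarith) (by linarith)
  set S := energy l w c R + κ * mass w c R with hS
  have heS : ∀ t ∈ J, e t ≤ S := fun t ht =>
    (le_iSup₂ (f := fun t (_ : t ∈ J) => ∫⁻ x in box c.2 R, ‖w (t, x)‖ₑ ^ (2 : ℝ)) t ht).trans
      (le_self_add.trans le_self_add)
  have hgS : ∫⁻ t in J, (g t + κ * e t) ≤ S := by
    rw [lintegral_add_left hggm, lintegral_const_mul _ hem]
    refine add_le_add ?_ (le_of_eq ?_)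
    · refine le_trans (le_of_eq ?_) le_add_self
      exact (lintegral_prod_set hFm).symm
    · rw [mass, pcyl, lintegral_prod_set hwm]
  have hem' : ∫⁻ t in J, e t = mass w c R := by rw [mass, pcyl, lintegral_prod_set hwm]
  have hθq1 : θ * q' ≤ 1 := by rw [le_div_iff₀ hq0] at hθq; exact hθq
  have hθ1 : θ ≤ 1 := hθq.trans hq1
  calc (∫⁻ t in I, (eLpNorm (fun x => w (t, x)) P
        (volume.restrict (box c.2 ρ)) ^ (2 : ℝ)) ^ q') ^ (1 / q')
      ≤ (∫⁻ t in J, (K ^ q' * S ^ (q' - 1)) * ((g t + κ * e t) ^ (θ * q') * e t ^ (1 - θ * q')))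
          ^ (1 / q') := by
        refine ENNReal.rpow_le_rpow ?_ (by positivity)
        refine le_trans ?_ (lintegral_mono_set hIJ)
        refine setLIntegral_mono' measurableSet_Ioo fun t ht => ?_
        refine (ENNReal.rpow_le_rpow (hpt t) hq0.le).trans ?_
        rw [ENNReal.mul_rpow_of_nonneg _ _ hq0.le, ENNReal.mul_rpow_of_nonneg _ _ hq0.le,
          ← ENNReal.rpow_mul, ← ENNReal.rpow_mul,
          show (1 - θ) * q' = (q' - 1) + (1 - θ * q') by ring,
          ENNReal.rpow_add_of_nonneg _ _ (by linarith) (by linarith)]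
        calc _ = (K ^ q' * e t ^ (q' - 1)) * ((g t + κ * e t) ^ (θ * q') * e t ^ (1 - θ * q')) := by
              ring
          _ ≤ _ := by
              gcongr
              exact heS t (hIJ ht)
    _ ≤ (K ^ q' * S ^ (q' - 1) * (S ^ (θ * q') * mass w c R ^ (1 - θ * q'))) ^ (1 / q') := by
        refine ENNReal.rpow_le_rpow ?_ (by positivity)
        have hmm : Measurable fun t => (g t + κ * e t) ^ (θ * q') * e t ^ (1 - θ * q') :=
          ((hggm.add (hem.const_mul _)).pow_const _).mul (hem.pow_const _)
        rw [lintegral_const_mul _ hmm]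
        gcongr
        refine (ENNReal.lintegral_mul_norm_pow_le (hggm.add (hem.const_mul _)).aemeasurable
          hem.aemeasurable (by positivity) (by linarith) (by ring)).trans ?_
        rw [hem']
        exact mul_le_mul' (ENNReal.rpow_le_rpow hgS (by positivity)) le_rfl
    _ = K * (S ^ (1 - (1 / q' - θ)) * mass w c R ^ (1 / q' - θ)) := by
        have hx : 0 ≤ 1 - 1 / q' := by linarith
        simp only [ENNReal.mul_rpow_of_nonneg _ _ (by positivity : 0 ≤ 1 / q'), ← ENNReal.rpow_mul]
        rw [mul_one_div_cancel hq0.ne', ENNReal.rpow_one,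
          show (q' - 1) * (1 / q') = 1 - 1 / q' by field_simp,
          show θ * q' * (1 / q') = θ by field_simp,
          show (1 - θ * q') * (1 / q') = 1 / q' - θ by field_simp,
          show 1 - (1 / q' - θ) = (1 - 1 / q') + θ by ring,
          ENNReal.rpow_add_of_nonneg _ _ hx hθ0]
        ring
    _ = _ := by
        rw [hK]
        push_cast
        rw [ENNReal.coe_rpow_of_nonneg _ hθ0, ENNReal.coe_rpow_of_nonneg _ (by positivity)]
        push_cast
        rfl

end

section

/-- The exponent `2p'`, where `p'` is conjugate to `p`. -/
noncomputable def dualExp (p : ℝ) : ℝ≥0∞ := (ENNReal.ofReal ((1 - 1 / p) / 2))⁻¹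

theorem recip_dualExp {p : ℝ} (hp : 1 ≤ p) : recip (dualExp p) = (1 - 1 / p) / 2 := by
  have : 1 / p ≤ 1 := by rw [div_le_one (by linarith)]; exact hp
  rw [recip, dualExp, inv_inv, ENNReal.toReal_ofReal (by linarith)]

/-- Hölder's inequality for `∫ V w²`. -/
theorem lintegral_mul_sq_le {α : Type*} [MeasurableSpace α] {μ : Measure α} {p : ℝ} (hp : 1 ≤ p)
    {V : α → ℝ≥0∞} {w : α → ℝ} (hV : AEMeasurable V μ) (hw : Measurable w) :
    ∫⁻ x, V x * ‖w x‖ₑ ^ (2 : ℝ) ∂μ ≤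
      (∫⁻ x, V x ^ p ∂μ) ^ (1 / p) * eLpNorm w (dualExp p) μ ^ (2 : ℝ) := by
  have hp0 : 0 < p := by linarith
  rcases hp.eq_or_lt with rfl | hp1
  · have : dualExp 1 = ⊤ := by simp [dualExp]
    rw [this, eLpNorm_exponent_top]
    simp only [ENNReal.rpow_one, div_one]
    rw [← lintegral_mul_const'' _ hV]
    refine lintegral_mono_ae ?_
    filter_upwards [enorm_ae_le_eLpNormEssSup w μ] with x hx
    gcongr
  · have hpp : 0 < 1 - 1 / p := by rw [sub_pos, div_lt_one hp0]; exact hp1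
    have hfin : dualExp p ≠ ⊤ := by
      rw [dualExp]; simp; field_simp at hpp ⊢; linarith
    have hne : dualExp p ≠ 0 := by simp [dualExp]
    have htr : (dualExp p).toReal = ((1 - 1 / p) / 2)⁻¹ := by
      rw [dualExp, ENNReal.toReal_inv, ENNReal.toReal_ofReal (by linarith)]
    rw [eLpNorm_eq_lintegral_rpow_enorm_toReal hne hfin, htr]
    have key := ENNReal.lintegral_mul_norm_pow_le (μ := μ) (hV.pow_const p)
      ((hw.enorm.pow_const (((1 - 1 / p) / 2)⁻¹)).aemeasurable (μ := μ)) (p := 1 / p) (q := 1 - 1 / p)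
      (by positivity) hpp.le (by ring)
    rw [← ENNReal.rpow_mul, show 1 / ((1 - 1 / p) / 2)⁻¹ * 2 = 1 - 1 / p by field_simp]
    refine le_trans (le_of_eq (lintegral_congr fun x => ?_)) key
    rw [← ENNReal.rpow_mul, ← ENNReal.rpow_mul, mul_one_div_cancel hp0.ne', ENNReal.rpow_one,
      show ((1 - 1 / p) / 2)⁻¹ * (1 - 1 / p) = 2 by field_simp]

/-- Hölder's inequality for three functions. -/
theorem lintegral_mul_mul_norm_pow_le {α : Type*} [MeasurableSpace α] {μ : Measure α}
    {f g h : α → ℝ≥0∞} (hf : AEMeasurable f μ) (hg : AEMeasurable g μ) (hh : AEMeasurable h μ)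
    {a b c : ℝ} (ha : 0 ≤ a) (hb : 0 ≤ b) (hc : 0 ≤ c) (habc : a + b + c = 1) :
    ∫⁻ x, f x ^ a * g x ^ b * h x ^ c ∂μ ≤
      (∫⁻ x, f x ∂μ) ^ a * (∫⁻ x, g x ∂μ) ^ b * (∫⁻ x, h x ∂μ) ^ c := by
  have := ENNReal.lintegral_prod_norm_pow_le (μ := μ) (Finset.univ : Finset (Fin 3))
    (f := ![f, g, h]) (p := ![a, b, c]) (by simp [Fin.forall_fin_succ, hf, hg, hh])
    (by simp [Fin.sum_univ_succ]; linarith) (by simp [Fin.forall_fin_succ, ha, hb, hc])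
  simpa [Fin.prod_univ_succ, mul_assoc] using this

/-- A potential in `L^q_t L^p_x` is form bounded with respect to the energy. -/
theorem lintegral_potential_le {d : ℕ} (hd : 2 ≤ d) {p0 p q : ℝ} (hp0 : 1 < p0)
    (hd0 : 0 < 2 / (d : ℝ) - 1 / p0) (hp : 1 ≤ p) (hq : 1 ≤ q)
    (hpq : 1 / p < (1 - 1 / q) * (2 / d - 1 / p0)) (NΛ : ℝ≥0) :
    ∃ (C : ℝ≥0) (δ : ℝ), 0 < δ ∧ δ ≤ 1 ∧ ∀ (l : Space d → ℝ≥0∞) (w : SpaceTime d → ℝ)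
      (V : SpaceTime d → ℝ≥0∞) (c : SpaceTime d) (ρ R : ℝ),
      ρ < R → R ≤ 1 → Measurable l → (∀ x, l x ≠ ⊤) → LocLip w → Measurable V →
      ∫⁻ x in box c.2 R, (l x)⁻¹ ^ p0 ≤ NΛ →
      ∫⁻ z in pcyl c ρ, V z * ‖w z‖ₑ ^ (2 : ℝ) ≤
        (∫⁻ t in Ioo (c.1 - ρ) (c.1 + ρ), (∫⁻ x in box c.2 ρ, V (t, x) ^ p) ^ (q / p)) ^ (1 / q) *
        (C * ((energy l w c R + ENNReal.ofReal (1 / (R - ρ)) ^ (2 : ℝ) * mass w c R) ^ (1 - δ) *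
          mass w c R ^ δ)) := by
  have hp00 : 0 < p := by linarith
  have hq00 : 0 < q := by linarith
  have hq1 : 1 < q := by
    rcases hq.eq_or_lt with rfl | h
    · norm_num at hpq; have := inv_pos.2 hp00; linarith
    · exact h
  have hqq : 0 < 1 - 1 / q := by rw [sub_pos, div_lt_one hq00]; exact hq1
  have hqi : 0 < 1 / q := by positivity
  set θ := 1 / p / (2 / (d : ℝ) - 1 / p0) with hθ
  have hθ0 : 0 ≤ θ := by positivity
  have hθq : θ < 1 - 1 / q := by rw [hθ, div_lt_iff₀ hd0]; exact hpq
  set q' := (1 - 1 / q)⁻¹ with hq'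
  have hq'1 : 1 / q' = 1 - 1 / q := by rw [hq', one_div, inv_inv]
  have hq'0 : 0 < q' := inv_pos.2 hqq
  have hq'ge : 1 ≤ q' := by rw [hq', one_le_inv₀ hqq]; linarith
  obtain ⟨C, hC⟩ := parabolic_interpolation hd (P := dualExp p) (p' := (1 - 1 / p)⁻¹) (q' := q')
    (θ := θ) hp0 (by rw [recip_dualExp hp, one_div, one_div, inv_inv]) hq'ge hθ0
    (by rw [one_div, inv_inv, hθ, div_mul_cancel₀ _ hd0.ne']; ring) (by rw [hq'1]; exact hθq.le) NΛ
  refine ⟨C, 1 / q' - θ, by rw [hq'1]; linarith, by rw [hq'1]; linarith, ?_⟩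
  intro l w V c ρ R hρR hR hl hlt hw hV hΛ
  refine le_trans ?_ (mul_le_mul' le_rfl (hC l w c ρ R hρR hR hl hlt hw hΛ))
  have hm : Measurable fun z : SpaceTime d => V z * ‖w z‖ₑ ^ (2 : ℝ) :=
    hV.mul (hw.continuous.measurable.enorm.pow_const _)
  rw [pcyl, lintegral_prod_set hm]
  have hVm : Measurable fun t => ∫⁻ x in box c.2 ρ, V (t, x) ^ p :=
    (hV.pow_const p).lintegral_prod_right' (ν := volume.restrict (box c.2 ρ))
  calc ∫⁻ t in Ioo (c.1 - ρ) (c.1 + ρ), ∫⁻ x in box c.2 ρ, V (t, x) * ‖w (t, x)‖ₑ ^ (2 : ℝ)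
      ≤ ∫⁻ t in Ioo (c.1 - ρ) (c.1 + ρ), (∫⁻ x in box c.2 ρ, V (t, x) ^ p) ^ (1 / p) *
        eLpNorm (fun x => w (t, x)) (dualExp p) (volume.restrict (box c.2 ρ)) ^ (2 : ℝ) := by
        refine lintegral_mono fun t => ?_
        exact lintegral_mul_sq_le hp (hV.comp measurable_prodMk_left).aemeasurable
          (hw.continuous.measurable.comp measurable_prodMk_left)
    _ = ∫⁻ t in Ioo (c.1 - ρ) (c.1 + ρ), ((∫⁻ x in box c.2 ρ, V (t, x) ^ p) ^ (q / p)) ^ (1 / q) *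
        ((eLpNorm (fun x => w (t, x)) (dualExp p) (volume.restrict (box c.2 ρ)) ^ (2 : ℝ)) ^ q')
          ^ (1 / q') := by
        refine lintegral_congr fun t => ?_
        rw [← ENNReal.rpow_mul, ← ENNReal.rpow_mul _ q', mul_one_div_cancel hq'0.ne', ENNReal.rpow_one]
        congr 2
        field_simp
    _ ≤ _ := by
        have hpne : 0 < 1 - 1 / p := by
          have : 2 / (d : ℝ) - 1 / p0 < 1 := by
            have h1 : 2 / (d : ℝ) ≤ 1 := by
              rw [div_le_one (by positivity)]; exact_mod_cast hd
            have : 0 < 1 / p0 := by positivity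
            linarith
          nlinarith
        have hfin : dualExp p ≠ ⊤ := by
          rw [dualExp]; simp; field_simp at hpne ⊢; linarith
        have hne : dualExp p ≠ 0 := by simp [dualExp]
        have hmeas : Measurable fun t => (eLpNorm (fun x => w (t, x)) (dualExp p)
            (volume.restrict (box c.2 ρ)) ^ (2 : ℝ)) ^ q' := by
          simp only [eLpNorm_eq_lintegral_rpow_enorm_toReal hne hfin]
          exact (((hw.continuous.measurable.enorm.pow_const _).lintegral_prod_right'
            (ν := volume.restrict (box c.2 ρ))).pow_const _).pow_const _ |>.pow_const _
        exact ENNReal.lintegral_mul_norm_pow_le (hVm.pow_const _).aemeasurable hmeas.aemeasurable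
          (by positivity) (by positivity) (by rw [hq'1]; ring)

open Filter Topology in
/-- **Minkowski's integral inequality**. -/
theorem lintegral_rpow_lintegral_le {α β : Type*} [MeasurableSpace α] [MeasurableSpace β]
    (μ : Measure α) [IsFiniteMeasure μ] (ν : Measure β) [SFinite ν] {F : α × β → ℝ≥0∞}
    (hF : Measurable F) {s : ℝ} (hs : 1 ≤ s) :
    ∫⁻ a, (∫⁻ b, F (a, b) ∂ν) ^ s ∂μ ≤ (∫⁻ b, (∫⁻ a, F (a, b) ^ s ∂μ) ^ (1 / s) ∂ν) ^ s := by
  have hs0 : 0 < s := by linarith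
  have hs1 : 1 / s ≤ 1 := by rw [div_le_one hs0]; exact hs
  set H : α → ℝ≥0∞ := fun a => ∫⁻ b, F (a, b) ∂ν with hH
  have hHm : Measurable H := hF.lintegral_prod_right'
  set B := ∫⁻ b, (∫⁻ a, F (a, b) ^ s ∂μ) ^ (1 / s) ∂ν with hB
  have hk : ∀ k : ℕ, ∫⁻ a, (min (H a) k) ^ s ∂μ ≤ B ^ s := by
    intro k
    have hkm : Measurable fun a => min (H a) (k : ℝ≥0∞) := hHm.min measurable_const
    set T := ∫⁻ a, (min (H a) k) ^ s ∂μ with hT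
    have hTfin : T ≠ ⊤ := by
      refine ne_top_of_le_ne_top (b := ∫⁻ _a, (k : ℝ≥0∞) ^ s ∂μ) ?_
        (lintegral_mono fun a => ENNReal.rpow_le_rpow (min_le_right _ _) hs0.le)
      rw [lintegral_const]
      exact ENNReal.mul_ne_top (ENNReal.rpow_ne_top_of_nonneg hs0.le (by simp)) (measure_ne_top _ _)
    have h1 : T ≤ T ^ (1 - 1 / s) * B := by
      calc T ≤ ∫⁻ a, (min (H a) k) ^ (s - 1) * H a ∂μ := by
            refine lintegral_mono fun a => ?_
            calc (min (H a) (k : ℝ≥0∞)) ^ s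
                = (min (H a) (k : ℝ≥0∞)) ^ (s - 1) * (min (H a) (k : ℝ≥0∞)) ^ (1 : ℝ) := by
                  rw [← ENNReal.rpow_add_of_nonneg _ _ (by linarith) (by norm_num)]; congr 1; ring
              _ ≤ _ := by rw [ENNReal.rpow_one]; gcongr; exact min_le_left _ _
        _ = ∫⁻ a, ∫⁻ b, (min (H a) k) ^ (s - 1) * F (a, b) ∂ν ∂μ := by
            refine lintegral_congr fun a => ?_
            have hFa : Measurable fun b => F (a, b) := hF.comp measurable_prodMk_left
            exact (lintegral_const_mul _ hFa).symm
        _ = ∫⁻ b, ∫⁻ a, (min (H a) k) ^ (s - 1) * F (a, b) ∂μ ∂ν := by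
            apply lintegral_lintegral_swap
            exact (((hkm.pow_const (s - 1)).comp measurable_fst).mul hF).aemeasurable
        _ ≤ ∫⁻ b, T ^ (1 - 1 / s) * (∫⁻ a, F (a, b) ^ s ∂μ) ^ (1 / s) ∂ν := by
            refine lintegral_mono fun b => ?_
            have := ENNReal.lintegral_mul_norm_pow_le (μ := μ) (hkm.pow_const s).aemeasurable
              ((hF.comp measurable_prodMk_right).pow_const s).aemeasurable (g := fun a => F (a, b) ^ s)
              (p := 1 - 1 / s) (q := 1 / s) (by linarith) (by positivity) (by ring)
            refine le_trans (le_of_eq (lintegral_congr fun a => ?_)) this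
            rw [← ENNReal.rpow_mul, ← ENNReal.rpow_mul, mul_one_div_cancel hs0.ne', ENNReal.rpow_one]
            congr 2; field_simp
        _ = _ := by
            rw [lintegral_const_mul' _ _ (ENNReal.rpow_ne_top_of_nonneg (by linarith) hTfin)]
    rcases eq_or_ne T 0 with h0 | h0
    · simp [h0]
    have h2 : T ^ (1 / s) ≤ B := by
      have e : T = T ^ (1 - 1 / s) * T ^ (1 / s) := by
        rw [← ENNReal.rpow_add _ _ h0 hTfin]; simp
      have hne : T ^ (1 - 1 / s) ≠ 0 := by simp [h0, hTfin]
      have hnt : T ^ (1 - 1 / s) ≠ ⊤ := ENNReal.rpow_ne_top_of_nonneg (by linarith) hTfin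
      rw [e] at h1
      have h1' : T ^ (1 - 1 / s) * T ^ (1 / s) ≤ T ^ (1 - 1 / s) * B := by rwa [← e] at h1 ⊢
      exact (ENNReal.mul_le_mul_iff_right hne hnt).1 h1'
    calc T = (T ^ (1 / s)) ^ s := by rw [← ENNReal.rpow_mul, one_div_mul_cancel hs0.ne', ENNReal.rpow_one]
      _ ≤ B ^ s := ENNReal.rpow_le_rpow h2 hs0.le
  have hlim : Tendsto (fun k : ℕ => ∫⁻ a, (min (H a) k) ^ s ∂μ) atTop (𝓝 (∫⁻ a, H a ^ s ∂μ)) := by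
    refine lintegral_tendsto_of_tendsto_of_monotone
      (fun k => ((hHm.min measurable_const).pow_const s).aemeasurable) ?_ ?_
    · refine Eventually.of_forall fun a i j hij => ?_
      exact ENNReal.rpow_le_rpow (min_le_min_left _ (by exact_mod_cast hij)) hs0.le
    · refine Eventually.of_forall fun a => ?_
      refine (ENNReal.continuous_rpow_const.tendsto _).comp ?_
      have := (tendsto_const_nhds (x := H a) (f := atTop)).min ENNReal.tendsto_nat_nhds_top
      simpa using this
  exact le_of_tendsto' hlim hk

/-- The embedding of `ℝⁿ` into `ℝ^{n+1}` as the hyperplane `x_i = s`. -/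
noncomputable def slab {n : ℕ} (i : Fin (n + 1)) (s : ℝ) (y : Fin n → ℝ) : Space (n + 1) :=
  WithLp.toLp 2 (i.insertNth (α := fun _ => ℝ) s y)

section Slices

variable {n : ℕ}

theorem measurable_slab (i : Fin (n + 1)) :
    Measurable fun sy : ℝ × (Fin n → ℝ) => slab i sy.1 sy.2 :=
  (PiLp.continuous_toLp 2 _).measurable.comp
    (MeasurableEquiv.piFinSuccAbove (fun _ : Fin (n + 1) => ℝ) i).symm.measurable

theorem measurePreserving_slab (i : Fin (n + 1)) :
    MeasurePreserving (fun sy : ℝ × (Fin n → ℝ) => slab i sy.1 sy.2) volume volume :=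
  (PiLp.volume_preserving_toLp (Fin (n + 1))).comp
    (volume_preserving_piFinSuccAbove (fun _ : Fin (n + 1) => ℝ) i).symm

theorem lintegral_slab (i : Fin (n + 1)) {F : Space (n + 1) → ℝ≥0∞} (hF : Measurable F) :
    ∫⁻ s, ∫⁻ y, F (slab i s y) = ∫⁻ x, F x := by
  have hm : Measurable fun sy : ℝ × (Fin n → ℝ) => F (slab i sy.1 sy.2) :=
    hF.comp (measurable_slab i)
  rw [← (measurePreserving_slab i).lintegral_comp hF, Measure.volume_eq_prod,
    lintegral_prod _ hm.aemeasurable]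

theorem slab_apply_same (i : Fin (n + 1)) (s : ℝ) (y : Fin n → ℝ) : slab i s y i = s := by
  simp [slab]

theorem slab_apply_succAbove (i : Fin (n + 1)) (s : ℝ) (y : Fin n → ℝ) (j : Fin n) :
    slab i s y (i.succAbove j) = y j := by
  simp [slab]

theorem lipschitzWith_slab (i : Fin (n + 1)) (s : ℝ) : LipschitzWith (n + 1 : ℕ) (slab i s) := by
  have h : LipschitzWith 1 fun y : Fin n → ℝ => i.insertNth (α := fun _ => ℝ) s y := by
    refine LipschitzWith.of_dist_le_mul fun a b => ?_
    rw [NNReal.coe_one, one_mul, dist_pi_le_iff dist_nonneg]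
    intro j
    rcases Fin.eq_self_or_eq_succAbove i j with rfl | ⟨k, rfl⟩
    · simp
    · simpa using dist_le_pi_dist a b k
  have := lipschitzWith_toLp.comp h
  rw [mul_one] at this
  exact this

theorem differentiable_slab (i : Fin (n + 1)) (s : ℝ) : Differentiable ℝ (slab i s) := by
  have h : Differentiable ℝ fun y : Fin n → ℝ => i.insertNth (α := fun _ => ℝ) s y := by
    rw [differentiable_pi]
    intro j
    rcases Fin.eq_self_or_eq_succAbove i j with rfl | ⟨k, rfl⟩
    · simp
    · simp only [Fin.insertNth_apply_succAbove]; fun_prop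
  exact (PiLp.continuousLinearEquiv 2 ℝ (fun _ : Fin (n + 1) => ℝ)).symm.differentiable.comp h

/-- Estimate of `∫ g w²` on a time-slice of a hyperplane. -/
theorem lintegral_slab_le (hn : 1 ≤ n) {p0 p q θ κ : ℝ} (hp0 : 1 < p0) (hp : 1 ≤ p)
    (hq : 0 < q) (hκ : 1 ≤ κ) (hθ0 : 0 ≤ θ) (hθ1 : θ ≤ 1)
    (hpe : 1 / p = θ * (2 / n - 1 / p0) + (1 - θ) * (1 - 1 / κ))
    (hqe : 1 / q = (1 - θ) * (1 - 1 / κ)) (hpq : p ≤ q) :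
    ∃ C : ℝ≥0, ∀ (l : Space (n + 1) → ℝ≥0∞) (w : SpaceTime (n + 1) → ℝ)
      (g : SpaceTime (n + 1) → ℝ≥0∞) (I : Set ℝ) (i : Fin (n + 1)) (s : ℝ) (y0 : Fin n → ℝ)
      (ρ R : ℝ), ρ < R → R ≤ 1 → Measurable l → (∀ x, l x ≠ ⊤) → LocLip w → Measurable g →
      volume I ≠ ⊤ →
      ∫⁻ y in Metric.ball y0 R, (l (slab i s y))⁻¹ ^ p0 ≠ ⊤ →
      (∀ᵐ t ∂(volume.restrict I), ∀ᵐ y ∂(volume.restrict (Metric.ball y0 R)),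
        DifferentiableAt ℝ (fun x => w (t, x)) (slab i s y)) →
      ∫⁻ t in I, ∫⁻ y in Metric.ball y0 ρ, g (t, slab i s y) * ‖w (t, slab i s y)‖ₑ ^ (2 : ℝ) ≤
        C * ((∫⁻ y in Metric.ball y0 ρ, (∫⁻ t in I, g (t, slab i s y) ^ q) ^ (p / q)) ^ (1 / p) *
          (((1 + ∫⁻ y in Metric.ball y0 R, (l (slab i s y))⁻¹ ^ p0) ^ (1 / p0) *
            ((∫⁻ t in I, ∫⁻ y in Metric.ball y0 R, l (slab i s y) *
                ‖spaceGrad w (t, slab i s y)‖ₑ ^ (2 : ℝ)) +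
              ENNReal.ofReal (1 / (R - ρ)) ^ (2 : ℝ) *
                ∫⁻ t in I, ∫⁻ y in Metric.ball y0 R, ‖w (t, slab i s y)‖ₑ ^ (2 : ℝ))) ^ θ *
          (∫⁻ t in I, ∫⁻ y in Metric.ball y0 R, ‖w (t, slab i s y)‖ₑ ^ (2 * κ)) ^ ((1 - θ) / κ))) := by
  have hp00 : 0 < p := by linarith
  have hκ0 : 0 < κ := by linarith
  have hP : recip (dualExp p) = θ * ((1 + 1 / p0) / 2 - 1 / n) + (1 - θ) / (2 * κ) := by
    rw [recip_dualExp hp, hpe]; field_simp; ring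
  obtain ⟨C, hC⟩ := comp_gagliardoNirenberg (n + 1) (by omega) hn hp0
    (by linarith : 1 ≤ 2 * κ) hθ0 hθ1 hP
  refine ⟨C, fun l w g I i s y0 ρ R hρR hR hl hlt hw hg hI hΛ hdiff => ?_⟩
  have : IsFiniteMeasure (volume.restrict I) := ⟨by simpa [lt_top_iff_ne_top] using hI⟩
  have hsm : Measurable (slab i s) := (lipschitzWith_slab i s).continuous.measurable
  have hts : Measurable fun ty : ℝ × (Fin n → ℝ) => (ty.1, slab i s ty.2) :=
    measurable_fst.prodMk (hsm.comp measurable_snd)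
  set a := (1 + ∫⁻ y in Metric.ball y0 R, (l (slab i s y))⁻¹ ^ p0) ^ (1 / p0) with ha
  set k := ENNReal.ofReal (1 / (R - ρ)) ^ (2 : ℝ) with hk
  set ν := volume.restrict (Metric.ball y0 R) with hν
  set ν' := volume.restrict (Metric.ball y0 ρ) with hν'
  have hgm := measurable_spaceGrad hw.continuous
  have hwm : Measurable fun z : SpaceTime (n + 1) => ‖w z‖ₑ := hw.continuous.measurable.enorm
  set γ : ℝ → ℝ≥0∞ := fun t => ∫⁻ y, g (t, slab i s y) ^ p ∂ν' with hγ
  set E : ℝ → ℝ≥0∞ := fun t => ∫⁻ y, l (slab i s y) * ‖spaceGrad w (t, slab i s y)‖ₑ ^ (2 : ℝ) ∂ν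
    with hE
  set S : ℝ → ℝ≥0∞ := fun t => ∫⁻ y, ‖w (t, slab i s y)‖ₑ ^ (2 : ℝ) ∂ν with hS
  set N : ℝ → ℝ≥0∞ := fun t => ∫⁻ y, ‖w (t, slab i s y)‖ₑ ^ (2 * κ) ∂ν with hN
  have hγm : Measurable γ := ((hg.comp hts).pow_const p).lintegral_prod_right' (ν := ν')
  have hEm : Measurable E := ((hl.comp (hsm.comp measurable_snd)).mul
    ((hgm.comp hts).enorm.pow_const _)).lintegral_prod_right' (ν := ν)
  have hSm : Measurable S := ((hwm.comp hts).pow_const _).lintegral_prod_right' (ν := ν)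
  have hNm : Measurable N := ((hwm.comp hts).pow_const _).lintegral_prod_right' (ν := ν)
  have hpt : ∀ᵐ t ∂(volume.restrict I), ∫⁻ y, g (t, slab i s y) * ‖w (t, slab i s y)‖ₑ ^ (2 : ℝ) ∂ν' ≤
      C * ((γ t ^ (q / p)) ^ (1 / q) * ((a * (E t + k * S t)) ^ θ * N t ^ ((1 - θ) / κ))) := by
    filter_upwards [hdiff] with t ht
    refine (lintegral_mul_sq_le hp ((hg.comp (hts.comp measurable_prodMk_left)).aemeasurable)
      (hw.continuous.measurable.comp (hts.comp measurable_prodMk_left))).trans ?_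
    have h := hC (slab i s) (lipschitzWith_slab i s) (differentiable_slab i s) y0 ρ R
      (fun x => w (t, x)) l hρR hR (hw.locLip_slice t) hl hlt hΛ (by
        exact (ae_restrict_iff' measurableSet_ball).1 ht)
    rw [← ENNReal.rpow_mul, show q / p * (1 / q) = 1 / p by field_simp,
      show 2 * (1 - θ) / (2 * κ) = (1 - θ) / κ by field_simp] at *
    calc _ ≤ γ t ^ (1 / p) * (C * ((a * (E t + k * S t)) ^ θ * N t ^ ((1 - θ) / κ))) := by
          refine mul_le_mul' le_rfl (h.trans (le_of_eq ?_))
          simp only [hE, enorm_spaceGrad]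
          rfl
      _ = _ := by ring
  have hγq : ∫⁻ t in I, γ t ^ (q / p) ≤ (∫⁻ y, (∫⁻ t in I, g (t, slab i s y) ^ q) ^ (p / q) ∂ν') ^ (q / p) := by
    have := lintegral_rpow_lintegral_le (volume.restrict I) ν' (F := fun ty => g (ty.1, slab i s ty.2) ^ p)
      ((hg.comp hts).pow_const p) (s := q / p) (by rw [le_div_iff₀ hp00]; linarith)
    simp only [← ENNReal.rpow_mul, one_div_div, mul_div_cancel₀ q hp00.ne'] at this
    exact this
  have hnn : 0 ≤ (1 - θ) / κ := div_nonneg (by linarith) hκ0.le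
  have hESm : Measurable fun t => E t + k * S t := hEm.add (hSm.const_mul k)
  have hH := lintegral_mul_mul_norm_pow_le (μ := volume.restrict I) (hγm.pow_const (q / p)).aemeasurable
    (hESm.const_mul a).aemeasurable hNm.aemeasurable (one_div_pos.2 hq).le hθ0 hnn
    (by rw [hqe]; field_simp; ring)
  calc _ ≤ ∫⁻ t in I, C * ((γ t ^ (q / p)) ^ (1 / q) * ((a * (E t + k * S t)) ^ θ *
          N t ^ ((1 - θ) / κ))) := lintegral_mono_ae hpt
    _ = C * ∫⁻ t in I, (γ t ^ (q / p)) ^ (1 / q) * (a * (E t + k * S t)) ^ θ *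
          N t ^ ((1 - θ) / κ) := by
        rw [lintegral_const_mul' _ _ ENNReal.coe_ne_top]
        simp only [mul_assoc]
    _ ≤ C * ((∫⁻ t in I, γ t ^ (q / p)) ^ (1 / q) * (∫⁻ t in I, a * (E t + k * S t)) ^ θ *
          (∫⁻ t in I, N t) ^ ((1 - θ) / κ)) := by gcongr
    _ ≤ C * (((∫⁻ y, (∫⁻ t in I, g (t, slab i s y) ^ q) ^ (p / q) ∂ν') ^ (q / p)) ^ (1 / q) *
          (a * ((∫⁻ t in I, E t) + k * ∫⁻ t in I, S t)) ^ θ *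
          (∫⁻ t in I, N t) ^ ((1 - θ) / κ)) := by
        rw [lintegral_const_mul _ hESm, lintegral_add_left hEm,
          lintegral_const_mul _ hSm]
        refine mul_le_mul' le_rfl (mul_le_mul' (mul_le_mul' ?_ le_rfl) le_rfl)
        exact ENNReal.rpow_le_rpow hγq (one_div_pos.2 hq).le
    _ = _ := by
        rw [← ENNReal.rpow_mul, show q / p * (1 / q) = 1 / p by field_simp, mul_assoc]

end Slices

end

section

/-- Most radii are good for finitely many integrable functions simultaneously. -/
theorem exists_good_radii {ι : Type*} [Fintype ι] {m : ι → ℝ → ℝ≥0∞} (hm : ∀ j, Measurable (m j))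
    {M : ι → ℝ≥0∞} {ρ R : ℝ} (h : ρ < R) (hM : ∀ j, ∫⁻ s in Ioo ρ R, m j s ≤ M j) :
    ∃ K, IsCompact K ∧ K ⊆ Ioo ρ R ∧ ENNReal.ofReal ((R - ρ) / 2) ≤ volume K ∧
      ∀ s ∈ K, ∀ j, m j s ≤ ENNReal.ofReal (4 * (Fintype.card ι + 1) / (R - ρ)) * M j := by
  have hr : 0 < R - ρ := by linarith
  obtain ⟨N, hN⟩ : ∃ N : ℝ, N = Fintype.card ι + 1 := ⟨_, rfl⟩
  have hN0 : 0 < N := by rw [hN]; positivity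
  rw [← hN]
  set A := ENNReal.ofReal (4 * N / (R - ρ)) with hA
  have hA0 : A ≠ 0 := by rw [hA]; simp; positivity
  have hAt : A ≠ ⊤ := by simp [hA]
  set bad : ι → Set ℝ := fun j => {s | A * M j < m j s} with hbad
  have hbm : ∀ j, MeasurableSet (bad j) := fun j => measurableSet_lt measurable_const (hm j)
  have hb : ∀ j, volume (bad j ∩ Ioo ρ R) ≤ A⁻¹ := by
    intro j
    rw [← Measure.restrict_apply (hbm j)]
    rcases eq_or_ne (M j) ⊤ with hT | hT
    · have : bad j = ∅ := by
        ext s; simp [hbad, hT, ENNReal.mul_top hA0]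
      simp [this]
    rcases eq_or_ne (M j) 0 with h0 | h0
    · have h1 := hM j
      rw [h0, nonpos_iff_eq_zero, lintegral_eq_zero_iff (hm j)] at h1
      have : (volume.restrict (Ioo ρ R)) (bad j) = 0 := by
        rw [measure_eq_zero_iff_ae_notMem]
        filter_upwards [h1] with s hs
        simp [hbad, hs]
      simp [this]
    have h1 := mul_meas_ge_le_lintegral (μ := volume.restrict (Ioo ρ R)) (hm j) (A * M j)
    have h2 : A * M j * (volume.restrict (Ioo ρ R)) (bad j) ≤ M j := by
      refine le_trans (mul_le_mul' le_rfl (measure_mono fun s hs => ?_)) (h1.trans (hM j))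
      exact (show A * M j < m j s from hs).le
    rw [mul_comm A, mul_assoc] at h2
    have h3 : A * (volume.restrict (Ioo ρ R)) (bad j) ≤ 1 := by
      refine (ENNReal.mul_le_mul_iff_right h0 hT).1 (h2.trans ?_)
      simp
    rw [ENNReal.le_inv_iff_mul_le, mul_comm]
    exact h3
  set G := Ioo ρ R \ ⋃ j, (bad j ∩ Ioo ρ R) with hG
  have hGm : MeasurableSet G :=
    measurableSet_Ioo.diff (MeasurableSet.iUnion fun j => (hbm j).inter measurableSet_Ioo)
  have hU : volume (⋃ j, (bad j ∩ Ioo ρ R)) ≤ ENNReal.ofReal ((R - ρ) / 4) := by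
    refine (measure_iUnion_fintype_le _ _).trans ((Finset.sum_le_sum fun j _ => hb j).trans ?_)
    rw [Finset.sum_const, Finset.card_univ, nsmul_eq_mul, hA, ← ENNReal.ofReal_inv_of_pos (by positivity),
      ← ENNReal.ofReal_natCast, ← ENNReal.ofReal_mul (by positivity)]
    refine ENNReal.ofReal_le_ofReal ?_
    have h5 : (Fintype.card ι : ℝ) ≤ N := by rw [hN]; linarith
    rw [inv_div, ← mul_div_assoc, div_le_div_iff₀ (by positivity) (by positivity)]
    nlinarith [mul_le_mul_of_nonneg_left h5 hr.le]
  have hGv : ENNReal.ofReal ((R - ρ) / 2) < volume G := by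
    have h1 : volume (Ioo ρ R) ≤ volume G + volume (⋃ j, (bad j ∩ Ioo ρ R)) := by
      refine (measure_mono (t := G ∪ ⋃ j, (bad j ∩ Ioo ρ R)) ?_).trans (measure_union_le _ _)
      rw [hG, sdiff_union_self]; exact subset_union_left
    rw [Real.volume_Ioo] at h1
    by_contra hc
    have h2 := h1.trans (add_le_add (not_lt.1 hc) hU)
    rw [← ENNReal.ofReal_add (by positivity) (by positivity), ENNReal.ofReal_le_ofReal_iff (by positivity)] at h2
    linarith
  obtain ⟨K, hKG, hK, hKv⟩ := hGm.exists_lt_isCompact hGv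
  refine ⟨K, hK, fun s hs => (hKG hs).1, hKv.le, fun s hs j => ?_⟩
  have h1 := hKG hs
  by_contra hc
  exact h1.2 (mem_iUnion.2 ⟨j, not_le.1 hc, h1.1⟩)

theorem lintegral_abs_sub_mem {K : Set ℝ} (hK : MeasurableSet K) (hK0 : K ⊆ Ioi 0) (a : ℝ)
    {h : ℝ → ℝ≥0∞} (hh : Measurable h) :
    ∫⁻ σ in K, (h (a + σ) + h (a - σ)) = ∫⁻ s in {s | |s - a| ∈ K}, h s := by
  have hS : MeasurableSet {s | |s - a| ∈ K} :=
    (measurable_id.sub_const a).abs hK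
  have h1 : Measurable fun σ => h (a + σ) := hh.comp (measurable_const_add a)
  rw [lintegral_add_left h1, ← lintegral_indicator hK, ← lintegral_indicator hK,
    ← lintegral_indicator hS,
    ← lintegral_sub_right_eq_self (fun σ => K.indicator (fun σ => h (a + σ)) σ) a,
    ← lintegral_sub_left_eq_self (fun σ => K.indicator (fun σ => h (a - σ)) σ) a, ← lintegral_add_left]
  · refine lintegral_congr fun s => ?_
    simp only [indicator, mem_ofPred_eq, add_sub_cancel, sub_sub_cancel]
    rcases lt_trichotomy (s - a) 0 with hlt | heq | hgt
    · have e1 : s - a ∉ K := fun hc => absurd (hK0 hc) (by simp; linarith)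
      have e2 : |s - a| ∈ K ↔ a - s ∈ K := by rw [abs_of_neg hlt, neg_sub]
      rw [if_neg e1, zero_add]
      by_cases h2 : a - s ∈ K
      · rw [if_pos h2, if_pos (e2.2 h2)]
      · rw [if_neg h2, if_neg fun hc => h2 (e2.1 hc)]
    · have e0 : (0 : ℝ) ∉ K := fun hc => absurd (hK0 hc) (by simp)
      simp [heq, show a - s = 0 by linarith, e0]
    · have e1 : a - s ∉ K := fun hc => absurd (hK0 hc) (by simp; linarith)
      have e2 : |s - a| ∈ K ↔ s - a ∈ K := by rw [abs_of_pos hgt]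
      rw [if_neg e1, add_zero]
      by_cases h2 : s - a ∈ K
      · rw [if_pos h2, if_pos (e2.2 h2)]
      · rw [if_neg h2, if_neg fun hc => h2 (e2.1 hc)]
  · exact ((h1.indicator hK).comp (measurable_id.sub_const a))

section Slices

variable {n : ℕ}

/-- The sum of the integrals of `F` over the faces at distance `σ` from the centre `z`. -/
noncomputable def sliceSum (F : Space (n + 1) → ℝ≥0∞) (z : Space (n + 1)) (r σ : ℝ) : ℝ≥0∞ :=
  ∑ i : Fin (n + 1),
    ((∫⁻ y in Metric.ball (fun j => z (i.succAbove j)) r, F (slab i (z i + σ) y)) +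
      ∫⁻ y in Metric.ball (fun j => z (i.succAbove j)) r, F (slab i (z i - σ) y))

theorem measurable_lintegral_slab {F : Space (n + 1) → ℝ≥0∞} (hF : Measurable F) (i : Fin (n + 1))
    (B : Set (Fin n → ℝ)) : Measurable fun s => ∫⁻ y in B, F (slab i s y) :=
  (hF.comp (measurable_slab i)).lintegral_prod_right' (ν := volume.restrict B)

theorem measurable_sliceSum {F : Space (n + 1) → ℝ≥0∞} (hF : Measurable F) (z : Space (n + 1))
    (r : ℝ) : Measurable (sliceSum F z r) := by
  refine Finset.measurable_sum _ fun i _ => Measurable.add ?_ ?_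
  · exact (measurable_lintegral_slab hF i _).comp (measurable_const_add _)
  · exact (measurable_lintegral_slab hF i _).comp (measurable_const.sub measurable_id)

theorem slab_mem_box_iff (i : Fin (n + 1)) (s : ℝ) (y : Fin n → ℝ) (z : Space (n + 1)) {r : ℝ}
    (hr : 0 < r) : slab i s y ∈ box z r ↔
      |s - z i| < r ∧ y ∈ Metric.ball (fun j => z (i.succAbove j)) r := by
  rw [mem_box_iff hr, Metric.mem_ball, dist_pi_lt_iff hr, Fin.forall_iff_succAbove i]
  simp only [slab_apply_same, slab_apply_succAbove, Real.dist_eq]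

/-- Fubini on the part of a cube where one coordinate belongs to a given set. -/
theorem lintegral_slab_region (i : Fin (n + 1)) (z : Space (n + 1)) {r : ℝ} (hr : 0 < r)
    {S : Set ℝ} (hS : MeasurableSet S) (hSr : ∀ s ∈ S, |s - z i| < r) {F : Space (n + 1) → ℝ≥0∞}
    (hF : Measurable F) :
    ∫⁻ s in S, ∫⁻ y in Metric.ball (fun j => z (i.succAbove j)) r, F (slab i s y) =
      ∫⁻ x in {x | x ∈ box z r ∧ x i ∈ S}, F x := by
  have hi : Measurable fun x : Space (n + 1) => x i := by fun_prop
  have hT : MeasurableSet {x | x ∈ box z r ∧ x i ∈ S} := (measurableSet_box z r).inter (hi hS)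
  rw [← lintegral_indicator hT, ← lintegral_slab i (hF.indicator hT), ← lintegral_indicator hS]
  refine lintegral_congr fun s => ?_
  by_cases hs : s ∈ S
  · rw [indicator_of_mem hs, ← lintegral_indicator measurableSet_ball]
    refine lintegral_congr fun y => ?_
    have h := slab_mem_box_iff i s y z hr
    by_cases hy : y ∈ Metric.ball (fun j => z (i.succAbove j)) r
    · rw [indicator_of_mem hy, indicator_of_mem]
      exact ⟨h.2 ⟨hSr s hs, hy⟩, by rw [slab_apply_same]; exact hs⟩
    · rw [indicator_of_notMem hy, indicator_of_notMem]
      exact fun hc => hy (h.1 hc.1).2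
  · rw [indicator_of_notMem hs]
    simp [indicator, slab_apply_same, hs]

theorem lintegral_sliceSum {F : Space (n + 1) → ℝ≥0∞} (hF : Measurable F) (z : Space (n + 1))
    (r : ℝ) (K : Set ℝ) :
    ∫⁻ σ in K, sliceSum F z r σ = ∑ i : Fin (n + 1), ∫⁻ σ in K,
      ((∫⁻ y in Metric.ball (fun j => z (i.succAbove j)) r, F (slab i (z i + σ) y)) +
        ∫⁻ y in Metric.ball (fun j => z (i.succAbove j)) r, F (slab i (z i - σ) y)) := by
  refine lintegral_finsetSum _ fun i _ => Measurable.add ?_ ?_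
  · exact (measurable_lintegral_slab hF i _).comp (measurable_const_add _)
  · exact (measurable_lintegral_slab hF i _).comp (measurable_const.sub measurable_id)

theorem lintegral_sliceSum_le {F : Space (n + 1) → ℝ≥0∞} (hF : Measurable F) (z : Space (n + 1))
    {r : ℝ} (hr : 0 < r) :
    ∫⁻ σ in Ioo 0 r, sliceSum F z r σ ≤ (n + 1 : ℕ) * ∫⁻ x in box z r, F x := by
  have hm := fun i => measurable_lintegral_slab hF i (Metric.ball (fun j => z (i.succAbove j)) r)
  rw [lintegral_sliceSum hF]
  calc _ ≤ ∑ _i : Fin (n + 1), ∫⁻ x in box z r, F x := by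
        refine Finset.sum_le_sum fun i _ => ?_
        rw [lintegral_abs_sub_mem measurableSet_Ioo (fun x hx => hx.1) (z i) (hm i),
          lintegral_slab_region i z hr ?_ (fun s hs => hs.2) hF]
        · exact lintegral_mono_set fun x hx => hx.1
        · exact (measurable_id.sub_const _).abs measurableSet_Ioo
    _ = _ := by simp

theorem lintegral_le_sliceSum {F : Space (n + 1) → ℝ≥0∞} (hF : Measurable F) (z : Space (n + 1))
    {r : ℝ} (hr : 0 < r) {K : Set ℝ} (hK : MeasurableSet K) (hKr : K ⊆ Ioo 0 r) :
    ∫⁻ x in {x | dist (WithLp.ofLp x) (WithLp.ofLp z) ∈ K}, F x ≤ ∫⁻ σ in K, sliceSum F z r σ := by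
  have hm := fun i => measurable_lintegral_slab hF i (Metric.ball (fun j => z (i.succAbove j)) r)
  have hKm : ∀ i, MeasurableSet {s | |s - z i| ∈ K} := fun i => (measurable_id.sub_const _).abs hK
  rw [lintegral_sliceSum hF]
  calc _ ≤ ∫⁻ x in ⋃ i : Fin (n + 1), {x | x ∈ box z r ∧ x i ∈ {s | |s - z i| ∈ K}}, F x := by
        refine lintegral_mono_set fun x hx => ?_
        obtain ⟨i, -, hi⟩ := Finset.exists_mem_eq_sup Finset.univ Finset.univ_nonempty
          fun i => nndist (x i) (z i)
        have hd : dist (WithLp.ofLp x) (WithLp.ofLp z) = |x i - z i| := by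
          rw [dist_pi_def, hi, coe_nndist, Real.dist_eq]
        refine mem_iUnion.2 ⟨i, ?_, ?_⟩
        · exact (hKr hx).2
        · rw [mem_ofPred_eq, ← hd]; exact hx
    _ ≤ ∑ i : Fin (n + 1), ∫⁻ x in {x | x ∈ box z r ∧ x i ∈ {s | |s - z i| ∈ K}}, F x := by
        rw [← tsum_fintype (L := .unconditional _)]
        exact lintegral_iUnion_le _ _
    _ ≤ _ := by
        refine Finset.sum_le_sum fun i _ => ?_
        rw [lintegral_abs_sub_mem hK (fun x hx => (hKr hx).1) (z i) (hm i),
          lintegral_slab_region i z hr (hKm i) (fun s hs => (hKr hs).2) hF]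

end Slices

section Cutoff

/-- The monotone cutoff that decreases from `1` to `0` on the set `K` only. -/
noncomputable def cutoffOn (K : Set ℝ) (s : ℝ) : ℝ := volume.real (K ∩ Ioi s) / volume.real K

variable {K : Set ℝ} {ρ R : ℝ}

theorem cutoffOn_nonneg (s : ℝ) : 0 ≤ cutoffOn K s := by unfold cutoffOn; positivity

theorem cutoffOn_le_one (hK : IsCompact K) (s : ℝ) : cutoffOn K s ≤ 1 :=
  div_le_one_of_le₀ (measureReal_mono inter_subset_left hK.measure_ne_top) (by positivity)

theorem cutoffOn_eq_one (hKR : K ⊆ Ioo ρ R) (hv : 0 < volume.real K) {s : ℝ} (hs : s ≤ ρ) :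
    cutoffOn K s = 1 := by
  have : K ∩ Ioi s = K := inter_eq_left.2 fun x hx => lt_of_le_of_lt hs (hKR hx).1
  rw [cutoffOn, this, div_self hv.ne']

theorem cutoffOn_eq_zero (hKR : K ⊆ Ioo ρ R) {s : ℝ} (hs : R ≤ s) :
    cutoffOn K s = 0 := by
  have : K ∩ Ioi s = ∅ := by
    ext x; simp only [mem_inter_iff, mem_Ioi, mem_empty_iff_false, iff_false, not_and, not_lt]
    exact fun hx => ((hKR hx).2.trans_le hs).le
  rw [cutoffOn, this]; simp

theorem cutoffOn_sub_le (hK : IsCompact K) {s t : ℝ} (hst : s ≤ t) :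
    0 ≤ cutoffOn K s - cutoffOn K t ∧
      cutoffOn K s - cutoffOn K t ≤ volume.real (K ∩ Ioc s t) / volume.real K := by
  have hf : ∀ A, volume (K ∩ A) ≠ ⊤ := fun A =>
    ne_top_of_le_ne_top hK.measure_ne_top (measure_mono inter_subset_left)
  have hm : volume.real (K ∩ Ioi t) ≤ volume.real (K ∩ Ioi s) :=
    measureReal_mono (inter_subset_inter_right _ (Ioi_subset_Ioi hst)) (hf _)
  have h : volume.real (K ∩ Ioi s) ≤ volume.real (K ∩ Ioc s t) + volume.real (K ∩ Ioi t) := by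
    rw [← Ioc_union_Ioi_eq_Ioi hst, inter_union_distrib_left]
    exact measureReal_union_le _ _
  rw [cutoffOn, cutoffOn, ← sub_div]
  exact ⟨div_nonneg (by linarith) (by positivity), by gcongr; linarith⟩

theorem lipschitzWith_cutoffOn (hK : IsCompact K) {C : ℝ≥0} (hC : 1 ≤ C * volume.real K) :
    LipschitzWith C (cutoffOn K) := by
  have hv : 0 < volume.real K := by
    by_contra h
    have : volume.real K = 0 := le_antisymm (not_lt.1 h) (by positivity)
    rw [this] at hC; norm_num at hC
  have key : ∀ s t : ℝ, s ≤ t → |cutoffOn K s - cutoffOn K t| ≤ C * (t - s) := by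
    intro s t hst
    obtain ⟨h1, h2⟩ := cutoffOn_sub_le hK hst
    rw [abs_of_nonneg h1]
    refine h2.trans ?_
    have h3 : volume.real (K ∩ Ioc s t) ≤ t - s := by
      refine (measureReal_mono inter_subset_right (by simp)).trans ?_
      simp [Measure.real, hst]
    rw [div_le_iff₀ hv]
    calc _ ≤ t - s := h3
      _ ≤ (t - s) * (C * volume.real K) := le_mul_of_one_le_right (by linarith) hC
      _ = _ := by ring
  refine LipschitzWith.of_dist_le_mul fun s t => ?_
  rw [Real.dist_eq, Real.dist_eq]
  rcases le_total s t with h | h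
  · rw [abs_sub_comm s t, abs_of_nonneg (by linarith : 0 ≤ t - s)]; exact key s t h
  · rw [abs_sub_comm, abs_of_nonneg (by linarith : 0 ≤ s - t)]; exact key t s h

theorem eventually_cutoffOn_eq (hK : IsCompact K) {s : ℝ} (hs : s ∉ K) :
    ∀ᶠ t in nhds s, cutoffOn K t = cutoffOn K s := by
  obtain ⟨ε, hε, hb⟩ := Metric.isOpen_iff.1 hK.isClosed.isOpen_compl s hs
  have h0 : ∀ a b : ℝ, a ≤ b → Icc a b ⊆ Metric.ball s ε → cutoffOn K a = cutoffOn K b := by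
    intro a b hab hsub
    obtain ⟨h1, h2⟩ := cutoffOn_sub_le hK hab
    have : K ∩ Ioc a b = ∅ := by
      ext x
      simp only [mem_inter_iff, mem_empty_iff_false, iff_false, not_and]
      exact fun hx hx2 => hb (hsub ⟨hx2.1.le, hx2.2⟩) hx
    rw [this] at h2
    simp at h2 h1
    linarith
  filter_upwards [Metric.ball_mem_nhds s hε] with t ht
  have hs' := Metric.mem_ball_self (x := s) hε
  have hc : (Metric.ball s ε).OrdConnected := (convex_ball s ε).ordConnected
  rcases le_total s t with h | h
  · exact (h0 s t h (hc.out hs' ht)).symm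
  · exact h0 t s h (hc.out ht hs')

/-- The cutoff on cubes obtained from `cutoffOn`. -/
theorem exists_cube_cutoff {d : ℕ} (hK : IsCompact K) (hρR : ρ < R) (hKR : K ⊆ Ioo ρ R)
    (hv : ENNReal.ofReal ((R - ρ) / 2) ≤ volume K) (z : Space d) :
    ∃ η : Space d → ℝ, LipschitzWith (Real.toNNReal (2 / (R - ρ))) η ∧ (∀ x, 0 ≤ η x) ∧
      (∀ x, η x ≤ 1) ∧ (∀ x ∈ box z ρ, η x = 1) ∧ (∀ x ∉ box z R, η x = 0) ∧
      ∀ x, dist (WithLp.ofLp x) (WithLp.ofLp z) ∉ K → gradient η x = 0 := by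
  have hr : 0 < R - ρ := by linarith
  have hv' : (R - ρ) / 2 ≤ volume.real K := (ENNReal.ofReal_le_iff_le_toReal hK.measure_ne_top).1 hv
  have hL := lipschitzWith_cutoffOn hK (C := Real.toNNReal (2 / (R - ρ))) (by
    rw [Real.coe_toNNReal _ (by positivity)]
    calc (1 : ℝ) = 2 / (R - ρ) * ((R - ρ) / 2) := by field_simp
      _ ≤ _ := by gcongr)
  have hD : LipschitzWith 1 fun x : Space d => dist (WithLp.ofLp x) (WithLp.ofLp z) := by
    have := (LipschitzWith.dist_left (WithLp.ofLp z)).comp (PiLp.lipschitzWith_ofLp 2 (fun _ : Fin d => ℝ))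
    rwa [mul_one] at this
  refine ⟨fun x => cutoffOn K (dist (WithLp.ofLp x) (WithLp.ofLp z)), ?_, fun x => cutoffOn_nonneg _,
    fun x => cutoffOn_le_one hK _, fun x hx => ?_, fun x hx => ?_, fun x hx => ?_⟩
  · have := hL.comp hD
    rwa [mul_one] at this
  · exact cutoffOn_eq_one hKR (by linarith) (Metric.mem_ball.1 hx).le
  · exact cutoffOn_eq_zero hKR (not_lt.1 hx)
  · have h1 := hD.continuous.continuousAt.eventually (eventually_cutoffOn_eq hK hx)
    rw [gradient, Filter.EventuallyEq.fderiv_eq (f₁ := fun x => cutoffOn K (dist (WithLp.ofLp x) (WithLp.ofLp z)))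
      (f := fun _ => cutoffOn K (dist (WithLp.ofLp x) (WithLp.ofLp z))) h1]
    simp

end Cutoff

end

section

theorem ENNReal.slice_bound_le (C C' Ng NΛ : ℝ≥0) {a0 : ℝ≥0} (ha0 : 1 ≤ a0) {p p0 θ κ δ : ℝ}
    (hp : 0 < p) (hp0 : 0 < p0) (hθ0 : 0 ≤ θ) (hθ1 : θ ≤ 1) (hκ : 0 < κ) (hδ1 : δ ≤ 1) :
    ∃ (K : ℝ≥0) (m : ℝ), 0 ≤ m ∧ ∀ τ E M : ℝ≥0∞, 1 ≤ τ →
      C * ((a0 * τ * Ng) ^ (1 / p) * (((1 + a0 * τ * NΛ) ^ (1 / p0) *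
        (a0 * τ * E + 9 * τ ^ (2 : ℝ) * (a0 * τ * M))) ^ θ *
        (a0 * τ * (C' * ((E + 9 * τ ^ (2 : ℝ) * M) ^ (1 - δ) * M ^ δ)) ^ κ) ^ ((1 - θ) / κ))) ≤
      K * τ ^ m * ((E + M) ^ (1 - (1 - θ) * δ) * M ^ ((1 - θ) * δ)) := by
  have hθ2 : 0 ≤ 1 - θ := by linarith
  have hδ2 : 0 ≤ 1 - δ := by linarith
  have hk : 0 ≤ (1 - θ) / κ := by positivity
  refine ⟨C * (a0 ^ (1 / p) * Ng ^ (1 / p) * ((a0 ^ (1 / p0) * (1 + NΛ) ^ (1 / p0)) * (a0 * 9)) ^ θ *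
    (a0 ^ ((1 - θ) / κ) * (C' * 9 ^ (1 - δ)) ^ (1 - θ))),
    1 / p + ((1 / p0 * θ + (1 + 2) * θ) + ((1 - θ) / κ + 2 * (1 - δ) * (1 - θ))), by positivity, ?_⟩
  intro τ E M hτ
  have hτ0 : τ ≠ 0 := by positivity
  have ha1 : (1 : ℝ≥0∞) ≤ a0 := by exact_mod_cast ha0
  have h9 : (1 : ℝ≥0∞) ≤ 9 * τ ^ (2 : ℝ) :=
    le_mul_of_one_le_of_le (by norm_num) (ENNReal.one_le_rpow hτ (by norm_num))
  have hE : E + 9 * τ ^ (2 : ℝ) * M ≤ 9 * τ ^ (2 : ℝ) * (E + M) := by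
    rw [mul_add]; gcongr; exact le_mul_of_one_le_left' h9
  have hΛ : 1 + a0 * τ * NΛ ≤ a0 * τ * (1 + NΛ) := by
    rw [mul_add, mul_one]; gcongr; exact one_le_mul ha1 hτ
  have h2 : a0 * τ * E + 9 * τ ^ (2 : ℝ) * (a0 * τ * M) ≤ a0 * τ * (9 * τ ^ (2 : ℝ) * (E + M)) := by
    calc _ = a0 * τ * (E + 9 * τ ^ (2 : ℝ) * M) := by ring
      _ ≤ _ := by gcongr
  calc _ ≤ C * ((a0 * τ * Ng) ^ (1 / p) * (((a0 * τ * (1 + NΛ)) ^ (1 / p0) *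
        (a0 * τ * (9 * τ ^ (2 : ℝ) * (E + M)))) ^ θ *
        (a0 * τ * (C' * ((9 * τ ^ (2 : ℝ) * (E + M)) ^ (1 - δ) * M ^ δ)) ^ κ) ^ ((1 - θ) / κ))) := by
        gcongr
    _ = _ := by
        rw [show 1 - (1 - θ) * δ = θ + (1 - δ) * (1 - θ) by ring]
        rw [ENNReal.rpow_add_of_nonneg θ _ hθ0 (by positivity),
          ENNReal.rpow_add_of_nonneg (1 / p) _ (by positivity) (by positivity),
          ENNReal.rpow_add_of_nonneg _ ((1 - θ) / κ + _) (by positivity) (by positivity),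
          ENNReal.rpow_add_of_nonneg _ ((1 + 2) * θ) (by positivity) (by positivity),
          ENNReal.rpow_add_of_nonneg ((1 - θ) / κ) _ (by positivity) (by positivity),
          ENNReal.rpow_mul τ (1 + 2),
          ENNReal.rpow_add_of_nonneg 1 2 (by positivity) (by positivity), ENNReal.rpow_one]
        push_cast
        simp only [ENNReal.coe_rpow_of_nonneg _ hθ0, ENNReal.coe_rpow_of_nonneg _ hθ2,
          ENNReal.coe_rpow_of_nonneg _ hδ2, ENNReal.coe_rpow_of_nonneg _ hk,
          ENNReal.coe_rpow_of_nonneg _ (one_div_pos.2 hp).le,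
          ENNReal.coe_rpow_of_nonneg _ (one_div_pos.2 hp0).le, ENNReal.coe_mul, ENNReal.coe_add,
          ENNReal.coe_one, ENNReal.coe_ofNat]
        have hk1 : κ * ((1 - θ) / κ) = 1 - θ := by field_simp
        simp only [ENNReal.mul_rpow_of_nonneg _ _ hθ0, ENNReal.mul_rpow_of_nonneg _ _ hθ2,
          ENNReal.mul_rpow_of_nonneg _ _ hδ2, ENNReal.mul_rpow_of_nonneg _ _ hk,
          ENNReal.mul_rpow_of_nonneg _ _ hκ.le,
          ENNReal.mul_rpow_of_nonneg _ _ (one_div_pos.2 hp).le,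
          ENNReal.mul_rpow_of_nonneg _ _ (one_div_pos.2 hp0).le, ← ENNReal.rpow_mul, hk1,
          mul_assoc (1 - δ) κ, mul_assoc δ κ, mul_assoc (2 : ℝ) (1 - δ),
          mul_assoc (2 : ℝ) ((1 - δ) * κ), mul_comm δ (1 - θ)]
        ring

section Slices

variable {n : ℕ}

/-- The contribution of one slice, after the bounds of `sliceSum`. -/
theorem le_sliceSum_add (F : Space (n + 1) → ℝ≥0∞) (z : Space (n + 1)) (r σ : ℝ) (i : Fin (n + 1)) :
    ∫⁻ y in Metric.ball (fun j => z (i.succAbove j)) r, F (slab i (z i + σ) y) ≤ sliceSum F z r σ :=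
  le_self_add.trans (Finset.single_le_sum (f := fun i : Fin (n + 1) =>
    (∫⁻ y in Metric.ball (fun j => z (i.succAbove j)) r, F (slab i (z i + σ) y)) +
      ∫⁻ y in Metric.ball (fun j => z (i.succAbove j)) r, F (slab i (z i - σ) y))
    (fun _ _ => zero_le) (Finset.mem_univ i))

theorem le_sliceSum_sub (F : Space (n + 1) → ℝ≥0∞) (z : Space (n + 1)) (r σ : ℝ) (i : Fin (n + 1)) :
    ∫⁻ y in Metric.ball (fun j => z (i.succAbove j)) r, F (slab i (z i - σ) y) ≤ sliceSum F z r σ :=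
  le_add_self.trans (Finset.single_le_sum (f := fun i : Fin (n + 1) =>
    (∫⁻ y in Metric.ball (fun j => z (i.succAbove j)) r, F (slab i (z i + σ) y)) +
      ∫⁻ y in Metric.ball (fun j => z (i.succAbove j)) r, F (slab i (z i - σ) y))
    (fun _ _ => zero_le) (Finset.mem_univ i))

theorem sliceSum_le {F : Space (n + 1) → ℝ≥0∞} {z : Space (n + 1)} {r σ : ℝ} {B : ℝ≥0∞}
    (h : ∀ (i : Fin (n + 1)) (s : ℝ), s = z i + σ ∨ s = z i - σ →
      ∫⁻ y in Metric.ball (fun j => z (i.succAbove j)) r, F (slab i s y) ≤ B) :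
    sliceSum F z r σ ≤ (2 * (n + 1) : ℕ) * B := by
  calc sliceSum F z r σ ≤ ∑ _i : Fin (n + 1), (B + B) :=
        Finset.sum_le_sum fun i _ => add_le_add (h i _ (Or.inl rfl)) (h i _ (Or.inr rfl))
    _ = _ := by simp; ring

theorem lintegral_slab_swap (i : Fin (n + 1)) (s : ℝ) (I : Set ℝ) (B : Set (Fin n → ℝ))
    {F : SpaceTime (n + 1) → ℝ≥0∞} (hF : Measurable F) :
    ∫⁻ t in I, ∫⁻ y in B, F (t, slab i s y) = ∫⁻ y in B, ∫⁻ t in I, F (t, slab i s y) := by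
  refine lintegral_lintegral_swap ?_
  exact (hF.comp (measurable_fst.prodMk
    ((lipschitzWith_slab i s).continuous.measurable.comp measurable_snd))).aemeasurable

theorem measurable_lintegral_time {d : ℕ} (I : Set ℝ) {F : SpaceTime d → ℝ≥0∞} (hF : Measurable F) :
    Measurable fun x => ∫⁻ t in I, F (t, x) :=
  Measurable.lintegral_prod_left' (μ := volume.restrict I) hF

theorem lintegral_box_time {d : ℕ} (I : Set ℝ) (B : Set (Space d)) {F : SpaceTime d → ℝ≥0∞}
    (hF : Measurable F) : ∫⁻ x in B, ∫⁻ t in I, F (t, x) = ∫⁻ z in I ×ˢ B, F z := by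
  rw [lintegral_prod_set hF]
  exact (lintegral_lintegral_swap (f := fun t x => F (t, x)) hF.aemeasurable).symm

/-- A cutoff adapted to finitely many weights, such that the commutator terms are controlled by an
interpolation between the energy and the mass. -/
theorem exists_good_cutoff (hn : 1 ≤ n) {ι : Type*} [Fintype ι] {p0 κ : ℝ} {p q θ : ι → ℝ}
    (hp0 : 1 < p0) (hd0 : 0 < 2 / ((n + 1 : ℕ) : ℝ) - 1 / p0) (hp : ∀ j, 1 ≤ p j)
    (hq : ∀ j, 0 < q j) (hκ : 1 ≤ κ) (hκ' : κ < 1 + (2 / ((n + 1 : ℕ) : ℝ) - 1 / p0))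
    (hθ0 : ∀ j, 0 ≤ θ j) (hθ1 : ∀ j, θ j < 1)
    (hpe : ∀ j, 1 / p j = θ j * (2 / n - 1 / p0) + (1 - θ j) * (1 - 1 / κ))
    (hqe : ∀ j, 1 / q j = (1 - θ j) * (1 - 1 / κ)) (hpq : ∀ j, p j ≤ q j) (NΛ Ng : ℝ≥0) :
    ∃ (C : ι → ℝ≥0) (m δ : ι → ℝ), (∀ j, 0 ≤ m j) ∧ (∀ j, 0 < δ j) ∧ (∀ j, δ j ≤ 1) ∧
      ∀ (l : Space (n + 1) → ℝ≥0∞) (w : SpaceTime (n + 1) → ℝ) (g : ι → SpaceTime (n + 1) → ℝ≥0∞)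
        (c : SpaceTime (n + 1)) (ρ R : ℝ), 0 ≤ ρ → ρ < R → R ≤ 1 → Measurable l →
        (∀ x, l x ≠ ⊤) → LocLip w → (∀ j, Measurable (g j)) →
        ∫⁻ x in box c.2 R, (l x)⁻¹ ^ p0 ≤ NΛ →
        (∀ j, ∫⁻ x in box c.2 R, (∫⁻ t in Ioo (c.1 - R) (c.1 + R), g j (t, x) ^ q j) ^ (p j / q j)
          ≤ Ng) →
        ∃ (η : Space (n + 1) → ℝ) (S : Set (Space (n + 1))),
          LipschitzWith (Real.toNNReal (6 / (R - ρ))) η ∧ (∀ x, 0 ≤ η x) ∧ (∀ x, η x ≤ 1) ∧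
          (∀ x ∈ box c.2 ρ, η x = 1) ∧ (∀ x ∉ box c.2 ((2 * ρ + R) / 3), η x = 0) ∧
          MeasurableSet S ∧ (∀ x ∉ S, gradient η x = 0) ∧
          ∀ j, ∫⁻ x in S, ∫⁻ t in Ioo (c.1 - (ρ + 2 * R) / 3) (c.1 + (ρ + 2 * R) / 3),
            g j (t, x) * ‖w (t, x)‖ₑ ^ (2 : ℝ) ≤
            C j * ENNReal.ofReal (1 / (R - ρ)) ^ m j *
              ((energy l w c R + mass w c R) ^ (1 - δ j) * mass w c R ^ δ j) := by
  have hκ0 : 0 < κ := by linarith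
  have hκ1 : 1 / κ ≤ 1 := by rw [div_le_one hκ0]; exact hκ
  obtain ⟨D, hD⟩ : ∃ D : ℝ, D = 2 / ((n + 1 : ℕ) : ℝ) - 1 / p0 := ⟨_, rfl⟩
  obtain ⟨θ', hθ'⟩ : ∃ θ' : ℝ, θ' = (1 - 1 / κ) / D := ⟨_, rfl⟩
  rw [← hD] at hd0 hκ'
  have hθ'0 : 0 ≤ θ' := by rw [hθ']; exact div_nonneg (by linarith) hd0.le
  have hθ'1 : θ' < 1 / κ := by
    rw [hθ', div_lt_iff₀ hd0]; field_simp; linarith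
  have hδ1 : 1 / κ - θ' ≤ 1 := by linarith
  obtain ⟨C', hC'⟩ := parabolic_interpolation (d := n + 1) (by omega) (P := ENNReal.ofReal (2 * κ))
    (p' := κ) (q' := κ) (θ := θ') hp0 (by
      rw [recip, ENNReal.toReal_inv, ENNReal.toReal_ofReal (by positivity)]; field_simp) hκ hθ'0
    (by rw [← hD, hθ', div_mul_cancel₀ _ hd0.ne']) hθ'1.le NΛ
  have hslab := fun j => lintegral_slab_le hn hp0 (hp j) (hq j) hκ (hθ0 j) (hθ1 j).le (hpe j) (hqe j)
    (hpq j)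
  choose C1 hC1 using hslab
  obtain ⟨a0, ha0⟩ : ∃ a0 : ℝ≥0, a0 = 12 * (Fintype.card (Fin 5 ⊕ ι) + 1) * (n + 1) := ⟨_, rfl⟩
  have ha01 : 1 ≤ a0 := by
    rw [ha0]
    have h1 : (1 : ℝ≥0) ≤ Fintype.card (Fin 5 ⊕ ι) + 1 := le_add_self
    have h2 : (1 : ℝ≥0) ≤ n + 1 := le_add_self
    exact one_le_mul (one_le_mul (by norm_num) h1) h2
  have halg := fun j => ENNReal.slice_bound_le (C1 j) C' Ng NΛ ha01 (p := p j) (p0 := p0) (θ := θ j)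
    (κ := κ) (δ := 1 / κ - θ') (by linarith [hp j]) (by linarith) (hθ0 j) (hθ1 j).le hκ0
    hδ1
  choose K m hm hK using halg
  refine ⟨fun j => (2 * (n + 1) : ℕ) * K j, m, fun j => (1 - θ j) * (1 / κ - θ'), hm,
    fun j => mul_pos (by linarith [hθ1 j]) (by linarith), fun j => by nlinarith [hθ0 j, hθ1 j], ?_⟩
  intro l w g c ρ R hρ0 hρR hR hl hlt hw hg hΛ hG
  obtain ⟨r, hr⟩ : ∃ r : ℝ, r = (R - ρ) / 3 := ⟨_, rfl⟩
  have hr0 : 0 < r := by rw [hr]; linarith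
  obtain ⟨R1, hR1⟩ : ∃ R1 : ℝ, R1 = (2 * ρ + R) / 3 := ⟨_, rfl⟩
  obtain ⟨R2, hR2⟩ : ∃ R2 : ℝ, R2 = (ρ + 2 * R) / 3 := ⟨_, rfl⟩
  rw [← hR1, ← hR2]
  have e1 : R1 - ρ = r := by rw [hR1, hr]; ring
  have e2 : R2 - R1 = r := by rw [hR1, hR2, hr]; ring
  have e3 : R - R2 = r := by rw [hR2, hr]; ring
  have hR10 : 0 < R1 := by linarith
  have hR20 : 0 < R2 := by linarith
  obtain ⟨I, hI⟩ : ∃ I, I = Ioo (c.1 - R2) (c.1 + R2) := ⟨_, rfl⟩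
  rw [← hI]
  obtain ⟨τ, hτ⟩ : ∃ τ, τ = ENNReal.ofReal (1 / (R - ρ)) := ⟨_, rfl⟩
  rw [← hτ]
  have hτ1 : 1 ≤ τ := by
    rw [hτ, ← ENNReal.ofReal_one]
    exact ENNReal.ofReal_le_ofReal (by rw [le_div_iff₀ (by linarith)]; linarith)
  have hkτ : ENNReal.ofReal (1 / r) ^ (2 : ℝ) = 9 * τ ^ (2 : ℝ) := by
    rw [hτ, show 1 / r = 3 * (1 / (R - ρ)) by rw [hr]; field_simp, ENNReal.ofReal_mul (by norm_num),
      ENNReal.mul_rpow_of_nonneg _ _ (by norm_num)]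
    congr 1
    norm_num [ENNReal.rpow_two]
  have hgm := measurable_spaceGrad hw.continuous
  have hwm : Measurable fun z : SpaceTime (n + 1) => ‖w z‖ₑ := hw.continuous.measurable.enorm
  have mE : Measurable fun z : SpaceTime (n + 1) => l z.2 * ‖spaceGrad w z‖ₑ ^ (2 : ℝ) :=
    (hl.comp measurable_snd).mul (hgm.enorm.pow_const _)
  have mM : Measurable fun z : SpaceTime (n + 1) => ‖w z‖ₑ ^ (2 : ℝ) := hwm.pow_const _
  have mN : Measurable fun z : SpaceTime (n + 1) => ‖w z‖ₑ ^ (2 * κ) := hwm.pow_const _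
  have hDs : MeasurableSet {z : SpaceTime (n + 1) | DifferentiableAt ℝ (fun x => w (z.1, x)) z.2} :=
    hw.measurableSet_differentiableAt
  obtain ⟨χ, hχ⟩ : ∃ χ : SpaceTime (n + 1) → ℝ≥0∞, χ = indicator
    {z : SpaceTime (n + 1) | DifferentiableAt ℝ (fun x => w (z.1, x)) z.2}ᶜ (fun _ => 1) := ⟨_, rfl⟩
  have mχ : Measurable χ := by rw [hχ]; exact measurable_const.indicator hDs.compl
  have mG : ∀ j, Measurable fun x => (∫⁻ t in I, g j (t, x) ^ q j) ^ (p j / q j) := fun j =>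
    (measurable_lintegral_time I ((hg j).pow_const _)).pow_const _
  obtain ⟨F, hF⟩ : ∃ F : Fin 5 ⊕ ι → Space (n + 1) → ℝ≥0∞, F = Sum.elim
    ![fun x => (l x)⁻¹ ^ p0, fun x => ∫⁻ t in I, l x * ‖spaceGrad w (t, x)‖ₑ ^ (2 : ℝ),
      fun x => ∫⁻ t in I, ‖w (t, x)‖ₑ ^ (2 : ℝ), fun x => ∫⁻ t in I, ‖w (t, x)‖ₑ ^ (2 * κ),
      fun x => ∫⁻ t in I, χ (t, x)]
    (fun j x => (∫⁻ t in I, g j (t, x) ^ q j) ^ (p j / q j)) := ⟨_, rfl⟩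
  have hFm : ∀ k, Measurable (F k) := by
    rw [hF]
    rintro (k | j)
    · fin_cases k
      · exact hl.inv.pow_const _
      · exact measurable_lintegral_time I mE
      · exact measurable_lintegral_time I mM
      · exact measurable_lintegral_time I mN
      · exact measurable_lintegral_time I mχ
    · exact mG j
  obtain ⟨Kc, hKc, hKsub, hKvol, hKgood⟩ := exists_good_radii
    (fun k => measurable_sliceSum (hFm k) c.2 R2) (ρ := ρ) (R := R1)
    (M := fun k => (n + 1 : ℕ) * ∫⁻ x in box c.2 R2, F k x) (by linarith) (fun k =>
      (lintegral_mono_set (Ioo_subset_Ioo hρ0 (by linarith))).trans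
        (lintegral_sliceSum_le (hFm k) c.2 hR20))
  have hgood : ∀ σ ∈ Kc, ∀ k, sliceSum (F k) c.2 R2 σ ≤ a0 * τ * ∫⁻ x in box c.2 R2, F k x := by
    intro σ hσ k
    refine (hKgood σ hσ k).trans (le_of_eq ?_)
    rw [← mul_assoc]
    congr 1
    rw [hτ, ← ENNReal.ofReal_natCast, ← ENNReal.ofReal_coe_nnreal, e1,
      ← ENNReal.ofReal_mul (by positivity), ← ENNReal.ofReal_mul (by positivity), hr, ha0]
    congr 1
    push_cast
    field_simp
    ring
  obtain ⟨η, hη1, hη2, hη3, hη4, hη5, hη6⟩ := exists_cube_cutoff hKc (by linarith) hKsub hKvol c.2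
  have hSm : MeasurableSet {x : Space (n + 1) | dist (WithLp.ofLp x) (WithLp.ofLp c.2) ∈ Kc} :=
    ((PiLp.continuous_ofLp 2 _).dist continuous_const).measurable hKc.measurableSet
  refine ⟨η, {x | dist (WithLp.ofLp x) (WithLp.ofLp c.2) ∈ Kc}, ?_, hη2, hη3, hη4, hη5, hSm,
    fun x hx => hη6 x hx, fun j => ?_⟩
  · rwa [e1, show 2 / r = 6 / (R - ρ) by rw [hr]; field_simp; norm_num] at hη1
  have hKIoo : Kc ⊆ Ioo 0 R1 := fun x hx => ⟨lt_of_le_of_lt hρ0 (hKsub hx).1, (hKsub hx).2⟩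
  have hFj : Measurable fun z : SpaceTime (n + 1) => g j z * ‖w z‖ₑ ^ (2 : ℝ) := (hg j).mul mM
  -- the integrals over the cube
  have hIsub : I ⊆ Ioo (c.1 - R) (c.1 + R) := by
    rw [hI]; exact Ioo_subset_Ioo (by linarith) (by linarith)
  have bΛ : ∫⁻ x in box c.2 R2, F (Sum.inl 0) x ≤ NΛ := by
    rw [hF]; exact (lintegral_mono_set (box_mono (by linarith))).trans hΛ
  have bE : ∫⁻ x in box c.2 R2, F (Sum.inl 1) x ≤ energy l w c R := by
    rw [hF]
    refine le_trans (le_of_eq (lintegral_box_time I (box c.2 R2) mE)) ?_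
    rw [hI]
    exact (lintegral_mono_set (pcyl_mono (by linarith : R2 ≤ R))).trans le_add_self
  have bM : ∫⁻ x in box c.2 R2, F (Sum.inl 2) x ≤ mass w c R := by
    rw [hF]
    refine le_trans (le_of_eq (lintegral_box_time I (box c.2 R2) mM)) ?_
    rw [hI]
    exact lintegral_mono_set (pcyl_mono (by linarith : R2 ≤ R))
  have bN : ∫⁻ x in box c.2 R2, F (Sum.inl 3) x ≤
      (C' * ((energy l w c R + 9 * τ ^ (2 : ℝ) * mass w c R) ^ (1 - (1 / κ - θ')) *
        mass w c R ^ (1 / κ - θ'))) ^ κ := by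
    have h1 := hC' l w c R2 R (by linarith) hR hl hlt hw hΛ
    rw [e3, hkτ, ← hI] at h1
    refine le_trans (le_of_eq ?_) (ENNReal.rpow_le_rpow h1 hκ0.le)
    rw [hF]
    refine (lintegral_box_time I (box c.2 R2) mN).trans ?_
    rw [lintegral_prod_set mN, ← ENNReal.rpow_mul, one_div_mul_cancel hκ0.ne', ENNReal.rpow_one]
    refine lintegral_congr fun t => ?_
    rw [eLpNorm_eq_lintegral_rpow_enorm_toReal (by simp; positivity)
      ENNReal.ofReal_ne_top,
      ENNReal.toReal_ofReal (by positivity), ← ENNReal.rpow_mul, ← ENNReal.rpow_mul,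
      show 1 / (2 * κ) * (2 * κ) = 1 by field_simp, ENNReal.rpow_one]
  have bχ : ∫⁻ x in box c.2 R2, F (Sum.inl 4) x = 0 := by
    rw [hF]
    refine (lintegral_box_time I (box c.2 R2) mχ).trans ?_
    rw [lintegral_eq_zero_iff mχ]
    refine ae_restrict_of_ae ?_
    filter_upwards [hw.ae_differentiableAt] with z hz
    rw [hχ]; simp [hz]
  have bG : ∫⁻ x in box c.2 R2, F (Sum.inr j) x ≤ Ng := by
    rw [hF]
    refine le_trans ?_ (hG j)
    refine (lintegral_mono_set (box_mono (by linarith : R2 ≤ R))).trans (lintegral_mono fun x => ?_)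
    have := hp j
    exact ENNReal.rpow_le_rpow (lintegral_mono_set hIsub) (by have := hq j; positivity)
  have hslice : ∀ σ ∈ Kc, ∀ (i : Fin (n + 1)) (s : ℝ), s = c.2 i + σ ∨ s = c.2 i - σ →
      ∫⁻ y in Metric.ball (fun j => c.2 (i.succAbove j)) R1, (∫⁻ t in I, g j (t, slab i s y) *
        ‖w (t, slab i s y)‖ₑ ^ (2 : ℝ)) ≤
      K j * τ ^ m j * ((energy l w c R + mass w c R) ^ (1 - (1 - θ j) * (1 / κ - θ')) *
        mass w c R ^ ((1 - θ j) * (1 / κ - θ'))) := by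
    intro σ hσ i s hs
    set y0 : Fin n → ℝ := fun j => c.2 (i.succAbove j) with hy0
    have hsl : ∀ k, ∫⁻ y in Metric.ball y0 R2, F k (slab i s y) ≤
        a0 * τ * ∫⁻ x in box c.2 R2, F k x := by
      intro k
      refine le_trans ?_ (hgood σ hσ k)
      rcases hs with rfl | rfl
      · exact le_sliceSum_add (F k) c.2 R2 σ i
      · exact le_sliceSum_sub (F k) c.2 R2 σ i
    have sΛ := (hsl (Sum.inl 0)).trans (mul_le_mul' le_rfl bΛ)
    have sE := (hsl (Sum.inl 1)).trans (mul_le_mul' le_rfl bE)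
    have sM := (hsl (Sum.inl 2)).trans (mul_le_mul' le_rfl bM)
    have sN := (hsl (Sum.inl 3)).trans (mul_le_mul' le_rfl bN)
    have sχ := hsl (Sum.inl 4)
    rw [bχ, mul_zero, nonpos_iff_eq_zero] at sχ
    have sG := (lintegral_mono_set (Metric.ball_subset_ball (by linarith : R1 ≤ R2))).trans
      ((hsl (Sum.inr j)).trans (mul_le_mul' le_rfl bG))
    rw [hF] at sΛ sE sM sN sχ sG
    have sE' := (lintegral_slab_swap i s I (Metric.ball y0 R2) mE).trans_le sE
    have sM' := (lintegral_slab_swap i s I (Metric.ball y0 R2) mM).trans_le sM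
    have sN' := (lintegral_slab_swap i s I (Metric.ball y0 R2) mN).trans_le sN
    have sχ' := (lintegral_slab_swap i s I (Metric.ball y0 R2) mχ).trans sχ
    have hτt : τ ≠ ⊤ := by rw [hτ]; simp
    have hdiff : ∀ᵐ t ∂(volume.restrict I), ∀ᵐ y ∂(volume.restrict (Metric.ball y0 R2)),
        DifferentiableAt ℝ (fun x => w (t, x)) (slab i s y) := by
      have mts : Measurable fun ty : ℝ × (Fin n → ℝ) => χ (ty.1, slab i s ty.2) :=
        mχ.comp (measurable_fst.prodMk
          ((lipschitzWith_slab i s).continuous.measurable.comp measurable_snd))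
      rw [lintegral_eq_zero_iff (mts.lintegral_prod_right' (ν := volume.restrict _))] at sχ'
      filter_upwards [sχ'] with t ht
      have ht' : ∫⁻ y in Metric.ball y0 R2, χ (t, slab i s y) = 0 := ht
      have mt : Measurable fun y => χ (t, slab i s y) := mts.comp measurable_prodMk_left
      rw [lintegral_eq_zero_iff mt] at ht'
      filter_upwards [ht'] with y hy
      by_contra hc
      rw [hχ] at hy
      simp [hc] at hy
    have h := hC1 j l w (g j) I i s y0 R1 R2 (by linarith) (by linarith) hl hlt hw (hg j)
      (by rw [hI]; simp) (ne_top_of_le_ne_top (by finiteness) sΛ) hdiff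
    rw [e2, hkτ] at h
    rw [← lintegral_slab_swap i s I (Metric.ball y0 R1) hFj]
    refine h.trans (le_trans ?_ (hK j τ (energy l w c R) (mass w c R) hτ1))
    have hp0j : 0 ≤ 1 / p j := one_div_nonneg.2 (by linarith [hp j])
    have hp00 : 0 ≤ 1 / p0 := by positivity
    have hθk : 0 ≤ (1 - θ j) / κ := div_nonneg (by linarith [hθ1 j]) hκ0.le
    refine mul_le_mul' le_rfl (mul_le_mul' (ENNReal.rpow_le_rpow sG hp0j) (mul_le_mul'
      (ENNReal.rpow_le_rpow (mul_le_mul' (ENNReal.rpow_le_rpow (add_le_add le_rfl sΛ) hp00)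
        (add_le_add sE' (mul_le_mul' le_rfl sM'))) (hθ0 j)) (ENNReal.rpow_le_rpow sN' hθk)))
  refine (lintegral_le_sliceSum (measurable_lintegral_time I hFj) c.2 hR10 hKc.measurableSet
    hKIoo).trans ?_
  refine (setLIntegral_mono' hKc.measurableSet fun σ hσ => sliceSum_le (hslice σ hσ)).trans ?_
  rw [setLIntegral_const]
  have hv : volume Kc ≤ 1 := by
    refine (measure_mono hKIoo).trans ?_
    rw [Real.volume_Ioo, ← ENNReal.ofReal_one]
    exact ENNReal.ofReal_le_ofReal (by linarith)
  refine (mul_le_mul' le_rfl hv).trans (le_of_eq ?_)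
  push_cast
  ring

end Slices

end

section

theorem young_absorb (C : ℝ≥0) {m δ : ℝ} (hm : 0 ≤ m) (hδ0 : 0 < δ) (hδ1 : δ ≤ 1)
    {ε : ℝ≥0} (hε : 0 < ε) :
    ∃ (C' : ℝ≥0) (m' : ℝ), 0 ≤ m' ∧ ∀ T X M : ℝ≥0∞, 1 ≤ T →
      C * T ^ m * (X ^ (1 - δ) * M ^ δ) ≤ ε * X + C' * T ^ m' * M := by
  have hδ2 : 0 ≤ 1 - δ := by linarith
  refine ⟨ε * ((C + 1) / ε) ^ (1 / δ), m / δ, by positivity, fun T X M hT => ?_⟩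
  obtain ⟨B, hB⟩ : ∃ B : ℝ≥0∞, B = (((C + 1) / ε) ^ (1 / δ) : ℝ≥0) * T ^ (m / δ) := ⟨_, rfl⟩
  have hBδ : C * T ^ m ≤ ε * B ^ δ := by
    rw [hB, ENNReal.mul_rpow_of_nonneg _ _ hδ0.le, ENNReal.coe_rpow_of_nonneg _ (by positivity),
      ← ENNReal.rpow_mul, ← ENNReal.rpow_mul, one_div_mul_cancel hδ0.ne', div_mul_cancel₀ _ hδ0.ne',
      ENNReal.rpow_one, ← mul_assoc, ← ENNReal.coe_mul, mul_div_cancel₀ _ hε.ne']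
    gcongr
    exact le_self_add
  have hgoal : (ε * ((C + 1) / ε) ^ (1 / δ) : ℝ≥0) * T ^ (m / δ) * M = ε * (B * M) := by
    rw [hB]; push_cast; ring
  rw [hgoal]
  refine (mul_le_mul' hBδ le_rfl).trans ?_
  have e1 : ∀ Y : ℝ≥0∞, Y ^ (1 - δ) * Y ^ δ = Y := by
    intro Y
    rw [← ENNReal.rpow_add_of_nonneg _ _ hδ2 hδ0.le]; simp
  have e2 : ε * B ^ δ * (X ^ (1 - δ) * M ^ δ) = ε * (X ^ (1 - δ) * (B * M) ^ δ) := by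
    rw [ENNReal.mul_rpow_of_nonneg _ _ hδ0.le]; ring
  rw [e2]
  rcases le_total (B * M) X with h | h
  · refine le_trans (mul_le_mul' le_rfl ?_) le_self_add
    calc X ^ (1 - δ) * (B * M) ^ δ ≤ X ^ (1 - δ) * X ^ δ := by gcongr
      _ = X := e1 X
  · refine le_trans (mul_le_mul' le_rfl ?_) le_add_self
    calc X ^ (1 - δ) * (B * M) ^ δ ≤ (B * M) ^ (1 - δ) * (B * M) ^ δ := by gcongr
      _ = _ := e1 _

/-- The hole-filling iteration. -/
theorem hole_filling {m : ℝ} (hm : 0 ≤ m) : ∃ C : ℝ≥0, ∀ (f : ℝ → ℝ≥0∞) (A F : ℝ≥0∞)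
    (ρ0 R0 : ℝ), ρ0 < R0 → F ≠ ⊤ → (∀ ρ ∈ Ico ρ0 R0, f ρ ≤ F) →
    (∀ ρ r, ρ0 ≤ ρ → ρ < r → r < R0 →
      f ρ ≤ (1 / 2 : ℝ≥0) * f r + A * ENNReal.ofReal (1 / (r - ρ)) ^ m) →
    f ρ0 ≤ C * A * ENNReal.ofReal (1 / (R0 - ρ0)) ^ m := by
  obtain ⟨s, hs⟩ : ∃ s : ℝ, s = 1 - (2 / 3 : ℝ) ^ (1 / (m + 1)) := ⟨_, rfl⟩
  have hm1 : 0 < m + 1 := by linarith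
  have h1s : 0 < 1 - s := by rw [hs]; simp; positivity
  have hs0 : 0 < s := by
    rw [hs, sub_pos]; exact Real.rpow_lt_one (by norm_num) (by norm_num) (by positivity)
  have hsm : (2 / 3 : ℝ) ≤ (1 - s) ^ m := by
    rw [hs, sub_sub_cancel, ← Real.rpow_mul (by norm_num)]
    calc (2 / 3 : ℝ) = (2 / 3 : ℝ) ^ (1 : ℝ) := (Real.rpow_one _).symm
      _ ≤ _ := by
        refine Real.rpow_le_rpow_of_exponent_ge (by norm_num) (by norm_num) ?_
        rw [one_div_mul_eq_div, div_le_one hm1]; linarith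
  refine ⟨4 * Real.toNNReal (1 / s) ^ m, fun f A F ρ0 R0 hρR hF hfF hrec => ?_⟩
  set S := ⨆ ρ ∈ Ico ρ0 R0, ENNReal.ofReal (R0 - ρ) ^ m * f ρ with hS
  have hSfin : S ≠ ⊤ := by
    refine ne_top_of_le_ne_top (b := ENNReal.ofReal (R0 - ρ0) ^ m * F)
      (ENNReal.mul_ne_top (by finiteness) hF) (iSup₂_le fun ρ hρ => ?_)
    refine mul_le_mul' (ENNReal.rpow_le_rpow (ENNReal.ofReal_le_ofReal ?_) hm) (hfF ρ hρ)
    linarith [hρ.1]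
  set B := A * ENNReal.ofReal (1 / s) ^ m with hB
  have hSle : S ≤ (3 / 4 : ℝ≥0) * S + B := by
    refine iSup₂_le fun ρ hρ => ?_
    have hL : 0 < R0 - ρ := by linarith [hρ.2]
    set r := ρ + s * (R0 - ρ) with hr
    have hR0r : R0 - r = (1 - s) * (R0 - ρ) := by rw [hr]; ring
    have hrR : r < R0 := by have := mul_pos h1s hL; linarith
    have hρr : ρ < r := by have := mul_pos hs0 hL; linarith
    have h := hrec ρ r hρ.1 hρr hrR
    have hrS : ENNReal.ofReal (R0 - r) ^ m * f r ≤ S :=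
      le_iSup₂ (f := fun ρ (_ : ρ ∈ Ico ρ0 R0) => ENNReal.ofReal (R0 - ρ) ^ m * f ρ) r
        ⟨by linarith [hρ.1], hrR⟩
    calc ENNReal.ofReal (R0 - ρ) ^ m * f ρ
        ≤ ENNReal.ofReal (R0 - ρ) ^ m *
          ((1 / 2 : ℝ≥0) * f r + A * ENNReal.ofReal (1 / (r - ρ)) ^ m) := by gcongr
      _ = (1 / 2 : ℝ≥0) * (ENNReal.ofReal (R0 - ρ) ^ m * f r) +
          A * (ENNReal.ofReal (R0 - ρ) * ENNReal.ofReal (1 / (r - ρ))) ^ m := by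
          rw [ENNReal.mul_rpow_of_nonneg _ _ hm]; ring
      _ ≤ (3 / 4 : ℝ≥0) * S + B := by
          refine add_le_add ?_ (le_of_eq ?_)
          · have h3 : ENNReal.ofReal (R0 - ρ) ^ m ≤ (3 / 2 : ℝ≥0) * ENNReal.ofReal (R0 - r) ^ m := by
              rw [hR0r, ENNReal.ofReal_mul h1s.le, ENNReal.mul_rpow_of_nonneg _ _ hm, ← mul_assoc]
              refine le_mul_of_one_le_left' ?_
              rw [ENNReal.ofReal_rpow_of_nonneg h1s.le hm, ← ENNReal.ofReal_coe_nnreal,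
                ← ENNReal.ofReal_mul (by positivity), ← ENNReal.ofReal_one]
              refine ENNReal.ofReal_le_ofReal ?_
              push_cast
              linarith
            calc _ ≤ ((1 / 2 : ℝ≥0) : ℝ≥0∞) * ((3 / 2 : ℝ≥0) * ENNReal.ofReal (R0 - r) ^ m * f r) := by
                  gcongr
              _ = ((1 / 2 * (3 / 2) : ℝ≥0) : ℝ≥0∞) * (ENNReal.ofReal (R0 - r) ^ m * f r) := by
                  rw [ENNReal.coe_mul]; ring
              _ ≤ _ := by
                  rw [show (1 / 2 * (3 / 2) : ℝ≥0) = 3 / 4 by rw [div_mul_div_comm]; norm_num]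
                  gcongr
          · rw [hB, ← ENNReal.ofReal_mul hL.le]
            congr 3
            rw [hr, add_sub_cancel_left]; field_simp
  have hS4 : S ≤ 4 * B := by
    rcases eq_or_ne B ⊤ with hBt | hBt
    · rw [hBt]; simp
    clear_value S B
    lift S to ℝ≥0 using hSfin
    lift B to ℝ≥0 using hBt
    norm_cast at hSle ⊢
    rw [← NNReal.coe_le_coe] at hSle ⊢
    push_cast at hSle ⊢
    linarith
  have h0 : ENNReal.ofReal (R0 - ρ0) ^ m * f ρ0 ≤ 4 * B :=
    (le_iSup₂ (f := fun ρ (_ : ρ ∈ Ico ρ0 R0) => ENNReal.ofReal (R0 - ρ) ^ m * f ρ) ρ0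
        ⟨le_rfl, hρR⟩).trans hS4
  have hL : 0 < R0 - ρ0 := by linarith
  calc f ρ0 = ENNReal.ofReal (1 / (R0 - ρ0)) ^ m * (ENNReal.ofReal (R0 - ρ0) ^ m * f ρ0) := by
        rw [← mul_assoc, ← ENNReal.mul_rpow_of_nonneg _ _ hm, ← ENNReal.ofReal_mul (by positivity),
          one_div_mul_cancel hL.ne']
        simp
    _ ≤ ENNReal.ofReal (1 / (R0 - ρ0)) ^ m * (4 * B) := by gcongr
    _ = _ := by
        rw [hB]
        push_cast
        rw [ENNReal.coe_rpow_of_nonneg _ hm]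
        simp only [ENNReal.ofReal]
        ring

/-- Exponents for the coefficients. The weights `g 0`, `g 1` belong to `L^p_x L^q_t`, the potentials
`V 0`, `V 1` to `L^Q_t L^P_x`. -/
structure Exponents (n : ℕ) where
  p0 : ℝ
  κ : ℝ
  p : Fin 2 → ℝ
  q : Fin 2 → ℝ
  θ : Fin 2 → ℝ
  P : Fin 2 → ℝ
  Q : Fin 2 → ℝ
  hn : 1 ≤ n
  hp0 : 1 < p0
  hd0 : 0 < 2 / ((n + 1 : ℕ) : ℝ) - 1 / p0
  hp : ∀ j, 1 ≤ p j
  hq : ∀ j, 0 < q j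
  hκ : 1 < κ
  hκ' : κ < 1 + (2 / ((n + 1 : ℕ) : ℝ) - 1 / p0)
  hθ0 : ∀ j, 0 ≤ θ j
  hθ1 : ∀ j, θ j < 1
  hpe : ∀ j, 1 / p j = θ j * (2 / n - 1 / p0) + (1 - θ j) * (1 - 1 / κ)
  hqe : ∀ j, 1 / q j = (1 - θ j) * (1 - 1 / κ)
  hpq : ∀ j, p j ≤ q j
  hP : ∀ j, 1 ≤ P j
  hQ : ∀ j, 1 ≤ Q j
  hPQ : ∀ j, 1 / P j < (1 - 1 / Q j) * (2 / ((n + 1 : ℕ) : ℝ) - 1 / p0)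

/-- Bounds for the coefficients on `pcyl c r`. -/
structure CoeffBound {n : ℕ} (e : Exponents n) (N : ℝ≥0) (l : Space (n + 1) → ℝ≥0∞)
    (g V : Fin 2 → SpaceTime (n + 1) → ℝ≥0∞) (c : SpaceTime (n + 1)) (r : ℝ) : Prop where
  ml : Measurable l
  lt : ∀ x, l x ≠ ⊤
  mg : ∀ j, Measurable (g j)
  mV : ∀ j, Measurable (V j)
  bl : ∫⁻ x in box c.2 r, (l x)⁻¹ ^ e.p0 ≤ N
  bg : ∀ j, ∫⁻ x in box c.2 r,
    (∫⁻ t in Ioo (c.1 - r) (c.1 + r), g j (t, x) ^ e.q j) ^ (e.p j / e.q j) ≤ N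
  bV : ∀ j, (∫⁻ t in Ioo (c.1 - r) (c.1 + r),
    (∫⁻ x in box c.2 r, V j (t, x) ^ e.P j) ^ (e.Q j / e.P j)) ^ (1 / e.Q j) ≤ N

/-- The energy inequality for `w`. -/
def EnergyIneq {d : ℕ} (l : Space d → ℝ≥0∞) (g : Fin 2 → SpaceTime d → ℝ≥0∞)
    (V : SpaceTime d → ℝ≥0∞) (w : SpaceTime d → ℝ) : Prop :=
  ∀ η : Space d → ℝ, (∃ L : ℝ≥0, LipschitzWith L η) → HasCompactSupport η → (∀ x, 0 ≤ η x) →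
    (∀ x, η x ≤ 1) → ∀ T1 T2 : ℝ, T1 ≤ T2 →
      (∫⁻ x, ‖w (T2, x)‖ₑ ^ (2 : ℝ) * ‖η x‖ₑ ^ (2 : ℝ)) +
        (∫⁻ t in Ioo T1 T2, ∫⁻ x, l x * ‖spaceGrad w (t, x)‖ₑ ^ (2 : ℝ) * ‖η x‖ₑ ^ (2 : ℝ)) ≤
      (∫⁻ x, ‖w (T1, x)‖ₑ ^ (2 : ℝ) * ‖η x‖ₑ ^ (2 : ℝ)) +
        8 * ∫⁻ t in Ioo T1 T2, ∫⁻ x, ‖w (t, x)‖ₑ ^ (2 : ℝ) *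
          (g 0 (t, x) * ‖gradient η x‖ₑ ^ (2 : ℝ) + g 1 (t, x) * (‖η x‖ₑ * ‖gradient η x‖ₑ) +
            V (t, x) * ‖η x‖ₑ ^ (2 : ℝ))

theorem CoeffBound.mono {n : ℕ} {e : Exponents n} {N : ℝ≥0} {l : Space (n + 1) → ℝ≥0∞}
    {g V : Fin 2 → SpaceTime (n + 1) → ℝ≥0∞} {c : SpaceTime (n + 1)} {r s : ℝ}
    (h : CoeffBound e N l g V c s) (hrs : r ≤ s) : CoeffBound e N l g V c r where
  ml := h.ml
  lt := h.lt
  mg := h.mg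
  mV := h.mV
  bl := (lintegral_mono_set (box_mono hrs)).trans h.bl
  bg j := by
    refine (lintegral_mono_set (box_mono hrs)).trans ((lintegral_mono fun x => ?_).trans (h.bg j))
    have h1 := e.hp j
    have h2 := e.hq j
    exact ENNReal.rpow_le_rpow (lintegral_mono_set (Ioo_subset_Ioo (by linarith) (by linarith)))
      (by positivity)
  bV j := by
    have h1 := e.hP j
    have h2 := e.hQ j
    refine (ENNReal.rpow_le_rpow ?_ (by positivity)).trans (h.bV j)
    refine (lintegral_mono_set (Ioo_subset_Ioo (by linarith) (by linarith))).trans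
      (lintegral_mono fun t => ?_)
    exact ENNReal.rpow_le_rpow (lintegral_mono_set (box_mono hrs)) (by positivity)

theorem box_subset_closedBall {d : ℕ} (z : Space d) (r : ℝ) :
    box z r ⊆ Metric.closedBall z (d * r) := by
  intro x hx
  have h := lipschitzWith_toLp.dist_le_mul (WithLp.ofLp x) (WithLp.ofLp z)
  have hx' : dist (WithLp.ofLp x) (WithLp.ofLp z) ≤ r := (Metric.mem_ball.1 hx).le
  refine Metric.mem_closedBall.2 (le_trans h ?_)
  rw [NNReal.coe_natCast]
  gcongr

theorem hasCompactSupport_of_box {d : ℕ} {η : Space d → ℝ} {z : Space d} {r : ℝ}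
    (h : ∀ x ∉ box z r, η x = 0) : HasCompactSupport η :=
  HasCompactSupport.of_support_subset_isCompact (isCompact_closedBall z (d * r)) fun x hx =>
    box_subset_closedBall z r (by by_contra hc; exact hx (h x hc))

end

section

theorem setLIntegral_prod_indicator {d : ℕ} {I : Set ℝ} {S : Set (Space d)}
    (hS : MeasurableSet S) (F : SpaceTime d → ℝ≥0∞) :
    ∫⁻ z in I ×ˢ (univ : Set (Space d)), ((univ : Set ℝ) ×ˢ S).indicator F z =
      ∫⁻ z in I ×ˢ S, F z := by
  rw [setLIntegral_indicator (MeasurableSet.univ.prod hS), prod_inter_prod, univ_inter, inter_univ]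

theorem enorm_gradient_le {d : ℕ} {η : Space d → ℝ} {L : ℝ} (hL : 0 ≤ L)
    (hη : LipschitzWith (Real.toNNReal L) η) (x : Space d) :
    ‖gradient η x‖ₑ ≤ ENNReal.ofReal L := by
  have h := norm_fderiv_le_of_lipschitz ℝ hη (x₀ := x)
  rw [Real.coe_toNNReal _ hL] at h
  rw [← ofReal_norm, gradient, LinearIsometryEquiv.norm_map]
  exact ENNReal.ofReal_le_ofReal h

section Terms

variable {d : ℕ} {l : Space d → ℝ≥0∞} {w : SpaceTime d → ℝ} {g V : Fin 2 → SpaceTime d → ℝ≥0∞}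
  {η : Space d → ℝ} {S : Set (Space d)} {c : SpaceTime d} {R1 R2 : ℝ} {A τ : ℝ≥0∞}

/-- Splitting of the right-hand side of the energy inequality. -/
theorem energy_rhs_le (mg : ∀ j, Measurable (g j)) (mV : ∀ j, Measurable (V j)) (hw : LocLip w)
    (hR12 : R1 ≤ R2) (hη1 : ∀ x, 0 ≤ η x) (hη2 : ∀ x, η x ≤ 1) (hη3 : ∀ x ∉ box c.2 R1, η x = 0)
    (hS : MeasurableSet S) (hSη : ∀ x ∉ S, gradient η x = 0) (hητ : ∀ x, ‖gradient η x‖ₑ ≤ 6 * τ)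
    {T1 T2 : ℝ} (hT : Ioo T1 T2 ⊆ Ioo (c.1 - R2) (c.1 + R2)) :
    ∫⁻ t in Ioo T1 T2, ∫⁻ x, ‖w (t, x)‖ₑ ^ (2 : ℝ) *
          (g 0 (t, x) * ‖gradient η x‖ₑ ^ (2 : ℝ) + g 1 (t, x) * (‖η x‖ₑ * ‖gradient η x‖ₑ) +
            (V 0 (t, x) + A * V 1 (t, x)) * ‖η x‖ₑ ^ (2 : ℝ)) ≤
      36 * τ ^ (2 : ℝ) * (∫⁻ x in S, ∫⁻ t in Ioo (c.1 - R2) (c.1 + R2),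
          g 0 (t, x) * ‖w (t, x)‖ₑ ^ (2 : ℝ)) +
        6 * τ * (∫⁻ x in S, ∫⁻ t in Ioo (c.1 - R2) (c.1 + R2),
          g 1 (t, x) * ‖w (t, x)‖ₑ ^ (2 : ℝ)) +
        ((∫⁻ z in pcyl c R2, V 0 z * ‖w z‖ₑ ^ (2 : ℝ)) +
          A * ∫⁻ z in pcyl c R2, V 1 z * ‖w z‖ₑ ^ (2 : ℝ)) := by
  have mw : Measurable fun z : SpaceTime d => ‖w z‖ₑ ^ (2 : ℝ) :=
    hw.continuous.measurable.enorm.pow_const _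
  have mgw : ∀ j, Measurable fun z : SpaceTime d => g j z * ‖w z‖ₑ ^ (2 : ℝ) := fun j =>
    (mg j).mul mw
  have mVw : ∀ j, Measurable fun z : SpaceTime d => V j z * ‖w z‖ₑ ^ (2 : ℝ) := fun j =>
    (mV j).mul mw
  have hUS : MeasurableSet ((univ : Set ℝ) ×ˢ S) := MeasurableSet.univ.prod hS
  have hUB : MeasurableSet ((univ : Set ℝ) ×ˢ box c.2 R2) :=
    MeasurableSet.univ.prod (measurableSet_box _ _)
  set I := Ioo (c.1 - R2) (c.1 + R2) with hI
  obtain ⟨G, hG⟩ : ∃ G : Fin 2 → SpaceTime d → ℝ≥0∞, G = fun j =>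
    ((univ : Set ℝ) ×ˢ S).indicator fun z => g j z * ‖w z‖ₑ ^ (2 : ℝ) := ⟨_, rfl⟩
  obtain ⟨W, hW⟩ : ∃ W : Fin 2 → SpaceTime d → ℝ≥0∞, W = fun j =>
    ((univ : Set ℝ) ×ˢ box c.2 R2).indicator fun z => V j z * ‖w z‖ₑ ^ (2 : ℝ) := ⟨_, rfl⟩
  have mG : ∀ j, Measurable (G j) := fun j => by rw [hG]; exact (mgw j).indicator hUS
  have mW : ∀ j, Measurable (W j) := fun j => by rw [hW]; exact (mVw j).indicator hUB
  have hpt : ∀ t x, ‖w (t, x)‖ₑ ^ (2 : ℝ) *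
          (g 0 (t, x) * ‖gradient η x‖ₑ ^ (2 : ℝ) + g 1 (t, x) * (‖η x‖ₑ * ‖gradient η x‖ₑ) +
            (V 0 (t, x) + A * V 1 (t, x)) * ‖η x‖ₑ ^ (2 : ℝ)) ≤
      36 * τ ^ (2 : ℝ) * G 0 (t, x) + 6 * τ * G 1 (t, x) + (W 0 (t, x) + A * W 1 (t, x)) := by
    intro t x
    have he1 : ‖η x‖ₑ ≤ 1 := by
      rw [← ofReal_norm, ← ENNReal.ofReal_one, Real.norm_of_nonneg (hη1 x)]
      exact ENNReal.ofReal_le_ofReal (hη2 x)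
    rw [mul_add, mul_add]
    refine add_le_add (add_le_add ?_ ?_) ?_
    · by_cases hx : x ∈ S
      · rw [hG]
        simp only [indicator_of_mem (show (t, x) ∈ (univ : Set ℝ) ×ˢ S from ⟨mem_univ _, hx⟩)]
        have : ‖gradient η x‖ₑ ^ (2 : ℝ) ≤ 36 * τ ^ (2 : ℝ) := by
          refine (ENNReal.rpow_le_rpow (hητ x) (by norm_num)).trans (le_of_eq ?_)
          rw [ENNReal.mul_rpow_of_nonneg _ _ (by norm_num)]
          congr 1; norm_num [ENNReal.rpow_two]
        calc _ ≤ ‖w (t, x)‖ₑ ^ (2 : ℝ) * (g 0 (t, x) * (36 * τ ^ (2 : ℝ))) := by gcongr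
          _ = _ := by ring
      · rw [hSη x hx]; simp
    · by_cases hx : x ∈ S
      · rw [hG]
        simp only [indicator_of_mem (show (t, x) ∈ (univ : Set ℝ) ×ˢ S from ⟨mem_univ _, hx⟩)]
        calc _ ≤ ‖w (t, x)‖ₑ ^ (2 : ℝ) * (g 1 (t, x) * (1 * (6 * τ))) := by
              gcongr
              exact hητ x
          _ = _ := by ring
      · rw [hSη x hx]; simp
    · by_cases hx : x ∈ box c.2 R2
      · rw [hW]
        simp only [indicator_of_mem
          (show (t, x) ∈ (univ : Set ℝ) ×ˢ box c.2 R2 from ⟨mem_univ _, hx⟩)]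
        have : ‖η x‖ₑ ^ (2 : ℝ) ≤ 1 := ENNReal.rpow_le_one he1 (by norm_num)
        calc _ ≤ ‖w (t, x)‖ₑ ^ (2 : ℝ) * ((V 0 (t, x) + A * V 1 (t, x)) * 1) := by gcongr
          _ = _ := by ring
      · rw [hη3 x (fun hc => hx (box_mono hR12 hc))]; simp
  have m1 : Measurable fun z => 36 * τ ^ (2 : ℝ) * G 0 z := (mG 0).const_mul _
  have m2 : Measurable fun z => 6 * τ * G 1 z := (mG 1).const_mul _
  have m3 : Measurable fun z => A * W 1 z := (mW 1).const_mul _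
  have m4 : Measurable fun z => 36 * τ ^ (2 : ℝ) * G 0 z + 6 * τ * G 1 z := m1.add m2
  have m5 : Measurable fun z => 36 * τ ^ (2 : ℝ) * G 0 z + 6 * τ * G 1 z + (W 0 z + A * W 1 z) :=
    m4.add ((mW 0).add m3)
  calc _ ≤ ∫⁻ t in I, ∫⁻ x, (36 * τ ^ (2 : ℝ) * G 0 (t, x) + 6 * τ * G 1 (t, x) +
        (W 0 (t, x) + A * W 1 (t, x))) :=
        (lintegral_mono_set hT).trans (lintegral_mono fun t => lintegral_mono fun x => hpt t x)
    _ = ∫⁻ z in I ×ˢ (univ : Set (Space d)), (36 * τ ^ (2 : ℝ) * G 0 z + 6 * τ * G 1 z +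
        (W 0 z + A * W 1 z)) := by
        rw [lintegral_prod_set m5, Measure.restrict_univ]
    _ = _ := by
        rw [lintegral_add_left m4, lintegral_add_left m1, lintegral_add_left (mW 0),
          lintegral_const_mul _ (mG 0), lintegral_const_mul _ (mG 1), lintegral_const_mul _ (mW 1),
          hG, hW]
        simp only [setLIntegral_prod_indicator hS, setLIntegral_prod_indicator (measurableSet_box _ _),
          lintegral_box_time I S (mgw _)]
        rfl

/-- The energy on the inner cylinder is controlled by the right-hand side of the energy
inequality. -/
theorem energy_le_of_energyIneq (ml : Measurable l) (hw : LocLip w) {U : SpaceTime d → ℝ≥0∞}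
    (hE : EnergyIneq l g U w) {ρ R : ℝ} (hρ : 0 ≤ ρ) (hρR1 : ρ < R1) (hR1R : R1 ≤ R)
    (hL : ∃ L : ℝ≥0, LipschitzWith L η) (hη1 : ∀ x, 0 ≤ η x) (hη2 : ∀ x, η x ≤ 1)
    (hη4 : ∀ x ∈ box c.2 ρ, η x = 1) (hη3 : ∀ x ∉ box c.2 R1, η x = 0) {B : ℝ≥0∞}
    (hB : ∀ T1 T2, Ioo T1 T2 ⊆ Ioo (c.1 - R1) (c.1 + R1) →
      ∫⁻ t in Ioo T1 T2, ∫⁻ x, ‖w (t, x)‖ₑ ^ (2 : ℝ) *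
          (g 0 (t, x) * ‖gradient η x‖ₑ ^ (2 : ℝ) + g 1 (t, x) * (‖η x‖ₑ * ‖gradient η x‖ₑ) +
            U (t, x) * ‖η x‖ₑ ^ (2 : ℝ)) ≤ B) :
    energy l w c ρ ≤ 2 * (ENNReal.ofReal (1 / (R1 - ρ)) * mass w c R + 8 * B) := by
  have mw : Measurable fun z : SpaceTime d => ‖w z‖ₑ ^ (2 : ℝ) :=
    hw.continuous.measurable.enorm.pow_const _
  have hr : 0 < R1 - ρ := by linarith
  have me : Measurable fun t => ∫⁻ x in box c.2 R1, ‖w (t, x)‖ₑ ^ (2 : ℝ) :=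
    mw.lintegral_prod_right' (ν := volume.restrict (box c.2 R1))
  have hvol : volume (Ioo (c.1 - R1) (c.1 - ρ)) = ENNReal.ofReal (R1 - ρ) := by
    rw [Real.volume_Ioo]; congr 1; ring
  obtain ⟨T1, hT1, hT1e⟩ := exists_le_setLAverage (μ := volume) (s := Ioo (c.1 - R1) (c.1 - ρ))
    (by rw [hvol]; simp; linarith) (by rw [hvol]; simp) me.aemeasurable
  have hT1m : ∫⁻ x in box c.2 R1, ‖w (T1, x)‖ₑ ^ (2 : ℝ) ≤
      ENNReal.ofReal (1 / (R1 - ρ)) * mass w c R := by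
    refine hT1e.trans ?_
    rw [setLAverage_eq, hvol, ENNReal.div_eq_inv_mul, ← ENNReal.ofReal_inv_of_pos hr, one_div]
    gcongr
    rw [← lintegral_prod_set mw]
    exact lintegral_mono_set (prod_mono (Ioo_subset_Ioo (by linarith) (by linarith)) (box_mono hR1R))
  have hηe : ∀ x, ‖η x‖ₑ ^ (2 : ℝ) ≤ (box c.2 R1).indicator (fun _ => 1) x := by
    intro x
    by_cases hx : x ∈ box c.2 R1
    · rw [indicator_of_mem hx]
      refine ENNReal.rpow_le_one ?_ (by norm_num)
      rw [← ofReal_norm, ← ENNReal.ofReal_one, Real.norm_of_nonneg (hη1 x)]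
      exact ENNReal.ofReal_le_ofReal (hη2 x)
    · rw [hη3 x hx]; simp
  have hηl : ∀ x, (box c.2 ρ).indicator (fun _ => (1 : ℝ≥0∞)) x ≤ ‖η x‖ₑ ^ (2 : ℝ) := by
    intro x
    by_cases hx : x ∈ box c.2 ρ
    · rw [indicator_of_mem hx, hη4 x hx]; simp
    · rw [indicator_of_notMem hx]; exact zero_le
  have hinit : ∫⁻ x, ‖w (T1, x)‖ₑ ^ (2 : ℝ) * ‖η x‖ₑ ^ (2 : ℝ) ≤
      ENNReal.ofReal (1 / (R1 - ρ)) * mass w c R := by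
    refine le_trans ?_ hT1m
    rw [← lintegral_indicator (measurableSet_box _ _)]
    refine lintegral_mono fun x => (mul_le_mul' le_rfl (hηe x)).trans (le_of_eq ?_)
    by_cases hx : x ∈ box c.2 R1 <;> simp [hx]
  have hmain : ∀ T2 ∈ Ioc (c.1 - ρ) (c.1 + ρ),
      (∫⁻ x, ‖w (T2, x)‖ₑ ^ (2 : ℝ) * ‖η x‖ₑ ^ (2 : ℝ)) +
        (∫⁻ t in Ioo T1 T2, ∫⁻ x, l x * ‖spaceGrad w (t, x)‖ₑ ^ (2 : ℝ) * ‖η x‖ₑ ^ (2 : ℝ)) ≤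
      ENNReal.ofReal (1 / (R1 - ρ)) * mass w c R + 8 * B := by
    intro T2 hT2
    refine (hE η hL (hasCompactSupport_of_box hη3) hη1 hη2 T1 T2
      (by linarith [hT1.2, hT2.1])).trans ?_
    refine add_le_add hinit (mul_le_mul' le_rfl (hB T1 T2 ?_))
    exact Ioo_subset_Ioo hT1.1.le (by linarith [hT2.2])
  rw [two_mul]
  refine add_le_add (iSup₂_le fun t ht => ?_) ?_
  · refine le_trans ?_ (hmain t ⟨ht.1, ht.2.le⟩)
    refine le_trans ?_ le_self_add
    rw [← lintegral_indicator (measurableSet_box _ _)]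
    refine lintegral_mono fun x => le_trans (le_of_eq ?_) (mul_le_mul' le_rfl (hηl x))
    by_cases hx : x ∈ box c.2 ρ <;> simp [hx]
  · rcases hρ.eq_or_lt with h0 | h0
    · rw [← h0, pcyl]; simp
    refine le_trans ?_ (hmain (c.1 + ρ) ⟨by linarith, le_rfl⟩)
    refine le_trans ?_ le_add_self
    have mE : Measurable fun z : SpaceTime d => l z.2 * ‖spaceGrad w z‖ₑ ^ (2 : ℝ) :=
      (ml.comp measurable_snd).mul ((measurable_spaceGrad hw.continuous).enorm.pow_const _)
    rw [pcyl, lintegral_prod_set mE]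
    refine (lintegral_mono_set (Ioo_subset_Ioo hT1.2.le le_rfl)).trans
      (lintegral_mono fun t => ?_)
    rw [← lintegral_indicator (measurableSet_box _ _)]
    refine lintegral_mono fun x => le_trans (le_of_eq ?_) (mul_le_mul' le_rfl (hηl x))
    by_cases hx : x ∈ box c.2 ρ <;> simp [hx]

end Terms

variable {n : ℕ}

/-- The Caccioppoli inequality, with a small multiple of the energy on the right. -/
theorem energy_le_half (e : Exponents n) (N : ℝ≥0) :
    ∃ (C : ℝ≥0) (m : ℝ), 0 ≤ m ∧ ∀ (l : Space (n + 1) → ℝ≥0∞)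
      (g V : Fin 2 → SpaceTime (n + 1) → ℝ≥0∞) (A : ℝ≥0∞) (w : SpaceTime (n + 1) → ℝ)
      (c : SpaceTime (n + 1)) (ρ R : ℝ), 0 ≤ ρ → ρ < R → R ≤ 1 → CoeffBound e N l g V c R →
      LocLip w → 1 ≤ A → EnergyIneq l g (fun z => V 0 z + A * V 1 z) w →
      energy l w c ρ ≤ (1 / 2 : ℝ≥0) * energy l w c R +
        C * (A * ENNReal.ofReal (1 / (R - ρ))) ^ m * mass w c R := by
  have hd0 := e.hd0
  obtain ⟨Cg, mg, δg, hmg, hδg0, hδg1, hg⟩ := exists_good_cutoff e.hn e.hp0 e.hd0 e.hp e.hq e.hκ.le e.hκ'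
    e.hθ0 e.hθ1 e.hpe e.hqe e.hpq N N
  have hpot := fun j => lintegral_potential_le (d := n + 1) (by have := e.hn; omega) e.hp0 e.hd0
    (e.hP j) (e.hQ j) (e.hPQ j) N
  choose CV δV hδV0 hδV1 hV using hpot
  obtain ⟨D0, k0, hk0, hy0⟩ := young_absorb (2 * 8 * 36 * Cg 0) (m := 2 + mg 0) (δ := δg 0)
    (by linarith [hmg 0]) (hδg0 0) (hδg1 0) (ε := 1 / 8) (by positivity)
  obtain ⟨D1, k1, hk1, hy1⟩ := young_absorb (2 * 8 * 6 * Cg 1) (m := 1 + mg 1) (δ := δg 1)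
    (by linarith [hmg 1]) (hδg0 1) (hδg1 1) (ε := 1 / 8) (by positivity)
  have hyV := fun j => young_absorb (2 * 8 * 9 * N * CV j) (m := 3) (δ := δV j)
    (by norm_num) (hδV0 j) (hδV1 j) (ε := 1 / 8) (by positivity)
  choose DV kV hkV hyV using hyV
  refine ⟨6 + D0 + D1 + DV 0 + DV 1 + 1 / 2, 1 + k0 + k1 + kV 0 + kV 1,
    by have := hkV 0; have := hkV 1; positivity, ?_⟩
  intro l g V A w c ρ R hρ hρR hR hc hw hA hE
  obtain ⟨η, S, hη1, hη2, hη3, hη4, hη5, hS, hSη, hgS⟩ :=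
    hg l w g c ρ R hρ hρR hR hc.ml hc.lt hw hc.mg hc.bl hc.bg
  obtain ⟨R1, hR1⟩ : ∃ R1 : ℝ, R1 = (2 * ρ + R) / 3 := ⟨_, rfl⟩
  obtain ⟨R2, hR2⟩ : ∃ R2 : ℝ, R2 = (ρ + 2 * R) / 3 := ⟨_, rfl⟩
  rw [← hR1] at hη5
  rw [← hR2] at hgS
  obtain ⟨τ, hτ⟩ : ∃ τ, τ = ENNReal.ofReal (1 / (R - ρ)) := ⟨_, rfl⟩
  rw [← hτ] at hgS ⊢
  have hτ1 : 1 ≤ τ := by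
    rw [hτ, ← ENNReal.ofReal_one]
    exact ENNReal.ofReal_le_ofReal (by rw [le_div_iff₀ (by linarith)]; linarith)
  have hητ : ∀ x, ‖gradient η x‖ₑ ≤ 6 * τ := by
    intro x
    refine (enorm_gradient_le (by have : 0 < R - ρ := by linarith
                                  positivity) hη1 x).trans (le_of_eq ?_)
    rw [hτ, show 6 / (R - ρ) = 6 * (1 / (R - ρ)) by ring, ENNReal.ofReal_mul (by norm_num)]
    simp
  have hR2R : 1 / (R - R2) = 3 * (1 / (R - ρ)) := by
    rw [hR2]; have : R - ρ ≠ 0 := by linarith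
    have : R - (ρ + 2 * R) / 3 = (R - ρ) / 3 := by ring
    rw [this]; field_simp
  have hR1ρ : ENNReal.ofReal (1 / (R1 - ρ)) = 3 * τ := by
    rw [hτ, show R1 - ρ = (R - ρ) / 3 by rw [hR1]; ring, one_div_div, div_eq_mul_one_div,
      ENNReal.ofReal_mul (by norm_num)]
    simp
  obtain ⟨En, hEn⟩ : ∃ En, En = energy l w c R := ⟨_, rfl⟩
  obtain ⟨Ms, hMs⟩ : ∃ Ms, Ms = mass w c R := ⟨_, rfl⟩
  obtain ⟨T, hT⟩ : ∃ T, T = A * τ := ⟨_, rfl⟩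
  have hT1 : 1 ≤ T := by rw [hT]; exact one_le_mul hA hτ1
  have hτT : τ ≤ T := by rw [hT]; exact le_mul_of_one_le_left' hA
  have hτ2 : 1 ≤ 9 * τ ^ (2 : ℝ) :=
    le_mul_of_one_le_of_le (by norm_num) (ENNReal.one_le_rpow hτ1 (by norm_num))
  have hVj : ∀ j, A * ∫⁻ z in pcyl c R2, V j z * ‖w z‖ₑ ^ (2 : ℝ) ≤
      9 * N * CV j * T ^ (3 : ℝ) * ((En + Ms) ^ (1 - δV j) * Ms ^ δV j) := by
    intro j
    have h := hV j l w (V j) c R2 R (by linarith) hR hc.ml hc.lt hw (hc.mV j) hc.bl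
    rw [hR2R, ENNReal.ofReal_mul (by norm_num), ← hτ, ENNReal.mul_rpow_of_nonneg _ _ (by norm_num),
      ← hEn, ← hMs] at h
    have h9 : ENNReal.ofReal 3 ^ (2 : ℝ) = 9 := by norm_num [ENNReal.rpow_two]
    rw [h9] at h
    have hb := (hc.mono (by linarith : R2 ≤ R)).bV j
    have hδ2 : 0 ≤ 1 - δV j := by linarith [hδV1 j]
    have hX : (En + 9 * τ ^ (2 : ℝ) * Ms) ^ (1 - δV j) ≤ 9 * τ ^ (2 : ℝ) * (En + Ms) ^ (1 - δV j) := by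
      calc _ ≤ (9 * τ ^ (2 : ℝ) * (En + Ms)) ^ (1 - δV j) := by
            refine ENNReal.rpow_le_rpow ?_ hδ2
            rw [mul_add]; gcongr; exact le_mul_of_one_le_left' hτ2
        _ = (9 * τ ^ (2 : ℝ)) ^ (1 - δV j) * (En + Ms) ^ (1 - δV j) := by
            rw [ENNReal.mul_rpow_of_nonneg _ _ hδ2]
        _ ≤ (9 * τ ^ (2 : ℝ)) ^ (1 : ℝ) * (En + Ms) ^ (1 - δV j) := by
            gcongr
            linarith [hδV0 j]
        _ = _ := by rw [ENNReal.rpow_one]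
    calc _ ≤ A * (N * (CV j * (9 * τ ^ (2 : ℝ) * (En + Ms) ^ (1 - δV j) * Ms ^ δV j))) := by
          refine mul_le_mul' le_rfl (h.trans (mul_le_mul' hb (mul_le_mul' le_rfl ?_)))
          exact mul_le_mul' hX le_rfl
      _ = 9 * N * CV j * (A * τ ^ (2 : ℝ)) * ((En + Ms) ^ (1 - δV j) * Ms ^ δV j) := by ring
      _ ≤ _ := by
          refine mul_le_mul' (mul_le_mul' le_rfl ?_) le_rfl
          rw [show (3 : ℝ) = 1 + 2 by norm_num, ENNReal.rpow_add_of_nonneg _ _ (by norm_num) (by norm_num),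
            ENNReal.rpow_one]
          refine mul_le_mul' ?_ (ENNReal.rpow_le_rpow hτT (by norm_num))
          rw [hT]; exact le_mul_of_one_le_right' hτ1
  obtain ⟨X, hX⟩ : ∃ X : ℝ → ℝ≥0∞, X = fun δ => (En + Ms) ^ (1 - δ) * Ms ^ δ := ⟨_, rfl⟩
  obtain ⟨B, hBdef⟩ : ∃ B : ℝ≥0∞, B = 36 * Cg 0 * T ^ (2 + mg 0) * X (δg 0) +
    6 * Cg 1 * T ^ (1 + mg 1) * X (δg 1) + (9 * N * CV 0 * T ^ (3 : ℝ) * X (δV 0) +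
      9 * N * CV 1 * T ^ (3 : ℝ) * X (δV 1)) := ⟨_, rfl⟩
  have hB : ∀ T1 T2, Ioo T1 T2 ⊆ Ioo (c.1 - R1) (c.1 + R1) →
      ∫⁻ t in Ioo T1 T2, ∫⁻ x, ‖w (t, x)‖ₑ ^ (2 : ℝ) *
          (g 0 (t, x) * ‖gradient η x‖ₑ ^ (2 : ℝ) + g 1 (t, x) * (‖η x‖ₑ * ‖gradient η x‖ₑ) +
            (V 0 (t, x) + A * V 1 (t, x)) * ‖η x‖ₑ ^ (2 : ℝ)) ≤ B := by
    intro T1 T2 hT12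
    refine (energy_rhs_le hc.mg hc.mV hw (by linarith : R1 ≤ R2) hη2 hη3 hη5 hS hSη hητ
      (hT12.trans (Ioo_subset_Ioo (by linarith) (by linarith)))).trans ?_
    rw [hBdef, hX]
    refine add_le_add (add_le_add ?_ ?_) (add_le_add ?_ (hVj 1))
    · refine (mul_le_mul' le_rfl (hgS 0)).trans ?_
      rw [← hEn, ← hMs, ENNReal.rpow_add_of_nonneg _ _ (by norm_num) (hmg 0)]
      calc _ = 36 * Cg 0 * (τ ^ (2 : ℝ) * τ ^ mg 0) *
            ((En + Ms) ^ (1 - δg 0) * Ms ^ δg 0) := by ring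
        _ ≤ _ := by
          refine mul_le_mul' (mul_le_mul' le_rfl (mul_le_mul' ?_ ?_)) le_rfl
          · exact ENNReal.rpow_le_rpow hτT (by norm_num)
          · exact ENNReal.rpow_le_rpow hτT (hmg 0)
    · refine (mul_le_mul' le_rfl (hgS 1)).trans ?_
      rw [← hEn, ← hMs, ENNReal.rpow_add_of_nonneg _ _ (by norm_num) (hmg 1), ENNReal.rpow_one]
      calc _ = 6 * Cg 1 * (τ * τ ^ mg 1) *
            ((En + Ms) ^ (1 - δg 1) * Ms ^ δg 1) := by ring
        _ ≤ _ := by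
          refine mul_le_mul' (mul_le_mul' le_rfl (mul_le_mul' hτT ?_)) le_rfl
          exact ENNReal.rpow_le_rpow hτT (hmg 1)
    · exact (le_mul_of_one_le_left' hA).trans (hVj 0)
  have hmain := energy_le_of_energyIneq hc.ml hw hE hρ (by linarith : ρ < R1) (by linarith : R1 ≤ R)
    ⟨_, hη1⟩ hη2 hη3 hη4 hη5 hB
  rw [hR1ρ, ← hMs] at hmain
  rw [← hT, ← hEn, ← hMs]
  refine hmain.trans ?_
  have y0 := hy0 T (En + Ms) Ms hT1
  have y1 := hy1 T (En + Ms) Ms hT1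
  have y2 := hyV 0 T (En + Ms) Ms hT1
  have y3 := hyV 1 T (En + Ms) Ms hT1
  have hle : ∀ a : ℝ, a ≤ 1 + k0 + k1 + kV 0 + kV 1 → T ^ a ≤ T ^ (1 + k0 + k1 + kV 0 + kV 1) :=
    fun a ha => ENNReal.rpow_le_rpow_of_exponent_le hT1 ha
  have hv0 := hkV 0
  have hv1 := hkV 1
  calc 2 * (3 * τ * Ms + 8 * B)
      = 6 * τ * Ms + ((((2 * 8 * 36 * Cg 0 : ℝ≥0) : ℝ≥0∞) * T ^ (2 + mg 0) *
          ((En + Ms) ^ (1 - δg 0) * Ms ^ δg 0)) +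
          (((2 * 8 * 6 * Cg 1 : ℝ≥0) : ℝ≥0∞) * T ^ (1 + mg 1) *
          ((En + Ms) ^ (1 - δg 1) * Ms ^ δg 1)) +
          (((2 * 8 * 9 * N * CV 0 : ℝ≥0) : ℝ≥0∞) * T ^ (3 : ℝ) *
          ((En + Ms) ^ (1 - δV 0) * Ms ^ δV 0)) +
          (((2 * 8 * 9 * N * CV 1 : ℝ≥0) : ℝ≥0∞) * T ^ (3 : ℝ) *
          ((En + Ms) ^ (1 - δV 1) * Ms ^ δV 1))) := by
        rw [hBdef, hX]; push_cast; ring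
    _ ≤ 6 * T ^ (1 : ℝ) * Ms + ((((1 / 8 : ℝ≥0) : ℝ≥0∞) * (En + Ms) + D0 * T ^ k0 * Ms) +
          (((1 / 8 : ℝ≥0) : ℝ≥0∞) * (En + Ms) + D1 * T ^ k1 * Ms) +
          (((1 / 8 : ℝ≥0) : ℝ≥0∞) * (En + Ms) + DV 0 * T ^ kV 0 * Ms) +
          (((1 / 8 : ℝ≥0) : ℝ≥0∞) * (En + Ms) + DV 1 * T ^ kV 1 * Ms)) := by
        rw [ENNReal.rpow_one]
        gcongr
    _ = ((1 / 8 * 4 : ℝ≥0) : ℝ≥0∞) * En + (6 * T ^ (1 : ℝ) + D0 * T ^ k0 + D1 * T ^ k1 +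
          DV 0 * T ^ kV 0 + DV 1 * T ^ kV 1 + ((1 / 8 * 4 : ℝ≥0) : ℝ≥0∞) * T ^ (0 : ℝ)) * Ms := by
        rw [ENNReal.rpow_zero]; push_cast; ring
    _ ≤ ((1 / 8 * 4 : ℝ≥0) : ℝ≥0∞) * En + (6 * T ^ (1 + k0 + k1 + kV 0 + kV 1) +
          D0 * T ^ (1 + k0 + k1 + kV 0 + kV 1) + D1 * T ^ (1 + k0 + k1 + kV 0 + kV 1) +
          DV 0 * T ^ (1 + k0 + k1 + kV 0 + kV 1) + DV 1 * T ^ (1 + k0 + k1 + kV 0 + kV 1) +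
          ((1 / 8 * 4 : ℝ≥0) : ℝ≥0∞) * T ^ (1 + k0 + k1 + kV 0 + kV 1)) * Ms := by
        have a1 := hle 1 (by linarith)
        have a2 := hle k0 (by linarith)
        have a3 := hle k1 (by linarith)
        have a4 := hle (kV 0) (by linarith)
        have a5 := hle (kV 1) (by linarith)
        have a6 := hle 0 (by linarith)
        gcongr
    _ = _ := by
        rw [show (1 / 8 * 4 : ℝ≥0) = 1 / 2 by rw [← NNReal.coe_inj]; push_cast; norm_num]
        push_cast
        ring

end

section

variable {n : ℕ}

theorem one_le_rpow_of_nonneg {x : ℝ≥0∞} (hx : 1 ≤ x) {a : ℝ} (ha : 0 ≤ a) : 1 ≤ x ^ a := by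
  simpa using ENNReal.rpow_le_rpow hx ha

/-- The Caccioppoli inequality. -/
theorem energy_le_mass (e : Exponents n) (N : ℝ≥0) :
    ∃ (C : ℝ≥0) (m : ℝ), 0 ≤ m ∧ ∀ (l : Space (n + 1) → ℝ≥0∞)
      (g V : Fin 2 → SpaceTime (n + 1) → ℝ≥0∞) (A : ℝ≥0∞) (w : SpaceTime (n + 1) → ℝ)
      (c : SpaceTime (n + 1)) (ρ R : ℝ), 0 ≤ ρ → ρ < R → R ≤ 1 → CoeffBound e N l g V c R →
      LocLip w → 1 ≤ A → EnergyIneq l g (fun z => V 0 z + A * V 1 z) w → energy l w c R ≠ ⊤ →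
      energy l w c ρ ≤ C * (A * ENNReal.ofReal (1 / (R - ρ))) ^ m * mass w c R := by
  obtain ⟨C, m, hm, h⟩ := energy_le_half e N
  obtain ⟨C', hC'⟩ := hole_filling hm
  refine ⟨C' * C, m, hm, fun l g V A w c ρ R hρ hρR hR hc hw hA hE hfin => ?_⟩
  have := hC' (energy l w c) (C * A ^ m * mass w c R) (energy l w c R) ρ R hρR hfin
    (fun r hr => energy_mono hr.2.le) (fun ρ' r hρ' hr hrR => ?_)
  · refine this.trans (le_of_eq ?_)
    rw [ENNReal.mul_rpow_of_nonneg _ _ hm]; push_cast; ring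
  · refine (h l g V A w c ρ' r (by linarith) hr (by linarith) (hc.mono hrR.le) hw hA hE).trans ?_
    refine add_le_add le_rfl ?_
    rw [ENNReal.mul_rpow_of_nonneg _ _ hm]
    calc _ ≤ C * (A ^ m * ENNReal.ofReal (1 / (r - ρ')) ^ m) * mass w c R :=
          mul_le_mul' le_rfl (mass_mono hrR.le)
      _ = _ := by ring

/-- Higher integrability. -/
theorem gain_integrability (e : Exponents n) (N : ℝ≥0) :
    ∃ (C : ℝ≥0) (m : ℝ), 0 ≤ m ∧ ∀ (l : Space (n + 1) → ℝ≥0∞)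
      (g V : Fin 2 → SpaceTime (n + 1) → ℝ≥0∞) (A : ℝ≥0∞) (w : SpaceTime (n + 1) → ℝ)
      (c : SpaceTime (n + 1)) (ρ R : ℝ), 0 ≤ ρ → ρ < R → R ≤ 1 → CoeffBound e N l g V c R →
      LocLip w → 1 ≤ A → EnergyIneq l g (fun z => V 0 z + A * V 1 z) w → energy l w c R ≠ ⊤ →
      (∫⁻ z in pcyl c ρ, ‖w z‖ₑ ^ (2 * e.κ)) ^ (1 / e.κ) ≤
        C * (A * ENNReal.ofReal (1 / (R - ρ))) ^ m * mass w c R := by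
  obtain ⟨C, m, hm, h⟩ := energy_le_mass e N
  have hκ := e.hκ
  have hκ0 : 0 < e.κ := by linarith
  have hκ1 : 1 / e.κ ≤ 1 := by rw [div_le_one hκ0]; exact hκ.le
  obtain ⟨D, hD⟩ : ∃ D : ℝ, D = 2 / ((n + 1 : ℕ) : ℝ) - 1 / e.p0 := ⟨_, rfl⟩
  obtain ⟨θ', hθ'⟩ : ∃ θ' : ℝ, θ' = (1 - 1 / e.κ) / D := ⟨_, rfl⟩
  have hd0 := e.hd0
  have hκ' := e.hκ'
  rw [← hD] at hd0 hκ'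
  have hθ'0 : 0 ≤ θ' := by rw [hθ']; exact div_nonneg (by linarith) hd0.le
  have hθ'1 : θ' < 1 / e.κ := by
    rw [hθ', div_lt_iff₀ hd0]; field_simp; linarith
  obtain ⟨C', hC'⟩ := parabolic_interpolation (d := n + 1) (by have := e.hn; omega)
    (P := ENNReal.ofReal (2 * e.κ)) (p' := e.κ) (q' := e.κ) (θ := θ') e.hp0 (by
      rw [recip, ENNReal.toReal_inv, ENNReal.toReal_ofReal (by positivity)]; field_simp) hκ.le hθ'0
    (by rw [← hD, hθ', div_mul_cancel₀ _ hd0.ne']) hθ'1.le N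
  refine ⟨C' * (C * 2 ^ m + 4), m + 2, by linarith, ?_⟩
  intro l g V A w c ρ R hρ hρR hR hc hw hA hE hfin
  obtain ⟨r, hr⟩ : ∃ r : ℝ, r = (ρ + R) / 2 := ⟨_, rfl⟩
  obtain ⟨τ, hτ⟩ : ∃ τ, τ = ENNReal.ofReal (1 / (R - ρ)) := ⟨_, rfl⟩
  have hτ1 : 1 ≤ τ := by
    rw [hτ, ← ENNReal.ofReal_one]
    exact ENNReal.ofReal_le_ofReal (by rw [le_div_iff₀ (by linarith)]; linarith)
  have hhalf : ENNReal.ofReal (2 * (1 / (R - ρ))) = 2 * τ := by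
    rw [ENNReal.ofReal_mul (by norm_num), ← hτ]; simp
  have h1 := h l g V A w c r R (by linarith) (by linarith) hR hc hw hA hE hfin
  have h2 := hC' l w c ρ r (by linarith) (by linarith) hc.ml hc.lt hw (hc.mono (by linarith)).bl
  rw [show 1 / (R - r) = 2 * (1 / (R - ρ)) by
    rw [hr, show R - (ρ + R) / 2 = (R - ρ) / 2 by ring]; field_simp, hhalf] at h1
  rw [show 1 / (r - ρ) = 2 * (1 / (R - ρ)) by
    rw [hr, show (ρ + R) / 2 - ρ = (R - ρ) / 2 by ring]; field_simp, hhalf] at h2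
  have mN : Measurable fun z : SpaceTime (n + 1) => ‖w z‖ₑ ^ (2 * e.κ) :=
    hw.continuous.measurable.enorm.pow_const _
  have hlhs : (∫⁻ z in pcyl c ρ, ‖w z‖ₑ ^ (2 * e.κ)) ^ (1 / e.κ) =
      (∫⁻ t in Ioo (c.1 - ρ) (c.1 + ρ), (eLpNorm (fun x => w (t, x)) (ENNReal.ofReal (2 * e.κ))
        (volume.restrict (box c.2 ρ)) ^ (2 : ℝ)) ^ e.κ) ^ (1 / e.κ) := by
    congr 1
    rw [pcyl, lintegral_prod_set mN]
    refine lintegral_congr fun t => ?_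
    rw [eLpNorm_eq_lintegral_rpow_enorm_toReal (by simp; positivity) ENNReal.ofReal_ne_top,
      ENNReal.toReal_ofReal (by positivity), ← ENNReal.rpow_mul, ← ENNReal.rpow_mul,
      show 1 / (2 * e.κ) * (2 * e.κ) = 1 by field_simp, ENNReal.rpow_one]
  rw [hlhs, ← hτ]
  refine h2.trans ?_
  obtain ⟨δ, hδ⟩ : ∃ δ, δ = 1 / e.κ - θ' := ⟨_, rfl⟩
  have hδ0 : 0 ≤ δ := by linarith
  have hδ2 : 0 ≤ 1 - δ := by linarith
  obtain ⟨T, hT⟩ : ∃ T, T = A * τ := ⟨_, rfl⟩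
  have hT1 : 1 ≤ T := by rw [hT]; exact one_le_mul hA hτ1
  have hτT : τ ≤ T := by rw [hT]; exact le_mul_of_one_le_left' hA
  obtain ⟨Ms, hMs⟩ : ∃ Ms, Ms = mass w c R := ⟨_, rfl⟩
  rw [← hδ, ← hT, ← hMs]
  have hm2 : mass w c r ≤ Ms := by rw [hMs]; exact mass_mono (by linarith)
  have hX : energy l w c r + (2 * τ) ^ (2 : ℝ) * mass w c r ≤
      ((C * 2 ^ m + 4 : ℝ≥0) : ℝ≥0∞) * T ^ (m + 2) * Ms := by
    have h4 : (2 * τ) ^ (2 : ℝ) ≤ 4 * T ^ (m + 2) := by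
      rw [ENNReal.mul_rpow_of_nonneg _ _ (by norm_num)]
      refine mul_le_mul' (le_of_eq (by norm_num [ENNReal.rpow_two])) ?_
      exact (ENNReal.rpow_le_rpow hτT (by norm_num)).trans
        (ENNReal.rpow_le_rpow_of_exponent_le hT1 (by linarith))
    have h5 : (A * (2 * τ)) ^ m ≤ 2 ^ m * T ^ (m + 2) := by
      rw [show A * (2 * τ) = 2 * T by rw [hT]; ring, ENNReal.mul_rpow_of_nonneg _ _ hm]
      exact mul_le_mul' le_rfl (ENNReal.rpow_le_rpow_of_exponent_le hT1 (by linarith))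
    calc _ ≤ C * (2 ^ m * T ^ (m + 2)) * Ms + 4 * T ^ (m + 2) * Ms := by
          refine add_le_add (h1.trans ?_) (mul_le_mul' h4 hm2)
          rw [← hMs]
          exact mul_le_mul' (mul_le_mul' le_rfl h5) le_rfl
      _ = _ := by
          push_cast
          rw [ENNReal.coe_rpow_of_nonneg _ hm]
          push_cast
          ring
  have hB1 : 1 ≤ ((C * 2 ^ m + 4 : ℝ≥0) : ℝ≥0∞) * T ^ (m + 2) := by
    refine one_le_mul ?_ (one_le_rpow_of_nonneg hT1 (by linarith))
    have : (1 : ℝ≥0) ≤ C * 2 ^ m + 4 := le_add_of_nonneg_of_le (by positivity) (by norm_num)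
    exact_mod_cast this
  calc _ ≤ (C' : ℝ≥0∞) * ((((C * 2 ^ m + 4 : ℝ≥0) : ℝ≥0∞) * T ^ (m + 2) * Ms) ^ (1 - δ) * Ms ^ δ) := by
        gcongr
    _ = C' * ((((C * 2 ^ m + 4 : ℝ≥0) : ℝ≥0∞) * T ^ (m + 2)) ^ (1 - δ) * Ms) := by
        rw [ENNReal.mul_rpow_of_nonneg _ Ms hδ2, mul_assoc (_ ^ (1 - δ)),
          ← ENNReal.rpow_add_of_nonneg _ _ hδ2 hδ0]
        simp
    _ ≤ C' * ((((C * 2 ^ m + 4 : ℝ≥0) : ℝ≥0∞) * T ^ (m + 2)) ^ (1 : ℝ) * Ms) := by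
        gcongr
        linarith
    _ = _ := by rw [ENNReal.rpow_one]; push_cast; ring

theorem enorm_rpow_of_pos {x : ℝ} (hx : 0 < x) {a : ℝ} (ha : 0 ≤ a) : ‖x ^ a‖ₑ = ‖x‖ₑ ^ a := by
  rw [← ofReal_norm, ← ofReal_norm, Real.norm_of_nonneg hx.le,
    Real.norm_of_nonneg (Real.rpow_nonneg hx.le _), ENNReal.ofReal_rpow_of_nonneg hx.le ha]

open Filter Topology in
/-- **Moser iteration.** -/
theorem moser_iteration (e : Exponents n) (N : ℝ≥0) :
    ∃ (C : ℝ≥0) (m : ℝ), 0 ≤ m ∧ ∀ (l : Space (n + 1) → ℝ≥0∞)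
      (g V : Fin 2 → SpaceTime (n + 1) → ℝ≥0∞) (v : SpaceTime (n + 1) → ℝ)
      (c : SpaceTime (n + 1)) (r : ℝ), 0 < r → r ≤ 1 → CoeffBound e N l g V c r →
      (∀ z, 0 < v z) → (∀ α : ℝ, 1 ≤ α → LocLip fun z => v z ^ α) →
      (∀ α : ℝ, 1 ≤ α → EnergyIneq l g (fun z => V 0 z + ENNReal.ofReal α * V 1 z)
        fun z => v z ^ α) →
      (∀ α : ℝ, 1 ≤ α → energy l (fun z => v z ^ α) c r ≠ ⊤) →
      ‖v c‖ₑ ^ (2 : ℝ) ≤ C * ENNReal.ofReal (1 / r) ^ m * mass v c r := by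
  obtain ⟨C, m, hm, h⟩ := gain_integrability e N
  have hκ := e.hκ
  obtain ⟨κ, hκe⟩ : ∃ κ, κ = e.κ := ⟨_, rfl⟩
  rw [← hκe] at hκ h
  have hκ0 : 0 < κ := by linarith
  have hκi : ‖κ⁻¹‖ < 1 := by
    rw [norm_inv, Real.norm_of_nonneg hκ0.le]; exact inv_lt_one_of_one_lt₀ hκ
  have hs0 : Summable fun k : ℕ => (κ⁻¹) ^ k := summable_geometric_of_norm_lt_one hκi
  have hs1 : Summable fun k : ℕ => (k : ℝ) * (κ⁻¹) ^ k := by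
    simpa using summable_pow_mul_geometric_of_norm_lt_one 1 hκi
  obtain ⟨S, hS⟩ : ∃ S : ℝ, S = ∑' k : ℕ, (κ⁻¹) ^ k := ⟨_, rfl⟩
  obtain ⟨U, hU⟩ : ∃ U : ℝ, U = ∑' k : ℕ, (k : ℝ) * (κ⁻¹) ^ k := ⟨_, rfl⟩
  have hS0 : 0 ≤ S := by rw [hS]; exact tsum_nonneg fun k => by positivity
  have hU0 : 0 ≤ U := by rw [hU]; exact tsum_nonneg fun k => by positivity
  obtain ⟨E, hE⟩ : ∃ E : ℝ≥0, E = (2 * Real.toNNReal κ) ^ m := ⟨_, rfl⟩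
  have hE1 : 1 ≤ E := by
    rw [hE]; refine NNReal.one_le_rpow (one_le_mul (by norm_num) ?_) hm
    rw [← Real.toNNReal_one]; exact Real.toNNReal_le_toNNReal hκ.le
  refine ⟨((C + 1) * 4 ^ m) ^ S * E ^ U, m * S, by positivity, ?_⟩
  intro l g V v c r hr0 hr1 hc hv hvl hvE hvf
  obtain ⟨D, hD⟩ : ∃ D : ℝ≥0∞, D = (C + 1) * ENNReal.ofReal (4 / r) ^ m := ⟨_, rfl⟩
  have hD1 : 1 ≤ D := by
    rw [hD]
    refine one_le_mul le_add_self (one_le_rpow_of_nonneg ?_ hm)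
    rw [← ENNReal.ofReal_one]
    refine ENNReal.ofReal_le_ofReal ?_
    rw [le_div_iff₀ hr0]; linarith
  obtain ⟨ρ, hρ⟩ : ∃ ρ : ℕ → ℝ, ρ = fun k => r / 2 + r / 2 * (1 / 2) ^ k := ⟨_, rfl⟩
  obtain ⟨I, hI⟩ : ∃ I : ℕ → ℝ≥0∞, I = fun k => ∫⁻ z in pcyl c (ρ k), ‖v z‖ₑ ^ (2 * κ ^ k) := ⟨_, rfl⟩
  have hκk : ∀ k : ℕ, 0 < κ ^ k := fun k => by positivity
  have hρr : ∀ k, ρ k ≤ r := by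
    intro k; rw [hρ]
    have : (1 / 2 : ℝ) ^ k ≤ 1 := pow_le_one₀ (by norm_num) (by norm_num)
    have := mul_le_mul_of_nonneg_left this (by positivity : 0 ≤ r / 2)
    simp only; linarith
  have hstep : ∀ k, I (k + 1) ^ (1 / κ ^ (k + 1)) ≤
      (D ^ ((κ⁻¹) ^ k) * (E : ℝ≥0∞) ^ (k * (κ⁻¹) ^ k)) * I k ^ (1 / κ ^ k) := by
    intro k
    have hα : 1 ≤ κ ^ k := one_le_pow₀ hκ.le
    have hd : ρ k - ρ (k + 1) = r / 4 * (1 / 2) ^ k := by rw [hρ]; simp only [pow_succ]; ring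
    have hpos : 0 < r / 4 * (1 / 2 : ℝ) ^ k := by positivity
    have hρ0 : 0 ≤ ρ (k + 1) := by rw [hρ]; positivity
    have h1 := h l g V (ENNReal.ofReal (κ ^ k)) (fun z => v z ^ (κ ^ k)) c (ρ (k + 1)) (ρ k) hρ0
      (by linarith) ((hρr k).trans hr1) (hc.mono (hρr k)) (hvl _ hα)
      (by rw [← ENNReal.ofReal_one]; exact ENNReal.ofReal_le_ofReal hα) (hvE _ hα)
      (ne_top_of_le_ne_top (hvf _ hα) (energy_mono (hρr k)))
    have e1 : mass (fun z => v z ^ (κ ^ k)) c (ρ k) = I k := by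
      rw [mass, hI]
      refine lintegral_congr fun z => ?_
      rw [enorm_rpow_of_pos (hv z) (hκk k).le, ← ENNReal.rpow_mul, mul_comm]
    have e2 : ∫⁻ z in pcyl c (ρ (k + 1)), ‖v z ^ (κ ^ k)‖ₑ ^ (2 * κ) = I (k + 1) := by
      rw [hI]
      refine lintegral_congr fun z => ?_
      rw [enorm_rpow_of_pos (hv z) (hκk k).le, ← ENNReal.rpow_mul]
      congr 1; ring
    have e3 : (ENNReal.ofReal (κ ^ k) * ENNReal.ofReal (1 / (ρ k - ρ (k + 1)))) ^ m =
        ENNReal.ofReal (4 / r) ^ m * (E : ℝ≥0∞) ^ (k : ℝ) := by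
      rw [hd, hE, ENNReal.coe_rpow_of_nonneg _ hm, ← ENNReal.rpow_mul, mul_comm m, ENNReal.rpow_mul,
        ← ENNReal.mul_rpow_of_nonneg _ _ hm]
      congr 1
      rw [ENNReal.rpow_natCast, ENNReal.coe_mul, ENNReal.coe_ofNat,
        show ((Real.toNNReal κ : ℝ≥0) : ℝ≥0∞) = ENNReal.ofReal κ from rfl,
        show (2 : ℝ≥0∞) = ENNReal.ofReal 2 by simp,
        ← ENNReal.ofReal_mul (p := 2) (by norm_num), ← ENNReal.ofReal_pow (by positivity),
        ← ENNReal.ofReal_mul (hκk k).le, ← ENNReal.ofReal_mul (by positivity)]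
      congr 1
      rw [mul_pow]
      field_simp
      rw [← mul_pow]; norm_num
    rw [e1, e2, e3] at h1
    have h2 : I (k + 1) ^ (1 / κ) ≤ D * (E : ℝ≥0∞) ^ (k : ℝ) * I k := by
      refine h1.trans (mul_le_mul' ?_ le_rfl)
      rw [hD, ← mul_assoc]
      gcongr
      exact le_self_add
    have h3 := ENNReal.rpow_le_rpow h2 (one_div_nonneg.2 (hκk k).le)
    rw [← ENNReal.rpow_mul, show 1 / κ * (1 / κ ^ k) = 1 / κ ^ (k + 1) by field_simp; ring,
      ENNReal.mul_rpow_of_nonneg _ _ (one_div_nonneg.2 (hκk k).le),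
      ENNReal.mul_rpow_of_nonneg _ _ (one_div_nonneg.2 (hκk k).le), ← ENNReal.rpow_mul] at h3
    rwa [inv_pow, ← one_div]
  have hind : ∀ k, I k ^ (1 / κ ^ k) ≤ (D ^ (∑ i ∈ Finset.range k, (κ⁻¹) ^ i) *
      (E : ℝ≥0∞) ^ (∑ i ∈ Finset.range k, (i : ℝ) * (κ⁻¹) ^ i)) * I 0 := by
    intro k
    induction k with
    | zero => simp
    | succ k ih =>
      refine (hstep k).trans ((mul_le_mul' le_rfl ih).trans (le_of_eq ?_))
      rw [Finset.sum_range_succ, Finset.sum_range_succ,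
        ENNReal.rpow_add_of_nonneg _ _ (Finset.sum_nonneg fun i _ => by positivity) (by positivity),
        ENNReal.rpow_add_of_nonneg _ _ (Finset.sum_nonneg fun i _ => by positivity) (by positivity)]
      ring
  obtain ⟨B, hB⟩ : ∃ B, B = D ^ S * (E : ℝ≥0∞) ^ U * I 0 := ⟨_, rfl⟩
  have hbound : ∀ k, I k ^ (1 / κ ^ k) ≤ B := by
    intro k
    refine (hind k).trans ?_
    rw [hB]
    refine mul_le_mul' (mul_le_mul' ?_ ?_) le_rfl
    · refine ENNReal.rpow_le_rpow_of_exponent_le hD1 ?_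
      rw [hS]; exact hs0.sum_le_tsum _ fun i _ => by positivity
    · refine ENNReal.rpow_le_rpow_of_exponent_le (by exact_mod_cast hE1) ?_
      rw [hU]; exact hs1.sum_le_tsum _ fun i _ => by positivity
  have hvB : ‖v c‖ₑ ^ (2 : ℝ) ≤ B := by
    have hcont : Continuous v := by
      have := (hvl 1 le_rfl).continuous
      simpa using this
    have hlt : ∀ a : ℝ, 0 < a → a < v c → ENNReal.ofReal a ^ (2 : ℝ) ≤ B := by
      intro a ha hac
      have hopen : IsOpen ({z | a < v z} ∩ pcyl c (r / 2)) :=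
        (isOpen_lt continuous_const hcont).inter (isOpen_pcyl _ _)
      have hcm : c ∈ pcyl c (r / 2) :=
        ⟨⟨by linarith, by linarith⟩, Metric.mem_ball_self (by positivity)⟩
      have hpos : 0 < volume ({z | a < v z} ∩ pcyl c (r / 2)) :=
        hopen.measure_pos volume ⟨c, hac, hcm⟩
      obtain ⟨b, hb0, hb⟩ := ENNReal.lt_iff_exists_nnreal_btwn.1 hpos
      have hb0' : (0 : ℝ) < b := by exact_mod_cast hb0
      have hk : ∀ k : ℕ, ENNReal.ofReal ((b : ℝ) ^ (1 / κ ^ k) * a ^ 2) ≤ B := by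
        intro k
        refine le_trans ?_ (hbound k)
        have h1 : (b : ℝ≥0∞) * ENNReal.ofReal a ^ (2 * κ ^ k) ≤ I k := by
          calc (b : ℝ≥0∞) * ENNReal.ofReal a ^ (2 * κ ^ k)
              ≤ ENNReal.ofReal a ^ (2 * κ ^ k) * volume ({z | a < v z} ∩ pcyl c (r / 2)) := by
                rw [mul_comm]; gcongr
            _ = ∫⁻ _z in {z | a < v z} ∩ pcyl c (r / 2), ENNReal.ofReal a ^ (2 * κ ^ k) := by
                rw [setLIntegral_const]
            _ ≤ ∫⁻ z in {z | a < v z} ∩ pcyl c (r / 2), ‖v z‖ₑ ^ (2 * κ ^ k) := by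
                refine setLIntegral_mono' hopen.measurableSet fun z hz => ?_
                refine ENNReal.rpow_le_rpow ?_ (by positivity)
                rw [← ofReal_norm, Real.norm_of_nonneg (hv z).le]
                exact ENNReal.ofReal_le_ofReal (le_of_lt hz.1)
            _ ≤ I k := by
                rw [hI]
                refine lintegral_mono_set (inter_subset_right.trans (pcyl_mono ?_))
                rw [hρ]
                have : 0 ≤ r / 2 * (1 / 2 : ℝ) ^ k := by positivity
                simp only; linarith
        refine le_trans (le_of_eq ?_) (ENNReal.rpow_le_rpow h1 (one_div_nonneg.2 (hκk k).le))
        rw [ENNReal.mul_rpow_of_nonneg _ _ (one_div_nonneg.2 (hκk k).le), ← ENNReal.rpow_mul,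
          show 2 * κ ^ k * (1 / κ ^ k) = 2 by field_simp, ENNReal.ofReal_mul (by positivity),
          ← ENNReal.ofReal_rpow_of_pos hb0', ENNReal.ofReal_coe_nnreal, ENNReal.rpow_two,
          ENNReal.ofReal_pow ha.le]
      have hlim : Tendsto (fun k : ℕ => ENNReal.ofReal ((b : ℝ) ^ (1 / κ ^ k) * a ^ 2)) atTop
          (𝓝 (ENNReal.ofReal ((b : ℝ) ^ (0 : ℝ) * a ^ 2))) := by
        refine ENNReal.tendsto_ofReal (Tendsto.mul_const _ ?_)
        have h0 : Tendsto (fun k : ℕ => 1 / κ ^ k) atTop (𝓝 0) := by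
          have := tendsto_pow_atTop_nhds_zero_of_norm_lt_one hκi
          simpa [inv_pow, one_div] using this
        exact (Real.continuous_const_rpow hb0'.ne').continuousAt.tendsto.comp h0
      have := le_of_tendsto' hlim hk
      rwa [Real.rpow_zero, one_mul, ENNReal.ofReal_pow ha.le, ← ENNReal.rpow_two] at this
    have hlim : Tendsto (fun a : ℝ => ENNReal.ofReal a ^ (2 : ℝ)) (𝓝[<] (v c))
        (𝓝 (ENNReal.ofReal (v c) ^ (2 : ℝ))) := by
      refine Tendsto.mono_left ?_ nhdsWithin_le_nhds
      exact (ENNReal.continuous_rpow_const.comp ENNReal.continuous_ofReal).continuousAt.tendsto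
    rw [← ofReal_norm, Real.norm_of_nonneg (hv c).le]
    refine le_of_tendsto hlim ?_
    filter_upwards [Ioo_mem_nhdsLT (hv c)] with a ha
    exact hlt a ha.1 ha.2
  refine hvB.trans (le_of_eq ?_)
  have hI0 : I 0 = mass v c r := by
    rw [hI, mass, hρ]; simp
  rw [hB, hI0, hD, div_eq_mul_one_div 4 r, ENNReal.ofReal_mul (by norm_num),
    ENNReal.mul_rpow_of_nonneg _ _ hm, ENNReal.mul_rpow_of_nonneg _ _ hS0,
    ENNReal.mul_rpow_of_nonneg _ _ hS0, ← ENNReal.rpow_mul _ m S]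
  push_cast
  rw [ENNReal.coe_rpow_of_nonneg _ hS0, ENNReal.coe_rpow_of_nonneg _ hU0]
  push_cast
  rw [ENNReal.coe_rpow_of_nonneg _ hm, ENNReal.mul_rpow_of_nonneg _ _ hS0, ← ENNReal.rpow_mul _ m S,
    ENNReal.ofReal_ofNat]
  push_cast
  rw [← ENNReal.rpow_mul]
  ring

end

section

open Filter Topology

/-- Bounded functions with bounded support, nonnegative, measurable, and Lipschitz in space. -/
structure IsTest {d : ℕ} (g : SpaceTime d → ℝ) (M L : ℝ≥0) (R : ℝ) : Prop where
  measurable : Measurable g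
  measurable_grad : Measurable (spaceGrad g)
  nonneg : ∀ z, 0 ≤ g z
  le : ∀ z, g z ≤ M
  supp : ∀ z, R < ‖z‖ → g z = 0
  lip : ∀ t, LipschitzWith L fun x => g (t, x)
  diff : ∀ᵐ x, ∀ᵐ t, DifferentiableAt ℝ (fun y => g (t, y)) x

theorem isAddHaarMeasure_spaceTime (d : ℕ) : (volume : Measure (SpaceTime d)).IsAddHaarMeasure :=
  Measure.prod.instIsAddHaarMeasure volume volume

/-- The Steklov average. -/
noncomputable def stek {d : ℕ} (h : ℝ) (g : SpaceTime d → ℝ) (z : SpaceTime d) : ℝ :=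
  h⁻¹ * ∫ s in z.1..z.1 + h, g (s, z.2)

theorem locallyIntegrable_of_bound {E : Type*} [NormedAddCommGroup E] {G : ℝ → E} {M : ℝ}
    (hG : AEStronglyMeasurable G) (hM : ∀ t, ‖G t‖ ≤ M) : LocallyIntegrable G :=
  (memLp_top_of_bound hG M (Eventually.of_forall hM)).locallyIntegrable le_top

theorem LocallyIntegrable.intervalIntegrable' {E : Type*} [NormedAddCommGroup E] {G : ℝ → E}
    (hG : LocallyIntegrable G) (a b : ℝ) : IntervalIntegrable G volume a b :=
  intervalIntegrable_iff.mpr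
    ((hG.integrableOn_isCompact isCompact_uIcc).mono_set uIoc_subset_uIcc)

theorem tendsto_average_of_locallyIntegrable {E : Type*} [NormedAddCommGroup E] [NormedSpace ℝ E]
    [CompleteSpace E] {G : ℝ → E} (hG : LocallyIntegrable G) :
    ∀ᵐ t, Tendsto (fun n : ℕ => (1 / ((n : ℝ) + 1))⁻¹ • ∫ s in t..t + 1 / ((n : ℝ) + 1), G s) atTop
      (𝓝 (G t)) := by
  filter_upwards [LocallyIntegrable.ae_hasDerivAt_integral hG] with t ht
  have h1 := (ht t).tendsto_slope_zero_right
  simp only [intervalIntegral.integral_same, sub_zero] at h1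
  refine h1.comp (tendsto_nhdsWithin_iff.2 ⟨tendsto_one_div_add_atTop_nhds_zero_nat, ?_⟩)
  exact Eventually.of_forall fun n => by simp only [mem_Ioi]; positivity

section Steklov

variable {d : ℕ} {g : SpaceTime d → ℝ} {M L : ℝ≥0} {R : ℝ}

theorem norm_spaceGrad_le {φ : SpaceTime d → ℝ} (hφ : ∀ t, LipschitzWith L fun x => φ (t, x))
    (z : SpaceTime d) : ‖spaceGrad φ z‖ ≤ L := by
  rw [norm_spaceGrad]; exact norm_fderiv_le_of_lipschitz ℝ (hφ z.1)

theorem spaceGrad_eq_zero_of_supp {φ : SpaceTime d → ℝ} (h : ∀ z, R < ‖z‖ → φ z = 0)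
    {z : SpaceTime d} (hz : R < ‖z‖) : spaceGrad φ z = 0 := by
  have ho : ∀ᶠ x in 𝓝 z.2, φ (z.1, x) = 0 := by
    have hc : Continuous fun x : Space d => ‖(z.1, x)‖ := by fun_prop
    filter_upwards [hc.continuousAt.eventually (lt_mem_nhds hz)] with x hx using h _ hx
  rw [spaceGrad, gradient, Filter.EventuallyEq.fderiv_eq (f := fun _ => (0 : ℝ)) ho]
  simp

namespace IsTest

theorem norm_le (hg : IsTest g M L R) (z : SpaceTime d) : ‖g z‖ ≤ M := by
  rw [Real.norm_of_nonneg (hg.nonneg z)]; exact hg.le z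

theorem locallyIntegrable (hg : IsTest g M L R) (x : Space d) :
    LocallyIntegrable fun t => g (t, x) :=
  locallyIntegrable_of_bound (hg.measurable.comp measurable_prodMk_right).aestronglyMeasurable
    fun t => hg.norm_le (t, x)

theorem intervalIntegrable (hg : IsTest g M L R) (x : Space d) (a b : ℝ) :
    IntervalIntegrable (fun t => g (t, x)) volume a b :=
  LocallyIntegrable.intervalIntegrable' (hg.locallyIntegrable x) a b

theorem measurable_fderiv (hg : IsTest g M L R) :
    Measurable fun z : SpaceTime d => fderiv ℝ (fun y => g (z.1, y)) z.2 := by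
  have e : (fun z : SpaceTime d => fderiv ℝ (fun y => g (z.1, y)) z.2) =
      fun z => InnerProductSpace.toDual ℝ (Space d) (spaceGrad g z) := by
    funext z; rw [spaceGrad, gradient, LinearIsometryEquiv.apply_symm_apply]
  rw [e]
  exact (InnerProductSpace.toDual ℝ (Space d)).continuous.measurable.comp hg.measurable_grad

theorem fderiv_locallyIntegrable (hg : IsTest g M L R) (x : Space d) :
    LocallyIntegrable fun t => fderiv ℝ (fun y => g (t, y)) x :=
  locallyIntegrable_of_bound (M := L)
    (hg.measurable_fderiv.comp measurable_prodMk_right).aestronglyMeasurable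
    fun t => norm_fderiv_le_of_lipschitz ℝ (hg.lip t)

theorem stek_nonneg (hg : IsTest g M L R) {h : ℝ} (hh : 0 < h) (z : SpaceTime d) :
    0 ≤ stek h g z :=
  mul_nonneg (inv_nonneg.2 hh.le)
    (intervalIntegral.integral_nonneg (by linarith) fun s _ => hg.nonneg _)

theorem norm_stek_le (hg : IsTest g M L R) {h : ℝ} (hh : 0 < h) (z : SpaceTime d) :
    ‖stek h g z‖ ≤ M := by
  rw [stek, norm_mul, norm_inv, Real.norm_of_nonneg hh.le]
  have := intervalIntegral.norm_integral_le_of_norm_le_const (a := z.1) (b := z.1 + h)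
    (f := fun s => g (s, z.2)) (C := M) fun s _ => hg.norm_le _
  rw [add_sub_cancel_left, abs_of_pos hh] at this
  rw [inv_mul_le_iff₀ hh]; linarith

theorem stek_supp (hg : IsTest g M L R) {h : ℝ} (hh : 0 < h) (hh1 : h ≤ 1) (z : SpaceTime d)
    (hz : R + 1 < ‖z‖) : stek h g z = 0 := by
  rw [stek, intervalIntegral.integral_congr (g := fun _ => (0 : ℝ))]
  · simp
  intro s hs
  rw [uIcc_of_le (by linarith)] at hs
  refine hg.supp _ ?_
  have h1 : ‖z‖ ≤ ‖(s, z.2)‖ + ‖((z.1 - s, 0) : SpaceTime d)‖ := by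
    refine le_trans (le_of_eq ?_) (norm_add_le _ _)
    congr 1; ext <;> simp
  have h2 : ‖((z.1 - s, 0) : SpaceTime d)‖ ≤ 1 := by
    rw [Prod.norm_def]; simp only [norm_zero, Real.norm_eq_abs]
    refine max_le (abs_le.2 ⟨?_, ?_⟩) zero_le_one <;> linarith [hs.1, hs.2]
  linarith

theorem stek_lip (hg : IsTest g M L R) {h : ℝ} (hh : 0 < h) (t : ℝ) :
    LipschitzWith L fun x => stek h g (t, x) := by
  refine LipschitzWith.of_dist_le_mul fun x y => ?_
  rw [Real.dist_eq, ← Real.norm_eq_abs]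
  simp only [stek]
  rw [← mul_sub, ← intervalIntegral.integral_sub (hg.intervalIntegrable x _ _)
    (hg.intervalIntegrable y _ _), norm_mul, norm_inv, Real.norm_of_nonneg hh.le]
  have := intervalIntegral.norm_integral_le_of_norm_le_const (a := t) (b := t + h)
    (f := fun s => g (s, x) - g (s, y)) (C := L * dist x y) fun s _ => by
      have := (hg.lip s).dist_le_mul x y
      rwa [Real.dist_eq, ← Real.norm_eq_abs] at this
  rw [add_sub_cancel_left, abs_of_pos hh] at this
  rw [inv_mul_le_iff₀ hh]; linarith

theorem stek_lip_time (hg : IsTest g M L R) {h : ℝ} (hh : 0 < h) (x : Space d) (t t' : ℝ) :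
    |stek h g (t, x) - stek h g (t', x)| ≤ 2 * M / h * |t - t'| := by
  have hi := hg.intervalIntegrable x
  have e : (∫ s in t..t + h, g (s, x)) - ∫ s in t'..t' + h, g (s, x) =
      (∫ s in t' + h..t + h, g (s, x)) - ∫ s in t'..t, g (s, x) := by
    have h1 := intervalIntegral.integral_add_adjacent_intervals (hi t' t) (hi t (t + h))
    have h2 := intervalIntegral.integral_add_adjacent_intervals (hi t' (t' + h)) (hi (t' + h) (t + h))
    linarith
  simp only [stek]
  rw [← mul_sub, e, ← Real.norm_eq_abs, norm_mul, norm_inv, Real.norm_of_nonneg hh.le]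
  have b1 := intervalIntegral.norm_integral_le_of_norm_le_const (a := t' + h) (b := t + h)
    (f := fun s => g (s, x)) (C := M) fun s _ => hg.norm_le _
  have b2 := intervalIntegral.norm_integral_le_of_norm_le_const (a := t') (b := t)
    (f := fun s => g (s, x)) (C := M) fun s _ => hg.norm_le _
  rw [add_sub_add_right_eq_sub] at b1
  have b3 := norm_sub_le (∫ s in t' + h..t + h, g (s, x)) (∫ s in t'..t, g (s, x))
  rw [inv_mul_le_iff₀ hh]
  have : h * (2 * M / h * |t - t'|) = 2 * M * |t - t'| := by field_simp
  linarith

theorem stek_lipschitz (hg : IsTest g M L R) {h : ℝ} (hh : 0 < h) :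
    ∃ K : ℝ≥0, LipschitzWith K (stek h g) := by
  refine ⟨L + Real.toNNReal (2 * M / h), LipschitzWith.of_dist_le_mul fun z z' => ?_⟩
  have h1 := (hg.stek_lip hh z.1).dist_le_mul z.2 z'.2
  have h2 := hg.stek_lip_time hh z'.2 z.1 z'.1
  rw [← Real.dist_eq, ← Real.dist_eq] at h2
  have h3 : dist z.1 z'.1 ≤ dist z z' := le_max_left _ _
  have h4 : dist z.2 z'.2 ≤ dist z z' := le_max_right _ _
  have h5 : 0 ≤ 2 * M / h := by positivity
  calc dist (stek h g z) (stek h g z') ≤ dist (stek h g (z.1, z.2)) (stek h g (z.1, z'.2)) +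
        dist (stek h g (z.1, z'.2)) (stek h g (z'.1, z'.2)) := dist_triangle _ _ _
    _ ≤ L * dist z z' + 2 * M / h * dist z z' := by
        refine add_le_add (h1.trans ?_) (h2.trans ?_) <;> gcongr
    _ = _ := by rw [NNReal.coe_add, Real.coe_toNNReal _ h5]; ring

theorem hasCompactSupport_stek (hg : IsTest g M L R) {h : ℝ} (hh : 0 < h) (hh1 : h ≤ 1) :
    HasCompactSupport (stek h g) :=
  HasCompactSupport.of_support_subset_isCompact (isCompact_closedBall 0 (R + 1)) fun z hz => by
    by_contra hc
    rw [mem_closedBall_zero_iff, not_le] at hc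
    exact hz (hg.stek_supp hh hh1 z hc)

theorem fderiv_stek (hg : IsTest g M L R) (h : ℝ) :
    ∀ᵐ x : Space d, ∀ t, fderiv ℝ (fun y => stek h g (t, y)) x =
      h⁻¹ • ∫ s in t..t + h, fderiv ℝ (fun y => g (s, y)) x := by
  filter_upwards [hg.diff] with x hx t
  have key := intervalIntegral.hasFDerivAt_integral_of_dominated_loc_of_lip (μ := volume)
    (F := fun y s => g (s, y)) (F' := fun s => fderiv ℝ (fun y => g (s, y)) x)
    (x₀ := x) (a := t) (b := t + h) (bound := fun _ => (L : ℝ)) (s := univ) univ_mem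
    (Eventually.of_forall fun y =>
      (hg.measurable.comp measurable_prodMk_right).aestronglyMeasurable)
    (hg.intervalIntegrable x _ _)
    (hg.fderiv_locallyIntegrable x).aestronglyMeasurable.restrict
    (Eventually.of_forall fun s _ => by
      have : Real.nnabs (L : ℝ) = L := by ext; simp
      rw [this]; exact (hg.lip s).lipschitzOnWith)
    intervalIntegrable_const
    (by
      filter_upwards [hx] with s hs _
      exact hs.hasFDerivAt)
  exact (key.2.const_mul h⁻¹).fderiv

theorem continuous_stek (hg : IsTest g M L R) {h : ℝ} (hh : 0 < h) : Continuous (stek h g) := by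
  obtain ⟨K, hK⟩ := hg.stek_lipschitz hh; exact hK.continuous

theorem ae_of_ae_ae_swap {p : SpaceTime d → Prop} (hp : MeasurableSet {z | p z})
    (h : ∀ᵐ x : Space d, ∀ᵐ t : ℝ, p (t, x)) : ∀ᵐ z, p z := by
  rw [Measure.volume_eq_prod, Measure.ae_prod_iff_ae_ae hp]
  exact (Measure.ae_ae_comm (p := fun t x => p (t, x)) hp).2 h

theorem ae_timeDeriv_stek (hg : IsTest g M L R) {h : ℝ} (hh : 0 < h) :
    ∀ᵐ z : SpaceTime d, timeDeriv (stek h g) z = h⁻¹ * (g (z.1 + h, z.2) - g z) := by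
  have hm1 : Measurable (timeDeriv (stek h g)) := by
    have := measurable_deriv_with_param (𝕜 := ℝ) (f := fun (x : Space d) (t : ℝ) => stek h g (t, x))
      ((hg.continuous_stek hh).comp continuous_swap)
    exact this.comp measurable_swap
  have hm2 : Measurable fun z : SpaceTime d => h⁻¹ * (g (z.1 + h, z.2) - g z) :=
    ((hg.measurable.comp ((measurable_fst.add_const h).prodMk measurable_snd)).sub
      hg.measurable).const_mul _
  refine ae_of_ae_ae_swap (measurableSet_eq_fun hm1 hm2) (Eventually.of_forall fun x => ?_)
  have h0 := LocallyIntegrable.ae_hasDerivAt_integral (hg.locallyIntegrable x)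
  have h1 : ∀ᵐ t : ℝ, ∀ c, HasDerivAt (fun y => ∫ s in c..y, g (s, x)) (g (t + h, x)) (t + h) :=
    (measurePreserving_add_right volume h).quasiMeasurePreserving.ae h0
  filter_upwards [h0, h1] with t ht0 ht1
  have hi := hg.intervalIntegrable x
  have e : (fun t => stek h g (t, x)) = fun t => h⁻¹ * ((∫ s in (0 : ℝ)..t + h, g (s, x)) -
      ∫ s in (0 : ℝ)..t, g (s, x)) := by
    funext t
    rw [stek, intervalIntegral.integral_interval_sub_left (hi _ _) (hi _ _)]
  have h2 : HasDerivAt (fun t => stek h g (t, x)) (h⁻¹ * (g (t + h, x) - g (t, x))) t := by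
    rw [e]
    exact (((ht1 0).comp_add_const t h).sub (ht0 0)).const_mul _
  exact h2.deriv

theorem ae_tendsto_stek (hg : IsTest g M L R) :
    ∀ᵐ z : SpaceTime d, Tendsto (fun n : ℕ => stek (1 / ((n : ℝ) + 1)) g z) atTop (𝓝 (g z)) := by
  refine ae_of_ae_ae_swap (measurableSet_tendsto_fun
    (fun n => (hg.continuous_stek (by positivity)).measurable) hg.measurable)
    (Eventually.of_forall fun x => ?_)
  filter_upwards [tendsto_average_of_locallyIntegrable (hg.locallyIntegrable x)] with t ht
  exact ht

theorem ae_tendsto_spaceGrad_stek (hg : IsTest g M L R) :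
    ∀ᵐ z : SpaceTime d, Tendsto (fun n : ℕ => spaceGrad (stek (1 / ((n : ℝ) + 1)) g) z) atTop
      (𝓝 (spaceGrad g z)) := by
  refine ae_of_ae_ae_swap (measurableSet_tendsto_fun
    (fun n => measurable_spaceGrad (hg.continuous_stek (by positivity))) hg.measurable_grad) ?_
  filter_upwards [ae_all_iff.2 fun n : ℕ => hg.fderiv_stek (1 / ((n : ℝ) + 1))] with x hx
  filter_upwards [tendsto_average_of_locallyIntegrable (hg.fderiv_locallyIntegrable x)] with t ht
  simp only [← hx _ t] at ht
  exact ((InnerProductSpace.toDual ℝ (Space d)).symm.continuous.tendsto _).comp ht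

theorem tendsto_integral_grad (hg : IsTest g M L R) {F : SpaceTime d → Space d} (hFm : Measurable F)
    (hF : ∀ r, IntegrableOn F (Metric.closedBall 0 r)) :
    Tendsto (fun n : ℕ => ∫ z, inner ℝ (F z) (spaceGrad (stek (1 / ((n : ℝ) + 1)) g) z)) atTop
      (𝓝 (∫ z, inner ℝ (F z) (spaceGrad g z))) := by
  have hpos : ∀ n : ℕ, 0 < 1 / ((n : ℝ) + 1) := fun n => by positivity
  have hle : ∀ n : ℕ, 1 / ((n : ℝ) + 1) ≤ 1 := fun n => by
    rw [div_le_one (by positivity)]; linarith [(Nat.cast_nonneg n : (0 : ℝ) ≤ n)]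
  refine tendsto_integral_of_dominated_convergence
    ((Metric.closedBall 0 (R + 1)).indicator fun z => ‖F z‖ * L) (fun n => ?_) ?_ (fun n => ?_) ?_
  · exact (hFm.inner (measurable_spaceGrad (hg.continuous_stek (hpos n)))).aestronglyMeasurable
  · have h1 : IntegrableOn (fun z => ‖F z‖ * (L : ℝ)) (Metric.closedBall 0 (R + 1)) :=
      (hF (R + 1)).norm.mul_const _
    exact h1.integrable_indicator measurableSet_closedBall
  · refine Eventually.of_forall fun z => ?_
    by_cases hz : z ∈ Metric.closedBall 0 (R + 1)
    · rw [indicator_of_mem hz]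
      refine (norm_inner_le_norm _ _).trans ?_
      gcongr
      exact norm_spaceGrad_le (hg.stek_lip (hpos n)) z
    · rw [indicator_of_notMem hz]
      rw [mem_closedBall_zero_iff, not_le] at hz
      rw [spaceGrad_eq_zero_of_supp (hg.stek_supp (hpos n) (hle n)) hz]
      simp
  · filter_upwards [hg.ae_tendsto_spaceGrad_stek] with z hz
    exact (tendsto_const_nhds.inner hz)

theorem tendsto_integral_mul (hg : IsTest g M L R) {f : SpaceTime d → ℝ} (hfm : Measurable f)
    (hf : ∀ r, IntegrableOn f (Metric.closedBall 0 r)) :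
    Tendsto (fun n : ℕ => ∫ z, f z * stek (1 / ((n : ℝ) + 1)) g z) atTop
      (𝓝 (∫ z, f z * g z)) := by
  have hpos : ∀ n : ℕ, 0 < 1 / ((n : ℝ) + 1) := fun n => by positivity
  have hle : ∀ n : ℕ, 1 / ((n : ℝ) + 1) ≤ 1 := fun n => by
    rw [div_le_one (by positivity)]; linarith [(Nat.cast_nonneg n : (0 : ℝ) ≤ n)]
  refine tendsto_integral_of_dominated_convergence
    ((Metric.closedBall 0 (R + 1)).indicator fun z => ‖f z‖ * M) (fun n => ?_) ?_ (fun n => ?_) ?_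
  · exact (hfm.mul (hg.continuous_stek (hpos n)).measurable).aestronglyMeasurable
  · have h1 : IntegrableOn (fun z => ‖f z‖ * (M : ℝ)) (Metric.closedBall 0 (R + 1)) :=
      (hf (R + 1)).norm.mul_const _
    exact h1.integrable_indicator measurableSet_closedBall
  · refine Eventually.of_forall fun z => ?_
    by_cases hz : z ∈ Metric.closedBall 0 (R + 1)
    · rw [indicator_of_mem hz, norm_mul]
      gcongr
      exact hg.norm_stek_le (hpos n) z
    · rw [indicator_of_notMem hz]
      rw [mem_closedBall_zero_iff, not_le] at hz
      rw [hg.stek_supp (hpos n) (hle n) z hz]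
      simp
  · filter_upwards [hg.ae_tendsto_stek] with z hz
    exact (tendsto_const_nhds.mul hz)

/-- Discrete integration by parts in time. -/
theorem integral_mul_timeDeriv_stek (hg : IsTest g M L R) {h : ℝ} (hh : 0 < h)
    {u : SpaceTime d → ℝ} (hu : Continuous u) :
    -(∫ z, u z * timeDeriv (stek h g) z) = h⁻¹ * ∫ z, g z * (u z - u (z.1 - h, z.2)) := by
  have hvg : ∀ v : SpaceTime d → ℝ, Continuous v → Integrable fun z => v z * g z := by
    intro v hv
    have h1 : IntegrableOn v (Metric.closedBall 0 R) :=
      hv.continuousOn.integrableOn_compact (isCompact_closedBall 0 R)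
    have h2 : Integrable fun z => (Metric.closedBall 0 R).indicator v z * g z :=
      (h1.integrable_indicator measurableSet_closedBall).mul_bdd (c := M)
        hg.measurable.aestronglyMeasurable (Eventually.of_forall hg.norm_le)
    refine h2.congr (Eventually.of_forall fun z => ?_)
    by_cases hz : z ∈ Metric.closedBall 0 R
    · simp only [indicator_of_mem hz]
    · simp only [indicator_of_notMem hz]
      rw [mem_closedBall_zero_iff, not_le] at hz
      rw [hg.supp z hz]; simp
  have : (volume : Measure (SpaceTime d)).IsAddHaarMeasure := isAddHaarMeasure_spaceTime d
  have hz : ∀ z : SpaceTime d, z + (h, 0) = (z.1 + h, z.2) := fun z => by ext <;> simp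
  have hshift : Continuous fun z : SpaceTime d => u (z.1 - h, z.2) := hu.comp (by fun_prop)
  have e1 : ∫ z : SpaceTime d, u z * g (z.1 + h, z.2) = ∫ z, u (z.1 - h, z.2) * g z := by
    rw [← integral_add_right_eq_self (fun z : SpaceTime d => u (z.1 - h, z.2) * g z) ((h, 0) : SpaceTime d)]
    refine integral_congr_ae (Eventually.of_forall fun z => ?_)
    simp only [hz, add_sub_cancel_right]
  have i1 : Integrable fun z : SpaceTime d => u z * g (z.1 + h, z.2) := by
    have := (hvg _ hshift).comp_add_right ((h, 0) : SpaceTime d)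
    refine this.congr (Eventually.of_forall fun z => ?_)
    simp only [hz, add_sub_cancel_right]
  calc -(∫ z, u z * timeDeriv (stek h g) z)
      = -(∫ z, h⁻¹ * (u z * g (z.1 + h, z.2) - u z * g z)) := by
        congr 1
        refine integral_congr_ae ?_
        filter_upwards [hg.ae_timeDeriv_stek hh] with z hz
        rw [hz]; ring
    _ = h⁻¹ * ((∫ z, u z * g z) - ∫ z, u (z.1 - h, z.2) * g z) := by
        rw [integral_const_mul, integral_sub i1 (hvg u hu), e1]; ring
    _ = _ := by
        rw [← integral_sub (hvg u hu) (hvg _ hshift)]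
        congr 1
        refine integral_congr_ae (Eventually.of_forall fun z => ?_)
        simp only
        ring

end IsTest

end Steklov

end

section

open Filter Topology

variable {d : ℕ}

theorem measurable_matVec {a : SpaceTime d → Matrix (Fin d) (Fin d) ℝ} {ξ : SpaceTime d → Space d}
    (ha : ∀ i j, Measurable fun z => a z i j) (hξ : Measurable ξ) :
    Measurable fun z => matVec (a z) (ξ z) := by
  refine (PiLp.continuous_toLp 2 _).measurable.comp (measurable_pi_iff.2 fun i => ?_)
  have hξj : ∀ j, Measurable fun z => ξ z j := fun j =>
    (show Measurable fun x : Space d => x j by fun_prop).comp hξ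
  have : Measurable fun z => ∑ j, a z i j * ξ z j :=
    Finset.measurable_sum _ fun j _ => (ha i j).mul (hξj j)
  exact this

theorem inner_spaceGrad (φ : SpaceTime d → ℝ) (z : SpaceTime d) (v : Space d) :
    inner ℝ v (spaceGrad φ z) = fderiv ℝ (fun x => φ (z.1, x)) z.2 v := by
  rw [spaceGrad, gradient, real_inner_comm, InnerProductSpace.toDual_symm_apply]

theorem norm_le_sum_abs (x : Space d) : ‖x‖ ≤ ∑ i, |x i| := by
  rw [EuclideanSpace.norm_eq]
  refine Real.sqrt_le_iff.2 ⟨by positivity, ?_⟩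
  simpa using Finset.sum_sq_le_sq_sum_of_nonneg (s := Finset.univ) (f := fun i => |x i|)
    fun i _ => abs_nonneg _

theorem lipschitzWith_ramp_norm (r : ℝ) :
    LipschitzWith 1 fun z : SpaceTime d => ramp r (r + 1) ‖z‖ := by
  have := (lipschitzWith_ramp (by linarith : r < r + 1)).comp (lipschitzWith_one_norm (E := SpaceTime d))
  have e : (1 / (r + 1 - r)).toNNReal * 1 = 1 := by simp
  rw [e] at this
  exact this

theorem hasCompactSupport_of_norm {φ : SpaceTime d → ℝ} {r : ℝ} (h : ∀ z, r < ‖z‖ → φ z = 0) :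
    HasCompactSupport φ :=
  HasCompactSupport.of_support_subset_isCompact (isCompact_closedBall 0 r) fun z hz => by
    by_contra hc
    rw [mem_closedBall_zero_iff, not_le] at hc
    exact hz (h z hc)

section Subsolution

variable {a : SpaceTime d → Matrix (Fin d) (Fin d) ℝ} {b : SpaceTime d → Space d}
  {f u : SpaceTime d → ℝ}

theorem IsLipschitzWeakSubsolution.locLip (hu : IsLipschitzWeakSubsolution a b f u) : LocLip u :=
  ⟨hu.continuous, hu.gradient_locally_bounded⟩

theorem IsLipschitzWeakSubsolution.integrableOn_zero_order (hu : IsLipschitzWeakSubsolution a b f u)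
    (r : ℝ) : IntegrableOn f (Metric.closedBall 0 r) ∧
      IntegrableOn (fun z => inner ℝ (b z) (spaceGrad u z)) (Metric.closedBall 0 r) := by
  obtain ⟨-, -, h1, h2, -⟩ := hu.weak_inequality (fun z => ramp r (r + 1) ‖z‖)
    ⟨1, lipschitzWith_ramp_norm r⟩
    (hasCompactSupport_of_norm (r := r + 1) fun z hz => ramp_eq_zero (by linarith) hz.le)
    fun z => ramp_nonneg _ _ _
  constructor
  · refine h2.integrableOn.congr_fun (fun z hz => ?_) measurableSet_closedBall
    rw [mem_closedBall_zero_iff] at hz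
    simp only [ramp_eq_one (by linarith : r < r + 1) hz, mul_one]
  · refine h1.integrableOn.congr_fun (fun z hz => ?_) measurableSet_closedBall
    rw [mem_closedBall_zero_iff] at hz
    simp only [ramp_eq_one (by linarith : r < r + 1) hz, mul_one]

theorem IsLipschitzWeakSubsolution.integrableOn_flux (hu : IsLipschitzWeakSubsolution a b f u)
    (ha : ∀ i j, Measurable fun z => a z i j) (r : ℝ) :
    IntegrableOn (fun z => matVec (a z) (spaceGrad u z)) (Metric.closedBall 0 r) := by
  have hm := measurable_matVec ha (measurable_spaceGrad hu.continuous)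
  have hcomp : ∀ j : Fin d, IntegrableOn (fun z => matVec (a z) (spaceGrad u z) j)
      (Metric.closedBall 0 |r|) := by
    intro j
    obtain ⟨s, hs⟩ : ∃ s : ℝ, s = |r| + 1 := ⟨_, rfl⟩
    have hs0 : 0 < s := by rw [hs]; positivity
    have hcoord : ∀ z : SpaceTime d, |z.2 j| ≤ ‖z‖ := fun z =>
      ((Real.norm_eq_abs _).symm.le.trans (PiLp.norm_apply_le z.2 j)).trans (le_max_right _ _)
    have hv : LipschitzWith 1 fun z : SpaceTime d => z.2 j + (s + 1) := by
      refine LipschitzWith.of_dist_le_mul fun z z' => ?_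
      have := hcoord (z - z')
      rw [Real.dist_eq, add_sub_add_right_eq_sub, NNReal.coe_one, one_mul, dist_eq_norm]
      simpa using this
    have hM : ∀ z ∈ Metric.ball (0 : SpaceTime d) (s + 1), |z.2 j + (s + 1)| ≤ 2 * (s + 1) := by
      intro z hz
      rw [mem_ball_zero_iff] at hz
      have := abs_le.1 ((hcoord z).trans hz.le)
      rw [abs_le]; constructor <;> linarith
    have hlip := lipschitzWith_mul_of_locally hv.lipschitzOnWith hM (lipschitzWith_ramp_norm s)
      (fun z => by rw [abs_of_nonneg (ramp_nonneg _ _ _)]; exact ramp_le_one _ _ _)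
      (fun z hz => by
        rw [mem_ball_zero_iff, not_lt] at hz
        exact ramp_eq_zero (by linarith) hz)
    obtain ⟨-, h1, -⟩ := hu.weak_inequality _ ⟨_, hlip⟩
      (hasCompactSupport_of_norm (r := s + 1) fun z hz => by
        simp only [ramp_eq_zero (by linarith : s < s + 1) hz.le, mul_zero])
      (fun z => by
        rcases le_or_gt ‖z‖ (s + 1) with hz | hz
        · have := abs_le.1 ((hcoord z).trans hz)
          exact mul_nonneg (by linarith) (ramp_nonneg _ _ _)
        · simp only [ramp_eq_zero (by linarith : s < s + 1) hz.le, mul_zero]; exact le_rfl)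
    refine h1.integrableOn.congr_fun (fun z hz => ?_) measurableSet_closedBall
    rw [mem_closedBall_zero_iff] at hz
    simp only [inner_spaceGrad]
    have hev : (fun x : Space d => (x j + (s + 1)) * ramp s (s + 1) ‖(z.1, x)‖) =ᶠ[𝓝 z.2]
        fun x => x j + (s + 1) := by
      have hc : Continuous fun x : Space d => ‖(z.1, x)‖ := by fun_prop
      have hz' : ‖(z.1, z.2)‖ < s := by rw [hs]; exact lt_of_le_of_lt hz (by linarith)
      filter_upwards [hc.continuousAt.eventually (gt_mem_nhds hz')] with x hx
      rw [ramp_eq_one (by linarith : s < s + 1) hx.le, mul_one]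
    rw [hev.fderiv_eq]
    have hp : HasFDerivAt (fun x : Space d => x j + (s + 1))
        (EuclideanSpace.proj j : Space d →L[ℝ] ℝ) z.2 :=
      ((EuclideanSpace.proj j : Space d →L[ℝ] ℝ).hasFDerivAt).add_const _
    rw [hp.fderiv]
    rfl
  have hsum : IntegrableOn (fun z => ∑ j, |matVec (a z) (spaceGrad u z) j|)
      (Metric.closedBall 0 |r|) := integrable_finsetSum _ fun j _ => (hcomp j).abs
  refine IntegrableOn.mono_set (Integrable.mono' hsum hm.aestronglyMeasurable
    (Eventually.of_forall fun z => norm_le_sum_abs _))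
    (Metric.closedBall_subset_closedBall (le_abs_self r))

/-- The weak inequality for discontinuous-in-time test functions, with the time derivative as a
limit of difference quotients. -/
theorem IsLipschitzWeakSubsolution.limit_inequality (hu : IsLipschitzWeakSubsolution a b f u)
    (ha : ∀ i j, Measurable fun z => a z i j) (hb : Measurable b) (hf : Measurable f)
    {g : SpaceTime d → ℝ} {M L : ℝ≥0} {R : ℝ} (hg : IsTest g M L R) {c : ℕ → ℝ} {c0 : ℝ}
    (hc : Tendsto c atTop (𝓝 c0))
    (hcle : ∀ n : ℕ, c n ≤ (1 / ((n : ℝ) + 1))⁻¹ *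
      ∫ z, g z * (u z - u (z.1 - 1 / ((n : ℝ) + 1), z.2))) :
    c0 ≤ -(∫ z, inner ℝ (matVec (a z) (spaceGrad u z)) (spaceGrad g z)) +
      (∫ z, inner ℝ (b z) (spaceGrad u z) * g z) + ∫ z, f z * g z := by
  have hum := measurable_spaceGrad hu.continuous
  have t1 := hg.tendsto_integral_grad (measurable_matVec ha hum) (hu.integrableOn_flux ha)
  have t2 := hg.tendsto_integral_mul (hb.inner hum) fun r => (hu.integrableOn_zero_order r).2
  have t3 := hg.tendsto_integral_mul hf fun r => (hu.integrableOn_zero_order r).1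
  refine le_of_tendsto_of_tendsto' hc ((t1.neg.add t2).add t3) fun n => ?_
  have hpos : 0 < 1 / ((n : ℝ) + 1) := by positivity
  have hle : 1 / ((n : ℝ) + 1) ≤ 1 := by
    rw [div_le_one (by positivity)]; linarith [(Nat.cast_nonneg n : (0 : ℝ) ≤ n)]
  obtain ⟨-, -, -, -, h⟩ := hu.weak_inequality _ (hg.stek_lipschitz hpos)
    (hg.hasCompactSupport_stek hpos hle) (hg.stek_nonneg hpos)
  rw [hg.integral_mul_timeDeriv_stek hpos hu.continuous] at h
  exact (hcle n).trans h

end Subsolution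

theorem spaceGrad_eq_of_differentiableAt {φ : SpaceTime d → ℝ} {z : SpaceTime d}
    (h : DifferentiableAt ℝ φ z) :
    spaceGrad φ z = (InnerProductSpace.toDual ℝ (Space d)).symm
      ((fderiv ℝ φ z).comp (ContinuousLinearMap.inr ℝ ℝ (Space d))) := by
  rw [spaceGrad, gradient]
  congr 1
  have h1 : HasFDerivAt (fun x : Space d => (z.1, x)) (ContinuousLinearMap.inr ℝ ℝ (Space d)) z.2 :=
    hasFDerivAt_prodMk_right z.1 z.2
  exact (HasFDerivAt.comp z.2 (g := φ) (f := fun x : Space d => (z.1, x)) h.hasFDerivAt h1).fderiv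

/-- Nonnegativity of the divergence, tested with Lipschitz functions. -/
theorem DivNonneg.lipschitz {v : SpaceTime d → Space d} (hv : DivNonneg v) (hvm : Measurable v)
    (hvi : ∀ r, IntegrableOn v (Metric.closedBall 0 r)) {φ : SpaceTime d → ℝ} {L : ℝ≥0}
    (hφ : LipschitzWith L φ) (hc : HasCompactSupport φ) (h0 : ∀ z, 0 ≤ φ z) :
    ∫ z, inner ℝ (v z) (spaceGrad φ z) ≤ 0 := by
  have : (volume : Measure (SpaceTime d)).IsAddHaarMeasure := isAddHaarMeasure_spaceTime d
  obtain ⟨φk, K, M, hK, hsm, hsupp, -, hnn, -, -, hL, -, hgrad⟩ :=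
    exists_smooth_approx_of_lipschitz volume hφ hc
  obtain ⟨r, hr⟩ := hK.isBounded.subset_closedBall 0
  have hcs : ∀ k, HasCompactSupport (φk k) := fun k =>
    HasCompactSupport.of_support_subset_isCompact hK ((subset_tsupport _).trans (hsupp k))
  have hlip : ∀ k, LipschitzWith L (φk k) := fun k =>
    lipschitzWith_of_nnnorm_fderiv_le ((hsm k).differentiable (by simp)) fun x => by
      have := hL k x; exact_mod_cast this
  have hlip' : ∀ k t, LipschitzWith L fun x => φk k (t, x) := fun k t => by
    have := (hlip k).comp (LipschitzWith.prodMk_left t)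
    rw [mul_one] at this
    exact this
  refine le_of_tendsto' (tendsto_integral_of_dominated_convergence
    ((Metric.closedBall 0 r).indicator fun z => ‖v z‖ * L) (fun k => ?_) ?_ (fun k => ?_) ?_)
    fun k => hv (φk k) (hsm k) (hcs k) (hnn h0 k)
  · exact (hvm.inner (measurable_spaceGrad (hlip k).continuous)).aestronglyMeasurable
  · have h1 : IntegrableOn (fun z => ‖v z‖ * (L : ℝ)) (Metric.closedBall 0 r) :=
      (hvi r).norm.mul_const _
    exact h1.integrable_indicator measurableSet_closedBall
  · refine Eventually.of_forall fun z => ?_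
    by_cases hz : z ∈ Metric.closedBall 0 r
    · rw [indicator_of_mem hz]
      refine (norm_inner_le_norm _ _).trans ?_
      gcongr
      exact norm_spaceGrad_le (hlip' k) z
    · rw [indicator_of_notMem hz]
      rw [mem_closedBall_zero_iff, not_le] at hz
      rw [spaceGrad_eq_zero_of_supp (R := r) (fun z' hz' => ?_) hz]
      · simp
      · by_contra hne
        have := hr (hsupp k (subset_tsupport _ hne))
        rw [mem_closedBall_zero_iff] at this
        linarith
  · filter_upwards [hgrad, hφ.ae_differentiableAt] with z hz hd
    refine tendsto_const_nhds.inner ?_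
    have e : ∀ k, spaceGrad (φk k) z = (InnerProductSpace.toDual ℝ (Space d)).symm
        ((fderiv ℝ (φk k) z).comp (ContinuousLinearMap.inr ℝ ℝ (Space d))) := fun k =>
      spaceGrad_eq_of_differentiableAt ((hsm k).differentiable (by simp) z)
    simp only [e, spaceGrad_eq_of_differentiableAt hd]
    refine ((InnerProductSpace.toDual ℝ (Space d)).symm.continuous.tendsto _).comp ?_
    have hcomp : Continuous fun T : SpaceTime d →L[ℝ] ℝ =>
        T.comp (ContinuousLinearMap.inr ℝ ℝ (Space d)) := by fun_prop
    exact (hcomp.tendsto _).comp hz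

/-- Nonnegativity of the divergence, tested with functions that jump in time. -/
theorem DivNonneg.isTest {v : SpaceTime d → Space d} (hv : DivNonneg v) (hvm : Measurable v)
    (hvi : ∀ r, IntegrableOn v (Metric.closedBall 0 r)) {g : SpaceTime d → ℝ} {M L : ℝ≥0} {R : ℝ}
    (hg : IsTest g M L R) : ∫ z, inner ℝ (v z) (spaceGrad g z) ≤ 0 := by
  refine le_of_tendsto' (hg.tendsto_integral_grad hvm hvi) fun n => ?_
  have hpos : 0 < 1 / ((n : ℝ) + 1) := by positivity
  have hle : 1 / ((n : ℝ) + 1) ≤ 1 := by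
    rw [div_le_one (by positivity)]; linarith [(Nat.cast_nonneg n : (0 : ℝ) ≤ n)]
  obtain ⟨K, hK⟩ := hg.stek_lipschitz hpos
  exact hv.lipschitz hvm hvi hK (hg.hasCompactSupport_stek hpos hle) (hg.stek_nonneg hpos)

end

section

open Filter Topology

variable {d : ℕ}

section Coefficients

variable {a : SpaceTime d → Matrix (Fin d) (Fin d) ℝ}

theorem matVec_smul (A : Matrix (Fin d) (Fin d) ℝ) (c : ℝ) (ξ : Space d) :
    matVec A (c • ξ) = c • matVec A ξ := by
  simp only [matVec, WithLp.ofLp_smul, Matrix.mulVec_smul, WithLp.toLp_smul]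

theorem quadForm_smul (A : Matrix (Fin d) (Fin d) ℝ) (c : ℝ) (ξ : Space d) :
    quadForm A (c • ξ) = c ^ 2 * quadForm A ξ := by
  rw [quadForm, matVec_smul, inner_smul_left, inner_smul_right, quadForm]
  simp only [conj_trivial]; ring

theorem exists_unit_smul {ξ : Space d} (hξ : ξ ≠ 0) : ∃ e : Space d, ‖e‖ = 1 ∧ ξ = ‖ξ‖ • e :=
  ⟨‖ξ‖⁻¹ • ξ, by rw [norm_smul, norm_inv, norm_norm, inv_mul_cancel₀ (norm_ne_zero_iff.2 hξ)],
    by rw [smul_smul, mul_inv_cancel₀ (norm_ne_zero_iff.2 hξ), one_smul]⟩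

theorem lam_le (z : SpaceTime d) {e : Space d} (he : ‖e‖ = 1) :
    lam a z.2 ≤ ENNReal.ofReal (quadForm (a z) e) :=
  (iInf_le _ z.1).trans ((iInf_le _ e).trans (iInf_le _ he))

theorem le_mu (z : SpaceTime d) {e : Space d} (he : ‖e‖ = 1) :
    ENNReal.ofReal (‖matVec (a z) e‖ ^ 2) / ENNReal.ofReal (quadForm (a z) e) ≤ mu a z.2 :=
  le_iSup_of_le z.1 (le_iSup_of_le e (le_iSup_of_le he le_rfl))

theorem exists_unit (hd : 1 ≤ d) : ∃ e : Space d, ‖e‖ = 1 :=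
  ⟨EuclideanSpace.single ⟨0, hd⟩ 1, by simp⟩

theorem lam_ne_top (hd : 1 ≤ d) (x : Space d) : lam a x ≠ ⊤ := by
  obtain ⟨e, he⟩ := exists_unit hd
  exact ne_top_of_le_ne_top ENNReal.ofReal_ne_top (lam_le (0, x) he)

theorem lam_toReal_mul_le (hd : 1 ≤ d) (z : SpaceTime d) (h0 : lam a z.2 ≠ 0) (ξ : Space d) :
    (lam a z.2).toReal * ‖ξ‖ ^ 2 ≤ quadForm (a z) ξ := by
  rcases eq_or_ne ξ 0 with rfl | hξ
  · simp [quadForm]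
  obtain ⟨e, he, hξe⟩ := exists_unit_smul hξ
  have h1 := lam_le (a := a) z he
  have hpos : 0 < quadForm (a z) e := by
    by_contra hc
    rw [ENNReal.ofReal_of_nonpos (not_lt.1 hc)] at h1
    exact h0 (le_antisymm h1 zero_le)
  have h2 : (lam a z.2).toReal ≤ quadForm (a z) e :=
    (ENNReal.le_ofReal_iff_toReal_le (lam_ne_top hd _) hpos.le).1 h1
  have h3 : quadForm (a z) ξ = ‖ξ‖ ^ 2 * quadForm (a z) e := by
    conv_lhs => rw [hξe, quadForm_smul]
  rw [h3, mul_comm]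
  gcongr

theorem sq_norm_matVec_le (z : SpaceTime d) (h0 : lam a z.2 ≠ 0) (hμ : mu a z.2 ≠ ⊤)
    (ξ : Space d) : ‖matVec (a z) ξ‖ ^ 2 ≤ (mu a z.2).toReal * quadForm (a z) ξ := by
  rcases eq_or_ne ξ 0 with rfl | hξ
  · have : matVec (a z) (0 : Space d) = 0 := by simp [matVec]
    simp [this, quadForm]
  obtain ⟨e, he, hξe⟩ := exists_unit_smul hξ
  have h1 := lam_le (a := a) z he
  have hpos : 0 < quadForm (a z) e := by
    by_contra hc
    rw [ENNReal.ofReal_of_nonpos (not_lt.1 hc)] at h1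
    exact h0 (le_antisymm h1 zero_le)
  have h2 := le_mu (a := a) z he
  rw [ENNReal.div_le_iff (by simpa using hpos) ENNReal.ofReal_ne_top,
    ← ENNReal.ofReal_toReal hμ, ← ENNReal.ofReal_mul ENNReal.toReal_nonneg,
    ENNReal.ofReal_le_ofReal_iff (mul_nonneg ENNReal.toReal_nonneg hpos.le)] at h2
  have h3 : quadForm (a z) ξ = ‖ξ‖ ^ 2 * quadForm (a z) e := by
    conv_lhs => rw [hξe, quadForm_smul]
  have h4 : ‖matVec (a z) ξ‖ ^ 2 = ‖ξ‖ ^ 2 * ‖matVec (a z) e‖ ^ 2 := by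
    conv_lhs => rw [hξe, matVec_smul, norm_smul, norm_norm, mul_pow]
  rw [h3, h4]
  nlinarith [sq_nonneg ‖ξ‖]

theorem lam_le_mu (hd : 1 ≤ d) (x : Space d) : lam a x ≤ mu a x := by
  rcases eq_or_ne (lam a x) 0 with h0 | h0
  · rw [h0]; exact zero_le
  obtain ⟨e, he⟩ := exists_unit hd
  have h1 := lam_le (a := a) (0, x) he
  have hpos : 0 < quadForm (a (0, x)) e := by
    by_contra hc
    rw [ENNReal.ofReal_of_nonpos (not_lt.1 hc)] at h1
    exact h0 (le_antisymm h1 zero_le)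
  refine h1.trans (le_trans ?_ (le_mu (a := a) (0, x) he))
  rw [ENNReal.le_div_iff_mul_le (Or.inl (by simpa using hpos)) (Or.inl ENNReal.ofReal_ne_top),
    ← ENNReal.ofReal_mul hpos.le]
  refine ENNReal.ofReal_le_ofReal ?_
  have h2 : quadForm (a (0, x)) e ≤ ‖matVec (a (0, x)) e‖ := by
    have := real_inner_le_norm e (matVec (a (0, x)) e)
    rwa [he, one_mul] at this
  nlinarith

end Coefficients

section LocLip

variable {u : SpaceTime d → ℝ}

theorem LocLip.exists_bound (hu : LocLip u) (R : ℝ) :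
    ∃ M : ℝ, ∀ z : SpaceTime d, ‖z‖ ≤ R → |u z| ≤ M := by
  obtain ⟨M, hM⟩ := (isCompact_closedBall (0 : SpaceTime d) R).exists_bound_of_continuousOn
    hu.continuous.continuousOn
  exact ⟨M, fun z hz => hM z (mem_closedBall_zero_iff.2 hz)⟩

theorem LocLip.comp (hu : LocLip u) {F F' : ℝ → ℝ} (hF : ∀ s, HasDerivAt F (F' s) s)
    (hF' : Continuous F') : LocLip fun z => F (u z) := by
  have hFc : Continuous F := continuous_iff_continuousAt.2 fun s => (hF s).continuousAt
  refine ⟨hFc.comp hu.continuous, fun R => ?_⟩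
  obtain ⟨L, hL⟩ := hu.lip R
  obtain ⟨M, hM⟩ := hu.exists_bound R
  obtain ⟨B, hB⟩ := (isCompact_Icc (a := -M) (b := M)).exists_bound_of_continuousOn hF'.continuousOn
  have hlip : LipschitzOnWith B.toNNReal F (Icc (-M) M) := by
    refine (convex_Icc _ _).lipschitzOnWith_of_nnnorm_hasDerivWithin_le
      (fun s _ => (hF s).hasDerivWithinAt) fun s hs => ?_
    rw [← NNReal.coe_le_coe, coe_nnnorm]
    exact (hB s hs).trans (Real.le_coe_toNNReal B)
  refine ⟨B.toNNReal * L, fun t ht => hlip.comp (hL t ht) fun x hx => ?_⟩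
  have hz : ‖(t, x)‖ ≤ R := by
    rw [Prod.norm_def]
    exact max_le (abs_le.2 ht) (mem_ball_zero_iff.1 hx).le
  exact abs_le.1 (hM (t, x) hz)

theorem LocLip.lipschitzWith_mul (hu : LocLip u) {ζ : Space d → ℝ} {Lζ : ℝ≥0}
    (hζ : LipschitzWith Lζ ζ) (hζ0 : ∀ x, 0 ≤ ζ x) (hζ1 : ∀ x, ζ x ≤ 1) {R : ℝ}
    (hs : ∀ x ∉ Metric.ball 0 R, ζ x = 0) :
    ∃ L : ℝ≥0, ∀ t ∈ Icc (-R) R, LipschitzWith L fun x => u (t, x) * ζ x := by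
  obtain ⟨L, hL⟩ := hu.lip R
  obtain ⟨M, hM⟩ := hu.exists_bound R
  refine ⟨L + M.toNNReal * Lζ, fun t ht => lipschitzWith_mul_of_locally (hL t ht) (fun x hx => ?_) hζ
    (fun x => by rw [abs_of_nonneg (hζ0 x)]; exact hζ1 x) hs⟩
  refine hM (t, x) ?_
  rw [Prod.norm_def]
  exact max_le (abs_le.2 ht) (mem_ball_zero_iff.1 hx).le

theorem HasCompactSupport.exists_ball {ζ : Space d → ℝ} (hc : HasCompactSupport ζ) :
    ∃ R : ℝ, 0 < R ∧ ∀ x ∉ Metric.ball 0 R, ζ x = 0 := by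
  obtain ⟨R, hR⟩ := hc.isBounded.subset_ball 0
  refine ⟨max R 1, by positivity, fun x hx => ?_⟩
  by_contra hne
  exact hx (Metric.ball_subset_ball (le_max_left _ _) (hR (subset_tsupport _ hne)))

theorem LocLip.mul_cutoff (hu : LocLip u) {ζ : Space d → ℝ} {Lζ : ℝ≥0}
    (hζ : LipschitzWith Lζ ζ) (hζ0 : ∀ x, 0 ≤ ζ x) (hζ1 : ∀ x, ζ x ≤ 1) (hc : HasCompactSupport ζ) :
    LocLip fun z => u z * ζ z.2 := by
  refine ⟨hu.continuous.mul (hζ.continuous.comp continuous_snd), fun R => ?_⟩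
  obtain ⟨R0, hR0, hs⟩ := hc.exists_ball
  obtain ⟨L, hL⟩ := hu.lipschitzWith_mul hζ hζ0 hζ1 (R := max R R0)
    fun x hx => hs x fun hx' => hx (Metric.ball_subset_ball (le_max_right _ _) hx')
  refine ⟨L, fun t ht => (hL t ⟨?_, ht.2.trans (le_max_left _ _)⟩).lipschitzOnWith⟩
  linarith [ht.1, le_max_left R R0]

/-- The test function `k ζ` restricted to the times in `(T₁, T₂]`. -/
noncomputable def slabTest (T1 T2 : ℝ) (k : SpaceTime d → ℝ) (ζ : Space d → ℝ) (z : SpaceTime d) : ℝ :=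
  (Ioc T1 T2 ×ˢ (univ : Set (Space d))).indicator (fun z => k z * ζ z.2) z

theorem slabTest_of_mem {T1 T2 t : ℝ} (ht : t ∈ Ioc T1 T2) (k : SpaceTime d → ℝ) (ζ : Space d → ℝ)
    (x : Space d) : slabTest T1 T2 k ζ (t, x) = k (t, x) * ζ x :=
  indicator_of_mem (show (t, x) ∈ Ioc T1 T2 ×ˢ (univ : Set (Space d)) from ⟨ht, mem_univ _⟩) _

theorem slabTest_of_notMem {T1 T2 t : ℝ} (ht : t ∉ Ioc T1 T2) (k : SpaceTime d → ℝ) (ζ : Space d → ℝ)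
    (x : Space d) : slabTest T1 T2 k ζ (t, x) = 0 :=
  indicator_of_notMem (fun h => ht h.1) _

theorem spaceGrad_slabTest (T1 T2 : ℝ) (k : SpaceTime d → ℝ) (ζ : Space d → ℝ) :
    spaceGrad (slabTest T1 T2 k ζ) = (Ioc T1 T2 ×ˢ (univ : Set (Space d))).indicator
      (spaceGrad fun z => k z * ζ z.2) := by
  funext z
  by_cases hz : z.1 ∈ Ioc T1 T2
  · rw [indicator_of_mem (show z ∈ Ioc T1 T2 ×ˢ (univ : Set (Space d)) from ⟨hz, mem_univ _⟩)]
    simp only [spaceGrad, slabTest_of_mem hz]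
  · rw [indicator_of_notMem fun h => hz h.1]
    simp only [spaceGrad, slabTest_of_notMem hz, gradient, fderiv_fun_const]
    simp

theorem LocLip.isTest (hk : LocLip u) (h0 : ∀ z, 0 ≤ u z) {ζ : Space d → ℝ} {Lζ : ℝ≥0}
    (hζ : LipschitzWith Lζ ζ) (hζ0 : ∀ x, 0 ≤ ζ x) (hζ1 : ∀ x, ζ x ≤ 1) (hc : HasCompactSupport ζ)
    (T1 T2 : ℝ) : ∃ (M L : ℝ≥0) (R : ℝ), IsTest (slabTest T1 T2 u ζ) M L R := by
  obtain ⟨R0, hR0, hs⟩ := hc.exists_ball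
  obtain ⟨R, hR⟩ : ∃ R : ℝ, R = max R0 (max |T1| |T2|) := ⟨_, rfl⟩
  have hT : Ioc T1 T2 ⊆ Icc (-R) R := by
    intro t ht
    have h1 : |T1| ≤ R := by rw [hR]; exact (le_max_left _ _).trans (le_max_right _ _)
    have h2 : |T2| ≤ R := by rw [hR]; exact (le_max_right _ _).trans (le_max_right _ _)
    exact ⟨by linarith [(abs_le.1 h1).1, ht.1], by linarith [(abs_le.1 h2).2, ht.2]⟩
  have hsR : ∀ x ∉ Metric.ball (0 : Space d) R, ζ x = 0 := fun x hx =>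
    hs x fun hx' => hx (Metric.ball_subset_ball (by rw [hR]; exact le_max_left _ _) hx')
  obtain ⟨L, hL⟩ := hk.lipschitzWith_mul hζ hζ0 hζ1 hsR
  obtain ⟨M, hM⟩ := hk.exists_bound R
  have hkζ := hk.mul_cutoff hζ hζ0 hζ1 hc
  have hS : MeasurableSet (Ioc T1 T2 ×ˢ (univ : Set (Space d))) :=
    measurableSet_Ioc.prod MeasurableSet.univ
  refine ⟨M.toNNReal, L, R, ⟨hkζ.continuous.measurable.indicator hS, ?_, ?_, ?_, ?_, ?_, ?_⟩⟩
  · rw [spaceGrad_slabTest]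
    exact (measurable_spaceGrad hkζ.continuous).indicator hS
  · exact fun z => indicator_nonneg (fun z _ => mul_nonneg (h0 z) (hζ0 _)) z
  · intro z
    by_cases hz : z.1 ∈ Ioc T1 T2
    · rw [show slabTest T1 T2 u ζ z = u z * ζ z.2 from slabTest_of_mem hz u ζ z.2]
      by_cases hx : z.2 ∈ Metric.ball 0 R
      · have hb := hM z (by
          rw [Prod.norm_def]; exact max_le (abs_le.2 (hT hz)) (mem_ball_zero_iff.1 hx).le)
        rw [abs_of_nonneg (h0 z)] at hb
        calc u z * ζ z.2 ≤ u z * 1 := by gcongr; exacts [h0 z, hζ1 _]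
          _ ≤ M := by rw [mul_one]; exact hb
          _ ≤ _ := Real.le_coe_toNNReal M
      · rw [hsR _ hx, mul_zero]; positivity
    · rw [show slabTest T1 T2 u ζ z = 0 from slabTest_of_notMem hz u ζ z.2]; positivity
  · intro z hz
    by_cases ht : z.1 ∈ Ioc T1 T2
    · rw [show slabTest T1 T2 u ζ z = u z * ζ z.2 from slabTest_of_mem ht u ζ z.2, hsR, mul_zero]
      intro hx
      refine absurd hz (not_lt.2 ?_)
      rw [Prod.norm_def]
      exact max_le (abs_le.2 (hT ht)) (mem_ball_zero_iff.1 hx).le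
    · exact slabTest_of_notMem ht u ζ z.2
  · intro t
    by_cases ht : t ∈ Ioc T1 T2
    · simp only [slabTest_of_mem ht]; exact hL t (hT ht)
    · simp only [slabTest_of_notMem ht]; exact (LipschitzWith.const 0).weaken zero_le
  · have h1 := hkζ.ae_differentiableAt
    rw [Measure.volume_eq_prod, Measure.ae_prod_iff_ae_ae hkζ.measurableSet_differentiableAt,
      Measure.ae_ae_comm hkζ.measurableSet_differentiableAt] at h1
    filter_upwards [h1] with x hx
    filter_upwards [hx] with t htx
    by_cases ht : t ∈ Ioc T1 T2
    · simp only [slabTest_of_mem ht]; exact htx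
    · simp only [slabTest_of_notMem ht]; exact differentiableAt_const _

end LocLip

theorem sub_le_of_monotone_deriv {Φ ψ : ℝ → ℝ} (hΦ : ∀ s, HasDerivAt Φ (ψ s) s) (hψ : Monotone ψ)
    (r s : ℝ) : Φ r - Φ s ≤ ψ r * (r - s) := by
  have hc : Continuous Φ := continuous_iff_continuousAt.2 fun s => (hΦ s).continuousAt
  rcases lt_trichotomy s r with h | h | h
  · obtain ⟨c, hc1, hc2⟩ := exists_hasDerivAt_eq_slope Φ ψ h hc.continuousOn fun x _ => hΦ x
    have h1 : ψ c ≤ ψ r := hψ hc1.2.le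
    rw [hc2, div_le_iff₀ (by linarith)] at h1
    exact h1
  · simp [h]
  · obtain ⟨c, hc1, hc2⟩ := exists_hasDerivAt_eq_slope Φ ψ h hc.continuousOn fun x _ => hΦ x
    have h1 : ψ r ≤ ψ c := hψ hc1.1.le
    rw [hc2, le_div_iff₀ (by linarith)] at h1
    linarith

theorem integrableOn_slab {H : SpaceTime d → ℝ} (hH : Continuous H) {R : ℝ}
    (hs : ∀ z : SpaceTime d, z.2 ∉ Metric.ball 0 R → H z = 0) (T1 T2 : ℝ) :
    IntegrableOn H (Ioc T1 T2 ×ˢ (univ : Set (Space d))) := by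
  have h1 : IntegrableOn H (Icc T1 T2 ×ˢ Metric.closedBall (0 : Space d) R) :=
    hH.continuousOn.integrableOn_compact (isCompact_Icc.prod (isCompact_closedBall 0 R))
  refine h1.of_forall_sdiff_eq_zero (measurableSet_Ioc.prod MeasurableSet.univ) fun z hz => hs z ?_
  intro hx
  exact hz.2 ⟨Ioc_subset_Icc_self hz.1.1, Metric.ball_subset_closedBall hx⟩

/-- The inequality for convex functions of a subsolution. -/
theorem IsLipschitzWeakSubsolution.convex_inequality {a : SpaceTime d → Matrix (Fin d) (Fin d) ℝ}
    {b : SpaceTime d → Space d} {f u : SpaceTime d → ℝ} (hu : IsLipschitzWeakSubsolution a b f u)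
    (ha : ∀ i j, Measurable fun z => a z i j) (hb : Measurable b) (hf : Measurable f)
    {Φ ψ ψ' : ℝ → ℝ} (hΦ : ∀ s, HasDerivAt Φ (ψ s) s) (hψ : ∀ s, HasDerivAt ψ (ψ' s) s)
    (hψ' : Continuous ψ') (hψ0 : ∀ s, 0 ≤ ψ s) (hψ'0 : ∀ s, 0 ≤ ψ' s)
    {ζ : Space d → ℝ} {Lζ : ℝ≥0} (hζ : LipschitzWith Lζ ζ) (hζ0 : ∀ x, 0 ≤ ζ x)
    (hζ1 : ∀ x, ζ x ≤ 1) (hc : HasCompactSupport ζ) {T1 T2 : ℝ} (hT : T1 ≤ T2) :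
    (∫ x, Φ (u (T2, x)) * ζ x) - (∫ x, Φ (u (T1, x)) * ζ x) ≤
      -(∫ z, inner ℝ (matVec (a z) (spaceGrad u z))
          (spaceGrad (slabTest T1 T2 (fun z => ψ (u z)) ζ) z)) +
        (∫ z, inner ℝ (b z) (spaceGrad u z) * slabTest T1 T2 (fun z => ψ (u z)) ζ z) +
        ∫ z, f z * slabTest T1 T2 (fun z => ψ (u z)) ζ z := by
  have hΦc : Continuous Φ := continuous_iff_continuousAt.2 fun s => (hΦ s).continuousAt
  have hψc : Continuous ψ := continuous_iff_continuousAt.2 fun s => (hψ s).continuousAt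
  have hψm : Monotone ψ := monotone_of_hasDerivAt_nonneg hψ hψ'0
  obtain ⟨M, L, R, hg⟩ := (hu.locLip.comp hψ hψ').isTest (fun z => hψ0 _) hζ hζ0 hζ1 hc T1 T2
  obtain ⟨R0, hR0, hs⟩ := hc.exists_ball
  obtain ⟨P, hP⟩ : ∃ P : ℝ → ℝ, P = fun t => ∫ x, Φ (u (t, x)) * ζ x := ⟨_, rfl⟩
  have hPc : Continuous P := by
    have e : P = fun t => ∫ x in Metric.closedBall (0 : Space d) R0, Φ (u (t, x)) * ζ x := by
      rw [hP]
      funext t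
      refine (setIntegral_eq_integral_of_forall_compl_eq_zero fun x hx => ?_).symm
      rw [hs x fun h => hx (Metric.ball_subset_closedBall h), mul_zero]
    rw [e]
    refine continuous_parametric_integral_of_continuous (f := fun t x => Φ (u (t, x)) * ζ x) ?_
      (isCompact_closedBall 0 R0)
    exact (hΦc.comp hu.continuous).mul (hζ.continuous.comp continuous_snd)
  have hPi : ∀ x y, IntervalIntegrable P volume x y := fun x y => hPc.intervalIntegrable x y
  have hlim : ∀ T : ℝ, Tendsto (fun n : ℕ => (1 / ((n : ℝ) + 1))⁻¹ *
      ∫ t in T - 1 / ((n : ℝ) + 1)..T, P t) atTop (𝓝 (P T)) := by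
    intro T
    have h1 := (hPc.integral_hasStrictDerivAt T T).hasDerivAt.tendsto_slope_zero
    have h2 : Tendsto (fun n : ℕ => -(1 / ((n : ℝ) + 1))) atTop (𝓝[≠] 0) := by
      refine tendsto_nhdsWithin_iff.2 ⟨?_, Eventually.of_forall fun n => ?_⟩
      · have h3 := (tendsto_one_div_add_atTop_nhds_zero_nat (𝕜 := ℝ)).neg
        rwa [neg_zero] at h3
      · have : (0 : ℝ) < 1 / ((n : ℝ) + 1) := by positivity
        simp only [mem_compl_iff, mem_singleton_iff]; linarith
    refine (h1.comp h2).congr fun n => ?_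
    simp only [Function.comp, intervalIntegral.integral_same, sub_zero, smul_eq_mul]
    rw [intervalIntegral.integral_symm, inv_neg, ← sub_eq_add_neg]; ring
  have hlim2 := (hlim T2).sub (hlim T1)
  rw [hP] at hlim2
  refine hu.limit_inequality ha hb hf hg hlim2 fun n => ?_
  rw [← hP]
  obtain ⟨h, hh⟩ : ∃ h : ℝ, h = 1 / ((n : ℝ) + 1) := ⟨_, rfl⟩
  have hpos : 0 < h := by rw [hh]; positivity
  rw [← hh, ← mul_sub]
  refine mul_le_mul_of_nonneg_left ?_ (inv_nonneg.2 hpos.le)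
  have hS : MeasurableSet (Ioc T1 T2 ×ˢ (univ : Set (Space d))) :=
    measurableSet_Ioc.prod MeasurableSet.univ
  have hshift : Continuous fun z : SpaceTime d => u (z.1 - h, z.2) := hu.continuous.comp (by fun_prop)
  have hζc : Continuous fun z : SpaceTime d => ζ z.2 := hζ.continuous.comp continuous_snd
  have i0 : ∀ v : SpaceTime d → ℝ, Continuous v →
      IntegrableOn (fun z : SpaceTime d => v z * ζ z.2) (Ioc T1 T2 ×ˢ (univ : Set (Space d))) :=
    fun v hv => integrableOn_slab (hv.mul hζc)
      (fun z hz => by change v z * ζ z.2 = 0; rw [hs _ hz, mul_zero]) T1 T2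
  have i1 := i0 (fun z => Φ (u z) - Φ (u (z.1 - h, z.2)))
    ((hΦc.comp hu.continuous).sub (hΦc.comp hshift))
  have i2 := i0 (fun z => ψ (u z) * (u z - u (z.1 - h, z.2)))
    ((hψc.comp hu.continuous).mul (hu.continuous.sub hshift))
  calc (∫ t in T2 - h..T2, P t) - ∫ t in T1 - h..T1, P t
      = ∫ t in T1..T2, (P t - P (t - h)) := by
        have hPs : Continuous fun t => P (t - h) := hPc.comp (by fun_prop)
        rw [intervalIntegral.integral_sub (hPi _ _) (hPs.intervalIntegrable _ _),
          intervalIntegral.integral_comp_sub_right (fun t => P t) h]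
        have h1 := intervalIntegral.integral_add_adjacent_intervals (hPi T1 (T2 - h)) (hPi (T2 - h) T2)
        have h2 := intervalIntegral.integral_add_adjacent_intervals (hPi (T1 - h) T1) (hPi T1 (T2 - h))
        linarith
    _ = ∫ z in Ioc T1 T2 ×ˢ (univ : Set (Space d)),
        (Φ (u z) - Φ (u (z.1 - h, z.2))) * ζ z.2 := by
        rw [intervalIntegral.integral_of_le hT, Measure.volume_eq_prod,
          setIntegral_prod _ i1]
        refine setIntegral_congr_fun measurableSet_Ioc fun t _ => ?_
        have hc1 : ∀ s, Integrable fun x => Φ (u (s, x)) * ζ x := fun s => by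
          refine Continuous.integrable_of_hasCompactSupport ?_ ?_
          · exact (hΦc.comp (hu.continuous.comp (by fun_prop))).mul hζ.continuous
          · exact hc.mul_left
        simp only [hP, Measure.restrict_univ, sub_mul]
        rw [integral_sub (hc1 t) (hc1 (t - h))]
    _ ≤ ∫ z in Ioc T1 T2 ×ˢ (univ : Set (Space d)),
        (ψ (u z) * (u z - u (z.1 - h, z.2))) * ζ z.2 := by
        refine setIntegral_mono_on i1 i2 hS fun z _ => ?_
        exact mul_le_mul_of_nonneg_right (sub_le_of_monotone_deriv hΦ hψm _ _) (hζ0 _)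
    _ = _ := by
        rw [← integral_indicator hS]
        refine integral_congr_ae (Eventually.of_forall fun z => ?_)
        simp only [slabTest, indicator]
        split_ifs <;> ring

end

section

open Filter Topology

variable {d : ℕ}

theorem IsTest.integrable_inner {g : SpaceTime d → ℝ} {M L : ℝ≥0} {R : ℝ} (hg : IsTest g M L R)
    {F : SpaceTime d → Space d} (hFm : Measurable F)
    (hF : ∀ r, IntegrableOn F (Metric.closedBall 0 r)) :
    Integrable fun z => inner ℝ (F z) (spaceGrad g z) := by
  have h1 : Integrable ((Metric.closedBall (0 : SpaceTime d) R).indicator fun z => ‖F z‖ * L) :=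
    IntegrableOn.integrable_indicator (((hF R).norm).mul_const _) measurableSet_closedBall
  refine h1.mono' (hFm.inner hg.measurable_grad).aestronglyMeasurable
    (Eventually.of_forall fun z => ?_)
  by_cases hz : z ∈ Metric.closedBall 0 R
  · rw [indicator_of_mem hz]
    exact (norm_inner_le_norm _ _).trans
      (mul_le_mul_of_nonneg_left (norm_spaceGrad_le hg.lip z) (norm_nonneg _))
  · rw [indicator_of_notMem hz, spaceGrad_eq_zero_of_supp hg.supp, inner_zero_right, norm_zero]
    rwa [mem_closedBall_zero_iff, not_le] at hz

theorem IsTest.integrable_mul {g : SpaceTime d → ℝ} {M L : ℝ≥0} {R : ℝ} (hg : IsTest g M L R)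
    {F : SpaceTime d → ℝ} (hFm : Measurable F) (hF : ∀ r, IntegrableOn F (Metric.closedBall 0 r)) :
    Integrable fun z => F z * g z := by
  have h1 : Integrable ((Metric.closedBall (0 : SpaceTime d) R).indicator fun z => ‖F z‖ * M) :=
    IntegrableOn.integrable_indicator (((hF R).norm).mul_const _) measurableSet_closedBall
  refine h1.mono' (hFm.mul hg.measurable).aestronglyMeasurable (Eventually.of_forall fun z => ?_)
  by_cases hz : z ∈ Metric.closedBall 0 R
  · rw [indicator_of_mem hz, norm_mul]
    exact mul_le_mul_of_nonneg_left (hg.norm_le z) (norm_nonneg _)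
  · rw [indicator_of_notMem hz, hg.supp, mul_zero, norm_zero]
    rwa [mem_closedBall_zero_iff, not_le] at hz

theorem lintegral_le_of_integral_le {α : Type*} [MeasurableSpace α] {ν : Measure α} {Z : α → ℝ}
    {E Y : α → ℝ≥0∞} (hZ : Integrable Z ν) (hE : AEMeasurable E ν) (hY : AEMeasurable Y ν)
    (hEt : ∀ᵐ z ∂ν, E z ≠ ⊤) (hZEY : ∀ᵐ z ∂ν, Y z ≠ ⊤ → Z z + (E z).toReal ≤ (Y z).toReal)
    {P1 P2 : ℝ} (hP1 : 0 ≤ P1) (hP2 : 0 ≤ P2) (hP : P2 - P1 ≤ ∫ z, Z z ∂ν) :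
    ENNReal.ofReal P2 + ∫⁻ z, E z ∂ν ≤ ENNReal.ofReal P1 + ∫⁻ z, Y z ∂ν := by
  by_cases hYt : ∫⁻ z, Y z ∂ν = ⊤
  · rw [hYt, add_top]; exact le_top
  have hYi := integrable_toReal_of_lintegral_ne_top hY hYt
  have hYf : ∀ᵐ z ∂ν, Y z ≠ ⊤ := (ae_lt_top' hY hYt).mono fun z hz => hz.ne
  have hEle : ∀ᵐ z ∂ν, (E z).toReal ≤ (Y z).toReal - Z z := by
    filter_upwards [hYf, hZEY] with z h1 h2
    linarith [h2 h1]
  have hEi : Integrable (fun z => (E z).toReal) ν := by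
    refine (hYi.sub hZ).mono' hE.ennreal_toReal.aestronglyMeasurable ?_
    filter_upwards [hEle] with z hz
    rw [Real.norm_of_nonneg ENNReal.toReal_nonneg]
    exact hz
  have h1 : ∫ z, (E z).toReal ∂ν ≤ (∫ z, (Y z).toReal ∂ν) - ∫ z, Z z ∂ν := by
    rw [← integral_sub hYi hZ]
    exact integral_mono_ae hEi (hYi.sub hZ) hEle
  have e1 : ∫⁻ z, E z ∂ν = ENNReal.ofReal (∫ z, (E z).toReal ∂ν) := by
    rw [ofReal_integral_eq_lintegral_ofReal hEi (Eventually.of_forall fun z => ENNReal.toReal_nonneg)]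
    exact lintegral_congr_ae (hEt.mono fun z hz => (ENNReal.ofReal_toReal hz).symm)
  have e2 : ∫⁻ z, Y z ∂ν = ENNReal.ofReal (∫ z, (Y z).toReal ∂ν) := by
    rw [ofReal_integral_eq_lintegral_ofReal hYi (Eventually.of_forall fun z => ENNReal.toReal_nonneg)]
    exact lintegral_congr_ae (hYf.mono fun z hz => (ENNReal.ofReal_toReal hz).symm)
  have n1 : 0 ≤ ∫ z, (E z).toReal ∂ν := integral_nonneg fun z => ENNReal.toReal_nonneg
  have n2 : 0 ≤ ∫ z, (Y z).toReal ∂ν := integral_nonneg fun z => ENNReal.toReal_nonneg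
  rw [e1, e2, ← ENNReal.ofReal_add hP2 n1, ← ENNReal.ofReal_add hP1 n2]
  exact ENNReal.ofReal_le_ofReal (by linarith)

theorem integral_two_mul_combination {α : Type*} [MeasurableSpace α] {ν : Measure α}
    {F₁ F₂ F₃ F₄ : α → ℝ} (h₁ : Integrable F₁ ν) (h₂ : Integrable F₂ ν) (h₃ : Integrable F₃ ν)
    (h₄ : Integrable F₄ ν) : ∫ z, 2 * (-F₁ z + F₂ z + F₃ z - F₄ z) ∂ν =
      2 * (-(∫ z, F₁ z ∂ν) + (∫ z, F₂ z ∂ν) + (∫ z, F₃ z ∂ν) - ∫ z, F₄ z ∂ν) := by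
  have h₅ : Integrable (fun z => -F₁ z) ν := h₁.neg
  have h₆ : Integrable (fun z => -F₁ z + F₂ z) ν := h₅.add h₂
  have h₇ : Integrable (fun z => -F₁ z + F₂ z + F₃ z) ν := h₆.add h₃
  rw [integral_const_mul, integral_sub h₇ h₄, integral_add h₆ h₃, integral_add h₅ h₂, integral_neg]

theorem inner_spaceGrad_comp_mul_sq {u : SpaceTime d → ℝ} {F : ℝ → ℝ} {F' : ℝ} {η : Space d → ℝ}
    {z : SpaceTime d} (hu : DifferentiableAt ℝ (fun x => u (z.1, x)) z.2)
    (hη : DifferentiableAt ℝ η z.2) (hF : HasDerivAt F F' (u z)) (v : Space d) :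
    inner ℝ v (spaceGrad (fun z => F (u z) * η z.2 ^ 2) z) =
      F' * inner ℝ v (spaceGrad u z) * η z.2 ^ 2 +
        2 * F (u z) * η z.2 * inner ℝ v (gradient η z.2) := by
  have h1 : HasFDerivAt (fun x => F (u (z.1, x))) (F' • fderiv ℝ (fun x => u (z.1, x)) z.2) z.2 :=
    HasDerivAt.comp_hasFDerivAt z.2 (h₂ := F) hF hu.hasFDerivAt
  have h2 := h1.mul (hη.hasFDerivAt.pow 2)
  have e1 : inner ℝ v (gradient η z.2) = fderiv ℝ η z.2 v := by
    rw [gradient, real_inner_comm, InnerProductSpace.toDual_symm_apply]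
  rw [inner_spaceGrad, inner_spaceGrad, e1]
  have h3 : fderiv ℝ (fun x => F (u (z.1, x)) * η x ^ 2) z.2 = _ := h2.fderiv
  rw [h3]
  simp
  ring

theorem spaceGrad_comp {u : SpaceTime d → ℝ} {F : ℝ → ℝ} {F' : ℝ} {z : SpaceTime d}
    (hu : DifferentiableAt ℝ (fun x => u (z.1, x)) z.2) (hF : HasDerivAt F F' (u z)) :
    spaceGrad (fun z => F (u z)) z = F' • spaceGrad u z := by
  have h1 : HasFDerivAt (fun x => F (u (z.1, x))) (F' • fderiv ℝ (fun x => u (z.1, x)) z.2) z.2 :=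
    HasDerivAt.comp_hasFDerivAt z.2 (h₂ := F) hF hu.hasFDerivAt
  rw [spaceGrad, gradient, h1.fderiv, spaceGrad, gradient, map_smulₛₗ]
  simp

/-- The pointwise estimate behind the energy inequality. -/
theorem energy_density_le {W W1 W2 q l m β e f : ℝ} {F ξ G b1 b2 : Space d} (hW : 0 ≤ W)
    (hW1 : 0 ≤ W1) (hW2 : 0 ≤ W2) (hβ : W1 ≤ β * W) (hl : 0 < l) (hm : 0 ≤ m) (he : 0 ≤ e)
    (hlq : l * ‖ξ‖ ^ 2 ≤ q) (hF : ‖F‖ ^ 2 ≤ m * q) :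
    -((W1 ^ 2 + W * W2) * q * e ^ 2 + 2 * (W * W1) * e * inner ℝ F G) +
        inner ℝ (b1 + b2) ξ * (W * W1 * e ^ 2) + f * (W * W1 * e ^ 2) -
        (W * W1 * inner ℝ b2 ξ * e ^ 2 + 2 * (W ^ 2 / 2) * e * inner ℝ b2 G) +
        1 / 2 * (l * (W1 ^ 2 * ‖ξ‖ ^ 2) * e ^ 2) ≤
      4 * (W ^ 2 * (m * ‖G‖ ^ 2 + ‖b2‖ * (e * ‖G‖) + (‖b1‖ ^ 2 * l⁻¹ + β * |f|) * e ^ 2)) := by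
  have hq : 0 ≤ q := le_trans (by positivity) hlq
  have hWβ : W * W1 ≤ β * W ^ 2 := by nlinarith
  have hβW : 0 ≤ β * W ^ 2 := le_trans (by positivity) hWβ
  have t1 : -(2 * (W * W1) * e * inner ℝ F G) ≤
      1 / 4 * (W1 ^ 2 * e ^ 2 * q) + 4 * (W ^ 2 * (m * ‖G‖ ^ 2)) := by
    obtain ⟨y, hy⟩ : ∃ y, y = inner ℝ F G := ⟨_, rfl⟩
    have hy2 : y ^ 2 ≤ m * q * ‖G‖ ^ 2 := by
      have h1 : y ^ 2 ≤ (‖F‖ * ‖G‖) ^ 2 := by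
        rw [hy]; exact sq_le_sq' (abs_le.1 (abs_real_inner_le_norm F G)).1 (real_inner_le_norm F G)
      calc y ^ 2 ≤ ‖F‖ ^ 2 * ‖G‖ ^ 2 := by rw [← mul_pow]; exact h1
        _ ≤ _ := by gcongr
    rw [← hy]
    suffices h : |2 * (W * W1) * e * y| ≤
        1 / 4 * (W1 ^ 2 * e ^ 2 * q) + 4 * (W ^ 2 * (m * ‖G‖ ^ 2)) by
      linarith [(abs_le.1 h).1]
    refine abs_le_of_sq_le_sq ?_ (by positivity)
    have h2 : (2 * (W * W1) * e * y) ^ 2 ≤ (2 * (W * W1) * e) ^ 2 * (m * q * ‖G‖ ^ 2) := by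
      rw [mul_pow]; gcongr
    nlinarith [sq_nonneg (1 / 4 * (W1 ^ 2 * e ^ 2 * q) - 4 * (W ^ 2 * (m * ‖G‖ ^ 2)))]
  have t2 : inner ℝ b1 ξ * (W * W1 * e ^ 2) ≤
      1 / 4 * (l * (W1 ^ 2 * ‖ξ‖ ^ 2) * e ^ 2) + W ^ 2 * (‖b1‖ ^ 2 * l⁻¹ * e ^ 2) := by
    have h1 := real_inner_le_norm b1 ξ
    have h2 : inner ℝ b1 ξ * (W * W1 * e ^ 2) ≤ ‖b1‖ * ‖ξ‖ * (W * W1 * e ^ 2) := by gcongr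
    have h3 : 0 ≤ l⁻¹ * (e * (1 / 2 * l * W1 * ‖ξ‖ - W * ‖b1‖)) ^ 2 := by positivity
    have h4 : l⁻¹ * (e * (1 / 2 * l * W1 * ‖ξ‖ - W * ‖b1‖)) ^ 2 =
        1 / 4 * (l * (W1 ^ 2 * ‖ξ‖ ^ 2) * e ^ 2) + W ^ 2 * (‖b1‖ ^ 2 * l⁻¹ * e ^ 2) -
          ‖b1‖ * ‖ξ‖ * (W * W1 * e ^ 2) := by
      field_simp; ring
    linarith
  have t3 : f * (W * W1 * e ^ 2) ≤ W ^ 2 * (β * |f| * e ^ 2) := by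
    calc f * (W * W1 * e ^ 2) ≤ |f| * (β * W ^ 2 * e ^ 2) := by
          gcongr; exact le_abs_self f
      _ = _ := by ring
  have t4 : -(2 * (W ^ 2 / 2) * e * inner ℝ b2 G) ≤ W ^ 2 * (‖b2‖ * (e * ‖G‖)) := by
    have h1 := (abs_le.1 (abs_real_inner_le_norm b2 G)).1
    have h2 : W ^ 2 * e * (-inner ℝ b2 G) ≤ W ^ 2 * e * (‖b2‖ * ‖G‖) := by
      gcongr; linarith
    linarith
  have t5 : l * (W1 ^ 2 * ‖ξ‖ ^ 2) * e ^ 2 ≤ W1 ^ 2 * e ^ 2 * q := by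
    have : W1 ^ 2 * e ^ 2 * (l * ‖ξ‖ ^ 2) ≤ W1 ^ 2 * e ^ 2 * q := by gcongr
    linarith
  have t6 : 0 ≤ W * W2 * q * e ^ 2 := by positivity
  have n1 : 0 ≤ W ^ 2 * (‖b2‖ * (e * ‖G‖)) := by positivity
  have n2 : 0 ≤ W ^ 2 * (‖b1‖ ^ 2 * l⁻¹ * e ^ 2) := by positivity
  have n3 : 0 ≤ W ^ 2 * (β * |f| * e ^ 2) := by
    have : 0 ≤ β * W ^ 2 * (|f| * e ^ 2) := by positivity
    linarith
  rw [inner_add_left]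
  linarith

/-- The energy inequality for a convex increasing function of a subsolution. -/
theorem IsLipschitzWeakSubsolution.energyIneq {a : SpaceTime d → Matrix (Fin d) (Fin d) ℝ}
    {b b1 b2 : SpaceTime d → Space d} {f u : SpaceTime d → ℝ}
    (hu : IsLipschitzWeakSubsolution a b f u) (hd : 1 ≤ d)
    (ha : ∀ i j, Measurable fun z => a z i j) (hlm : Measurable (lam a)) (hmm : Measurable (mu a))
    (hl0 : ∀ᵐ x, lam a x ≠ 0) (hmt : ∀ᵐ x, mu a x ≠ ⊤)
    (hb1 : Measurable b1) (hb2 : Measurable b2) (hb : ∀ z, b z = b1 z + b2 z) (hf : Measurable f)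
    (hdiv : DivNonneg b2) (hvi : ∀ r, IntegrableOn b2 (Metric.closedBall 0 r))
    {W W1 W2 : ℝ → ℝ} (hW : ∀ s, HasDerivAt W (W1 s) s) (hW1 : ∀ s, HasDerivAt W1 (W2 s) s)
    (hW2c : Continuous W2) (hW0 : ∀ s, 0 ≤ W s) (hW10 : ∀ s, 0 ≤ W1 s) (hW20 : ∀ s, 0 ≤ W2 s)
    {β : ℝ≥0} (hβ : ∀ s, W1 s ≤ β * W s) :
    EnergyIneq (lam a) ![fun z => mu a z.2, fun z => ‖b2 z‖ₑ]
      (fun z => ‖b1 z‖ₑ ^ (2 : ℝ) * (lam a z.2)⁻¹ + β * ‖f z‖ₑ) fun z => W (u z) := by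
  rintro η ⟨Lη, hη⟩ hηc hη0 hη1 T1 T2 hT
  have hbm : Measurable b := by
    have : b = fun z => b1 z + b2 z := funext hb
    rw [this]; exact hb1.add hb2
  have hWc : Continuous W := continuous_iff_continuousAt.2 fun s => (hW s).continuousAt
  have hW1c : Continuous W1 := continuous_iff_continuousAt.2 fun s => (hW1 s).continuousAt
  have hΦ : ∀ s, HasDerivAt (fun s => W s ^ 2 / 2) (W s * W1 s) s := fun s => by
    have := ((hW s).pow 2).div_const 2
    refine this.congr_deriv ?_
    simp; ring
  have hψ : ∀ s, HasDerivAt (fun s => W s * W1 s) (W1 s ^ 2 + W s * W2 s) s := fun s => by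
    refine ((hW s).mul (hW1 s)).congr_deriv ?_
    ring
  have hψ'c : Continuous fun s => W1 s ^ 2 + W s * W2 s := by fun_prop
  have hψc : Continuous fun s => W s * W1 s := by fun_prop
  have hζ : LipschitzWith (2 * Lη) fun x => η x ^ 2 := by
    refine LipschitzWith.of_dist_le_mul fun x y => ?_
    have h1 := hη.dist_le_mul x y
    rw [Real.dist_eq] at h1 ⊢
    have h2 : η x ^ 2 - η y ^ 2 = (η x - η y) * (η x + η y) := by ring
    rw [h2, abs_mul, abs_of_nonneg (add_nonneg (hη0 x) (hη0 y))]
    push_cast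
    nlinarith [abs_nonneg (η x - η y), hη0 x, hη0 y, hη1 x, hη1 y]
  have hζ0 : ∀ x, 0 ≤ η x ^ 2 := fun x => by positivity
  have hζ1 : ∀ x, η x ^ 2 ≤ 1 := fun x => pow_le_one₀ (hη0 x) (hη1 x)
  have hζc : HasCompactSupport fun x => η x ^ 2 := hηc.comp_left (g := fun y : ℝ => y ^ 2) (by simp)
  obtain ⟨S, hSdef⟩ : ∃ S, S = Ioc T1 T2 ×ˢ (univ : Set (Space d)) := ⟨_, rfl⟩
  have hS : MeasurableSet S := by rw [hSdef]; exact measurableSet_Ioc.prod MeasurableSet.univ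
  obtain ⟨M, L, R, hg⟩ := (hu.locLip.comp hψ hψ'c).isTest
    (fun z => mul_nonneg (hW0 _) (hW10 _)) hζ hζ0 hζ1 hζc T1 T2
  obtain ⟨M', L', R', hk⟩ := (hu.locLip.comp hΦ hψc).isTest
    (fun z => by positivity) hζ hζ0 hζ1 hζc T1 T2
  have key := hu.convex_inequality ha hbm hf hΦ hψ hψ'c (fun s => mul_nonneg (hW0 s) (hW10 s))
    (fun s => add_nonneg (sq_nonneg _) (mul_nonneg (hW0 s) (hW20 s))) hζ hζ0 hζ1 hζc hT
  have hdivk := hdiv.isTest hb2 hvi hk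
  have hum := measurable_spaceGrad hu.continuous
  have i1 := hg.integrable_inner (measurable_matVec ha hum) (hu.integrableOn_flux ha)
  have i2 := hg.integrable_mul (hbm.inner hum) fun r => (hu.integrableOn_zero_order r).2
  have i3 := hg.integrable_mul hf fun r => (hu.integrableOn_zero_order r).1
  have i4 := hk.integrable_inner hb2 hvi
  obtain ⟨Z, hZ⟩ : ∃ Z : SpaceTime d → ℝ, Z = fun z =>
      2 * (-inner ℝ (matVec (a z) (spaceGrad u z))
          (spaceGrad (slabTest T1 T2 (fun z => W (u z) * W1 (u z)) fun x => η x ^ 2) z) +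
        inner ℝ (b z) (spaceGrad u z) *
          slabTest T1 T2 (fun z => W (u z) * W1 (u z)) (fun x => η x ^ 2) z +
        f z * slabTest T1 T2 (fun z => W (u z) * W1 (u z)) (fun x => η x ^ 2) z -
        inner ℝ (b2 z)
          (spaceGrad (slabTest T1 T2 (fun z => W (u z) ^ 2 / 2) fun x => η x ^ 2) z)) := ⟨_, rfl⟩
  have hZi : Integrable Z := by
    rw [hZ]; exact ((((i1.neg).add i2).add i3).sub i4).const_mul 2
  have hZS : ∫ z in S, Z z = ∫ z, Z z := by
    refine setIntegral_eq_integral_of_forall_compl_eq_zero fun z hz => ?_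
    have hz' : z.1 ∉ Ioc T1 T2 := fun h => hz (by rw [hSdef]; exact ⟨h, mem_univ _⟩)
    rw [hZ]
    simp only [spaceGrad_slabTest]
    rw [← hSdef, indicator_of_notMem hz, indicator_of_notMem hz,
      show slabTest T1 T2 (fun z => W (u z) * W1 (u z)) (fun x => η x ^ 2) z = 0 from
        slabTest_of_notMem hz' _ _ z.2]
    simp
  have hZval : ∫ z, Z z = 2 * (-(∫ z, inner ℝ (matVec (a z) (spaceGrad u z))
          (spaceGrad (slabTest T1 T2 (fun z => W (u z) * W1 (u z)) fun x => η x ^ 2) z)) +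
        (∫ z, inner ℝ (b z) (spaceGrad u z) *
          slabTest T1 T2 (fun z => W (u z) * W1 (u z)) (fun x => η x ^ 2) z) +
        (∫ z, f z * slabTest T1 T2 (fun z => W (u z) * W1 (u z)) (fun x => η x ^ 2) z) -
        ∫ z, inner ℝ (b2 z)
          (spaceGrad (slabTest T1 T2 (fun z => W (u z) ^ 2 / 2) fun x => η x ^ 2) z)) := by
    rw [hZ]; exact integral_two_mul_combination i1 i2 i3 i4
  have hPval : ∀ T, ∫⁻ x, ‖W (u (T, x))‖ₑ ^ (2 : ℝ) * ‖η x‖ₑ ^ (2 : ℝ) =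
      ENNReal.ofReal (2 * ∫ x, W (u (T, x)) ^ 2 / 2 * η x ^ 2) := by
    intro T
    have hi : Integrable fun x => 2 * (W (u (T, x)) ^ 2 / 2 * η x ^ 2) := by
      refine Integrable.const_mul (Continuous.integrable_of_hasCompactSupport ?_ hζc.mul_left) 2
      have h1 : Continuous fun x => W (u (T, x)) := hWc.comp (hu.continuous.comp (by fun_prop))
      exact ((h1.pow 2).div_const 2).mul hζ.continuous
    rw [← integral_const_mul, ofReal_integral_eq_lintegral_ofReal hi
      (Eventually.of_forall fun x => by positivity)]
    refine lintegral_congr fun x => ?_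
    rw [← ofReal_norm, ← ofReal_norm, ENNReal.rpow_two, ENNReal.rpow_two,
      ← ENNReal.ofReal_pow (norm_nonneg _), ← ENNReal.ofReal_pow (norm_nonneg _),
      ← ENNReal.ofReal_mul (by positivity)]
    simp only [Real.norm_eq_abs, sq_abs]
    congr 1; ring
  have hwm : Measurable fun z => ‖W (u z)‖ₑ := (hWc.comp hu.continuous).measurable.enorm
  have hηm : Measurable fun z : SpaceTime d => ‖η z.2‖ₑ :=
    (hη.continuous.measurable.comp measurable_snd).enorm
  have hGm : Measurable fun z : SpaceTime d => ‖gradient η z.2‖ₑ :=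
    (measurable_spaceGrad (w := fun z : SpaceTime d => η z.2)
      (hη.continuous.comp continuous_snd)).enorm
  have hgwm : Measurable fun z : SpaceTime d => ‖spaceGrad (fun z => W (u z)) z‖ₑ :=
    (measurable_spaceGrad (hWc.comp hu.continuous)).enorm
  have hlm' : Measurable fun z : SpaceTime d => lam a z.2 := hlm.comp measurable_snd
  have hmm' : Measurable fun z : SpaceTime d => mu a z.2 := hmm.comp measurable_snd
  have hb1n : Measurable fun z => ‖b1 z‖ₑ := hb1.enorm
  have hb2n : Measurable fun z => ‖b2 z‖ₑ := hb2.enorm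
  have hfn : Measurable fun z => ‖f z‖ₑ := hf.enorm
  obtain ⟨E, hE⟩ : ∃ E : SpaceTime d → ℝ≥0∞, E = fun z =>
      lam a z.2 * ‖spaceGrad (fun z => W (u z)) z‖ₑ ^ (2 : ℝ) * ‖η z.2‖ₑ ^ (2 : ℝ) := ⟨_, rfl⟩
  obtain ⟨Y, hY⟩ : ∃ Y : SpaceTime d → ℝ≥0∞, Y = fun z => ‖W (u z)‖ₑ ^ (2 : ℝ) *
      (mu a z.2 * ‖gradient η z.2‖ₑ ^ (2 : ℝ) + ‖b2 z‖ₑ * (‖η z.2‖ₑ * ‖gradient η z.2‖ₑ) +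
        (‖b1 z‖ₑ ^ (2 : ℝ) * (lam a z.2)⁻¹ + β * ‖f z‖ₑ) * ‖η z.2‖ₑ ^ (2 : ℝ)) := ⟨_, rfl⟩
  have hEm : Measurable E := by
    rw [hE]; exact (hlm'.mul (hgwm.pow_const _)).mul (hηm.pow_const _)
  have hYm : Measurable Y := by
    rw [hY]
    exact (hwm.pow_const _).mul (((hmm'.mul (hGm.pow_const _)).add (hb2n.mul (hηm.mul hGm))).add
      ((((hb1n.pow_const _).mul hlm'.inv).add (hfn.const_mul _)).mul (hηm.pow_const _)))
  have hfub : ∀ H : SpaceTime d → ℝ≥0∞, Measurable H →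
      ∫⁻ t in Ioo T1 T2, ∫⁻ x, H (t, x) = ∫⁻ z in S, H z := by
    intro H hH
    have h1 := lintegral_prod_set (I := Ioc T1 T2) (B := (univ : Set (Space d))) hH
    rw [hSdef, h1, restrict_Ioo_eq_restrict_Ioc]
    simp only [Measure.restrict_univ]
  have hfE := hfub E hEm
  have hfY := hfub Y hYm
  rw [hE] at hfE; rw [hY] at hfY
  simp only [Matrix.cons_val_zero, Matrix.cons_val_one]
  rw [hPval, hPval]
  refine (add_le_add_right hfE.le _).trans (le_trans ?_ (add_le_add_right (mul_le_mul' le_rfl hfY.ge) _))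
  rw [← hE, ← hY, ← lintegral_const_mul _ hYm]
  have hPn : ∀ T, 0 ≤ 2 * ∫ x, W (u (T, x)) ^ 2 / 2 * η x ^ 2 := fun T =>
    mul_nonneg zero_le_two (integral_nonneg fun x => by positivity)
  refine lintegral_le_of_integral_le hZi.integrableOn hEm.aemeasurable
    (hYm.const_mul 8).aemeasurable (Eventually.of_forall fun z => ?_) ?_ (hPn _) (hPn _) ?_
  · rw [hE]
    refine ENNReal.mul_ne_top (ENNReal.mul_ne_top (lam_ne_top hd _) ?_) ?_ <;> finiteness
  · have ae1 : ∀ᵐ z : SpaceTime d, lam a z.2 ≠ 0 :=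
      (Measure.quasiMeasurePreserving_snd (μ := (volume : Measure ℝ))).ae hl0
    have ae2 : ∀ᵐ z : SpaceTime d, mu a z.2 ≠ ⊤ :=
      (Measure.quasiMeasurePreserving_snd (μ := (volume : Measure ℝ))).ae hmt
    have ae3 : ∀ᵐ z : SpaceTime d, DifferentiableAt ℝ η z.2 :=
      (Measure.quasiMeasurePreserving_snd (μ := (volume : Measure ℝ))).ae hη.ae_differentiableAt
    rw [ae_restrict_iff' hS]
    filter_upwards [ae1, ae2, ae3, hu.locLip.ae_differentiableAt] with z h1 h2 h3 h4 hzS _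
    have hzT : z.1 ∈ Ioc T1 T2 := by rw [hSdef] at hzS; exact hzS.1
    have hlt : lam a z.2 ≠ ⊤ := lam_ne_top hd _
    have hlpos : 0 < (lam a z.2).toReal := ENNReal.toReal_pos h1 hlt
    have hd1 := inner_spaceGrad_comp_mul_sq (F := fun s => W s * W1 s) h4 h3 (hψ (u z))
      (matVec (a z) (spaceGrad u z))
    have hd2 := inner_spaceGrad_comp_mul_sq (F := fun s => W s ^ 2 / 2) h4 h3 (hΦ (u z)) (b2 z)
    have hq : inner ℝ (matVec (a z) (spaceGrad u z)) (spaceGrad u z) =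
        quadForm (a z) (spaceGrad u z) := by rw [quadForm, real_inner_comm]
    rw [hq] at hd1
    have hpt := energy_density_le (f := f z) (G := gradient η z.2) (b1 := b1 z) (b2 := b2 z)
      (hW0 (u z)) (hW10 (u z)) (hW20 (u z)) (hβ (u z)) hlpos
      (ENNReal.toReal_nonneg (a := mu a z.2)) (hη0 z.2) (lam_toReal_mul_le hd z h1 (spaceGrad u z))
      (sq_norm_matVec_le z h1 h2 (spaceGrad u z))
    have eZ : Z z = 2 * (-((W1 (u z) ^ 2 + W (u z) * W2 (u z)) * quadForm (a z) (spaceGrad u z) *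
          η z.2 ^ 2 + 2 * (W (u z) * W1 (u z)) * η z.2 *
            inner ℝ (matVec (a z) (spaceGrad u z)) (gradient η z.2)) +
        inner ℝ (b1 z + b2 z) (spaceGrad u z) * (W (u z) * W1 (u z) * η z.2 ^ 2) +
        f z * (W (u z) * W1 (u z) * η z.2 ^ 2) -
        (W (u z) * W1 (u z) * inner ℝ (b2 z) (spaceGrad u z) * η z.2 ^ 2 +
          2 * (W (u z) ^ 2 / 2) * η z.2 * inner ℝ (b2 z) (gradient η z.2))) := by
      rw [hZ]
      simp only [spaceGrad_slabTest]
      rw [← hSdef, indicator_of_mem hzS, indicator_of_mem hzS, hd1, hd2, hb z,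
        show slabTest T1 T2 (fun z => W (u z) * W1 (u z)) (fun x => η x ^ 2) z =
          W (u z) * W1 (u z) * η z.2 ^ 2 from slabTest_of_mem hzT _ _ z.2]
    have eE : (E z).toReal = (lam a z.2).toReal * (W1 (u z) ^ 2 * ‖spaceGrad u z‖ ^ 2) *
        η z.2 ^ 2 := by
      rw [hE]
      simp only [ENNReal.toReal_mul, spaceGrad_comp h4 (hW (u z)), ENNReal.rpow_two,
        ENNReal.toReal_pow, toReal_enorm, norm_smul, mul_pow, Real.norm_eq_abs, sq_abs]
    have eY : (8 * Y z).toReal = 8 * (W (u z) ^ 2 * ((mu a z.2).toReal * ‖gradient η z.2‖ ^ 2 +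
        ‖b2 z‖ * (η z.2 * ‖gradient η z.2‖) +
          (‖b1 z‖ ^ 2 * (lam a z.2).toReal⁻¹ + β * |f z|) * η z.2 ^ 2)) := by
      have f1 : mu a z.2 * ‖gradient η z.2‖ₑ ^ (2 : ℝ) ≠ ⊤ := ENNReal.mul_ne_top h2 (by finiteness)
      have f2 : ‖b2 z‖ₑ * (‖η z.2‖ₑ * ‖gradient η z.2‖ₑ) ≠ ⊤ := by finiteness
      have f3 : ‖b1 z‖ₑ ^ (2 : ℝ) * (lam a z.2)⁻¹ ≠ ⊤ :=
        ENNReal.mul_ne_top (by finiteness) (ENNReal.inv_ne_top.2 h1)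
      have f4 : β * ‖f z‖ₑ ≠ ⊤ := by finiteness
      have f5 : (‖b1 z‖ₑ ^ (2 : ℝ) * (lam a z.2)⁻¹ + β * ‖f z‖ₑ) * ‖η z.2‖ₑ ^ (2 : ℝ) ≠ ⊤ :=
        ENNReal.mul_ne_top (ENNReal.add_ne_top.2 ⟨f3, f4⟩) (by finiteness)
      rw [hY]
      simp only [ENNReal.toReal_mul]
      rw [ENNReal.toReal_add (ENNReal.add_ne_top.2 ⟨f1, f2⟩) f5, ENNReal.toReal_add f1 f2,
        ENNReal.toReal_mul (b := ‖η z.2‖ₑ ^ (2 : ℝ)), ENNReal.toReal_add f3 f4]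
      simp only [ENNReal.toReal_mul, ENNReal.rpow_two, ENNReal.toReal_pow, toReal_enorm,
        ENNReal.toReal_inv, ENNReal.coe_toReal, Real.norm_eq_abs, sq_abs, abs_of_nonneg (hη0 z.2)]
      norm_num
    rw [eZ, eE, eY]
    linarith
  · rw [hZS, hZval]
    linarith

end

section

open Filter Topology

section Regularization

/-- A smooth convex regularization of the positive part. -/
theorem exists_smooth_posPart {ε : ℝ} (hε : 0 < ε) : ∃ h h' h'' : ℝ → ℝ,
    (∀ s, HasDerivAt h (h' s) s) ∧ (∀ s, HasDerivAt h' (h'' s) s) ∧ Continuous h'' ∧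
      (∀ s, 0 ≤ h' s) ∧ (∀ s, h' s ≤ 1) ∧ (∀ s, 0 ≤ h'' s) ∧ (∀ s, max s 0 ≤ h s) ∧
      ∀ s, h s ≤ max s 0 + ε := by
  obtain ⟨D, hD⟩ : ∃ D : ℝ → ℝ, D = fun s => √(s ^ 2 + ε ^ 2) := ⟨_, rfl⟩
  have hpos : ∀ s : ℝ, 0 < s ^ 2 + ε ^ 2 := fun s => by positivity
  have hDpos : ∀ s, 0 < D s := fun s => by rw [hD]; exact Real.sqrt_pos.2 (hpos s)
  have hDsq : ∀ s, D s ^ 2 = s ^ 2 + ε ^ 2 := fun s => by rw [hD]; exact Real.sq_sqrt (hpos s).le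
  have hDc : Continuous D := by rw [hD]; fun_prop
  have hDd : ∀ s, HasDerivAt D (s / D s) s := fun s => by
    have h1 : HasDerivAt (fun s : ℝ => s ^ 2 + ε ^ 2) (2 * s) s := by
      simpa using (hasDerivAt_pow 2 s).add_const (ε ^ 2)
    have h2 := h1.sqrt (hpos s).ne'
    rw [hD]
    refine h2.congr_deriv ?_
    rw [mul_div_mul_left _ _ two_ne_zero]
  have habs : ∀ s, |s| ≤ D s := fun s => abs_le_of_sq_le_sq (by nlinarith [hDsq s]) (hDpos s).le
  have hsq : ∀ s, s * (s / D s) ≤ D s := fun s => by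
    rw [← mul_div_assoc, div_le_iff₀ (hDpos s)]
    nlinarith [hDsq s, sq_nonneg ε]
  refine ⟨fun s => (D s + s) / 2, fun s => (s / D s + 1) / 2,
    fun s => (1 * D s - s * (s / D s)) / D s ^ 2 / 2, fun s => ((hDd s).add (hasDerivAt_id s)).div_const 2,
    fun s => (((hasDerivAt_id s).div (hDd s) (hDpos s).ne').add_const 1).div_const 2, ?_, ?_, ?_, ?_,
    ?_, ?_⟩
  · have h0 : ∀ s, D s ≠ 0 := fun s => (hDpos s).ne'
    have h1 : ∀ s, D s ^ 2 ≠ 0 := fun s => pow_ne_zero 2 (h0 s)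
    fun_prop (disch := assumption)
  · intro s
    have : -1 ≤ s / D s := by rw [le_div_iff₀ (hDpos s)]; linarith [(abs_le.1 (habs s)).1]
    linarith
  · intro s
    have : s / D s ≤ 1 := by rw [div_le_one (hDpos s)]; linarith [(abs_le.1 (habs s)).2]
    linarith
  · intro s
    have := hsq s
    have h2 : 0 ≤ 1 * D s - s * (s / D s) := by linarith
    positivity
  · intro s
    have := abs_le.1 (habs s)
    exact max_le (by linarith [this.2]) (by linarith [this.1])
  · intro s
    have h1 : D s ≤ |s| + ε := by
      refine abs_le_of_sq_le_sq' ?_ (by positivity) |>.2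
      rw [hDsq]; nlinarith [abs_nonneg s, sq_abs s]
    rcases le_total 0 s with hs | hs
    · rw [max_eq_left hs]; rw [abs_of_nonneg hs] at h1; linarith
    · rw [max_eq_right hs]; rw [abs_of_nonpos hs] at h1; linarith

theorem exists_power_derivatives {h h' h'' : ℝ → ℝ} (hh : ∀ s, HasDerivAt h (h' s) s)
    (hh' : ∀ s, HasDerivAt h' (h'' s) s) (hc : Continuous h'') (h0 : ∀ s, 0 ≤ h s)
    (h0' : ∀ s, 0 ≤ h' s) (h1' : ∀ s, h' s ≤ 1) (h0'' : ∀ s, 0 ≤ h'' s) {K α : ℝ} (hK : 0 < K)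
    (hα : 1 ≤ α) : ∃ W1 W2 : ℝ → ℝ, (∀ s, HasDerivAt (fun s => (h s + K) ^ α) (W1 s) s) ∧
      (∀ s, HasDerivAt W1 (W2 s) s) ∧ Continuous W2 ∧ (∀ s, 0 ≤ W1 s) ∧ (∀ s, 0 ≤ W2 s) ∧
      ∀ s, W1 s ≤ α / K * (h s + K) ^ α := by
  have hpos : ∀ s, 0 < h s + K := fun s => by linarith [h0 s]
  have hne : ∀ s, h s + K ≠ 0 := fun s => (hpos s).ne'
  have hhc : Continuous h := continuous_iff_continuousAt.2 fun s => (hh s).continuousAt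
  have hhc' : Continuous h' := continuous_iff_continuousAt.2 fun s => (hh' s).continuousAt
  have hd : ∀ β s, HasDerivAt (fun s => (h s + K) ^ β) (h' s * β * (h s + K) ^ (β - 1)) s :=
    fun β s => ((hh s).add_const K).rpow_const (Or.inl (hne s))
  have hrc : ∀ β : ℝ, Continuous fun s => (h s + K) ^ β := fun β =>
    (hhc.add continuous_const).rpow_const fun s => Or.inl (hne s)
  have hα0 : 0 ≤ α - 1 := by linarith
  refine ⟨fun s => h' s * α * (h s + K) ^ (α - 1), fun s => h'' s * α * (h s + K) ^ (α - 1) +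
    h' s * α * (h' s * (α - 1) * (h s + K) ^ (α - 1 - 1)), hd α,
    fun s => ((hh' s).mul_const α).mul (hd (α - 1) s), ?_, fun s => ?_, fun s => ?_, fun s => ?_⟩
  · have := hrc (α - 1); have := hrc (α - 1 - 1)
    fun_prop
  · have := hpos s; have := h0' s; positivity
  · have := hpos s; have := h0' s; have := h0'' s; positivity
  · have h1 : (h s + K) ^ (α - 1) * K ≤ (h s + K) ^ α := by
      calc (h s + K) ^ (α - 1) * K ≤ (h s + K) ^ (α - 1) * (h s + K) := by
            have := hpos s
            gcongr; linarith [h0 s]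
        _ = _ := by rw [Real.rpow_sub_one (hne s), div_mul_cancel₀ _ (hne s)]
    have h2 : h' s * α * (h s + K) ^ (α - 1) ≤ 1 * α * (h s + K) ^ (α - 1) := by
      have := hpos s
      gcongr
      exact h1' s
    refine h2.trans ?_
    rw [one_mul, div_mul_eq_mul_div, le_div_iff₀ hK, mul_assoc]
    gcongr

end Regularization

theorem CoeffBound.of_subset {n : ℕ} {e : Exponents n} {N : ℝ≥0} {l : Space (n + 1) → ℝ≥0∞}
    {g V : Fin 2 → SpaceTime (n + 1) → ℝ≥0∞} {c c' : SpaceTime (n + 1)} {r s : ℝ}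
    (h : CoeffBound e N l g V c' s) (hI : Ioo (c.1 - r) (c.1 + r) ⊆ Ioo (c'.1 - s) (c'.1 + s))
    (hB : box c.2 r ⊆ box c'.2 s) : CoeffBound e N l g V c r where
  ml := h.ml
  lt := h.lt
  mg := h.mg
  mV := h.mV
  bl := (lintegral_mono_set hB).trans h.bl
  bg j := by
    refine (lintegral_mono_set hB).trans ((lintegral_mono fun x => ?_).trans (h.bg j))
    have h1 := e.hp j
    have h2 := e.hq j
    exact ENNReal.rpow_le_rpow (lintegral_mono_set hI) (by positivity)
  bV j := by
    have h1 := e.hP j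
    have h2 := e.hQ j
    refine (ENNReal.rpow_le_rpow ?_ (by positivity)).trans (h.bV j)
    refine (lintegral_mono_set hI).trans (lintegral_mono fun t => ?_)
    exact ENNReal.rpow_le_rpow (lintegral_mono_set hB) (by positivity)

theorem pcyl_subset_closedBall {d : ℕ} (c : SpaceTime d) {r : ℝ} (hr : 0 ≤ r) :
    pcyl c r ⊆ Metric.closedBall 0 (‖c‖ + (r + d * r)) := by
  intro z hz
  have h1 := box_subset_closedBall _ _ hz.2
  rw [mem_closedBall_zero_iff, Prod.norm_def]
  have hc1 : |c.1| ≤ ‖c‖ := norm_fst_le c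
  have hc2 : ‖c.2‖ ≤ ‖c‖ := norm_snd_le c
  have hdr : 0 ≤ d * r := by positivity
  refine max_le ?_ ?_
  · rw [Real.norm_eq_abs, abs_le]
    have := abs_le.1 hc1
    exact ⟨by linarith [hz.1.1], by linarith [hz.1.2]⟩
  · have h2 : ‖z.2‖ ≤ ‖c.2‖ + ‖z.2 - c.2‖ := by
      have := norm_add_le c.2 (z.2 - c.2); rwa [add_sub_cancel] at this
    rw [Metric.mem_closedBall, dist_eq_norm] at h1
    linarith

theorem volume_box_lt_top {d : ℕ} (z : Space d) (r : ℝ) : volume (box z r) < ⊤ :=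
  (measure_mono (box_subset_closedBall z r)).trans_lt (isCompact_closedBall z _).measure_lt_top

theorem LocLip.energy_ne_top {d : ℕ} {w : SpaceTime d → ℝ} (hw : LocLip w) {l : Space d → ℝ≥0∞}
    (hl : Measurable l) {c : SpaceTime d} {r : ℝ} (hr : 0 ≤ r) (hli : ∫⁻ x in box c.2 r, l x ≠ ⊤) :
    energy l w c r ≠ ⊤ := by
  obtain ⟨R, hR⟩ : ∃ R : ℝ, R = ‖c‖ + (r + d * r) + 1 := ⟨_, rfl⟩
  have hsub : pcyl c r ⊆ Metric.closedBall 0 (R - 1) := by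
    have := pcyl_subset_closedBall c hr
    rwa [hR, add_sub_cancel_right]
  obtain ⟨M, hM⟩ := hw.exists_bound R
  obtain ⟨L, hL⟩ := hw.lip R
  have hn : ∀ z ∈ pcyl c r, ‖z‖ < R := fun z hz => by
    have := mem_closedBall_zero_iff.1 (hsub hz); linarith
  refine ENNReal.add_ne_top.2 ⟨?_, ?_⟩
  · refine ne_top_of_le_ne_top (b := ENNReal.ofReal M ^ (2 : ℝ) * volume (box c.2 r))
      (ENNReal.mul_ne_top (by finiteness) (volume_box_lt_top _ _).ne) (iSup₂_le fun t ht => ?_)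
    rw [← setLIntegral_const]
    refine setLIntegral_mono measurable_const fun x hx => ?_
    rw [← ofReal_norm]
    gcongr
    exact hM (t, x) (hn (t, x) ⟨ht, hx⟩).le
  · have hb : ∀ z ∈ pcyl c r, l z.2 * ‖spaceGrad w z‖ₑ ^ (2 : ℝ) ≤ l z.2 * (L : ℝ≥0∞) ^ (2 : ℝ) := by
      intro z hz
      have hz1 := hn z hz
      rw [Prod.norm_def, max_lt_iff] at hz1
      rw [enorm_spaceGrad, ← ofReal_norm, ← ENNReal.ofReal_coe_nnreal]
      gcongr
      refine norm_fderiv_le_of_lipschitzOn ℝ (Metric.isOpen_ball.mem_nhds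
        (mem_ball_zero_iff.2 hz1.2)) (hL z.1 (abs_le.1 hz1.1.le))
    have hm : Measurable fun z : SpaceTime d => l z.2 * (L : ℝ≥0∞) ^ (2 : ℝ) :=
      (hl.comp measurable_snd).mul_const _
    refine ne_top_of_le_ne_top ?_ (setLIntegral_mono hm hb)
    rw [pcyl, lintegral_prod_set hm]
    simp only
    rw [setLIntegral_const, lintegral_mul_const _ hl]
    refine ENNReal.mul_ne_top (ENNReal.mul_ne_top hli (by finiteness)) ?_
    rw [Real.volume_Ioo]; exact ENNReal.ofReal_ne_top

/-- A subsolution together with the qualitative properties of the coefficients. -/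
structure RegularSubsolution {d : ℕ} (a : SpaceTime d → Matrix (Fin d) (Fin d) ℝ)
    (b1 b2 : SpaceTime d → Space d) (f u : SpaceTime d → ℝ) : Prop where
  sub : IsLipschitzWeakSubsolution a (fun z => b1 z + b2 z) f u
  measurable_a : ∀ i j, Measurable fun z => a z i j
  measurable_lam : Measurable (lam a)
  measurable_mu : Measurable (mu a)
  lam_ne_zero : ∀ᵐ x, lam a x ≠ 0
  mu_ne_top : ∀ᵐ x, mu a x ≠ ⊤
  measurable_b1 : Measurable b1
  measurable_b2 : Measurable b2
  measurable_f : Measurable f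
  div : DivNonneg b2
  integrable_b2 : ∀ r, IntegrableOn b2 (Metric.closedBall 0 r)
  mu_integrable : ∀ z r, r ≤ 1 / (2 * d : ℝ) → ∫⁻ x in box z r, mu a x ≠ ⊤

/-- The weights of the first-order terms in the energy inequality. -/
noncomputable def firstOrder {d : ℕ} (a : SpaceTime d → Matrix (Fin d) (Fin d) ℝ)
    (b2 : SpaceTime d → Space d) : Fin 2 → SpaceTime d → ℝ≥0∞ :=
  ![fun z => mu a z.2, fun z => ‖b2 z‖ₑ]

/-- The weights of the zero-order terms in the energy inequality. -/
noncomputable def zeroOrder {d : ℕ} (a : SpaceTime d → Matrix (Fin d) (Fin d) ℝ)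
    (b1 : SpaceTime d → Space d) (f : SpaceTime d → ℝ) (K : ℝ) : Fin 2 → SpaceTime d → ℝ≥0∞ :=
  ![fun z => ‖b1 z‖ₑ ^ (2 : ℝ) * (lam a z.2)⁻¹, fun z => ENNReal.ofReal K⁻¹ * ‖f z‖ₑ]

theorem RegularSubsolution.sq_le_mass {n : ℕ} (e : Exponents n) (N : ℝ≥0) :
    ∃ (C : ℝ≥0) (m : ℝ), 0 ≤ m ∧ ∀ (a : SpaceTime (n + 1) → Matrix (Fin (n + 1)) (Fin (n + 1)) ℝ)
      (b1 b2 : SpaceTime (n + 1) → Space (n + 1)) (f u : SpaceTime (n + 1) → ℝ)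
      (K : ℝ) (c : SpaceTime (n + 1)) (r : ℝ), RegularSubsolution a b1 b2 f u → 0 < K → 0 < r →
      r ≤ 1 / (2 * (n + 1 : ℕ) : ℝ) →
      CoeffBound e N (lam a) (firstOrder a b2) (zeroOrder a b1 f K) c r →
      ENNReal.ofReal (max (u c) 0 + K) ^ (2 : ℝ) ≤ C * ENNReal.ofReal (1 / r) ^ m *
        ∫⁻ z in pcyl c r, ENNReal.ofReal (max (u z) 0 + K) ^ (2 : ℝ) := by
  obtain ⟨C, m, hm, hC⟩ := moser_iteration e N
  refine ⟨C * 4, m, hm, fun a b1 b2 f u K c r hu hK hr hr1 hco => ?_⟩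
  obtain ⟨h, h', h'', hh, hh', hc, h0', h1', h0'', hle, hge⟩ := exists_smooth_posPart hK
  have h0 : ∀ s, 0 ≤ h s := fun s => (le_max_right s 0).trans (hle s)
  have hd : 1 ≤ n + 1 := by omega
  have hr1' : r ≤ 1 := by
    refine hr1.trans ?_
    rw [div_le_one (by positivity)]
    push_cast
    linarith [(Nat.cast_nonneg n : (0 : ℝ) ≤ n)]
  have hlip : ∀ α : ℝ, 1 ≤ α → LocLip fun z => (h (u z) + K) ^ α := by
    intro α hα
    obtain ⟨W1, W2, hW, hW1, -⟩ := exists_power_derivatives hh hh' hc h0 h0' h1' h0'' hK hα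
    exact hu.sub.locLip.comp hW (continuous_iff_continuousAt.2 fun s => (hW1 s).continuousAt)
  have key := hC (lam a) (firstOrder a b2) (zeroOrder a b1 f K) (fun z => h (u z) + K) c r hr hr1'
    hco (fun z => by linarith [h0 (u z)]) hlip ?_ ?_
  · have e1 : ∀ z, ENNReal.ofReal (max (u z) 0 + K) ≤ ‖h (u z) + K‖ₑ := fun z => by
      rw [← ofReal_norm, Real.norm_of_nonneg (by linarith [h0 (u z)])]
      exact ENNReal.ofReal_le_ofReal (by linarith [hle (u z)])
    have e2 : ∀ z, ‖h (u z) + K‖ₑ ^ (2 : ℝ) ≤ 4 * ENNReal.ofReal (max (u z) 0 + K) ^ (2 : ℝ) := by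
      intro z
      have h4 : (4 : ℝ≥0∞) = ENNReal.ofReal 2 ^ (2 : ℝ) := by
        rw [ENNReal.rpow_two, ← ENNReal.ofReal_pow (by norm_num)]; norm_num
      rw [h4, ← ENNReal.mul_rpow_of_nonneg _ _ (by norm_num), ← ENNReal.ofReal_mul (by norm_num),
        ← ofReal_norm, Real.norm_of_nonneg (by linarith [h0 (u z)])]
      gcongr
      linarith [hge (u z), le_max_right (u z) 0]
    refine (ENNReal.rpow_le_rpow (e1 c) (by norm_num)).trans (key.trans ?_)
    have hmeas : Measurable fun z => ENNReal.ofReal (max (u z) 0 + K) ^ (2 : ℝ) :=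
      (((hu.sub.continuous.max continuous_const).add continuous_const).measurable.ennreal_ofReal).pow_const _
    calc C * ENNReal.ofReal (1 / r) ^ m * mass (fun z => h (u z) + K) c r
        ≤ C * ENNReal.ofReal (1 / r) ^ m *
          (4 * ∫⁻ z in pcyl c r, ENNReal.ofReal (max (u z) 0 + K) ^ (2 : ℝ)) := by
          rw [← lintegral_const_mul _ hmeas]
          gcongr
          exact lintegral_mono fun z => e2 z
      _ = _ := by push_cast; ring
  · intro α hα
    obtain ⟨W1, W2, hW, hW1, hW2c, hW10, hW20, hWβ⟩ :=
      exists_power_derivatives hh hh' hc h0 h0' h1' h0'' hK hα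
    have hβ : ((α / K).toNNReal : ℝ) = α / K := Real.coe_toNNReal _ (by positivity)
    have := hu.sub.energyIneq hd hu.measurable_a hu.measurable_lam hu.measurable_mu hu.lam_ne_zero
      hu.mu_ne_top hu.measurable_b1 hu.measurable_b2 (fun z => rfl) hu.measurable_f hu.div
      hu.integrable_b2 hW hW1 hW2c
      (fun s => Real.rpow_nonneg (by linarith [h0 s]) _) hW10 hW20 (β := (α / K).toNNReal)
      (fun s => by rw [hβ]; exact hWβ s)
    have e : (fun z => zeroOrder a b1 f K 0 z + ENNReal.ofReal α * zeroOrder a b1 f K 1 z) =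
        fun z => ‖b1 z‖ₑ ^ (2 : ℝ) * (lam a z.2)⁻¹ + (α / K).toNNReal * ‖f z‖ₑ := by
      funext z
      simp only [zeroOrder, Matrix.cons_val_zero, Matrix.cons_val_one]
      rw [← mul_assoc, ← ENNReal.ofReal_mul (by linarith), ← div_eq_mul_inv]
      rfl
    rw [e]
    exact this
  · intro α hα
    refine (hlip α hα).energy_ne_top hu.measurable_lam hr.le ?_
    exact ne_top_of_le_ne_top (hu.mu_integrable c.2 r hr1) (lintegral_mono fun x => lam_le_mu hd x)

end

section

open Filter Topology

theorem lintegral_rpow_le_eLpNorm {α ε : Type*} [MeasurableSpace α] [ENorm ε]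
    {ν : Measure α} {B : Set α} (hB : MeasurableSet B) (hνB : ν B ≤ 1) {f : α → ℝ≥0∞}
    (hf : Measurable f) {p' : ℝ} (hp' : 0 < p') {p : ℝ≥0∞} (hp : ENNReal.ofReal p' ≤ p) {G : α → ε}
    (hG : ∀ x ∈ B, f x ≤ ‖G x‖ₑ) :
    (∫⁻ x in B, f x ^ p' ∂ν) ^ (1 / p') ≤ eLpNorm G p ν := by
  have h0 : ENNReal.ofReal p' ≠ 0 := by simpa using hp'
  have e1 : (∫⁻ x in B, f x ^ p' ∂ν) ^ (1 / p') = eLpNorm f (ENNReal.ofReal p') (ν.restrict B) := by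
    rw [eLpNorm_eq_lintegral_rpow_enorm_toReal h0 ENNReal.ofReal_ne_top,
      ENNReal.toReal_ofReal hp'.le]
    rfl
  rw [e1]
  have e2 := eLpNorm_le_eLpNorm_mul_rpow_measure_univ hp
    (hf.aestronglyMeasurable (μ := ν.restrict B))
  have e3 : eLpNorm f p (ν.restrict B) ≤ eLpNorm G p ν := by
    rw [← eLpNorm_indicator_eq_eLpNorm_restrict hB]
    refine eLpNorm_mono_enorm fun x => ?_
    by_cases hx : x ∈ B
    · rw [indicator_of_mem hx]; exact hG x hx
    · rw [indicator_of_notMem hx]; simp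
  refine e2.trans (le_trans ?_ e3)
  refine mul_le_of_le_one_right' (ENNReal.rpow_le_one ?_ ?_)
  · rwa [Measure.restrict_apply_univ]
  · rw [sub_nonneg, ENNReal.toReal_ofReal hp'.le]
    rcases eq_or_ne p ⊤ with rfl | hpt
    · simp; positivity
    · exact one_div_le_one_div_of_le hp' ((ENNReal.ofReal_le_iff_le_toReal hpt).1 hp)

theorem volume_box_le_one {d : ℕ} (z : Space d) {r : ℝ} (hr : 0 < r) (hr1 : r ≤ 1 / 2) :
    volume (box z r) ≤ 1 := by
  have h := lintegral_box z r (F := fun _ => 1) measurable_const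
  rw [setLIntegral_one, setLIntegral_one, Real.volume_pi_ball _ hr] at h
  rw [h, ENNReal.ofReal_le_one]
  exact pow_le_one₀ (by positivity) (by linarith)

theorem volume_Ioo_le_one (t : ℝ) {r : ℝ} (hr1 : r ≤ 1 / 2) : volume (Ioo (t - r) (t + r)) ≤ 1 := by
  rw [Real.volume_Ioo, ENNReal.ofReal_le_one]; linarith

theorem volume_pcyl_le_one {d : ℕ} (c : SpaceTime d) {r : ℝ} (hr : 0 < r) (hr1 : r ≤ 1 / 2) :
    volume (pcyl c r) ≤ 1 := by
  rw [pcyl, Measure.volume_eq_prod, Measure.prod_prod]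
  exact mul_le_one' (volume_Ioo_le_one _ hr1) (volume_box_le_one _ hr hr1)

theorem lintegral_le_mixedNormTX {d : ℕ} {F : Type*} [NormedAddCommGroup F] [MeasurableSpace F]
    [OpensMeasurableSpace F] {g : SpaceTime d → F} (hg : Measurable g) {p' q' : ℝ} (hp' : 0 < p')
    (hq' : 0 < q') {p q : ℝ≥0∞} (hp : ENNReal.ofReal p' ≤ p) (hq : ENNReal.ofReal q' ≤ q)
    {I : Set ℝ} {B : Set (Space d)} {S : Set (SpaceTime d)} (hI : MeasurableSet I)
    (hB : MeasurableSet B) (hI1 : volume I ≤ 1) (hB1 : volume B ≤ 1) (hS : I ×ˢ B ⊆ S) :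
    (∫⁻ t in I, (∫⁻ x in B, ‖g (t, x)‖ₑ ^ p') ^ (q' / p')) ^ (1 / q') ≤
      mixedNormTX q p (S.indicator g) := by
  have hgm : Measurable fun z : ℝ × Space d => ‖g z‖ₑ ^ p' := hg.enorm.pow_const _
  have hm : Measurable fun t => (∫⁻ x in B, ‖g (t, x)‖ₑ ^ p') ^ (1 / p') :=
    (hgm.lintegral_prod_right' (ν := volume.restrict B)).pow_const _
  have e : ∀ t, (∫⁻ x in B, ‖g (t, x)‖ₑ ^ p') ^ (q' / p') =
      ((∫⁻ x in B, ‖g (t, x)‖ₑ ^ p') ^ (1 / p')) ^ q' := fun t => by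
    rw [← ENNReal.rpow_mul, one_div_mul_eq_div]
  simp only [e]
  refine lintegral_rpow_le_eLpNorm hI hI1 hm hq' hq fun t ht => ?_
  refine lintegral_rpow_le_eLpNorm hB hB1 (hg.comp measurable_prodMk_left).enorm hp' hp fun x hx => ?_
  rw [indicator_of_mem (hS ⟨ht, hx⟩)]
  rfl

theorem lintegral_le_mixedNormXT {d : ℕ} {F : Type*} [NormedAddCommGroup F] [MeasurableSpace F]
    [OpensMeasurableSpace F] {g : SpaceTime d → F} (hg : Measurable g) {p' q' : ℝ} (hp' : 0 < p')
    (hq' : 0 < q') {p q : ℝ≥0∞} (hp : ENNReal.ofReal p' ≤ p) (hq : ENNReal.ofReal q' ≤ q)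
    {I : Set ℝ} {B : Set (Space d)} {S : Set (SpaceTime d)} (hI : MeasurableSet I)
    (hB : MeasurableSet B) (hI1 : volume I ≤ 1) (hB1 : volume B ≤ 1) (hS : I ×ˢ B ⊆ S) :
    (∫⁻ x in B, (∫⁻ t in I, ‖g (t, x)‖ₑ ^ q') ^ (p' / q')) ^ (1 / p') ≤
      mixedNormXT p q (S.indicator g) := by
  have hgm : Measurable fun z : Space d × ℝ => ‖g (z.2, z.1)‖ₑ ^ q' :=
    (hg.comp measurable_swap).enorm.pow_const _
  have hm : Measurable fun x => (∫⁻ t in I, ‖g (t, x)‖ₑ ^ q') ^ (1 / q') :=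
    (hgm.lintegral_prod_right' (ν := volume.restrict I)).pow_const _
  have e : ∀ x, (∫⁻ t in I, ‖g (t, x)‖ₑ ^ q') ^ (p' / q') =
      ((∫⁻ t in I, ‖g (t, x)‖ₑ ^ q') ^ (1 / q')) ^ p' := fun t => by
    rw [← ENNReal.rpow_mul, one_div_mul_eq_div]
  simp only [e]
  refine lintegral_rpow_le_eLpNorm hB hB1 hm hp' hp fun x hx => ?_
  refine lintegral_rpow_le_eLpNorm hI hI1 (hg.comp measurable_prodMk_right).enorm hq' hq fun t ht => ?_
  rw [indicator_of_mem (hS ⟨ht, hx⟩)]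
  rfl

section SupBound

variable {n : ℕ}

theorem box_subset_box {d : ℕ} {z z' : Space d} {r s : ℝ} (hz : z ∈ box z' s) :
    box z r ⊆ box z' (s + r) := by
  refine preimage_mono (Metric.ball_subset_ball' ?_)
  have := (Metric.mem_ball.1 hz).le
  linarith

theorem RegularSubsolution.sq_le_of_lt_two (e : Exponents n) (N : ℝ≥0) {p r0 : ℝ} (hp : 0 < p)
    (hp2 : p < 2) (hr0 : 0 < r0) (hr1 : r0 ≤ 1 / (2 * (n + 1 : ℕ) : ℝ)) :
    ∃ C : ℝ≥0, ∀ (a : SpaceTime (n + 1) → Matrix (Fin (n + 1)) (Fin (n + 1)) ℝ)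
      (b1 b2 : SpaceTime (n + 1) → Space (n + 1)) (f u : SpaceTime (n + 1) → ℝ)
      (K : ℝ) (c : SpaceTime (n + 1)), RegularSubsolution a b1 b2 f u → 0 < K →
      CoeffBound e N (lam a) (firstOrder a b2) (zeroOrder a b1 f K) c r0 →
      ENNReal.ofReal (max (u c) 0 + K) ≤
        C * (∫⁻ z in pcyl c r0, ENNReal.ofReal (max (u z) 0 + K) ^ p) ^ (1 / p) := by
  obtain ⟨C1, m, hm, h1⟩ := RegularSubsolution.sq_le_mass e N
  obtain ⟨C2, m', hm', h2⟩ := young_absorb C1 hm (δ := p / 2) (by linarith) (by linarith)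
    (ε := 1 / 2) (by norm_num)
  obtain ⟨C3, h3⟩ := hole_filling hm'
  have hr1' : r0 ≤ 1 := by
    refine hr1.trans ?_
    rw [div_le_one (by positivity)]
    push_cast
    linarith [(Nat.cast_nonneg n : (0 : ℝ) ≤ n)]
  refine ⟨(C3 * C2 * (1 / (r0 - r0 / 2)).toNNReal ^ m') ^ (1 / 2 : ℝ),
    fun a b1 b2 f u K c hu hK hco => ?_⟩
  obtain ⟨U, hU⟩ : ∃ U : SpaceTime (n + 1) → ℝ≥0∞, U = fun z => ENNReal.ofReal (max (u z) 0 + K) :=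
    ⟨_, rfl⟩
  have hUc : Continuous fun z => max (u z) 0 + K :=
    (hu.sub.continuous.max continuous_const).add continuous_const
  have hUm : Measurable U := by rw [hU]; exact hUc.measurable.ennreal_ofReal
  obtain ⟨f0, hf0⟩ : ∃ f0 : ℝ → ℝ≥0∞, f0 = fun ρ => ⨆ z ∈ pcyl c ρ, U z ^ (2 : ℝ) := ⟨_, rfl⟩
  obtain ⟨I, hI⟩ : ∃ I, I = ∫⁻ z in pcyl c r0, U z ^ p := ⟨_, rfl⟩
  obtain ⟨M, hM⟩ := (isCompact_closedBall (0 : SpaceTime (n + 1))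
    (‖c‖ + (r0 + (n + 1 : ℕ) * r0))).exists_bound_of_continuousOn hUc.continuousOn
  have hmain := h3 f0 (C2 * I ^ (2 / p)) (ENNReal.ofReal M ^ (2 : ℝ)) (r0 / 2) r0 (by linarith)
    (by finiteness) ?_ ?_
  · have hc : c ∈ pcyl c (r0 / 2) := ⟨⟨by linarith, by linarith⟩, by
      show WithLp.ofLp c.2 ∈ Metric.ball _ _
      exact Metric.mem_ball_self (by linarith)⟩
    have hle : U c ^ (2 : ℝ) ≤ f0 (r0 / 2) := by
      rw [hf0]; exact le_iSup₂ (f := fun z (_ : z ∈ pcyl c (r0 / 2)) => U z ^ (2 : ℝ)) c hc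
    have h4 := ENNReal.rpow_le_rpow (hle.trans hmain) (z := 1 / 2) (by norm_num)
    rw [← ENNReal.rpow_mul, mul_one_div_cancel two_ne_zero, ENNReal.rpow_one] at h4
    have e1 : C3 * (C2 * I ^ (2 / p)) * ENNReal.ofReal (1 / (r0 - r0 / 2)) ^ m' =
        ((C3 * C2 * (1 / (r0 - r0 / 2)).toNNReal ^ m' : ℝ≥0) : ℝ≥0∞) * I ^ (2 / p) := by
      push_cast
      rw [ENNReal.ofReal, ENNReal.coe_rpow_of_nonneg _ hm']; ring
    rw [e1, ENNReal.mul_rpow_of_nonneg _ _ (by norm_num), ← ENNReal.rpow_mul,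
      ← ENNReal.coe_rpow_of_nonneg _ (by norm_num)] at h4
    have e2 : 2 / p * (1 / 2) = 1 / p := by field_simp
    rw [e2, hI, hU] at h4
    exact h4
  · intro ρ hρ
    rw [hf0]
    refine iSup₂_le fun z hz => ENNReal.rpow_le_rpow ?_ (by norm_num)
    rw [hU]
    refine ENNReal.ofReal_le_ofReal ((le_abs_self _).trans (hM z ?_))
    exact pcyl_subset_closedBall c hr0.le (pcyl_mono hρ.2.le hz)
  · intro ρ r hρ hρr hr
    rw [hf0]
    refine iSup₂_le fun z hz => ?_
    have hs : 0 < r - ρ := by linarith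
    have hIs : Ioo (z.1 - (r - ρ)) (z.1 + (r - ρ)) ⊆ Ioo (c.1 - r) (c.1 + r) :=
      Ioo_subset_Ioo (by linarith [hz.1.1]) (by linarith [hz.1.2])
    have hBs : box z.2 (r - ρ) ⊆ box c.2 r := by
      have := box_subset_box (r := r - ρ) hz.2
      rwa [add_sub_cancel] at this
    have hco' := (hco.mono hr.le).of_subset hIs hBs
    have h5 := h1 a b1 b2 f u K z (r - ρ) hu hK hs (by linarith) hco'
    have hT : 1 ≤ ENNReal.ofReal (1 / (r - ρ)) := by
      rw [ENNReal.one_le_ofReal, le_div_iff₀ hs]; linarith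
    have h6 := h2 (ENNReal.ofReal (1 / (r - ρ))) (f0 r) (I ^ (2 / p)) hT
    have e3 : (I ^ (2 / p)) ^ (p / 2) = I := by
      rw [← ENNReal.rpow_mul, div_mul_div_cancel₀ hp.ne', div_self two_ne_zero, ENNReal.rpow_one]
    rw [e3] at h6
    have h7 : ∫⁻ y in pcyl z (r - ρ), U y ^ (2 : ℝ) ≤ f0 r ^ (1 - p / 2) * I := by
      rw [hI, ← lintegral_const_mul _ (hUm.pow_const _)]
      have hsub : pcyl z (r - ρ) ⊆ pcyl c r0 :=
        (prod_mono hIs hBs).trans (pcyl_mono hr.le)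
      refine le_trans ?_ (lintegral_mono_set hsub)
      refine setLIntegral_mono' (measurableSet_pcyl _ _) fun y hy => ?_
      have hy' : y ∈ pcyl c r := ⟨hIs hy.1, hBs hy.2⟩
      have h8 : U y ^ (2 : ℝ) ≤ f0 r := by
        rw [hf0]; exact le_iSup₂ (f := fun z (_ : z ∈ pcyl c r) => U z ^ (2 : ℝ)) y hy'
      calc U y ^ (2 : ℝ) = (U y ^ (2 : ℝ)) ^ (1 - p / 2) * U y ^ p := by
            rw [← ENNReal.rpow_mul, ← ENNReal.rpow_add_of_nonneg _ _ (by linarith) hp.le]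
            congr 1; ring
        _ ≤ _ := mul_le_mul' (ENNReal.rpow_le_rpow h8 (by linarith)) le_rfl
    calc U z ^ (2 : ℝ) ≤ C1 * ENNReal.ofReal (1 / (r - ρ)) ^ m *
          ∫⁻ y in pcyl z (r - ρ), U y ^ (2 : ℝ) := by rw [hU]; exact h5
      _ ≤ C1 * ENNReal.ofReal (1 / (r - ρ)) ^ m * (f0 r ^ (1 - p / 2) * I) := by gcongr
      _ ≤ _ := h6
      _ = _ := by rw [hf0]; ring

theorem RegularSubsolution.le_norm (e : Exponents n) (N : ℝ≥0) {p r0 : ℝ} (hp : 0 < p)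
    (hr0 : 0 < r0) (hr1 : r0 ≤ 1 / (2 * (n + 1 : ℕ) : ℝ)) :
    ∃ C : ℝ≥0, ∀ (a : SpaceTime (n + 1) → Matrix (Fin (n + 1)) (Fin (n + 1)) ℝ)
      (b1 b2 : SpaceTime (n + 1) → Space (n + 1)) (f u : SpaceTime (n + 1) → ℝ)
      (K : ℝ) (c : SpaceTime (n + 1)), RegularSubsolution a b1 b2 f u → 0 < K →
      CoeffBound e N (lam a) (firstOrder a b2) (zeroOrder a b1 f K) c r0 →
      ENNReal.ofReal (max (u c) 0) ≤
        C * ((∫⁻ z in pcyl c r0, ‖max (u z) 0‖ₑ ^ p) ^ (1 / p) + ENNReal.ofReal K) := by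
  have hr2 : r0 ≤ 1 / 2 := by
    refine hr1.trans (one_div_le_one_div_of_le two_pos ?_)
    push_cast
    linarith [(Nat.cast_nonneg n : (0 : ℝ) ≤ n)]
  obtain ⟨s, hs0, hs2, hsp⟩ : ∃ s : ℝ, 0 < s ∧ s < 2 ∧ s ≤ p :=
    ⟨min p 1, by positivity, by linarith [min_le_right p 1], min_le_left _ _⟩
  obtain ⟨C, hC⟩ := RegularSubsolution.sq_le_of_lt_two e N hs0 hs2 hr0 hr1
  have h0 : ENNReal.ofReal p ≠ 0 := by simpa using hp
  refine ⟨C * (ENNReal.LpAddConst (ENNReal.ofReal p)).toNNReal, fun a b1 b2 f u K c hu hK hco => ?_⟩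
  have hvc : Continuous fun z => max (u z) 0 := hu.sub.continuous.max continuous_const
  have hUc : Continuous fun z => max (u z) 0 + K := hvc.add continuous_const
  have hv := volume_pcyl_le_one c hr0 hr2
  obtain ⟨ν, hν⟩ : ∃ ν, ν = volume.restrict (pcyl c r0) := ⟨_, rfl⟩
  have hν1 : ν univ ≤ 1 := by rw [hν, Measure.restrict_apply_univ]; exact hv
  have eU : ∀ z, ENNReal.ofReal (max (u z) 0 + K) = ‖max (u z) 0 + K‖ₑ := fun z => by
    rw [← ofReal_norm, Real.norm_of_nonneg (by positivity)]
  have h1 : (∫⁻ z in pcyl c r0, ENNReal.ofReal (max (u z) 0 + K) ^ s) ^ (1 / s) ≤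
      eLpNorm (fun z => max (u z) 0 + K) (ENNReal.ofReal p) ν := by
    have := lintegral_rpow_le_eLpNorm (ν := ν) MeasurableSet.univ hν1
      hUc.measurable.ennreal_ofReal hs0 (ENNReal.ofReal_le_ofReal hsp)
      (G := fun z => max (u z) 0 + K) fun z _ => (eU z).le
    rw [Measure.restrict_univ] at this
    rwa [← hν]
  have h2 := eLpNorm_add_le' (μ := ν) hvc.aestronglyMeasurable
    (continuous_const (y := K)).aestronglyMeasurable (ENNReal.ofReal p)
  have h3 : eLpNorm (fun _ : SpaceTime (n + 1) => K) (ENNReal.ofReal p) ν ≤ ENNReal.ofReal K := by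
    rw [eLpNorm_const' _ h0 ENNReal.ofReal_ne_top, ← ofReal_norm, Real.norm_of_nonneg hK.le]
    exact mul_le_of_le_one_right' (ENNReal.rpow_le_one hν1 (by positivity))
  have h4 : eLpNorm (fun z => max (u z) 0) (ENNReal.ofReal p) ν =
      (∫⁻ z in pcyl c r0, ‖max (u z) 0‖ₑ ^ p) ^ (1 / p) := by
    rw [eLpNorm_eq_lintegral_rpow_enorm_toReal h0 ENNReal.ofReal_ne_top,
      ENNReal.toReal_ofReal hp.le, hν]
  calc ENNReal.ofReal (max (u c) 0) ≤ ENNReal.ofReal (max (u c) 0 + K) :=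
        ENNReal.ofReal_le_ofReal (by linarith)
    _ ≤ _ := hC a b1 b2 f u K c hu hK hco
    _ ≤ C * (ENNReal.LpAddConst (ENNReal.ofReal p) *
        ((∫⁻ z in pcyl c r0, ‖max (u z) 0‖ₑ ^ p) ^ (1 / p) + ENNReal.ofReal K)) := by
        refine mul_le_mul' le_rfl (h1.trans (h2.trans ?_))
        rw [h4]
        gcongr
    _ = _ := by
        rw [ENNReal.coe_mul, ENNReal.coe_toNNReal (ENNReal.LpAddConst_lt_top _).ne, mul_assoc]

end SupBound

end

section

open Filter Topology

/-- The interpolation exponents for a weight with integrability `x` in space and `y` in time. -/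
theorem exists_interpolation {x y c Y : ℝ} (hy : 0 ≤ y) (hyx : y ≤ x) (hx : x ≤ 1) (hY : 0 < Y)
    (hY1 : Y < 1) (hYc : Y < c) (h : x / c + y * (1 / Y - 1 / c) < 1) :
    ∃ θ : ℝ, 0 ≤ θ ∧ θ < 1 ∧ x ≤ θ * c + (1 - θ) * Y ∧ θ * c + (1 - θ) * Y ≤ 1 ∧
      y ≤ (1 - θ) * Y := by
  have hc : 0 < c := hY.trans hYc
  have h1 : x * Y + y * (c - Y) < c * Y := by
    have : x / c + y * (1 / Y - 1 / c) = (x * Y + y * (c - Y)) / (c * Y) := by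
      field_simp
    rwa [this, div_lt_one (by positivity)] at h
  have hcY : 0 < c - Y := by linarith
  have hxc : x < c := by
    have : 0 ≤ y * (c - Y) := by positivity
    exact lt_of_mul_lt_mul_right (by linarith : x * Y < c * Y) hY.le
  have hyY : y < Y := by
    have : y * Y ≤ x * Y := by gcongr
    exact lt_of_mul_lt_mul_right (by linarith : y * c < Y * c) hc.le
  rcases le_total 1 ((c - x) / (c - Y)) with hs | hs
  · refine ⟨0, le_rfl, zero_lt_one, ?_, ?_, ?_⟩
    · rw [le_div_iff₀ hcY] at hs; linarith
    · linarith
    · linarith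
  · obtain ⟨s, hs'⟩ : ∃ s, s = (c - x) / (c - Y) := ⟨_, rfl⟩
    rw [← hs'] at hs
    have hsx : s * (c - Y) = c - x := by rw [hs', div_mul_cancel₀ _ hcY.ne']
    have hs0 : 0 < s := by rw [hs']; exact div_pos (by linarith) hcY
    refine ⟨1 - s, by linarith, by linarith, by linarith, by linarith, ?_⟩
    rw [sub_sub_cancel, hs', div_mul_eq_mul_div, le_div_iff₀ hcY]
    linarith

theorem continuousAt_eventually {f : ℝ → ℝ} {x : ℝ} (hf : ContinuousAt f x) {p : ℝ → Prop}
    (hp : ∀ᶠ y in 𝓝 (f x), p y) : ∀ᶠ y in 𝓝 x, p (f y) :=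
  hf.eventually hp

theorem exists_pos_perturb {x y D : ℝ} (h : x < (1 - y) * D) :
    ∃ δ : ℝ, 0 < δ ∧ x + δ < (1 - (y + δ)) * D := by
  have h1 : ContinuousAt (fun δ : ℝ => (1 - (y + δ)) * D - (x + δ)) 0 := by fun_prop
  have h2 : ∀ᶠ δ in 𝓝 (0 : ℝ), 0 < (1 - (y + δ)) * D - (x + δ) :=
    h1.eventually (lt_mem_nhds (by simpa using h))
  obtain ⟨δ, h3, h4⟩ := ((h2.filter_mono nhdsWithin_le_nhds).and
    (self_mem_nhdsWithin : Ioi (0 : ℝ) ∈ 𝓝[>] 0)).exists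
  exact ⟨δ, h4, by linarith⟩

theorem recip_nonneg (p : ℝ≥0∞) : 0 ≤ recip p := ENNReal.toReal_nonneg

theorem recip_le_one {p : ℝ≥0∞} (hp : 1 ≤ p) : recip p ≤ 1 :=
  ENNReal.toReal_mono ENNReal.one_ne_top (ENNReal.inv_le_one.2 hp) |>.trans_eq ENNReal.toReal_one

theorem recip_anti {p q : ℝ≥0∞} (hp : 1 ≤ p) (h : p ≤ q) : recip q ≤ recip p :=
  ENNReal.toReal_mono (ENNReal.inv_ne_top.2 (by positivity)) (ENNReal.inv_le_inv.2 h)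

theorem ofReal_one_div_le {p : ℝ≥0∞} (hp : p ≠ 0) {x : ℝ} (hx : 0 < x) (h : recip p ≤ x) :
    ENNReal.ofReal (1 / x) ≤ p := by
  rw [one_div, ENNReal.ofReal_inv_of_pos hx, ENNReal.inv_le_iff_inv_le]
  exact (ENNReal.le_ofReal_iff_toReal_le (ENNReal.inv_ne_top.2 hp) hx.le).2 h

/-- The conditions on the exponents, in terms of the reciprocals `a = 1/p₀`, `x₁ = 1/p₁`,
`x₂ = 1/p₂`, `y₂ = 1/q₂` and so on. -/
structure AdmissibleRecip (d : ℕ) (a x1 x2 y2 x3 y3 x4 y4 : ℝ) (drift : Prop) : Prop where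
  lt : a < 2 / d
  mu : a + x1 < 2 / ((d : ℝ) - 1)
  b1 : drift → a / 2 + x2 < (1 / 2 - y2) * (2 / d - a)
  b2 : x3 / (2 / ((d : ℝ) - 1) - a) +
    y3 * (1 + 1 / (2 / d - a) - 1 / (2 / ((d : ℝ) - 1) - a)) < 1
  f : x4 < (1 - y4) * (2 / d - a)

theorem two_div_lt {d : ℕ} (hd : 2 ≤ d) : (2 : ℝ) / d < 2 / ((d : ℝ) - 1) := by
  have hd' : (2 : ℝ) ≤ d := by exact_mod_cast hd
  exact div_lt_div_of_pos_left two_pos (by linarith) (by linarith)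

theorem AdmissibleRecip.exists_pos {d : ℕ} (hd : 2 ≤ d) {a x1 x2 y2 x3 y3 x4 y4 : ℝ} {drift : Prop}
    (ha : 0 ≤ a) (h : AdmissibleRecip d a x1 x2 y2 x3 y3 x4 y4 drift) :
    ∃ a', 0 < a' ∧ a ≤ a' ∧ AdmissibleRecip d a' x1 x2 y2 x3 y3 x4 y4 drift := by
  have h0 : 2 / (d : ℝ) - a ≠ 0 := by linarith [h.lt]
  have h1 : 2 / ((d : ℝ) - 1) - a ≠ 0 := by linarith [h.lt, two_div_lt hd]
  have e1 : ∀ᶠ s : ℝ in 𝓝 a, s < 2 / d := gt_mem_nhds h.lt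
  have e2 : ∀ᶠ s in 𝓝 a, s + x1 < 2 / ((d : ℝ) - 1) :=
    continuousAt_eventually (x := a) (f := fun s => s + x1) (by fun_prop) (gt_mem_nhds h.mu)
  have e3 : ∀ᶠ s in 𝓝 a, drift → s / 2 + x2 < (1 / 2 - y2) * (2 / d - s) := by
    by_cases hdr : drift
    · have := (continuousAt_eventually (x := a)
        (f := fun s => (1 / 2 - y2) * (2 / d - s) - (s / 2 + x2)) (by fun_prop)
        (lt_mem_nhds (sub_pos.2 (h.b1 hdr))))
      filter_upwards [this] with s hs _
      linarith
    · exact Eventually.of_forall fun s hs => absurd hs hdr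
  have e4 : ∀ᶠ s in 𝓝 a, x3 / (2 / ((d : ℝ) - 1) - s) +
      y3 * (1 + 1 / (2 / d - s) - 1 / (2 / ((d : ℝ) - 1) - s)) < 1 :=
    continuousAt_eventually (x := a) (f := fun s => x3 / (2 / ((d : ℝ) - 1) - s) +
      y3 * (1 + 1 / (2 / d - s) - 1 / (2 / ((d : ℝ) - 1) - s))) (by fun_prop (disch := assumption))
      (gt_mem_nhds h.b2)
  have e5 : ∀ᶠ s in 𝓝 a, x4 < (1 - y4) * (2 / d - s) :=
    continuousAt_eventually (x := a) (f := fun s => (1 - y4) * (2 / d - s)) (by fun_prop) (lt_mem_nhds h.f)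
  rcases ha.eq_or_lt with rfl | hpos
  · have e6 := (e1.and (e2.and (e3.and (e4.and e5)))).filter_mono
      (nhdsWithin_le_nhds (s := Ioi (0 : ℝ)))
    obtain ⟨s, ⟨h1, h2, h3, h4, h5⟩, h6⟩ := (e6.and
      (self_mem_nhdsWithin : Ioi (0 : ℝ) ∈ 𝓝[>] 0)).exists
    exact ⟨s, h6, (mem_Ioi.1 h6).le, ⟨h1, h2, h3, h4, h5⟩⟩
  · exact ⟨a, hpos, le_rfl, h⟩

theorem admissibleRecip_of_exponents {d : ℕ} (hd : 2 ≤ d) {p0 p1 p2 q2 p3 q3 p4 q4 : ℝ≥0∞}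
    (hp0 : (d : ℝ≥0∞) / 2 < p0) (hp01 : recip p0 + recip p1 < 2 / ((d : ℝ) - 1))
    (hpq4 : (p4, q4) ∈ indexSet d p0) (h1 : (d : ℝ≥0∞) < p0 → DriftExponents1 d p0 p2 q2)
    (h2 : DriftExponents2 d p0 p3 q3) :
    AdmissibleRecip d (recip p0) (recip p1) (recip p2) (recip q2) (recip p3) (recip q3) (recip p4)
      (recip q4) ((d : ℝ≥0∞) < p0) := by
  have hd' : (2 : ℝ) ≤ d := by exact_mod_cast hd
  have hlt : recip p0 < 2 / d := by
    have hne : (d : ℝ≥0∞) ≠ 0 := by simp; omega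
    have h3 : p0⁻¹ < (d / 2 : ℝ≥0∞)⁻¹ := ENNReal.inv_lt_inv.2 hp0
    have h4 : ((d / 2 : ℝ≥0∞)⁻¹).toReal = 2 / d := by
      rw [ENNReal.toReal_inv, ENNReal.toReal_div]; simp
    rw [← h4]
    refine (ENNReal.toReal_lt_toReal h3.ne_top ?_).2 h3
    exact ENNReal.inv_ne_top.2 (ENNReal.div_ne_zero.2 ⟨hne, by simp⟩)
  refine ⟨hlt, hp01, fun h => ?_, ?_, hpq4.2.2⟩
  · exact (h1 h).2.2
  · obtain ⟨-, -, h3⟩ := h2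
    have hc := two_div_lt hd
    obtain ⟨a, ha⟩ : ∃ a, a = recip p0 := ⟨_, rfl⟩
    rw [← ha] at hlt ⊢
    have t1 : ((d : ℝ) - 1) * theta1 d p0 = 2 / (2 / ((d : ℝ) - 1) - a) := by
      have h4 : 2 / ((d : ℝ) - 1) - a ≠ 0 := by linarith
      have h5 : (d : ℝ) - 1 ≠ 0 := by linarith
      have h6 : 1 - ((d : ℝ) - 1) / 2 * a = ((d : ℝ) - 1) / 2 * (2 / ((d : ℝ) - 1) - a) := by
        field_simp
      rw [theta1, ← ha, h6, mul_inv]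
      field_simp
    have t2 : (d : ℝ) * theta2 d p0 = 2 / (2 / d - a) := by
      have h4 : 2 / (d : ℝ) - a ≠ 0 := by linarith
      have h5 : (d : ℝ) ≠ 0 := by linarith
      have h6 : 1 - (d : ℝ) / 2 * a = (d : ℝ) / 2 * (2 / d - a) := by
        field_simp
      rw [theta2, ← ha, h6, mul_inv]
      field_simp
    have t3 : 2 + theta1 d p0 + (d : ℝ) * (theta2 d p0 - theta1 d p0) =
        2 + (d : ℝ) * theta2 d p0 - ((d : ℝ) - 1) * theta1 d p0 := by ring
    rw [t3, t1, t2] at h3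
    have h7 : 2 / (2 / ((d : ℝ) - 1) - a) * recip p3 +
        (2 + 2 / (2 / d - a) - 2 / (2 / ((d : ℝ) - 1) - a)) * recip q3 =
      2 * (recip p3 / (2 / ((d : ℝ) - 1) - a) +
        recip q3 * (1 + 1 / (2 / d - a) - 1 / (2 / ((d : ℝ) - 1) - a))) := by ring
    linarith

/-- Finite exponents to which the iteration applies. -/
theorem AdmissibleRecip.exists_exponents {n : ℕ} (hn : 1 ≤ n) {a x1 x2 y2 x3 y3 x4 y4 : ℝ}
    {drift : Prop} (ha : 0 < a) (h : AdmissibleRecip (n + 1) a x1 x2 y2 x3 y3 x4 y4 drift)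
    (hx1 : 0 ≤ x1) (hx1' : x1 ≤ 1) (hx2 : 0 ≤ x2) (hy2 : 0 ≤ y2) (hy3 : 0 ≤ y3) (hyx3 : y3 ≤ x3)
    (hx3 : x3 ≤ 1) (hx4 : 0 ≤ x4) (hy4 : 0 ≤ y4) :
    ∃ e : Exponents n, e.p0 = 1 / a ∧ x1 ≤ 1 / e.p 0 ∧ x3 ≤ 1 / e.p 1 ∧ y3 ≤ 1 / e.q 1 ∧
      x4 ≤ 1 / e.P 1 ∧ y4 ≤ 1 / e.Q 1 ∧ (drift → ∃ x2' y2', 0 < x2' ∧ x2 ≤ x2' ∧ 0 < y2' ∧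
        y2 ≤ y2' ∧ 1 / e.P 0 = 2 * x2' + a ∧ 1 / e.Q 0 = 2 * y2') := by
  obtain ⟨D, hD⟩ : ∃ D : ℝ, D = 2 / ((n + 1 : ℕ) : ℝ) - a := ⟨_, rfl⟩
  obtain ⟨c, hc⟩ : ∃ c : ℝ, c = 2 / (n : ℝ) - a := ⟨_, rfl⟩
  have hn0 : (1 : ℝ) ≤ n := by exact_mod_cast hn
  have hn1 : ((n + 1 : ℕ) : ℝ) - 1 = n := by push_cast; ring
  have hcD : D < c := by
    have := two_div_lt (d := n + 1) (by omega)
    rw [hn1] at this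
    rw [hD, hc]; linarith
  have hD0 : 0 < D := by rw [hD]; linarith [h.lt]
  have hD1 : D + a ≤ 1 := by
    rw [hD, sub_add_cancel, div_le_one (by positivity)]; push_cast; linarith
  have hmu : x1 < c := by have := h.mu; rw [hn1] at this; rw [hc]; linarith
  have hb2 : x3 / c + y3 * (1 + 1 / D - 1 / c) < 1 := by
    have := h.b2; rw [hn1] at this; rw [hc, hD]; exact this
  have hf : x4 < (1 - y4) * D := by rw [hD]; exact h.f
  have hY1 : 1 / (1 - 1 / (1 + D)) = 1 + 1 / D := by
    have : 1 + D ≠ 0 := by positivity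
    have h2 : 1 - 1 / (1 + D) = D / (1 + D) := by field_simp; ring
    rw [h2]; field_simp; ring
  obtain ⟨κ, hκ1, hκ2, hκ3⟩ : ∃ κ : ℝ, 1 < κ ∧ κ < 1 + D ∧
      x3 / c + y3 * (1 / (1 - 1 / κ) - 1 / c) < 1 := by
    have hne : 1 + D ≠ 0 := by positivity
    have hne2 : 1 - 1 / (1 + D) ≠ 0 := by
      have : 1 / (1 + D) < 1 := by rw [div_lt_one (by positivity)]; linarith
      linarith
    have e1 : ∀ᶠ κ in 𝓝 (1 + D), x3 / c + y3 * (1 / (1 - 1 / κ) - 1 / c) < 1 :=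
      continuousAt_eventually (f := fun κ => x3 / c + y3 * (1 / (1 - 1 / κ) - 1 / c))
        (by fun_prop (disch := assumption)) (gt_mem_nhds (by rw [hY1]; exact hb2))
    have e2 : ∀ᶠ κ in 𝓝 (1 + D), 1 < κ := lt_mem_nhds (by linarith)
    obtain ⟨κ, ⟨h1, h2⟩, h3⟩ := (((e1.and e2).filter_mono
      (nhdsWithin_le_nhds (s := Iio (1 + D)))).and self_mem_nhdsWithin).exists
    exact ⟨κ, h2, h3, h1⟩
  obtain ⟨Y, hY⟩ : ∃ Y, Y = 1 - 1 / κ := ⟨_, rfl⟩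
  rw [← hY] at hκ3
  have hYpos : 0 < Y := by
    have : 1 / κ < 1 := by rw [div_lt_one (by positivity)]; exact hκ1
    rw [hY]; linarith
  have hYlt : Y < 1 := by
    have : 0 < 1 / κ := by positivity
    rw [hY]; linarith
  have hYD : Y < D := by
    have : Y * κ = κ - 1 := by rw [hY]; field_simp
    nlinarith
  have hYc : Y < c := hYD.trans hcD
  have hc0 : 0 < c := hYpos.trans hYc
  obtain ⟨θ, hθ0, hθ1, hθx, hθ1', hθy⟩ := exists_interpolation (x := x1) (y := 0) le_rfl hx1 hx1'
    hYpos hYlt hYc (by rw [zero_mul, add_zero, div_lt_one hc0]; exact hmu)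
  obtain ⟨τ, hτ0, hτ1, hτx, hτ1', hτy⟩ := exists_interpolation hy3 hyx3 hx3 hYpos hYlt hYc hκ3
  obtain ⟨δ, hδ, hδf⟩ := exists_pos_perturb hf
  have hyδ : y4 + δ < 1 := by
    by_contra hcon
    have : (1 - (y4 + δ)) * D ≤ 0 := mul_nonpos_of_nonpos_of_nonneg (by linarith) hD0.le
    linarith
  have hxδ : x4 + δ < 1 := by
    have : (1 - (y4 + δ)) * D ≤ 1 * D := by gcongr; linarith
    linarith
  obtain ⟨X0, Y0, hX0, hY0, hX01, hY01, hXY, hdr⟩ : ∃ X0 Y0 : ℝ, 0 < X0 ∧ 0 < Y0 ∧ X0 ≤ 1 ∧ Y0 ≤ 1 ∧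
      X0 < (1 - Y0) * D ∧ (drift → ∃ x2' y2', 0 < x2' ∧ x2 ≤ x2' ∧ 0 < y2' ∧ y2 ≤ y2' ∧
        X0 = 2 * x2' + a ∧ Y0 = 2 * y2') := by
    by_cases hdrift : drift
    · have h1 : 2 * x2 + a < (1 - 2 * y2) * D := by
        have := h.b1 hdrift
        rw [← hD] at this
        linarith
      obtain ⟨s, hs, hsf⟩ := exists_pos_perturb h1
      have hy1 : 2 * y2 + s < 1 := by
        by_contra hcon
        have : (1 - (2 * y2 + s)) * D ≤ 0 := mul_nonpos_of_nonpos_of_nonneg (by linarith) hD0.le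
        linarith
      have hx1 : 2 * x2 + a + s < 1 := by
        have : (1 - (2 * y2 + s)) * D ≤ 1 * D := by gcongr; linarith
        linarith
      exact ⟨2 * x2 + a + s, 2 * y2 + s, by linarith, by linarith, hx1.le, hy1.le, hsf,
        fun _ => ⟨x2 + s / 2, y2 + s / 2, by linarith, by linarith, by linarith, by linarith,
          by ring, by ring⟩⟩
    · exact ⟨x4 + δ, y4 + δ, by linarith, by linarith, hxδ.le, hyδ.le, hδf, fun hh => absurd hh hdrift⟩
  have hθp : 0 < (1 - θ) * Y := mul_pos (by linarith) hYpos
  have hτp : 0 < (1 - τ) * Y := mul_pos (by linarith) hYpos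
  have hθp' : 0 < θ * c + (1 - θ) * Y := by positivity
  have hτp' : 0 < τ * c + (1 - τ) * Y := by positivity
  have hθc : 0 ≤ θ * c := by positivity
  have hτc : 0 ≤ τ * c := by positivity
  refine ⟨{
    p0 := 1 / a
    κ := κ
    p := ![1 / (θ * c + (1 - θ) * Y), 1 / (τ * c + (1 - τ) * Y)]
    q := ![1 / ((1 - θ) * Y), 1 / ((1 - τ) * Y)]
    θ := ![θ, τ]
    P := ![1 / X0, 1 / (x4 + δ)]
    Q := ![1 / Y0, 1 / (y4 + δ)]
    hn := hn
    hp0 := by rw [lt_div_iff₀ ha]; linarith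
    hd0 := by rw [one_div_one_div, ← hD]; exact hD0
    hp := ?_
    hq := ?_
    hκ := hκ1
    hκ' := by rw [one_div_one_div, ← hD]; exact hκ2
    hθ0 := ?_
    hθ1 := ?_
    hpe := ?_
    hqe := ?_
    hpq := ?_
    hP := ?_
    hQ := ?_
    hPQ := ?_ }, rfl, ?_, ?_, ?_, ?_, ?_, ?_⟩
  all_goals simp only [Fin.forall_fin_two, Matrix.cons_val_zero, Matrix.cons_val_one, one_div_one_div,
    ← hD, ← hc, ← hY]
  · exact ⟨by rw [le_div_iff₀ hθp']; linarith, by rw [le_div_iff₀ hτp']; linarith⟩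
  · exact ⟨by positivity, by positivity⟩
  · exact ⟨hθ0, hτ0⟩
  · exact ⟨hθ1, hτ1⟩
  · exact ⟨trivial, trivial⟩
  · exact ⟨trivial, trivial⟩
  · exact ⟨one_div_le_one_div_of_le hθp (by linarith), one_div_le_one_div_of_le hτp (by linarith)⟩
  · exact ⟨by rw [le_div_iff₀ hX0]; linarith, by rw [le_div_iff₀ (by linarith)]; linarith⟩
  · exact ⟨by rw [le_div_iff₀ hY0]; linarith, by rw [le_div_iff₀ (by linarith)]; linarith⟩
  · exact ⟨hXY, hδf⟩
  · exact hθx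
  · exact hτx
  · exact hτy
  · linarith
  · linarith
  · exact hdr

end

section

open Filter Topology

section Geometry

variable {d : ℕ}

theorem box_subset_ball (hd : 1 ≤ d) (z : Space d) : box z (1 / (2 * d : ℝ)) ⊆ Metric.ball z 1 := by
  refine (box_subset_closedBall z _).trans (Metric.closedBall_subset_ball ?_)
  have : (1 : ℝ) ≤ d := by exact_mod_cast hd
  have h : (d : ℝ) * (1 / (2 * d : ℝ)) = 1 / 2 := by field_simp
  rw [h]; norm_num

theorem radius_pos (hd : 1 ≤ d) : 0 < 1 / (2 * d : ℝ) := by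
  have : (1 : ℝ) ≤ d := by exact_mod_cast hd
  positivity

theorem radius_le (hd : 1 ≤ d) : 1 / (2 * d : ℝ) ≤ 1 / 2 := by
  have : (1 : ℝ) ≤ d := by exact_mod_cast hd
  exact one_div_le_one_div_of_le two_pos (by linarith)

theorem pcyl_subset_cyl_one (hd : 1 ≤ d) (c : SpaceTime d) :
    Ioo (c.1 - 1 / (2 * d : ℝ)) (c.1 + 1 / (2 * d : ℝ)) ×ˢ box c.2 (1 / (2 * d : ℝ)) ⊆ cyl 1 c := by
  have h := radius_le hd
  refine prod_mono (fun t ht => ⟨?_, ?_⟩) (box_subset_ball hd c.2)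
  · linarith [ht.1]
  · linarith [ht.2]

theorem pcyl_subset_cyl_two (hd : 1 ≤ d) {c : SpaceTime d} (hc : c ∈ cyl 1 (0 : SpaceTime d)) :
    Ioo (c.1 - 1 / (2 * d : ℝ)) (c.1 + 1 / (2 * d : ℝ)) ×ˢ box c.2 (1 / (2 * d : ℝ)) ⊆
      cyl 2 (0 : SpaceTime d) := by
  have h := radius_le hd
  obtain ⟨⟨h1, h2⟩, h3⟩ := hc
  simp only [Prod.fst_zero, Prod.snd_zero] at h1 h2 h3
  refine prod_mono (fun t ht => ⟨?_, ?_⟩) ((box_subset_ball hd c.2).trans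
    (Metric.ball_subset_ball' ?_))
  · simp only [Prod.fst_zero]; linarith [ht.1]
  · simp only [Prod.fst_zero]; linarith [ht.2]
  · have := (Metric.mem_ball.1 h3).le
    simp only [Prod.snd_zero]; linarith

theorem lintegral_box_rpow_le_locNorm (hd : 1 ≤ d) {h : Space d → ℝ≥0∞} (hh : Measurable h) {s : ℝ}
    (hs : 0 < s) {p : ℝ≥0∞} (hp : ENNReal.ofReal s ≤ p) (z : Space d) :
    ∫⁻ x in box z (1 / (2 * d : ℝ)), h x ^ s ≤ locNorm p h ^ s := by
  have h1 : (∫⁻ x in box z (1 / (2 * d : ℝ)), h x ^ s) ^ (1 / s) ≤ locNorm p h := by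
    refine (lintegral_rpow_le_eLpNorm (measurableSet_box z _)
      (volume_box_le_one z (radius_pos hd) (radius_le hd)) hh hs hp
      (G := (Metric.ball z 1).indicator h) fun x hx => ?_).trans
      (le_iSup (fun z => eLpNorm ((Metric.ball z 1).indicator h) p volume) z)
    rw [indicator_of_mem (box_subset_ball hd z hx)]
    rfl
  have h2 := ENNReal.rpow_le_rpow h1 hs.le
  rwa [← ENNReal.rpow_mul, one_div_mul_cancel hs.ne', ENNReal.rpow_one] at h2

theorem ae_ne_top_of_locNorm (hd : 1 ≤ d) {h : Space d → ℝ≥0∞} (hh : Measurable h) {p : ℝ≥0∞}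
    (hp : 1 ≤ p) (hfin : locNorm p h ≠ ⊤) : ∀ᵐ x, h x ≠ ⊤ := by
  rw [ae_iff]
  refine measure_null_of_locally_null _ fun x _ =>
    ⟨{x | ¬h x ≠ ⊤} ∩ box x (1 / (2 * d : ℝ)), inter_mem_nhdsWithin _
      ((isOpen_box x _).mem_nhds (Metric.mem_ball_self (radius_pos hd))), ?_⟩
  have h1 := lintegral_box_rpow_le_locNorm hd hh one_pos (by simpa using hp) x
  simp only [ENNReal.rpow_one] at h1
  have h2 := ae_lt_top hh (ne_top_of_le_ne_top hfin h1)
  rw [ae_iff, Measure.restrict_apply' (measurableSet_box x _)] at h2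
  simpa [lt_top_iff_ne_top] using h2

theorem integrableOn_of_locNormXT (hd : 1 ≤ d) {v : SpaceTime d → Space d} (hv : Measurable v)
    {p q : ℝ≥0∞} (hp : 1 ≤ p) (hq : 1 ≤ q) (hfin : locNormXT p q v ≠ ⊤) (r : ℝ) :
    IntegrableOn v (Metric.closedBall 0 r) := by
  have hloc : LocallyIntegrable v := by
    intro c
    refine ⟨pcyl c (1 / (2 * d : ℝ)), (isOpen_Ioo.prod (isOpen_box _ _)).mem_nhds ⟨?_, ?_⟩,
      hv.aestronglyMeasurable, ?_⟩
    · have := radius_pos hd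
      exact ⟨by linarith, by linarith⟩
    · exact Metric.mem_ball_self (radius_pos hd)
    · rw [hasFiniteIntegral_iff_enorm, pcyl, ← lintegral_box_time _ _ hv.enorm]
      have h1 := lintegral_le_mixedNormXT hv one_pos one_pos (by simpa using hp) (by simpa using hq)
        measurableSet_Ioo (measurableSet_box c.2 _) (volume_Ioo_le_one c.1 (radius_le hd))
        (volume_box_le_one c.2 (radius_pos hd) (radius_le hd)) (pcyl_subset_cyl_one hd c)
      simp only [div_one, ENNReal.rpow_one] at h1
      refine (h1.trans (le_iSup (fun c => mixedNormXT p q ((cyl 1 c).indicator v)) c)).trans_lt ?_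
      exact hfin.lt_top
  exact hloc.integrableOn_isCompact (isCompact_closedBall 0 r)

end Geometry

section MixedHolder

variable {d : ℕ}

theorem mixed_const_mul {I : Set ℝ} {B : Set (Space d)} {H : SpaceTime d → ℝ≥0∞}
    (hH : Measurable H) (k : ℝ≥0∞) {P Q : ℝ} (hP : 0 < P) (hQ : 0 < Q) :
    (∫⁻ t in I, (∫⁻ x in B, (k * H (t, x)) ^ P) ^ (Q / P)) ^ (1 / Q) =
      k * (∫⁻ t in I, (∫⁻ x in B, H (t, x) ^ P) ^ (Q / P)) ^ (1 / Q) := by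
  have hHm : Measurable fun z : ℝ × Space d => H z ^ P := hH.pow_const _
  have hm : Measurable fun t => (∫⁻ x in B, H (t, x) ^ P) ^ (Q / P) :=
    (hHm.lintegral_prod_right' (ν := volume.restrict B)).pow_const _
  have e1 : ∀ t, (∫⁻ x in B, (k * H (t, x)) ^ P) ^ (Q / P) =
      k ^ Q * (∫⁻ x in B, H (t, x) ^ P) ^ (Q / P) := fun t => by
    have hHt : Measurable fun x => H (t, x) ^ P := hHm.comp measurable_prodMk_left
    simp only [ENNReal.mul_rpow_of_nonneg _ _ hP.le]
    rw [lintegral_const_mul _ hHt, ENNReal.mul_rpow_of_nonneg _ _ (by positivity),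
      ← ENNReal.rpow_mul, mul_div_cancel₀ _ hP.ne']
  simp only [e1]
  rw [lintegral_const_mul _ hm, ENNReal.mul_rpow_of_nonneg _ _ (by positivity), ← ENNReal.rpow_mul,
    mul_one_div_cancel hQ.ne', ENNReal.rpow_one]

theorem mixed_holder {I : Set ℝ} {B : Set (Space d)} {H : SpaceTime d → ℝ≥0∞} {G : Space d → ℝ≥0∞}
    (hH : Measurable H) (hG : Measurable G) {x y s P Q : ℝ} (hx : 0 < x) (hy : 0 < y) (hs : 0 < s)
    (hP : 1 / P = 2 * x + s) (hQ : 1 / Q = 2 * y) :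
    (∫⁻ t in I, (∫⁻ x in B, (H (t, x) ^ (2 : ℝ) * G x) ^ P) ^ (Q / P)) ^ (1 / Q) ≤
      (∫⁻ x in B, G x ^ (1 / s)) ^ s *
        ((∫⁻ t in I, (∫⁻ z in B, H (t, z) ^ (1 / x)) ^ (1 / y / (1 / x))) ^ (1 / (1 / y))) ^ (2 : ℝ) := by
  have hP0 : 0 < P := by
    have : 0 < 1 / P := by rw [hP]; positivity
    exact one_div_pos.1 this
  have hQ0 : 0 < Q := by
    have : 0 < 1 / Q := by rw [hQ]; positivity
    exact one_div_pos.1 this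
  have hPP : 2 * x * P + s * P = 1 := by
    rw [← add_mul, ← hP, one_div_mul_cancel hP0.ne']
  have hQQ : 2 * y * Q = 1 := by rw [← hQ, one_div_mul_cancel hQ0.ne']
  obtain ⟨k, hk⟩ : ∃ k, k = (∫⁻ x in B, G x ^ (1 / s)) ^ s := ⟨_, rfl⟩
  have hHm : Measurable fun z : ℝ × Space d => H z ^ (1 / x) := hH.pow_const _
  have hm : Measurable fun t => (∫⁻ z in B, H (t, z) ^ (1 / x)) ^ (1 / y / (1 / x)) :=
    (hHm.lintegral_prod_right' (ν := volume.restrict B)).pow_const _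
  have e1 : ∀ t, (∫⁻ x in B, (H (t, x) ^ (2 : ℝ) * G x) ^ P) ^ (Q / P) ≤
      k ^ Q * (∫⁻ z in B, H (t, z) ^ (1 / x)) ^ (1 / y / (1 / x)) := fun t => by
    have hHt : Measurable fun z => H (t, z) ^ (1 / x) := hHm.comp measurable_prodMk_left
    have h1 := ENNReal.lintegral_mul_norm_pow_le (μ := volume.restrict B) hHt.aemeasurable
      (hG.pow_const (1 / s)).aemeasurable (by positivity : 0 ≤ 2 * x * P)
      (by positivity : 0 ≤ s * P) hPP
    have h2 : ∀ z, (H (t, z) ^ (1 / x)) ^ (2 * x * P) * (G z ^ (1 / s)) ^ (s * P) =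
        (H (t, z) ^ (2 : ℝ) * G z) ^ P := fun z => by
      rw [← ENNReal.rpow_mul, ← ENNReal.rpow_mul, ENNReal.mul_rpow_of_nonneg _ _ hP0.le,
        ← ENNReal.rpow_mul]
      congr 2 <;> field_simp
    simp only [h2] at h1
    refine (ENNReal.rpow_le_rpow h1 (by positivity : 0 ≤ Q / P)).trans_eq ?_
    rw [ENNReal.mul_rpow_of_nonneg _ _ (by positivity), ← ENNReal.rpow_mul, ← ENNReal.rpow_mul, hk,
      ← ENNReal.rpow_mul, mul_comm]
    have e2 : s * P * (Q / P) = s * Q := by field_simp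
    have e3 : 2 * x * P * (Q / P) = 1 / y / (1 / x) := by
      have : Q = 1 / (2 * y) := by field_simp; linarith
      rw [this]; field_simp
    rw [e2, e3]
  refine (ENNReal.rpow_le_rpow (lintegral_mono e1) (by positivity)).trans_eq ?_
  rw [lintegral_const_mul _ hm, ENNReal.mul_rpow_of_nonneg _ _ (by positivity), ← ENNReal.rpow_mul,
    mul_one_div_cancel hQ0.ne', ENNReal.rpow_one, ← hk, ← ENNReal.rpow_mul]
  congr 2
  rw [hQ]; field_simp

end MixedHolder

end

section

open Filter Topology

section Assumptions

variable {d : ℕ} {p0 p1 p3 q3 : ℝ≥0∞} {Nlam Nmu N2 : ℝ≥0}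
  {a : SpaceTime d → Matrix (Fin d) (Fin d) ℝ}

theorem HypA.regularSubsolution (hd : 1 ≤ d) (hp0 : 1 ≤ p0) (hp1 : 1 ≤ p1)
    (hA : HypA p0 p1 Nlam Nmu a) {b1 b2 : SpaceTime d → Space d} {f u : SpaceTime d → ℝ}
    (hb1 : Measurable b1) (hb2 : Measurable b2) (hf : Measurable f) (hdiv : DivNonneg b2)
    (hp3 : 1 ≤ p3) (hq3 : 1 ≤ q3) (hN2 : locNormXT p3 q3 b2 ≤ N2)
    (hu : IsLipschitzWeakSubsolution a (fun z => b1 z + b2 z) f u) :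
    RegularSubsolution a b1 b2 f u where
  sub := hu
  measurable_a := hA.measurable_a
  measurable_lam := hA.measurable_lam
  measurable_mu := hA.measurable_mu
  lam_ne_zero := by
    filter_upwards [ae_ne_top_of_locNorm hd hA.measurable_lam.inv hp0
      (ne_top_of_le_ne_top ENNReal.coe_ne_top hA.norm_lam_inv_le)] with x hx
    exact ENNReal.inv_ne_top.1 hx
  mu_ne_top := ae_ne_top_of_locNorm hd hA.measurable_mu hp1
    (ne_top_of_le_ne_top ENNReal.coe_ne_top hA.norm_mu_le)
  measurable_b1 := hb1
  measurable_b2 := hb2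
  measurable_f := hf
  div := hdiv
  integrable_b2 := integrableOn_of_locNormXT hd hb2 hp3 hq3
    (ne_top_of_le_ne_top ENNReal.coe_ne_top hN2)
  mu_integrable := fun z r hr => by
    have h1 := lintegral_box_rpow_le_locNorm hd hA.measurable_mu one_pos (by simpa using hp1) z
    simp only [ENNReal.rpow_one] at h1
    exact ne_top_of_le_ne_top (ne_top_of_le_ne_top ENNReal.coe_ne_top hA.norm_mu_le)
      ((lintegral_mono_set (box_mono hr)).trans h1)

end Assumptions

theorem lintegral_box_mu_le {d : ℕ} (hd : 1 ≤ d) {h : Space d → ℝ≥0∞} (hh : Measurable h)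
    {s q : ℝ} (hs : 0 < s) (hq : 0 < q) {p : ℝ≥0∞} (hp : ENNReal.ofReal s ≤ p) (c : SpaceTime d) :
    ∫⁻ x in box c.2 (1 / (2 * d : ℝ)), (∫⁻ _ in Ioo (c.1 - 1 / (2 * d : ℝ)) (c.1 + 1 / (2 * d : ℝ)),
      h x ^ q) ^ (s / q) ≤ locNorm p h ^ s := by
  refine (lintegral_mono fun x => ?_).trans (lintegral_box_rpow_le_locNorm hd hh hs hp c.2)
  rw [setLIntegral_const]
  calc (h x ^ q * volume (Ioo (c.1 - 1 / (2 * d : ℝ)) (c.1 + 1 / (2 * d : ℝ)))) ^ (s / q)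
      ≤ (h x ^ q) ^ (s / q) := by
        gcongr
        exact mul_le_of_le_one_right' (volume_Ioo_le_one _ (radius_le hd))
    _ = h x ^ s := by rw [← ENNReal.rpow_mul, mul_div_cancel₀ _ hq.ne']

theorem exists_coeffBound {n : ℕ} (hn : 1 ≤ n) {p0 p1 p2 q2 p3 q3 p4 q4 : ℝ≥0∞}
    (hp0 : p0 ≠ 0) (hp1 : 1 ≤ p1) (hp4 : 1 ≤ p4) (hq4 : 1 ≤ q4)
    (hadm : AdmissibleRecip (n + 1) (recip p0) (recip p1) (recip p2) (recip q2) (recip p3)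
      (recip q3) (recip p4) (recip q4) (((n + 1 : ℕ) : ℝ≥0∞) < p0))
    (h1 : ((n + 1 : ℕ) : ℝ≥0∞) < p0 → DriftExponents1 (n + 1) p0 p2 q2)
    (h2 : DriftExponents2 (n + 1) p0 p3 q3) (Nlam Nmu N1 N2 : ℝ≥0) :
    ∃ (e : Exponents n) (N : ℝ≥0), ∀ (a : SpaceTime (n + 1) → Matrix (Fin (n + 1)) (Fin (n + 1)) ℝ)
      (b1 b2 : SpaceTime (n + 1) → Space (n + 1)) (f : SpaceTime (n + 1) → ℝ) (K : ℝ)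
      (c : SpaceTime (n + 1)), HypA p0 p1 Nlam Nmu a → Measurable b1 → Measurable b2 →
      Measurable f → (p0 ≤ ((n + 1 : ℕ) : ℝ≥0∞) → ∀ z, b1 z = 0) →
      (((n + 1 : ℕ) : ℝ≥0∞) < p0 → locNormTX q2 p2 b1 ≤ N1) → locNormXT p3 q3 b2 ≤ N2 → 0 < K →
      mixedNormTX q4 p4 ((cyl 2 0).indicator f) ≤ ENNReal.ofReal K →
      c ∈ cyl 1 (0 : SpaceTime (n + 1)) →
      CoeffBound e N (lam a) (firstOrder a b2) (zeroOrder a b1 f K) c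
        (1 / (2 * (n + 1 : ℕ) : ℝ)) := by
  obtain ⟨s, hs, hps, hadm'⟩ := hadm.exists_pos (by omega) (recip_nonneg p0)
  have hq3 : 1 ≤ q3 := h2.1.trans h2.2.1
  obtain ⟨e, he0, hex1, hex3, hey3, hex4, hey4, hdr⟩ := hadm'.exists_exponents hn hs
    (recip_nonneg _) (recip_le_one hp1) (recip_nonneg _) (recip_nonneg _) (recip_nonneg _)
    (recip_anti h2.1 h2.2.1) (recip_le_one h2.1) (recip_nonneg _) (recip_nonneg _)
  have hd : 1 ≤ n + 1 := by omega
  have hp : ∀ j, 0 < e.p j := fun j => zero_lt_one.trans_le (e.hp j)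
  have hP : ∀ j, 0 < e.P j := fun j => zero_lt_one.trans_le (e.hP j)
  have hQ : ∀ j, 0 < e.Q j := fun j => zero_lt_one.trans_le (e.hQ j)
  have hle : ∀ {p : ℝ≥0∞} {t : ℝ}, 1 ≤ p → 0 < t → recip p ≤ 1 / t → ENNReal.ofReal t ≤ p := by
    intro p t hp1 ht h
    have := ofReal_one_div_le (zero_lt_one.trans_le hp1).ne' (one_div_pos.2 ht) h
    rwa [one_div_one_div] at this
  have hs0 : 0 < 1 / s := one_div_pos.2 hs
  have hsp : ENNReal.ofReal (1 / s) ≤ p0 := ofReal_one_div_le hp0 hs hps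
  refine ⟨e, Nlam ^ (1 / s) + Nmu ^ e.p 0 + N2 ^ e.p 1 + Nlam * N1 ^ 2 + 1,
    fun a b1 b2 f K c hA hb1 hb2 hf hb10 hN1 hN2 hK hfK hc => ?_⟩
  have hlamI : ∫⁻ x in box c.2 (1 / (2 * (n + 1 : ℕ) : ℝ)), (lam a x)⁻¹ ^ (1 / s) ≤
      (Nlam : ℝ≥0∞) ^ (1 / s) :=
    (lintegral_box_rpow_le_locNorm hd hA.measurable_lam.inv hs0 hsp c.2).trans
      (ENNReal.rpow_le_rpow hA.norm_lam_inv_le hs0.le)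
  have hlm' : Measurable fun z : SpaceTime (n + 1) => lam a z.2 :=
    hA.measurable_lam.comp measurable_snd
  have hI1 := volume_Ioo_le_one c.1 (radius_le hd)
  have hB1 := volume_box_le_one c.2 (radius_pos hd) (radius_le hd)
  have hmI := measurableSet_Ioo (a := c.1 - 1 / (2 * (n + 1 : ℕ) : ℝ))
    (b := c.1 + 1 / (2 * (n + 1 : ℕ) : ℝ))
  have hmB := measurableSet_box c.2 (1 / (2 * (n + 1 : ℕ) : ℝ))
  constructor
  · exact hA.measurable_lam
  · exact lam_ne_top hd
  · intro j
    fin_cases j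
    · exact hA.measurable_mu.comp measurable_snd
    · exact hb2.enorm
  · intro j
    fin_cases j
    · exact (hb1.enorm.pow_const _).mul hlm'.inv
    · exact hf.enorm.const_mul _
  · rw [he0]
    refine hlamI.trans ?_
    rw [← ENNReal.coe_rpow_of_nonneg _ hs0.le]
    refine ENNReal.coe_le_coe.2 ?_
    simp only [add_assoc]
    exact le_self_add
  · intro j
    fin_cases j
    · refine (lintegral_box_mu_le hd hA.measurable_mu (hp 0) (e.hq 0) (hle hp1 (hp 0) hex1) c).trans
        ((ENNReal.rpow_le_rpow hA.norm_mu_le (hp 0).le).trans ?_)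
      rw [← ENNReal.coe_rpow_of_nonneg _ (hp 0).le]
      refine ENNReal.coe_le_coe.2 ?_
      simp only [add_assoc]
      exact le_self_add.trans le_add_self
    · have h3 := (lintegral_le_mixedNormXT hb2 (hp 1) (e.hq 1) (hle h2.1 (hp 1) hex3)
        (hle hq3 (e.hq 1) hey3) hmI hmB hI1 hB1 (pcyl_subset_cyl_one hd c)).trans
        ((le_iSup (fun c => mixedNormXT p3 q3 ((cyl 1 c).indicator b2)) c).trans hN2)
      have h4 := ENNReal.rpow_le_rpow h3 (hp 1).le
      rw [← ENNReal.rpow_mul, one_div_mul_cancel (hp 1).ne', ENNReal.rpow_one] at h4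
      refine h4.trans ?_
      rw [← ENNReal.coe_rpow_of_nonneg _ (hp 1).le]
      refine ENNReal.coe_le_coe.2 ?_
      simp only [add_assoc]
      exact le_self_add.trans (le_add_self.trans le_add_self)
  · intro j
    fin_cases j
    · by_cases hdrift : ((n + 1 : ℕ) : ℝ≥0∞) < p0
      · obtain ⟨x, y, hx, hpx, hy, hqy, hPx, hQy⟩ := hdr hdrift
        obtain ⟨hp2, hq2, -⟩ := h1 hdrift
        have h3 := (lintegral_le_mixedNormTX hb1 (one_div_pos.2 hx) (one_div_pos.2 hy)
          (ofReal_one_div_le (zero_lt_one.trans_le hp2).ne' hx hpx)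
          (ofReal_one_div_le (zero_lt_one.trans_le hq2).ne' hy hqy)
          hmI hmB hI1 hB1 (pcyl_subset_cyl_one hd c)).trans
          ((le_iSup (fun c => mixedNormTX q2 p2 ((cyl 1 c).indicator b1)) c).trans (hN1 hdrift))
        refine (mixed_holder hb1.enorm hA.measurable_lam.inv hx hy hs hPx hQy).trans ?_
        have h4 : (∫⁻ x in box c.2 (1 / (2 * (n + 1 : ℕ) : ℝ)), (lam a x)⁻¹ ^ (1 / s)) ^ s ≤ Nlam := by
          refine (ENNReal.rpow_le_rpow hlamI hs.le).trans_eq ?_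
          rw [← ENNReal.rpow_mul, one_div_mul_cancel hs.ne', ENNReal.rpow_one]
        refine (mul_le_mul' h4 (ENNReal.rpow_le_rpow h3 zero_le_two)).trans ?_
        rw [ENNReal.rpow_two]
        norm_cast
        exact le_add_self.trans le_self_add
      · have hz : ∀ z, zeroOrder a b1 f K 0 z = 0 := fun z => by
          simp [zeroOrder, hb10 (not_lt.1 hdrift) z]
        have h3 := hP 0
        have h4 := hQ 0
        simp only [Fin.zero_eta, hz, ENNReal.zero_rpow_of_pos h3, lintegral_zero,
          ENNReal.zero_rpow_of_pos (div_pos h4 h3), ENNReal.zero_rpow_of_pos (one_div_pos.2 h4)]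
        exact zero_le
    · refine (mixed_const_mul hf.enorm (ENNReal.ofReal K⁻¹) (hP 1) (hQ 1)).trans_le ?_
      have h3 := (lintegral_le_mixedNormTX hf (hP 1) (hQ 1) (hle hp4 (hP 1) hex4)
        (hle hq4 (hQ 1) hey4) hmI hmB hI1 hB1 (pcyl_subset_cyl_two hd hc)).trans hfK
      refine (mul_le_mul' le_rfl h3).trans ?_
      rw [← ENNReal.ofReal_mul (inv_nonneg.2 hK.le), inv_mul_cancel₀ hK.ne', ENNReal.ofReal_one]
      exact_mod_cast le_add_self

end

/-- **Local maximum estimate.** The constant `C` is chosen before `a`, `b`, `f` and `u`; it depends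
only on `d`, the exponents and the bounds for the norms of `λ⁻¹`, `μ`, `b₁` and `b₂`. -/
theorem local_maximum_estimate (d : ℕ) (hd : 2 ≤ d)
    (p0 p1 p2 q2 p3 q3 p4 q4 : ℝ≥0∞)
    (hp0 : (d : ℝ≥0∞) / 2 < p0) (hp1 : 1 ≤ p1)
    (hp01 : recip p0 + recip p1 < 2 / ((d : ℝ) - 1))
    (hpq4 : (p4, q4) ∈ indexSet d p0)
    (Nlam Nmu N1 N2 : ℝ≥0) (p : ℝ) (hp : 0 < p) :
    ∃ C : ℝ, 0 < C ∧
      ∀ (a : SpaceTime d → Matrix (Fin d) (Fin d) ℝ) (b : SpaceTime d → Space d)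
        (f : SpaceTime d → ℝ),
        HypA p0 p1 Nlam Nmu a → HypB p0 p2 q2 p3 q3 N1 N2 b →
        Measurable f → mixedNormTX q4 p4 ((cyl 2 0).indicator f) < ⊤ →
        ∀ u : SpaceTime d → ℝ, IsLipschitzWeakSubsolution a b f u →
          eLpNorm ((cyl 1 0).indicator fun z => max (u z) 0) ⊤ volume ≤
            ENNReal.ofReal C *
              (mixedNormTX (ENNReal.ofReal p) (ENNReal.ofReal p)
                  ((cyl 2 0).indicator fun z => max (u z) 0)
                + mixedNormTX q4 p4 ((cyl 2 0).indicator f)) := by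
  by_cases hE : ((d : ℝ≥0∞) < p0 → DriftExponents1 d p0 p2 q2) ∧ DriftExponents2 d p0 p3 q3
  swap
  · exact ⟨1, one_pos, fun a b f _ hB => absurd ⟨hB.1, hB.2.1⟩ hE⟩
  obtain ⟨hE1, hE2⟩ := hE
  have hadm := admissibleRecip_of_exponents hd hp0 hp01 hpq4 hE1 hE2
  obtain ⟨n, rfl⟩ : ∃ n, d = n + 1 := ⟨d - 1, by omega⟩
  have hd1 : 1 ≤ n + 1 := by omega
  have hp0' : 1 ≤ p0 := by
    refine le_trans ?_ hp0.le
    rw [ENNReal.le_div_iff_mul_le (Or.inl two_ne_zero) (Or.inl ENNReal.ofNat_ne_top), one_mul]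
    exact_mod_cast hd
  obtain ⟨e, N, hcoef⟩ := exists_coeffBound (by omega) (zero_lt_one.trans_le hp0').ne' hp1 hpq4.1
    hpq4.2.1 hadm hE1 hE2 Nlam Nmu N1 N2
  obtain ⟨C, hC⟩ := RegularSubsolution.le_norm e N hp (radius_pos hd1) le_rfl
  refine ⟨C + 1, by positivity, fun a b f hA hB hf hfin u hu => ?_⟩
  obtain ⟨-, -, b1, b2, hb1, hb2, hb, hb10, hN1, hdiv, hN2⟩ := hB
  have hbeq : b = fun z => b1 z + b2 z := funext hb
  rw [hbeq] at hu
  have hreg := hA.regularSubsolution hd1 hp0' hp1 hb1 hb2 hf hdiv hE2.1 (hE2.1.trans hE2.2.1) hN2 hu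
  obtain ⟨F, hF⟩ : ∃ F, F = mixedNormTX q4 p4 ((cyl 2 0).indicator f) := ⟨_, rfl⟩
  obtain ⟨U, hU⟩ : ∃ U, U = mixedNormTX (ENNReal.ofReal p) (ENNReal.ofReal p)
    ((cyl 2 0).indicator fun z => max (u z) 0) := ⟨_, rfl⟩
  rw [← hF] at hfin ⊢
  rw [← hU]
  have hvm : Measurable fun z => max (u z) 0 := (hu.continuous.max continuous_const).measurable
  have hC1 : ENNReal.ofReal ((C : ℝ) + 1) = C + 1 := by
    rw [ENNReal.ofReal_add C.coe_nonneg zero_le_one, ENNReal.ofReal_coe_nnreal, ENNReal.ofReal_one]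
  have hpt : ∀ c ∈ cyl 1 (0 : SpaceTime (n + 1)), ‖max (u c) 0‖ₑ ≤ (C + 1) * (U + F) := by
    intro c hc
    refine ENNReal.le_of_forall_pos_le_add fun ε hε _ => ?_
    have hδ : 0 < ε / (C + 1) := by positivity
    have hKF : ENNReal.ofReal (F.toReal + (ε / (C + 1) : ℝ≥0)) = F + (ε / (C + 1) : ℝ≥0) := by
      rw [ENNReal.ofReal_add ENNReal.toReal_nonneg NNReal.zero_le_coe, ENNReal.ofReal_toReal hfin.ne,
        ENNReal.ofReal_coe_nnreal]
    have hK : 0 < F.toReal + (ε / (C + 1) : ℝ≥0) :=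
      add_pos_of_nonneg_of_pos ENNReal.toReal_nonneg hδ
    have h1 := hC a b1 b2 f u _ c hreg hK (hcoef a b1 b2 f _ c hA hb1 hb2 hf hb10 hN1 hN2 hK
      (by rw [hKF, ← hF]; exact le_self_add) hc)
    have h2 : (∫⁻ z in pcyl c (1 / (2 * (n + 1 : ℕ) : ℝ)), ‖max (u z) 0‖ₑ ^ p) ^ (1 / p) ≤ U := by
      have hvp : Measurable fun z : SpaceTime (n + 1) => ‖max (u z) 0‖ₑ ^ p := hvm.enorm.pow_const _
      have h3 := lintegral_le_mixedNormTX hvm hp hp le_rfl le_rfl measurableSet_Ioo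
        (measurableSet_box c.2 _) (volume_Ioo_le_one c.1 (radius_le hd1))
        (volume_box_le_one c.2 (radius_pos hd1) (radius_le hd1)) (pcyl_subset_cyl_two hd1 hc)
      simp only [div_self hp.ne', ENNReal.rpow_one] at h3
      rw [pcyl, lintegral_prod_set hvp, hU]
      exact h3
    rw [hKF] at h1
    rw [← ofReal_norm, Real.norm_of_nonneg (le_max_right _ _)]
    calc ENNReal.ofReal (max (u c) 0) ≤ C * (U + (F + (ε / (C + 1) : ℝ≥0))) :=
          h1.trans (by gcongr)
      _ ≤ (C + 1) * (U + (F + (ε / (C + 1) : ℝ≥0))) := by gcongr; exact le_self_add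
      _ = (C + 1) * (U + F) + ((C + 1) * (ε / (C + 1)) : ℝ≥0) := by push_cast; ring
      _ = (C + 1) * (U + F) + ε := by rw [mul_div_cancel₀ _ (by positivity)]
  rw [eLpNorm_exponent_top, hC1]
  refine eLpNormEssSup_le_of_ae_enorm_bound (Filter.Eventually.of_forall fun c => ?_)
  by_cases hc : c ∈ cyl 1 (0 : SpaceTime (n + 1))
  · rw [indicator_of_mem hc]; exact hpt c hc
  · rw [indicator_of_notMem hc, enorm_zero]; exact zero_le
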